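/- Let N ≥ 2, let Ω ⊂ ℝ^N be a bounded domain with C³ boundary and unit volume, and let p ∈ (1, p_N). Assume that for every λ ≥ 0 and every solution (α, ψ) of problem (P)_λ on Ω, every eigenvalue of the linearized operator L_λ at (α, ψ) is strictly positive (i.e. λ_*(Ω, p) = +∞). Then the Emden problem −Δu = u^p in Ω, u > 0 in Ω, u = 0 on ∂Ω admits exactly one solution u ∈ C²(Ω̄). -/

import Mathlib

open MeasureTheory Metric Set

noncomputable section

/-- The Laplacian of a function on Euclidean space. -/
def lapl {N : ℕ} (f : EuclideanSpace ℝ (Fin N) → ℝ) (x : EuclideanSpace ℝ (Fin N)) : ℝ :=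
  ∑ i : Fin N,
    fderiv ℝ (fun y => fderiv ℝ f y (EuclideanSpace.single i (1 : ℝ))) x
      (EuclideanSpace.single i (1 : ℝ))

/-- `(α, ψ)` is a solution of problem `(P)_λ` on `Ω`:
`ψ ∈ C²`, `-Δψ = (max (α + λψ) 0)^p` in `Ω`, `ψ = 0` on `∂Ω`, and
`∫_Ω (max (α + λψ) 0)^p = 1`. -/
def IsSol {N : ℕ} (Ω : Set (EuclideanSpace ℝ (Fin N))) (p lam α : ℝ)
    (ψ : EuclideanSpace ℝ (Fin N) → ℝ) : Prop :=
  ContDiff ℝ 2 ψ ∧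
  (∀ x ∈ Ω, -lapl ψ x = (max (α + lam * ψ x) 0) ^ p) ∧
  (∀ x ∈ frontier Ω, ψ x = 0) ∧
  (∫ x in Ω, (max (α + lam * ψ x) 0) ^ p) = 1

/-- The weight `V = (max (α + λψ) 0)^(p-1)`. -/
def Vfun {N : ℕ} (p lam α : ℝ) (ψ : EuclideanSpace ℝ (Fin N) → ℝ)
    (x : EuclideanSpace ℝ (Fin N)) : ℝ :=
  (max (α + lam * ψ x) 0) ^ (p - 1)

/-- `m = ∫_Ω V`. -/
def mV {N : ℕ} (Ω : Set (EuclideanSpace ℝ (Fin N))) (p lam α : ℝ)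
    (ψ : EuclideanSpace ℝ (Fin N) → ℝ) : ℝ :=
  ∫ x in Ω, Vfun p lam α ψ x

/-- The weighted average `⟨φ⟩ = (∫_Ω V φ) / m`. -/
def avgV {N : ℕ} (Ω : Set (EuclideanSpace ℝ (Fin N))) (p lam α : ℝ)
    (ψ φ : EuclideanSpace ℝ (Fin N) → ℝ) : ℝ :=
  (∫ x in Ω, Vfun p lam α ψ x * φ x) / mV Ω p lam α ψ

/-- `σ` is an eigenvalue of the linearized operator `L_λ` at the solution `(α, ψ)`:
there is a nontrivial `φ ∈ C²(Ω̄)` vanishing on `∂Ω` with `-Δφ = (pλ + σ) V [φ]` in `Ω`. -/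
def IsEigen {N : ℕ} (Ω : Set (EuclideanSpace ℝ (Fin N))) (p lam α : ℝ)
    (ψ : EuclideanSpace ℝ (Fin N) → ℝ) (σ : ℝ) : Prop :=
  ∃ φ : EuclideanSpace ℝ (Fin N) → ℝ, ContDiff ℝ 2 φ ∧
    (∃ x ∈ closure Ω, φ x ≠ 0) ∧ (∀ x ∈ frontier Ω, φ x = 0) ∧
    ∀ x ∈ Ω, -lapl φ x = (p * lam + σ) * (Vfun p lam α ψ x * (φ x - avgV Ω p lam α ψ φ))

/-- `Ω` is a bounded domain of class `C³`: open, connected, bounded, and near every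
boundary point `Ω` is the sublevel set of a `C³` function with nonvanishing gradient. -/
def IsC3Domain {N : ℕ} (Ω : Set (EuclideanSpace ℝ (Fin N))) : Prop :=
  IsOpen Ω ∧ IsConnected Ω ∧ Bornology.IsBounded Ω ∧
  ∀ x ∈ frontier Ω, ∃ (U : Set (EuclideanSpace ℝ (Fin N)))
      (f : EuclideanSpace ℝ (Fin N) → ℝ),
    IsOpen U ∧ x ∈ U ∧ ContDiff ℝ 3 f ∧ (∀ y ∈ U, fderiv ℝ f y ≠ 0) ∧
    Ω ∩ U = {y ∈ U | f y < 0}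

/-- `u` solves the Emden problem on `Ω`: `u ∈ C²`, `-Δu = u^p` and `u > 0` in `Ω`,
`u = 0` on `∂Ω`. -/
def IsEmden {N : ℕ} (Ω : Set (EuclideanSpace ℝ (Fin N))) (p : ℝ)
    (u : EuclideanSpace ℝ (Fin N) → ℝ) : Prop :=
  ContDiff ℝ 2 u ∧ (∀ x ∈ Ω, -lapl u x = u x ^ p) ∧ (∀ x ∈ Ω, 0 < u x) ∧
  ∀ x ∈ frontier Ω, u x = 0

namespace Schauder

open scoped SchwartzMap

set_option linter.unusedSectionVars false
set_option linter.unusedVariables false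

section Gaussian

variable (E : Type) [NormedAddCommGroup E] [InnerProductSpace ℝ E]

/-- The function `exp (-‖x‖² / 4)` as a Schwartz function. -/
def gauss0 : 𝓢(E, ℝ) where
  toFun x := Real.exp (-(4⁻¹ * ‖x‖ ^ 2))
  smooth' := by
    have : ContDiff ℝ (⊤ : ℕ∞) fun x : E => ‖x‖ ^ 2 := contDiff_norm_sq ℝ
    fun_prop
  decay' := by
    intro k n
    have htg : (fun x : E => 4⁻¹ * ‖x‖ ^ 2).HasTemperateGrowth := by
      have h1 : (fun _ : E => (4⁻¹ : ℝ)).HasTemperateGrowth := .const _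
      exact h1.mul (Function.hasTemperateGrowth_norm_sq E)
    obtain ⟨l, C, hC, hb⟩ := htg.norm_iteratedFDeriv_le_uniform n
    set D : ℝ := 1 + C with hD
    have hD1 : 1 ≤ D := by linarith
    -- the elementary decay bound
    have hexp : ∀ m : ℕ, ∃ B : ℝ, ∀ r : ℝ, 0 ≤ r → (1 + r) ^ m * Real.exp (-(4⁻¹ * r ^ 2)) ≤ B := by
      intro m
      refine ⟨(m.factorial : ℝ) * Real.exp 2, fun r hr => ?_⟩
      have h1 : (1 + r) ^ m ≤ m.factorial * Real.exp (1 + r) := by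
        have := Real.pow_div_factorial_le_exp (1 + r) (by linarith) m
        rw [div_le_iff₀ (by positivity)] at this
        linarith
      calc (1 + r) ^ m * Real.exp (-(4⁻¹ * r ^ 2))
          ≤ m.factorial * Real.exp (1 + r) * Real.exp (-(4⁻¹ * r ^ 2)) := by gcongr
        _ = m.factorial * Real.exp (1 + r - 4⁻¹ * r ^ 2) := by
            rw [mul_assoc, ← Real.exp_add]; ring_nf
        _ ≤ _ := by
            gcongr
            nlinarith [sq_nonneg (r - 2)]
    obtain ⟨B, hB⟩ := hexp (k + l * n)
    refine ⟨n.factorial * D ^ n * B, fun x => ?_⟩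
    have hder : ∀ i t, ‖iteratedFDeriv ℝ i (fun t : ℝ => Real.exp (-t)) t‖ = Real.exp (-t) := by
      intro i t
      rw [norm_iteratedFDeriv_eq_norm_iteratedDeriv]
      have : iteratedDeriv i (fun t : ℝ => Real.exp (-t)) = fun t => (-1) ^ i * Real.exp (-t) := by
        have := iteratedDeriv_exp_const_mul i (-1 : ℝ)
        simpa using this
      rw [this]
      simp
    have := norm_iteratedFDeriv_comp_le (𝕜 := ℝ) (g := fun t : ℝ => Real.exp (-t))
      (f := fun x : E => 4⁻¹ * ‖x‖ ^ 2) (n := n) (N := (⊤ : ℕ∞)) (by fun_prop)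
      (by
        have : ContDiff ℝ (⊤ : ℕ∞) fun x : E => ‖x‖ ^ 2 := contDiff_norm_sq ℝ
        fun_prop) (by exact_mod_cast le_top) x
      (C := Real.exp (-(4⁻¹ * ‖x‖ ^ 2))) (D := D * (1 + ‖x‖) ^ l)
      (fun i _ => (hder i _).le)
      (fun i hi hin => by
        refine (hb i hin x).trans ?_
        have h2 : 1 ≤ D * (1 + ‖x‖) ^ l := by
          have : 1 ≤ (1 + ‖x‖) ^ l := one_le_pow₀ (by linarith [norm_nonneg x])
          nlinarith
        calc C * (1 + ‖x‖) ^ l ≤ D * (1 + ‖x‖) ^ l := by gcongr; linarith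
          _ ≤ _ := le_self_pow₀ h2 (by omega))
    calc ‖x‖ ^ k * ‖iteratedFDeriv ℝ n (fun x : E => Real.exp (-(4⁻¹ * ‖x‖ ^ 2))) x‖
        ≤ (1 + ‖x‖) ^ k * (n.factorial * Real.exp (-(4⁻¹ * ‖x‖ ^ 2)) * (D * (1 + ‖x‖) ^ l) ^ n) := by
          gcongr
          · linarith
          · exact this
      _ = n.factorial * D ^ n * ((1 + ‖x‖) ^ (k + l * n) * Real.exp (-(4⁻¹ * ‖x‖ ^ 2))) := by
          rw [mul_pow, pow_add, ← pow_mul]; ring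
      _ ≤ _ := by
          gcongr
          exact hB _ (norm_nonneg _)

theorem gauss0_apply (x : E) : gauss0 E x = Real.exp (-(4⁻¹ * ‖x‖ ^ 2)) := rfl

variable [FiniteDimensional ℝ E] [MeasurableSpace E] [BorelSpace E]

theorem integral_gauss0_pos : 0 < ∫ x, gauss0 E x := by
  apply integral_pos_of_integrable_nonneg_nonzero (x := 0) (gauss0 E).continuous
    (gauss0 E).integrable
  · intro x; rw [gauss0_apply]; positivity
  · rw [gauss0_apply]; positivity

/-- The normalised Gaussian. -/
def gauss : 𝓢(E, ℝ) := (∫ x, gauss0 E x)⁻¹ • gauss0 E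

theorem gauss_apply (x : E) :
    gauss E x = (∫ x, gauss0 E x)⁻¹ * Real.exp (-(4⁻¹ * ‖x‖ ^ 2)) := rfl

theorem integral_gauss : ∫ x, gauss E x = 1 := by
  have : ∀ x, gauss E x = (∫ x, gauss0 E x)⁻¹ * gauss0 E x := fun x => rfl
  simp_rw [this, integral_const_mul]
  exact inv_mul_cancel₀ (integral_gauss0_pos E).ne'

end Gaussian

section Conv

variable {E : Type} [NormedAddCommGroup E] [InnerProductSpace ℝ E] [FiniteDimensional ℝ E]
  [MeasurableSpace E] [BorelSpace E]
  {F : Type} [NormedAddCommGroup F] [NormedSpace ℝ F]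

/-- Convolution of a bounded function `g` with the dilate of `θ` at scale `s`. -/
def conv (θ : 𝓢(E, F)) (s : ℝ) (g : E → ℝ) (x : E) : F := ∫ z, g (x - s • z) • θ z

variable (θ : 𝓢(E, F)) {g h : E → ℝ} {M : ℝ}

theorem conv_integrable (hg : Measurable g) (hM : ∀ x, |g x| ≤ M) (s : ℝ) (x : E) :
    Integrable fun z => g (x - s • z) • θ z := by
  refine (θ.integrable.norm.const_mul M).mono' ?_ ?_
  · exact (hg.comp (by fun_prop)).aestronglyMeasurable.smul θ.continuous.aestronglyMeasurable
  · refine Filter.Eventually.of_forall fun z => ?_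
    rw [norm_smul]
    gcongr
    simpa using hM _

theorem conv_norm_le (hg : Measurable g) (hM : ∀ x, |g x| ≤ M) (s : ℝ) (x : E) :
    ‖conv θ s g x‖ ≤ M * ∫ z, ‖θ z‖ := by
  rw [conv, ← integral_const_mul]
  refine norm_integral_le_of_norm_le (θ.integrable.norm.const_mul _) ?_
  refine Filter.Eventually.of_forall fun z => ?_
  rw [norm_smul]
  gcongr
  simpa using hM _

theorem conv_add (hg : Measurable g) (hM : ∀ x, |g x| ≤ M) {M' : ℝ} (hh : Measurable h)
    (hM' : ∀ x, |h x| ≤ M') (s : ℝ) (x : E) :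
    conv θ s (fun y => g y + h y) x = conv θ s g x + conv θ s h x := by
  unfold conv
  rw [← integral_add (conv_integrable θ hg hM s x) (conv_integrable θ hh hM' s x)]
  simp_rw [add_smul]

theorem conv_const_mul (c : ℝ) (s : ℝ) (x : E) :
    conv θ s (fun y => c * g y) x = c • conv θ s g x := by
  unfold conv
  rw [← integral_smul]
  simp_rw [mul_smul]

theorem conv_const (c : ℝ) (s : ℝ) (x : E) :
    conv θ s (fun _ => c) x = c • ∫ z, θ z := by
  unfold conv
  rw [← integral_smul]

theorem integrable_moment {β : ℝ} (hβ : 0 < β) (hβ1 : β < 1) :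
    Integrable fun z => ‖θ z‖ * ‖z‖ ^ β := by
  have h1 : Integrable fun z => ‖θ z‖ + ‖z‖ ^ 1 * ‖θ z‖ :=
    θ.integrable.norm.add (θ.integrable_pow_mul volume 1)
  refine h1.mono' ?_ ?_
  · refine (θ.continuous.norm.mul ?_).aestronglyMeasurable
    exact continuous_norm.rpow_const fun _ => Or.inr hβ.le
  · refine Filter.Eventually.of_forall fun z => ?_
    rw [Real.norm_of_nonneg (by positivity)]
    have : ‖z‖ ^ β ≤ 1 + ‖z‖ := by
      rcases le_total ‖z‖ 1 with h | h
      · have := Real.rpow_le_one (norm_nonneg z) h hβ.le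
        linarith [norm_nonneg z]
      · have := Real.rpow_le_rpow_of_exponent_le h hβ1.le
        rw [Real.rpow_one] at this; linarith
    nlinarith [norm_nonneg (θ z)]

/-- The `β`-moment of a kernel. -/
def moment (θ : 𝓢(E, F)) (β : ℝ) : ℝ := ∫ z, ‖θ z‖ * ‖z‖ ^ β

theorem moment_nonneg (β : ℝ) : 0 ≤ moment θ β := integral_nonneg fun _ => by positivity

theorem conv_norm_le_moment {β : ℝ} (hβ : 0 < β) (hβ1 : β < 1) {H : ℝ} {x : E}
    (hg : ∀ y, |g y| ≤ H * ‖y - x‖ ^ β) {s : ℝ} (hs : 0 ≤ s) :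
    ‖conv θ s g x‖ ≤ H * s ^ β * moment θ β := by
  rw [conv, moment, ← integral_const_mul]
  refine norm_integral_le_of_norm_le ((integrable_moment θ hβ hβ1).const_mul _) ?_
  refine Filter.Eventually.of_forall fun z => ?_
  rw [norm_smul]
  have := hg (x - s • z)
  have h2 : ‖x - s • z - x‖ = s * ‖z‖ := by
    rw [show x - s • z - x = -(s • z) by abel, norm_neg, norm_smul, Real.norm_of_nonneg hs]
  rw [h2, Real.mul_rpow hs (norm_nonneg _)] at this
  calc ‖g (x - s • z)‖ * ‖θ z‖ ≤ (H * (s ^ β * ‖z‖ ^ β)) * ‖θ z‖ := by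
        gcongr; simpa using this
    _ = _ := by ring

/-- Uniform decay of a Schwartz function. -/
theorem exists_decay : ∃ C : ℝ, 0 ≤ C ∧ ∀ z, ‖θ z‖ ≤ C * (1 + ‖z‖) ^ (-((Module.finrank ℝ E : ℝ) + 1)) := by
  set k := Module.finrank ℝ E + 1
  have h := fun x => SchwartzMap.one_add_le_sup_seminorm_apply (𝕜 := ℝ) (m := (k, 0)) le_rfl le_rfl θ x
  refine ⟨2 ^ k * ((Finset.Iic (k, 0)).sup fun m : ℕ × ℕ => SchwartzMap.seminorm ℝ m.1 m.2) θ,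
    by positivity, fun z => ?_⟩
  have h1 := h z
  simp only [norm_iteratedFDeriv_zero] at h1
  have h2 : (0 : ℝ) < 1 + ‖z‖ := by positivity
  rw [Real.rpow_neg h2.le, ← div_eq_mul_inv, le_div_iff₀ (by positivity)]
  have h3 : (1 + ‖z‖) ^ ((Module.finrank ℝ E : ℝ) + 1) = (1 + ‖z‖) ^ k := by
    rw [← Real.rpow_natCast]; simp [k]
  rw [h3, mul_comm]
  exact h1

theorem conv_eq (s : ℝ) (hs : s ≠ 0) (g : E → ℝ) (x : E) :
    conv θ s g x = conv θ 1 (fun y => g (s • y)) (s⁻¹ • x) := by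
  unfold conv
  congr 1; ext z
  simp only
  rw [smul_sub, smul_inv_smul₀ hs, one_smul]

theorem conv_one_eq (g : E → ℝ) (x : E) : conv θ 1 g x = ∫ y, g y • θ (x - y) := by
  unfold conv
  rw [← integral_sub_left_eq_self (fun y => g y • θ (x - y)) volume x]
  simp

theorem hasFDerivAt_conv_one (hg : Measurable g) (hM : ∀ x, |g x| ≤ M) (x : E) :
    HasFDerivAt (conv θ 1 g) (conv (SchwartzMap.fderivCLM ℝ E F θ) 1 g x) x := by
  have h0 : conv θ 1 g = fun x => ∫ y, g y • θ (x - y) := funext (conv_one_eq θ g)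
  rw [h0, conv_one_eq]
  have hM0 : 0 ≤ M := (abs_nonneg _).trans (hM 0)
  obtain ⟨C, hC, hdec⟩ := exists_decay (SchwartzMap.fderivCLM ℝ E F θ)
  set r : ℝ := (Module.finrank ℝ E : ℝ) + 1 with hr
  have hr0 : 0 < r := by positivity
  have hmeas : ∀ {G : Type} [NormedAddCommGroup G] [NormedSpace ℝ G] (η : 𝓢(E, G)) (x : E),
      AEStronglyMeasurable (fun y => g y • η (x - y)) := fun η x =>
    hg.aestronglyMeasurable.smul
      (η.continuous.comp (by fun_prop : Continuous fun y => x - y)).aestronglyMeasurable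
  refine hasFDerivAt_integral_of_dominated_of_fderiv_le (s := ball x 1)
    (bound := fun y => M * (C * 2 ^ r) * (1 + ‖x - y‖) ^ (-r))
    (F' := fun x y => g y • SchwartzMap.fderivCLM ℝ E F θ (x - y))
    (ball_mem_nhds _ one_pos) (Filter.Eventually.of_forall fun x => hmeas θ x) ?_ (hmeas _ x)
    ?_ ?_ ?_
  · refine ((θ.integrable.comp_sub_left x).norm.const_mul M).mono' (hmeas _ x) ?_
    refine Filter.Eventually.of_forall fun z => ?_
    rw [norm_smul]
    gcongr
    simpa using hM _
  · refine Filter.Eventually.of_forall fun y x' hx' => ?_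
    rw [norm_smul, mul_assoc M]
    refine mul_le_mul (by simpa using hM y) ?_ (norm_nonneg _) hM0
    refine (hdec _).trans ?_
    rw [mul_assoc]
    gcongr
    have h1 : (1 + ‖x - y‖) / 2 ≤ 1 + ‖x' - y‖ := by
      have : ‖x - y‖ ≤ ‖x - x'‖ + ‖x' - y‖ := norm_sub_le_norm_sub_add_norm_sub _ _ _
      have h3 : ‖x - x'‖ < 1 := by rwa [← dist_eq_norm, dist_comm]
      linarith [norm_nonneg (x' - y)]
    calc (1 + ‖x' - y‖) ^ (-r) ≤ ((1 + ‖x - y‖) / 2) ^ (-r) :=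
          Real.rpow_le_rpow_of_nonpos (by positivity) h1 (by linarith)
      _ = _ := by
          rw [Real.div_rpow (by positivity) (by norm_num), Real.rpow_neg (by norm_num : (0:ℝ) ≤ 2),
            div_inv_eq_mul, mul_comm]
  · refine Integrable.const_mul ?_ _
    exact (integrable_one_add_norm (E := E) (μ := volume) (r := r) (by linarith)).comp_sub_left x
  · refine Filter.Eventually.of_forall fun y x' _ => ?_
    have h1 : HasFDerivAt θ (SchwartzMap.fderivCLM ℝ E F θ (x' - y)) (x' - y) := by
      simpa using θ.hasFDerivAt (x' - y)
    have h2 : HasFDerivAt (fun x => x - y) (ContinuousLinearMap.id ℝ E) x' :=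
      (hasFDerivAt_id x').sub_const y
    have h3 : HasFDerivAt (fun x => g y • θ (x - y)) _ x' := (h1.comp x' h2).const_smul (g y)
    simpa using h3

theorem hasFDerivAt_conv (hg : Measurable g) (hM : ∀ x, |g x| ≤ M) {s : ℝ} (hs : s ≠ 0) (x : E) :
    HasFDerivAt (conv θ s g) (s⁻¹ • conv (SchwartzMap.fderivCLM ℝ E F θ) s g x) x := by
  have h0 : conv θ s g = fun x => conv θ 1 (fun y => g (s • y)) (s⁻¹ • x) :=
    funext (conv_eq θ s hs g)
  rw [h0, conv_eq _ s hs]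
  have h1 := hasFDerivAt_conv_one θ (g := fun y => g (s • y)) (hg.comp (by fun_prop))
    (fun x => hM _) (s⁻¹ • x)
  have h2 : HasFDerivAt (fun x : E => s⁻¹ • x) (s⁻¹ • ContinuousLinearMap.id ℝ E) x :=
    (hasFDerivAt_id x).const_smul s⁻¹
  have h3 : HasFDerivAt (fun x => conv θ 1 (fun y => g (s • y)) (s⁻¹ • x)) _ x := h1.comp x h2
  refine h3.congr_fderiv ?_
  ext v
  simp

theorem conv_fderiv_eq_zero {s : ℝ} (hs : s ≠ 0) (hg : Measurable g) (hM : ∀ x, |g x| ≤ M) {v : E}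
    (hv : ∀ x (t : ℝ), g (x + t • v) = g x) (x : E) :
    conv (SchwartzMap.fderivCLM ℝ E F θ) s g x v = 0 := by
  have h1 := (hasFDerivAt_conv θ hg hM hs x)
  have h2 : HasDerivAt (fun t : ℝ => conv θ s g (x + t • v))
      ((s⁻¹ • conv (SchwartzMap.fderivCLM ℝ E F θ) s g x) v) 0 := by
    have h3 : HasDerivAt (fun t : ℝ => x + t • v) v 0 := by
      simpa using ((hasDerivAt_id (0:ℝ)).smul_const v).const_add x
    have h1' : HasFDerivAt (conv θ s g) (s⁻¹ • conv (SchwartzMap.fderivCLM ℝ E F θ) s g x)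
      (x + (0 : ℝ) • v) := by simpa using h1
    exact h1'.comp_hasDerivAt (0:ℝ) h3
  have h4 : (fun t : ℝ => conv θ s g (x + t • v)) = fun _ => conv θ s g x := by
    ext t
    unfold conv
    congr 1; ext z
    rw [show x + t • v - s • z = (x - s • z) + t • v by abel, hv]
  rw [h4] at h2
  have h5 := h2.unique (hasDerivAt_const _ _)
  simpa [hs] using h5

theorem integral_fderivCLM : ∫ z, SchwartzMap.fderivCLM ℝ E F θ z = 0 := by
  ext v
  have := conv_fderiv_eq_zero θ (g := fun _ => 1) (M := 1) (s := 1) one_ne_zero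
    measurable_const (by simp) (v := v) (by simp) 0
  rw [conv_const] at this
  simpa using this

end Conv

set_option maxSynthPendingDepth 4

section ConvScale

variable {E : Type} [NormedAddCommGroup E] [InnerProductSpace ℝ E] [FiniteDimensional ℝ E]
  [MeasurableSpace E] [BorelSpace E]
  {F : Type} [NormedAddCommGroup F] [NormedSpace ℝ F]

theorem integral_scale (φ : E → F) {s : ℝ} (hs : 0 < s) (x : E) :
    ∫ y, (s ^ Module.finrank ℝ E)⁻¹ • φ (s⁻¹ • (x - y)) = ∫ z, φ z := by
  rw [integral_sub_left_eq_self (fun y => (s ^ Module.finrank ℝ E)⁻¹ • φ (s⁻¹ • y)) volume x,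
    integral_smul, Measure.integral_comp_smul]
  rw [inv_pow, inv_inv, abs_of_pos (by positivity), smul_smul, inv_mul_cancel₀ (by positivity),
    one_smul]

theorem conv_eq_scale (θ : 𝓢(E, F)) (g : E → ℝ) {s : ℝ} (hs : 0 < s) (x : E) :
    conv θ s g x = ∫ y, (s ^ Module.finrank ℝ E)⁻¹ • g y • θ (s⁻¹ • (x - y)) := by
  unfold conv
  rw [← integral_scale _ hs x]
  congr 1; ext y
  rw [smul_inv_smul₀ hs.ne', sub_sub_cancel]

/-- The kernel of the scale derivative. -/
def scaleKer (θ : 𝓢(E, F)) (z : E) : F :=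
  -(Module.finrank ℝ E : ℝ) • θ z - SchwartzMap.fderivCLM ℝ E F θ z z

theorem hasDerivAt_conv_scale (θ : 𝓢(E, F)) {g : E → ℝ} {M : ℝ} (hg : Measurable g)
    (hM : ∀ x, |g x| ≤ M) {s : ℝ} (hs : 0 < s) (x : E) :
    HasDerivAt (fun s => conv θ s g x) (s⁻¹ • ∫ z, g (x - s • z) • scaleKer θ z) s := by
  set n := Module.finrank ℝ E with hn
  have hM0 : 0 ≤ M := (abs_nonneg _).trans (hM 0)
  have key : HasDerivAt (fun s => ∫ y, (s ^ n)⁻¹ • g y • θ (s⁻¹ • (x - y)))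
      (∫ y, (s ^ n)⁻¹ • s⁻¹ • g y • scaleKer θ (s⁻¹ • (x - y))) s := by
    obtain ⟨C0, hC0, hdec0⟩ := exists_decay θ
    have hdec1 : ∃ C : ℝ, 0 ≤ C ∧ ∀ z, ‖SchwartzMap.fderivCLM ℝ E F θ z z‖
        ≤ C * (1 + ‖z‖) ^ (-((n : ℝ) + 1)) := by
      set k := n + 2
      have h := fun x => SchwartzMap.one_add_le_sup_seminorm_apply (𝕜 := ℝ) (m := (k, 0))
        le_rfl le_rfl (SchwartzMap.fderivCLM ℝ E F θ) x
      refine ⟨2 ^ k * ((Finset.Iic (k, 0)).sup fun m : ℕ × ℕ => SchwartzMap.seminorm ℝ m.1 m.2)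
        (SchwartzMap.fderivCLM ℝ E F θ), by positivity, fun z => ?_⟩
      have h1 := h z
      simp only [norm_iteratedFDeriv_zero] at h1
      have h2 : (0 : ℝ) < 1 + ‖z‖ := by positivity
      rw [Real.rpow_neg h2.le, ← div_eq_mul_inv, le_div_iff₀ (by positivity)]
      have h3 : (1 + ‖z‖) ^ ((n : ℝ) + 1) = (1 + ‖z‖) ^ (n + 1) := by
        rw [← Real.rpow_natCast]; simp
      rw [h3]
      refine le_trans ?_ h1
      calc ‖SchwartzMap.fderivCLM ℝ E F θ z z‖ * (1 + ‖z‖) ^ (n + 1)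
          ≤ (‖SchwartzMap.fderivCLM ℝ E F θ z‖ * (1 + ‖z‖)) * (1 + ‖z‖) ^ (n + 1) := by
            gcongr
            refine (ContinuousLinearMap.le_opNorm _ _).trans ?_
            gcongr
            linarith
        _ = _ := by ring
    obtain ⟨C1, hC1, hdec1⟩ := hdec1
    set r : ℝ := (n : ℝ) + 1 with hr
    have hr0 : 0 < r := by positivity
    have hκ : ∀ z, ‖scaleKer θ z‖ ≤ (n * C0 + C1) * (1 + ‖z‖) ^ (-r) := by
      intro z
      unfold scaleKer
      refine (norm_sub_le _ _).trans ?_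
      rw [norm_smul, norm_neg, Real.norm_of_nonneg (by positivity), add_mul, mul_assoc]
      exact add_le_add (mul_le_mul_of_nonneg_left (hdec0 z) (by positivity)) (hdec1 z)
    have hcκ : Continuous (scaleKer θ) := by
      unfold scaleKer
      exact (θ.continuous.const_smul _).sub
        ((SchwartzMap.fderivCLM ℝ E F θ).continuous.clm_apply continuous_id)
    have hmeas : ∀ {η : E → F} (_ : Continuous η) (s : ℝ),
        AEStronglyMeasurable (fun y => g y • η (s⁻¹ • (x - y))) := fun hη s =>
      hg.aestronglyMeasurable.smul (hη.comp (by fun_prop)).aestronglyMeasurable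
    refine (hasDerivAt_integral_of_dominated_loc_of_deriv_le (s := Ioo (s / 2) (2 * s))
      (bound := fun y => ((s / 2) ^ n)⁻¹ * ((s / 2)⁻¹ * (M * ((n * C0 + C1) *
        (1 + ‖(2 * s)⁻¹ • (x - y)‖) ^ (-r)))))
      (F' := fun s y => (s ^ n)⁻¹ • s⁻¹ • g y • scaleKer θ (s⁻¹ • (x - y)))
      (Ioo_mem_nhds (by linarith) (by linarith))
      (Filter.Eventually.of_forall fun t => (hmeas θ.continuous t).const_smul _) ?_
      (((hmeas hcκ s).const_smul _).const_smul _) ?_ ?_ ?_).2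
    · have h1 : Integrable fun y => θ (s⁻¹ • (x - y)) :=
        ((integrable_comp_smul_iff volume θ (inv_ne_zero hs.ne')).2 θ.integrable).comp_sub_left x
      refine Integrable.smul _ ?_
      refine (h1.norm.const_mul M).mono' (hmeas θ.continuous s) ?_
      refine Filter.Eventually.of_forall fun z => ?_
      rw [norm_smul]
      gcongr
      simpa using hM _
    · refine Filter.Eventually.of_forall fun y t ht => ?_
      have ht0 : 0 < t := by linarith [ht.1]
      rw [norm_smul, norm_smul, norm_smul, norm_inv, norm_inv, Real.norm_of_nonneg ht0.le,
        Real.norm_of_nonneg (by positivity)]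
      have ht1 := ht.1.le
      gcongr
      · simpa using hM y
      · refine (hκ _).trans ?_
        gcongr (_ * ?_)
        refine Real.rpow_le_rpow_of_nonpos (by positivity) ?_ (by linarith)
        rw [norm_smul, norm_smul, norm_inv, norm_inv, Real.norm_of_nonneg ht0.le,
          Real.norm_of_nonneg (by positivity)]
        have := ht.2.le
        gcongr
    · refine Integrable.const_mul (Integrable.const_mul (Integrable.const_mul
        (Integrable.const_mul ?_ _) _) _) _
      have h1 := integrable_one_add_norm (E := E) (μ := volume) (r := r) (by linarith)
      exact ((integrable_comp_smul_iff volume (fun z : E => (1 + ‖z‖) ^ (-r))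
        (inv_ne_zero (by positivity : 2 * s ≠ 0))).2 h1).comp_sub_left x
    · refine Filter.Eventually.of_forall fun y t ht => ?_
      have ht0 : 0 < t := by linarith [ht.1]
      have h1 : HasDerivAt (fun t : ℝ => (t ^ n)⁻¹) (-(n : ℝ) * t⁻¹ * (t ^ n)⁻¹) t := by
        have : HasDerivAt (fun t : ℝ => (t ^ n)⁻¹) _ t := (hasDerivAt_pow n t).inv (by positivity)
        refine this.congr_deriv ?_
        rcases Nat.eq_zero_or_pos n with h | h
        · simp [h]
        · obtain ⟨m, hm⟩ := Nat.exists_eq_succ_of_ne_zero h.ne'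
          rw [hm]
          rw [Nat.succ_sub_one, pow_succ]
          field_simp
          rw [pow_succ]
      have h2 : HasDerivAt (fun t : ℝ => t⁻¹ • (x - y)) (-(t ^ 2)⁻¹ • (x - y)) t :=
        (hasDerivAt_inv ht0.ne').smul_const _
      have h3 : HasFDerivAt θ (SchwartzMap.fderivCLM ℝ E F θ (t⁻¹ • (x - y))) (t⁻¹ • (x - y)) := by
        simpa using θ.hasFDerivAt (t⁻¹ • (x - y))
      have h4 : HasDerivAt (fun t => (t ^ n)⁻¹ • g y • θ (t⁻¹ • (x - y))) _ t :=
        h1.smul ((h3.comp_hasDerivAt t h2).const_smul (g y))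
      refine h4.congr_deriv ?_
      unfold scaleKer
      generalize x - y = u at *
      have hw : SchwartzMap.fderivCLM ℝ E F θ (t⁻¹ • u) (-(t ^ 2)⁻¹ • u)
          = -(t⁻¹) • SchwartzMap.fderivCLM ℝ E F θ (t⁻¹ • u) (t⁻¹ • u) := by
        rw [← map_smul, smul_smul]
        congr 2
        field_simp
      rw [hw, ← hn]
      module
  have h1 : (fun s => conv θ s g x) =ᶠ[nhds s]
      fun s => ∫ y, (s ^ n)⁻¹ • g y • θ (s⁻¹ • (x - y)) := by
    filter_upwards [lt_mem_nhds hs] with t ht using conv_eq_scale θ g ht x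
  refine (key.congr_of_eventuallyEq h1).congr_deriv ?_
  rw [← integral_smul, ← integral_scale (fun z => s⁻¹ • g (x - s • z) • scaleKer θ z) hs x]
  congr 1; ext y
  rw [smul_inv_smul₀ hs.ne', sub_sub_cancel]

theorem continuousOn_conv_scale (θ : 𝓢(E, F)) {g : E → ℝ} {M : ℝ} (hg : Measurable g)
    (hM : ∀ x, |g x| ≤ M) (x : E) : ContinuousOn (fun s => conv θ s g x) (Ioi 0) :=
  fun _ hs => (hasDerivAt_conv_scale θ hg hM hs x).continuousAt.continuousWithinAt

end ConvScale

section Kernels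
variable (E : Type) [NormedAddCommGroup E] [InnerProductSpace ℝ E] [FiniteDimensional ℝ E]
  [MeasurableSpace E] [BorelSpace E]

/-- First derivative of the Gaussian. -/
def K1 : 𝓢(E, E →L[ℝ] ℝ) := SchwartzMap.fderivCLM ℝ E ℝ (gauss E)
/-- Second derivative of the Gaussian. -/
def K2 : 𝓢(E, E →L[ℝ] E →L[ℝ] ℝ) := SchwartzMap.fderivCLM ℝ E _ (K1 E)

variable {E}

theorem hasFDerivAt_gauss (z : E) :
    HasFDerivAt (gauss E) ((-2⁻¹ * gauss E z) • innerSL ℝ z) z := by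
  have h1 : HasFDerivAt (fun x : E => ‖x‖ ^ 2) (2 • innerSL ℝ z) z := by
    simpa using (hasFDerivAt_id z).norm_sq
  have h2 := ((h1.const_mul (4⁻¹:ℝ)).neg.exp).const_mul (∫ x, gauss0 E x)⁻¹
  have h3 : (gauss E : E → ℝ) = fun x => (∫ x, gauss0 E x)⁻¹ * Real.exp (-(4⁻¹ * ‖x‖ ^ 2)) :=
    funext (gauss_apply E)
  rw [h3]
  refine h2.congr_fderiv ?_
  ext v
  simp
  ring

theorem K1_apply (z v : E) : K1 E z v = -2⁻¹ * gauss E z * inner ℝ z v := by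
  rw [K1, SchwartzMap.fderivCLM_apply, (hasFDerivAt_gauss z).fderiv]
  simp

theorem K2_apply (z w v : E) :
    K2 E z w v = gauss E z * (4⁻¹ * inner ℝ z w * inner ℝ z v - 2⁻¹ * inner ℝ w v) := by
  have h0 : HasFDerivAt (K1 E) (K2 E z) z := by
    simpa [K2] using (K1 E).hasFDerivAt z
  have h1 : HasFDerivAt (fun z => K1 E z v) ((ContinuousLinearMap.apply ℝ ℝ v).comp (K2 E z)) z :=
    (ContinuousLinearMap.apply ℝ ℝ v).hasFDerivAt.comp z h0
  have h2 : HasFDerivAt (fun z => -2⁻¹ * gauss E z * inner ℝ z v) _ z :=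
    ((hasFDerivAt_gauss z).const_mul (-2⁻¹)).mul ((hasFDerivAt_id z).inner ℝ (hasFDerivAt_const v z))
  have h3 : (fun z => K1 E z v) = fun z => -2⁻¹ * gauss E z * inner ℝ z v :=
    funext fun z => K1_apply z v
  rw [h3] at h1
  have h4 := congrArg (fun L : E →L[ℝ] ℝ => L w) (h1.unique h2)
  simp at h4
  rw [h4]
  ring

theorem K2_symm (z w v : E) : K2 E z w v = K2 E z v w := by
  rw [K2_apply, K2_apply, real_inner_comm w v]; ring

theorem scaleKer_gauss {ι : Type} [Fintype ι] (b : OrthonormalBasis ι ℝ E) (z : E) :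
    scaleKer (gauss E) z = 2 * ∑ i, K2 E z (b i) (b i) := by
  have h1 : SchwartzMap.fderivCLM ℝ E ℝ (gauss E) z z = K1 E z z := rfl
  rw [scaleKer, h1, K1_apply]
  simp_rw [K2_apply]
  rw [← Finset.mul_sum, Finset.sum_sub_distrib]
  have h2 : ∑ i, 4⁻¹ * inner ℝ z (b i) * inner ℝ z (b i) = 4⁻¹ * ‖z‖ ^ 2 := by
    simp_rw [mul_assoc]
    rw [← Finset.mul_sum, ← b.sum_sq_norm_inner_right z]
    congr 1
    refine Finset.sum_congr rfl fun i _ => ?_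
    rw [real_inner_comm, Real.norm_eq_abs, sq_abs, sq]
  have h3 : ∑ i : ι, (2⁻¹:ℝ) * inner ℝ (b i) (b i) = 2⁻¹ * Module.finrank ℝ E := by
    simp [Module.finrank_eq_card_basis b.toBasis]; ring
  rw [h2, h3, real_inner_self_eq_norm_sq]
  simp only [smul_eq_mul]
  ring

end Kernels

section Holder
variable {E : Type} [NormedAddCommGroup E] {G : Type} [NormedAddCommGroup G]

/-- Scaled Hölder bound: `f` is bounded by `A` and `β`-Hölder with constant `A / ρ ^ β`. -/
def HB (β ρ A : ℝ) (f : E → G) : Prop :=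
  (∀ x, ‖f x‖ ≤ A) ∧ ∀ x y, ‖f x - f y‖ ≤ A * (‖x - y‖ / ρ) ^ β

theorem HB.nonneg {β ρ A : ℝ} {f : E → G} (h : HB β ρ A f) : 0 ≤ A :=
  (norm_nonneg _).trans (h.1 0)

theorem HB.mono {β ρ A A' : ℝ} {f : E → G} (h : HB β ρ A f) (hρ : 0 < ρ) (hA : A ≤ A') :
    HB β ρ A' f :=
  ⟨fun x => (h.1 x).trans hA, fun x y => (h.2 x y).trans (by gcongr)⟩

theorem HB.continuous {β ρ A : ℝ} (hβ : 0 < β) {f : E → G} (h : HB β ρ A f) :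
    Continuous f := by
  rw [continuous_iff_continuousAt]
  intro x
  rw [ContinuousAt, tendsto_iff_norm_sub_tendsto_zero]
  have h1 : Filter.Tendsto (fun y => A * (‖y - x‖ / ρ) ^ β) (nhds x) (nhds 0) := by
    have : Continuous fun y => A * (‖y - x‖ / ρ) ^ β :=
      continuous_const.mul (Continuous.rpow_const (by fun_prop) fun _ => Or.inr hβ.le)
    have h2 := this.tendsto x
    simpa [Real.zero_rpow hβ.ne'] using h2
  exact squeeze_zero (fun _ => norm_nonneg _) (fun y => h.2 y x) h1

end Holder

section Weighted

variable {E : Type} [NormedAddCommGroup E] [InnerProductSpace ℝ E] [FiniteDimensional ℝ E]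
  [MeasurableSpace E] [BorelSpace E]
  {F : Type} [NormedAddCommGroup F] [NormedSpace ℝ F]

variable (θ : 𝓢(E, F)) {g : E → ℝ} {M : ℝ}

theorem aesm_weighted (hg : Measurable g) (hM : ∀ x, |g x| ≤ M) {a : ℝ → ℝ}
    (ha : ContinuousOn a (Ioi 0)) (x : E) :
    AEStronglyMeasurable (fun s => a s • conv θ s g x) (volume.restrict (Ioi 0)) :=
  (ha.smul (continuousOn_conv_scale θ hg hM x)).aestronglyMeasurable measurableSet_Ioi

theorem integrable_weighted (hg : Measurable g) (hM : ∀ x, |g x| ≤ M) {a : ℝ → ℝ}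
    (ha : ContinuousOn a (Ioi 0)) (hai : IntegrableOn a (Ioi 0)) (x : E) :
    IntegrableOn (fun s => a s • conv θ s g x) (Ioi 0) := by
  refine (hai.norm.mul_const (M * ∫ z, ‖θ z‖)).mono' (aesm_weighted θ hg hM ha x) ?_
  refine Filter.Eventually.of_forall fun s => ?_
  rw [norm_smul]
  gcongr
  exact conv_norm_le θ hg hM s x

theorem hasFDerivAt_weighted (hg : Measurable g) (hM : ∀ x, |g x| ≤ M) {a : ℝ → ℝ}
    (ha : ContinuousOn a (Ioi 0)) (hai : IntegrableOn a (Ioi 0)) {U : Set E} {x₀ : E}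
    (hU : U ∈ nhds x₀) {b : ℝ → ℝ} (hb : IntegrableOn b (Ioi 0))
    (hbound : ∀ s, 0 < s → ∀ x ∈ U,
      ‖(a s * s⁻¹) • conv (SchwartzMap.fderivCLM ℝ E F θ) s g x‖ ≤ b s) :
    HasFDerivAt (fun x => ∫ s in Ioi (0:ℝ), a s • conv θ s g x)
      (∫ s in Ioi (0:ℝ), (a s * s⁻¹) • conv (SchwartzMap.fderivCLM ℝ E F θ) s g x₀) x₀ := by
  have ha' : ContinuousOn (fun s => a s * s⁻¹) (Ioi 0) :=
    ha.mul (continuousOn_inv₀.mono fun s hs => ne_of_gt hs)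
  refine hasFDerivAt_integral_of_dominated_of_fderiv_le (s := U) (bound := b)
    (F' := fun x s => (a s * s⁻¹) • conv (SchwartzMap.fderivCLM ℝ E F θ) s g x) hU
    (Filter.Eventually.of_forall fun x => aesm_weighted θ hg hM ha x)
    (integrable_weighted θ hg hM ha hai x₀) (aesm_weighted _ hg hM ha' x₀) ?_ hb ?_
  · filter_upwards [ae_restrict_mem measurableSet_Ioi] with s hs x hx using hbound s hs x hx
  · filter_upwards [ae_restrict_mem measurableSet_Ioi] with s hs x hx
    have := (hasFDerivAt_conv θ hg hM (ne_of_gt hs) x).const_smul (a s)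
    rw [smul_smul] at this
    exact this

/-- The weight of the second-order singular integral. -/
def wt (s : ℝ) : ℝ := 2 * s⁻¹ * Real.exp (-s ^ 2)

theorem continuousOn_wt : ContinuousOn wt (Ioi 0) := by
  unfold wt
  exact (continuousOn_const.mul (continuousOn_inv₀.mono fun s hs => ne_of_gt hs)).mul
    (by fun_prop)

theorem integrableOn_exp_rpow {t : ℝ} (ht : -1 < t) :
    IntegrableOn (fun s : ℝ => s ^ t * Real.exp (-s ^ 2)) (Ioi 0) := by
  simpa using integrableOn_rpow_mul_exp_neg_mul_sq (b := 1) one_pos ht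

theorem wt_mul_rpow {β : ℝ} {s : ℝ} (hs : 0 < s) :
    wt s * s ^ β = 2 * (s ^ (β - 1) * Real.exp (-s ^ 2)) := by
  rw [wt, Real.rpow_sub_one hs.ne']
  field_simp

theorem wt_nonneg {s : ℝ} (hs : 0 < s) : 0 ≤ wt s := by unfold wt; positivity

theorem integrableOn_wt_rpow {β : ℝ} (hβ : 0 < β) :
    IntegrableOn (fun s : ℝ => wt s * s ^ β) (Ioi 0) :=
  IntegrableOn.congr_fun (Integrable.const_mul (integrableOn_exp_rpow (t := β - 1) (by linarith)) 2)
    (fun s hs => (wt_mul_rpow hs).symm) measurableSet_Ioi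

theorem integrableOn_wt_conv (hg : Measurable g) (hM : ∀ x, |g x| ≤ M) {β H : ℝ} (hβ : 0 < β)
    {x : E} (h0 : ∀ s, 0 < s → ‖conv θ s g x‖ ≤ H * s ^ β) :
    IntegrableOn (fun s => wt s • conv θ s g x) (Ioi 0) := by
  refine ((integrableOn_wt_rpow hβ).const_mul H).mono' (aesm_weighted θ hg hM continuousOn_wt x) ?_
  filter_upwards [ae_restrict_mem measurableSet_Ioi] with s hs
  rw [norm_smul, Real.norm_of_nonneg (wt_nonneg hs)]
  calc wt s * ‖conv θ s g x‖ ≤ wt s * (H * s ^ β) :=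
        mul_le_mul_of_nonneg_left (h0 s hs) (wt_nonneg hs)
    _ = _ := by ring

/-- Hölder estimate for the second-order singular integral. -/
theorem exists_singular_bound {β : ℝ} (hβ : 0 < β) (hβ1 : β < 1) : ∃ c : ℝ, 0 ≤ c ∧
    ∀ (g : E → ℝ) (M H : ℝ), Measurable g → (∀ x, |g x| ≤ M) →
    (∀ s x, 0 < s → ‖conv θ s g x‖ ≤ H * s ^ β) →
    (∀ s x, 0 < s → ‖conv (SchwartzMap.fderivCLM ℝ E F θ) s g x‖ ≤ H * s ^ β) →
    HB β 1 (c * H) fun x => ∫ s in Ioi (0:ℝ), wt s • conv θ s g x := by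
  set I := ∫ s in Ioi (0:ℝ), wt s * s ^ β with hI
  have hI0 : 0 ≤ I := setIntegral_nonneg measurableSet_Ioi fun s hs => by
    have := wt_nonneg hs; have hs' : (0:ℝ) < s := hs; positivity
  refine ⟨I + 4 / β + 2 / (1 - β), by
    have : 0 < 1 - β := by linarith
    positivity, fun g M H hg hM h0 h1 => ⟨fun x => ?_, fun x y => ?_⟩⟩
  · have hH : 0 ≤ H := by simpa using (norm_nonneg _).trans (h0 1 x one_pos)
    have h2 : ‖∫ s in Ioi (0:ℝ), wt s • conv θ s g x‖ ≤ ∫ s in Ioi (0:ℝ), H * (wt s * s ^ β) := by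
      refine norm_integral_le_of_norm_le ((integrableOn_wt_rpow hβ).const_mul H) ?_
      filter_upwards [ae_restrict_mem measurableSet_Ioi] with s hs
      rw [norm_smul, Real.norm_of_nonneg (wt_nonneg hs)]
      calc wt s * ‖conv θ s g x‖ ≤ wt s * (H * s ^ β) :=
            mul_le_mul_of_nonneg_left (h0 s x hs) (wt_nonneg hs)
        _ = _ := by ring
    rw [integral_const_mul, ← hI] at h2
    have h3 : 0 < 1 - β := by linarith
    have : 0 ≤ (4 / β + 2 / (1 - β)) * H := by positivity
    nlinarith
  · have hH : 0 ≤ H := by simpa using (norm_nonneg _).trans (h0 1 x one_pos)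
    rcases eq_or_ne x y with rfl | hxy
    · simp [Real.zero_rpow hβ.ne']
    set h := ‖x - y‖ with hh
    have hpos : 0 < h := norm_pos_iff.2 (sub_ne_zero.2 hxy)
    rw [← integral_sub (integrableOn_wt_conv θ hg hM hβ fun s hs => h0 s x hs)
      (integrableOn_wt_conv θ hg hM hβ fun s hs => h0 s y hs)]
    set D : ℝ → F := fun s => wt s • conv θ s g x - wt s • conv θ s g y with hD
    have hDint : IntegrableOn D (Ioi 0) := (integrableOn_wt_conv θ hg hM hβ fun s hs => h0 s x hs).sub
      (integrableOn_wt_conv θ hg hM hβ fun s hs => h0 s y hs)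
    have hwt : ∀ s : ℝ, 0 < s → wt s ≤ 2 * s⁻¹ := fun s hs => by
      unfold wt
      have : Real.exp (-s ^ 2) ≤ 1 := Real.exp_le_one_iff.2 (by nlinarith)
      exact mul_le_of_le_one_right (by positivity) this
    have b1 : ∀ s, 0 < s → ‖D s‖ ≤ 4 * H * s ^ (β - 1) := by
      intro s hs
      rw [hD]; simp only
      rw [← smul_sub, norm_smul, Real.norm_of_nonneg (wt_nonneg hs)]
      calc wt s * ‖conv θ s g x - conv θ s g y‖ ≤ 2 * s⁻¹ * (H * s ^ β + H * s ^ β) := by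
            refine mul_le_mul (hwt s hs) ?_ (norm_nonneg _) (by positivity)
            exact (norm_sub_le _ _).trans (add_le_add (h0 s x hs) (h0 s y hs))
        _ = _ := by rw [Real.rpow_sub_one hs.ne']; ring
    have b2 : ∀ s, 0 < s → ‖D s‖ ≤ 2 * H * h * s ^ (β - 2) := by
      intro s hs
      rw [hD]; simp only
      rw [← smul_sub, norm_smul, Real.norm_of_nonneg (wt_nonneg hs)]
      have h3 : ‖conv θ s g x - conv θ s g y‖ ≤ (s⁻¹ * (H * s ^ β)) * ‖x - y‖ := by
        refine Convex.norm_image_sub_le_of_norm_hasFDerivWithin_le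
          (f' := fun x => s⁻¹ • conv (SchwartzMap.fderivCLM ℝ E F θ) s g x) (s := univ)
          (fun x _ => (hasFDerivAt_conv θ hg hM hs.ne' x).hasFDerivWithinAt) (fun x _ => ?_)
          convex_univ (mem_univ _) (mem_univ _)
        rw [norm_smul, norm_inv, Real.norm_of_nonneg hs.le]
        gcongr
        exact h1 s x hs
      calc wt s * ‖conv θ s g x - conv θ s g y‖ ≤ 2 * s⁻¹ * ((s⁻¹ * (H * s ^ β)) * h) :=
            mul_le_mul (hwt s hs) h3 (norm_nonneg _) (by positivity)
        _ = _ := by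
            rw [show β - 2 = β - 1 - 1 by ring, Real.rpow_sub_one hs.ne', Real.rpow_sub_one hs.ne']
            ring
    have hsplit : Ioi (0:ℝ) = Ioc 0 h ∪ Ioi h := (Ioc_union_Ioi_eq_Ioi hpos.le).symm
    rw [hsplit, setIntegral_union (Ioc_disjoint_Ioi le_rfl) measurableSet_Ioi
      (hDint.mono_set Ioc_subset_Ioi_self) (hDint.mono_set (Ioi_subset_Ioi hpos.le))]
    have i1 : ‖∫ s in Ioc 0 h, D s‖ ≤ 4 * H * (h ^ β / β) := by
      have e1 : ∫ s in Ioc 0 h, 4 * H * s ^ (β - 1) = 4 * H * (h ^ β / β) := by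
        rw [integral_const_mul, ← intervalIntegral.integral_of_le hpos.le,
          integral_rpow (Or.inl (by linarith))]
        simp [Real.zero_rpow hβ.ne']
      rw [← e1]
      refine norm_integral_le_of_norm_le ?_ ?_
      · refine Integrable.const_mul ?_ _
        have := (intervalIntegral.intervalIntegrable_rpow' (a := 0) (b := h) (r := β - 1)
          (by linarith)).1
        exact this
      · filter_upwards [ae_restrict_mem measurableSet_Ioc] with s hs using b1 s hs.1
    have i2 : ‖∫ s in Ioi h, D s‖ ≤ 2 * H * (h ^ β / (1 - β)) := by
      have e1 : ∫ s in Ioi h, 2 * H * h * s ^ (β - 2) = 2 * H * (h ^ β / (1 - β)) := by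
        rw [integral_const_mul, integral_Ioi_rpow_of_lt (by linarith) hpos]
        rw [show β - 2 + 1 = β - 1 by ring, Real.rpow_sub_one hpos.ne', ← neg_sub 1 β, neg_div_neg_eq]
        field_simp
      rw [← e1]
      refine norm_integral_le_of_norm_le ?_ ?_
      · exact (integrableOn_Ioi_rpow_of_lt (by linarith) hpos).const_mul _
      · filter_upwards [ae_restrict_mem measurableSet_Ioi] with s hs using b2 s (hpos.trans hs)
    have i3 : 0 ≤ I * H * h ^ β := by positivity
    calc _ ≤ 4 * H * (h ^ β / β) + 2 * H * (h ^ β / (1 - β)) := (norm_add_le _ _).trans (add_le_add i1 i2)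
      _ ≤ 4 * H * (h ^ β / β) + 2 * H * (h ^ β / (1 - β)) + I * H * h ^ β := by linarith
      _ = _ := by rw [div_one]; ring

end Weighted

section Potential

variable {E : Type} [NormedAddCommGroup E] [InnerProductSpace ℝ E] [FiniteDimensional ℝ E]
  [MeasurableSpace E] [BorelSpace E]
  {F : Type} [NormedAddCommGroup F] [NormedSpace ℝ F]

theorem conv_postcomp {F' : Type} [NormedAddCommGroup F'] [NormedSpace ℝ F']
    [FiniteDimensional ℝ F] [FiniteDimensional ℝ F']
    (L : F →L[ℝ] F') (θ : 𝓢(E, F)) {g : E → ℝ} {M : ℝ}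
    (hg : Measurable g) (hM : ∀ x, |g x| ≤ M) (s : ℝ) (x : E) :
    conv (SchwartzMap.postcompCLM L θ) s g x = L (conv θ s g x) := by
  have := FiniteDimensional.complete ℝ F
  have := FiniteDimensional.complete ℝ F'
  rw [conv, conv, ← L.integral_comp_comm (conv_integrable θ hg hM s x)]
  simp

theorem conv_norm_le_holder [FiniteDimensional ℝ F] (θ : 𝓢(E, F)) (hθ : ∫ z, θ z = 0) {g : E → ℝ} {M : ℝ}
    (hg : Measurable g) (hM : ∀ x, |g x| ≤ M) {β : ℝ} (hβ : 0 < β) (hβ1 : β < 1) {H : ℝ} {x : E}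
    (hH : ∀ y, |g y - g x| ≤ H * ‖y - x‖ ^ β) {s : ℝ} (hs : 0 ≤ s) :
    ‖conv θ s g x‖ ≤ H * s ^ β * moment θ β := by
  have h1 : conv θ s g x = conv θ s (fun y => g y - g x) x := by
    have h2 := conv_add θ (g := fun y => g y - g x) (h := fun _ => g x) (M := M + M)
      (hg.sub_const _) (fun y => (abs_sub _ _).trans (add_le_add (hM _) (hM _)))
      measurable_const (fun _ => hM x) s x
    rw [conv_const, hθ, smul_zero, add_zero] at h2
    rw [← h2]
    simp
  rw [h1]
  exact conv_norm_le_moment θ hβ hβ1 hH hs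

/-- The bounded potential `(1 - Δ)⁻¹ g`. -/
def pot (g : E → ℝ) (x : E) : ℝ :=
  ∫ s in Ioi (0:ℝ), (2 * s * Real.exp (-s ^ 2)) • conv (gauss E) s g x

/-- The derivative of the potential. -/
def potD (g : E → ℝ) (x : E) : E →L[ℝ] ℝ :=
  ∫ s in Ioi (0:ℝ), (2 * Real.exp (-s ^ 2)) • conv (K1 E) s g x

/-- The second derivative of the potential, as a singular integral. -/
def potDD (g : E → ℝ) (x : E) : E →L[ℝ] E →L[ℝ] ℝ :=
  ∫ s in Ioi (0:ℝ), wt s • conv (K2 E) s g x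

theorem integrableOn_w0 : IntegrableOn (fun s : ℝ => 2 * s * Real.exp (-s ^ 2)) (Ioi 0) := by
  have h := (integrableOn_exp_rpow (t := 1) (by norm_num)).const_mul 2
  refine h.congr (Filter.Eventually.of_forall fun s => ?_)
  simp [mul_assoc]

theorem integrableOn_w1 : IntegrableOn (fun s : ℝ => 2 * Real.exp (-s ^ 2)) (Ioi 0) := by
  have h := (integrableOn_exp_rpow (t := 0) (by norm_num)).const_mul 2
  refine h.congr (Filter.Eventually.of_forall fun s => ?_)
  simp

variable {g : E → ℝ} {M : ℝ}

theorem hasFDerivAt_pot (hg : Measurable g) (hM : ∀ x, |g x| ≤ M) (x : E) :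
    HasFDerivAt (pot g) (potD g x) x := by
  have h := hasFDerivAt_weighted (gauss E) hg hM (a := fun s => 2 * s * Real.exp (-s ^ 2))
    (by fun_prop) integrableOn_w0 (U := univ) (x₀ := x) Filter.univ_mem
    (b := fun s => 2 * Real.exp (-s ^ 2) * (M * ∫ z, ‖K1 E z‖)) (integrableOn_w1.mul_const _)
    (fun s hs y _ => by
      rw [norm_smul]
      refine mul_le_mul (le_of_eq ?_) (conv_norm_le (K1 E) hg hM s y) (norm_nonneg _) (by positivity)
      rw [Real.norm_of_nonneg (by positivity)]
      field_simp)
  refine h.congr_fderiv ?_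
  refine setIntegral_congr_fun measurableSet_Ioi fun s hs => ?_
  have : (0:ℝ) < s := hs
  simp only [K1]
  congr 1
  field_simp

theorem continuous_potD (hg : Measurable g) (hM : ∀ x, |g x| ≤ M) : Continuous (potD g) := by
  refine continuous_of_dominated (bound := fun s => 2 * Real.exp (-s ^ 2) * (M * ∫ z, ‖K1 E z‖))
    (fun x => aesm_weighted _ hg hM (by fun_prop) x) (fun x => ?_) (integrableOn_w1.mul_const _) ?_
  · refine Filter.Eventually.of_forall fun s => ?_
    rw [norm_smul, Real.norm_of_nonneg (by positivity)]
    exact mul_le_mul_of_nonneg_left (conv_norm_le (K1 E) hg hM s x) (by positivity)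
  · filter_upwards [ae_restrict_mem measurableSet_Ioi] with s hs
    have hs' : s ≠ 0 := ne_of_gt hs
    have h1 : Continuous (conv (K1 E) s g) :=
      continuous_iff_continuousAt.2 fun x => (hasFDerivAt_conv (K1 E) hg hM hs' x).continuousAt
    exact h1.const_smul (2 * Real.exp (-s ^ 2))

theorem norm_pot_le (hg : Measurable g) (hM : ∀ x, |g x| ≤ M) (x : E) :
    ‖pot g x‖ ≤ (∫ s in Ioi (0:ℝ), 2 * s * Real.exp (-s ^ 2)) * (∫ z, ‖gauss E z‖) * M := by
  have h : ‖pot g x‖ ≤ ∫ s in Ioi (0:ℝ), 2 * s * Real.exp (-s ^ 2) * (M * ∫ z, ‖gauss E z‖) := by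
    refine norm_integral_le_of_norm_le (integrableOn_w0.mul_const _) ?_
    filter_upwards [ae_restrict_mem measurableSet_Ioi] with s hs
    have hs' : (0:ℝ) < s := hs
    rw [norm_smul, Real.norm_of_nonneg (by positivity)]
    exact mul_le_mul_of_nonneg_left (conv_norm_le (gauss E) hg hM s x) (by positivity)
  rw [integral_mul_const] at h
  linarith

theorem norm_potD_le (hg : Measurable g) (hM : ∀ x, |g x| ≤ M) (x : E) :
    ‖potD g x‖ ≤ (∫ s in Ioi (0:ℝ), 2 * Real.exp (-s ^ 2)) * (∫ z, ‖K1 E z‖) * M := by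
  have h : ‖potD g x‖ ≤ ∫ s in Ioi (0:ℝ), 2 * Real.exp (-s ^ 2) * (M * ∫ z, ‖K1 E z‖) := by
    refine norm_integral_le_of_norm_le (integrableOn_w1.mul_const _) ?_
    refine Filter.Eventually.of_forall fun s => ?_
    rw [norm_smul, Real.norm_of_nonneg (by positivity)]
    exact mul_le_mul_of_nonneg_left (conv_norm_le (K1 E) hg hM s x) (by positivity)
  rw [integral_mul_const] at h
  linarith

theorem hasFDerivAt_potD (hg : Measurable g) (hM : ∀ x, |g x| ≤ M) {β : ℝ} (hβ : 0 < β)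
    (hβ1 : β < 1) {H : ℝ} {x : E} {U : Set E} (hU : U ∈ nhds x)
    (hH : ∀ x ∈ U, ∀ y, |g y - g x| ≤ H * ‖y - x‖ ^ β) :
    HasFDerivAt (potD g) (potDD g x) x := by
  have h := hasFDerivAt_weighted (K1 E) hg hM (a := fun s => 2 * Real.exp (-s ^ 2))
    (by fun_prop) integrableOn_w1 (U := U) (x₀ := x) hU
    (b := fun s => (wt s * s ^ β) * (H * moment (K2 E) β)) ((integrableOn_wt_rpow hβ).mul_const _)
    (fun s hs y hy => by
      rw [norm_smul]
      have h1 := conv_norm_le_holder (K2 E) (integral_fderivCLM (K1 E)) hg hM hβ hβ1 (hH y hy) hs.le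
      have h2 : ‖2 * Real.exp (-s ^ 2) * s⁻¹‖ = wt s := by
        rw [Real.norm_of_nonneg (by positivity), wt]; ring
      rw [h2]
      calc _ ≤ wt s * (H * s ^ β * moment (K2 E) β) :=
            mul_le_mul_of_nonneg_left h1 (wt_nonneg hs)
        _ = _ := by ring)
  refine h.congr_fderiv ?_
  refine setIntegral_congr_fun measurableSet_Ioi fun s hs => ?_
  simp only [K2, wt]
  congr 1
  ring

theorem tendsto_conv_gauss (hg : Measurable g) (hM : ∀ x, |g x| ≤ M) {β : ℝ} (hβ : 0 < β)
    (hβ1 : β < 1) {H : ℝ} {x : E} (hH : ∀ y, |g y - g x| ≤ H * ‖y - x‖ ^ β) :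
    Filter.Tendsto (fun s => conv (gauss E) s g x) (nhdsWithin 0 (Ioi 0)) (nhds (g x)) := by
  rw [tendsto_iff_norm_sub_tendsto_zero]
  have h1 : ∀ s : ℝ, 0 < s → ‖conv (gauss E) s g x - g x‖ ≤ H * s ^ β * moment (gauss E) β := by
    intro s hs
    have h2 := conv_add (gauss E) (g := fun y => g y - g x) (h := fun _ => g x) (M := M + M)
      (hg.sub_const _) (fun y => (abs_sub _ _).trans (add_le_add (hM _) (hM _)))
      measurable_const (fun _ => hM x) s x
    rw [conv_const, integral_gauss, smul_eq_mul, mul_one] at h2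
    simp only [sub_add_cancel] at h2
    have h3 : conv (gauss E) s g x - g x = conv (gauss E) s (fun y => g y - g x) x := by
      rw [show conv (gauss E) s g x = _ from h2]; ring
    rw [h3]
    exact conv_norm_le_moment _ hβ hβ1 hH hs.le
  refine squeeze_zero' (Filter.Eventually.of_forall fun _ => norm_nonneg _)
    (eventually_nhdsWithin_of_forall h1) ?_
  have h4 : Filter.Tendsto (fun s : ℝ => H * s ^ β * moment (gauss E) β) (nhds 0)
      (nhds (H * (0:ℝ) ^ β * moment (gauss E) β)) := by
    have : Continuous fun s : ℝ => H * s ^ β * moment (gauss E) β :=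
      (continuous_const.mul (Real.continuous_rpow_const hβ.le)).mul continuous_const
    exact this.tendsto 0
  rw [Real.zero_rpow hβ.ne'] at h4
  simp only [mul_zero, zero_mul] at h4
  exact h4.mono_left nhdsWithin_le_nhds

theorem integrable_K2 (hg : Measurable g) (hM : ∀ x, |g x| ≤ M) {β : ℝ} (hβ : 0 < β)
    (hβ1 : β < 1) {H : ℝ} {x : E} (hH : ∀ y, |g y - g x| ≤ H * ‖y - x‖ ^ β) :
    IntegrableOn (fun s => wt s • conv (K2 E) s g x) (Ioi 0) := by
  refine integrableOn_wt_conv (K2 E) hg hM (H := H * moment (K2 E) β) hβ fun s hs => ?_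
  have := conv_norm_le_holder (K2 E) (integral_fderivCLM (K1 E)) hg hM hβ hβ1 hH hs.le
  linarith

/-- The potential solves `u - Δu = g` wherever `g` is Hölder. -/
theorem pot_sub_trace (hg : Measurable g) (hM : ∀ x, |g x| ≤ M) {β : ℝ} (hβ : 0 < β)
    (hβ1 : β < 1) {H : ℝ} {x : E} (hH : ∀ y, |g y - g x| ≤ H * ‖y - x‖ ^ β)
    {ι : Type} [Fintype ι] (b : OrthonormalBasis ι ℝ E) :
    pot g x - ∑ i, potDD g x (b i) (b i) = g x := by
  have hK := integrable_K2 hg hM hβ hβ1 hH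
  have hKi : ∀ i, IntegrableOn (fun s => wt s * conv (K2 E) s g x (b i) (b i)) (Ioi 0) := by
    intro i
    exact ((ContinuousLinearMap.apply ℝ ℝ (b i)).comp
      (ContinuousLinearMap.apply ℝ (E →L[ℝ] ℝ) (b i))).integrable_comp hK
  have hKe : ∀ i, potDD g x (b i) (b i) = ∫ s in Ioi (0:ℝ), wt s * conv (K2 E) s g x (b i) (b i) := by
    intro i
    exact (((ContinuousLinearMap.apply ℝ ℝ (b i)).comp
      (ContinuousLinearMap.apply ℝ (E →L[ℝ] ℝ) (b i))).integral_comp_comm hK).symm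
  have hsum : ∑ i, potDD g x (b i) (b i)
      = ∫ s in Ioi (0:ℝ), ∑ i, wt s * conv (K2 E) s g x (b i) (b i) := by
    rw [integral_finsetSum _ fun i _ => hKi i]
    exact Finset.sum_congr rfl fun i _ => hKe i
  have h0 := integrable_weighted (gauss E) hg hM (a := fun s => 2 * s * Real.exp (-s ^ 2))
    (by fun_prop) integrableOn_w0 x
  have hS : IntegrableOn (fun s => ∑ i, wt s * conv (K2 E) s g x (b i) (b i)) (Ioi 0) :=
    integrable_finsetSum _ fun i _ => hKi i
  have hker : ∀ s : ℝ, ∫ z, g (x - s • z) • scaleKer (gauss E) z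
      = 2 * ∑ i, conv (K2 E) s g x (b i) (b i) := by
    intro s
    have h1 : ∀ i, conv (K2 E) s g x (b i) (b i) = ∫ z, g (x - s • z) * K2 E z (b i) (b i) := by
      intro i
      exact (((ContinuousLinearMap.apply ℝ ℝ (b i)).comp
        (ContinuousLinearMap.apply ℝ (E →L[ℝ] ℝ) (b i))).integral_comp_comm
          (conv_integrable (K2 E) hg hM s x)).symm
    have h2 : ∀ i, Integrable fun z => g (x - s • z) * K2 E z (b i) (b i) := fun i =>
      ((ContinuousLinearMap.apply ℝ ℝ (b i)).comp
        (ContinuousLinearMap.apply ℝ (E →L[ℝ] ℝ) (b i))).integrable_comp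
          (conv_integrable (K2 E) hg hM s x)
    simp_rw [h1]
    rw [← integral_finsetSum _ fun i _ => h2 i, ← integral_const_mul]
    refine integral_congr_ae (Filter.Eventually.of_forall fun z => ?_)
    simp only [scaleKer_gauss b, smul_eq_mul, Finset.mul_sum]
    exact Finset.sum_congr rfl fun i _ => by ring
  have hder : ∀ s ∈ Ioi (0:ℝ), HasDerivAt (fun s => Real.exp (-s ^ 2) * conv (gauss E) s g x)
      ((∑ i, wt s * conv (K2 E) s g x (b i) (b i)) -
        (2 * s * Real.exp (-s ^ 2)) • conv (gauss E) s g x) s := by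
    intro s hs
    have hs' : (0:ℝ) < s := hs
    have h1 := hasDerivAt_conv_scale (gauss E) hg hM hs' x
    rw [hker] at h1
    have h2 : HasDerivAt (fun s : ℝ => Real.exp (-s ^ 2)) (Real.exp (-s ^ 2) * (-(2 * s))) s := by
      have h3 : HasDerivAt (fun s : ℝ => -s ^ 2) (-(2 * s)) s :=
        ((hasDerivAt_pow 2 s).neg).congr_deriv (by simp)
      exact h3.exp
    refine (h2.mul h1).congr_deriv ?_
    rw [← Finset.mul_sum, wt]
    simp only [smul_eq_mul]
    ring
  have hlim0 : Filter.Tendsto (fun s => Real.exp (-s ^ 2) * conv (gauss E) s g x)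
      (nhdsWithin 0 (Ioi 0)) (nhds (g x)) := by
    have h1 : Filter.Tendsto (fun s : ℝ => Real.exp (-s ^ 2)) (nhdsWithin 0 (Ioi 0)) (nhds 1) := by
      have : Continuous fun s : ℝ => Real.exp (-s ^ 2) := by fun_prop
      have h := this.tendsto 0
      simp only [ne_eq, OfNat.ofNat_ne_zero, not_false_eq_true, zero_pow, neg_zero,
        Real.exp_zero] at h
      exact h.mono_left nhdsWithin_le_nhds
    simpa using h1.mul (tendsto_conv_gauss hg hM hβ hβ1 hH)
  have hlim1 : Filter.Tendsto (fun s => Real.exp (-s ^ 2) * conv (gauss E) s g x)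
      Filter.atTop (nhds 0) := by
    have h1 : Filter.Tendsto (fun s : ℝ => Real.exp (-s ^ 2)) Filter.atTop (nhds 0) :=
      Real.tendsto_exp_neg_atTop_nhds_zero.comp (Filter.tendsto_pow_atTop two_ne_zero)
    refine squeeze_zero_norm (a := fun s => Real.exp (-s ^ 2) * (M * ∫ z, ‖gauss E z‖)) (fun s => ?_)
      (by simpa using h1.mul_const (M * ∫ z, ‖gauss E z‖))
    rw [norm_mul, Real.norm_of_nonneg (Real.exp_pos _).le]
    exact mul_le_mul_of_nonneg_left (conv_norm_le _ hg hM s x) (Real.exp_pos _).le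
  have hzero : Real.exp (-(0:ℝ) ^ 2) * conv (gauss E) 0 g x = g x := by
    have : conv (gauss E) 0 g x = g x := by
      simp only [conv, zero_smul, sub_zero, smul_eq_mul]
      rw [integral_const_mul, integral_gauss, mul_one]
    simp [this]
  have hcont : ContinuousWithinAt (fun s => Real.exp (-s ^ 2) * conv (gauss E) s g x) (Ici 0) 0 := by
    rw [← Ioi_insert, continuousWithinAt_insert_self, ContinuousWithinAt, hzero]
    exact hlim0
  have hmain := integral_Ioi_of_hasDerivAt_of_tendsto hcont hder (hS.sub h0) hlim1
  have hsub : ∫ s in Ioi (0:ℝ), ((∑ i, wt s * conv (K2 E) s g x (b i) (b i)) -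
        (2 * s * Real.exp (-s ^ 2)) • conv (gauss E) s g x)
      = (∫ s in Ioi (0:ℝ), ∑ i, wt s * conv (K2 E) s g x (b i) (b i)) - pot g x :=
    integral_sub hS h0
  rw [hzero, hsub, ← hsum] at hmain
  linarith

end Potential

section HBalgebra

variable {E : Type} [NormedAddCommGroup E] {G : Type} [NormedAddCommGroup G]
  {β ρ A A' : ℝ} {f g : E → G}

theorem HB.add (hf : HB β ρ A f) (hg : HB β ρ A' g) : HB β ρ (A + A') fun x => f x + g x :=
  ⟨fun x => (norm_add_le _ _).trans (add_le_add (hf.1 x) (hg.1 x)), fun x y => by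
    have : f x + g x - (f y + g y) = (f x - f y) + (g x - g y) := by abel
    rw [this, add_mul]
    exact (norm_add_le _ _).trans (add_le_add (hf.2 x y) (hg.2 x y))⟩

theorem HB.neg (hf : HB β ρ A f) : HB β ρ A fun x => - f x :=
  ⟨fun x => by rw [norm_neg]; exact hf.1 x, fun x y => by
    rw [← neg_sub', norm_neg]; exact hf.2 x y⟩

theorem HB.sub (hf : HB β ρ A f) (hg : HB β ρ A' g) : HB β ρ (A + A') fun x => f x - g x := by
  simpa [sub_eq_add_neg] using hf.add hg.neg

variable [NormedSpace ℝ G] {G' : Type} [NormedAddCommGroup G'] [NormedSpace ℝ G']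

theorem HB.clm (L : G →L[ℝ] G') (hf : HB β ρ A f) : HB β ρ (‖L‖ * A) fun x => L (f x) :=
  ⟨fun x => (L.le_opNorm _).trans (by gcongr; exact hf.1 x), fun x y => by
    rw [← map_sub, mul_assoc]
    exact (L.le_opNorm _).trans (by gcongr; exact hf.2 x y)⟩

theorem HB.comp_lip (hβ : 0 < β) (hβ1 : β < 1) (hρ : 0 < ρ) {E' : Type} [NormedAddCommGroup E']
    {Φ : E' → E} {c : ℝ} (hc : 1 ≤ c)
    (hΦ : ∀ x y, ‖Φ x - Φ y‖ ≤ c * ‖x - y‖) (hf : HB β ρ A f) :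
    HB β ρ (c * A) fun x => f (Φ x) := by
  have hA := hf.nonneg
  refine ⟨fun x => (hf.1 _).trans (by nlinarith), fun x y => (hf.2 _ _).trans ?_⟩
  have h1 : (‖Φ x - Φ y‖ / ρ) ^ β ≤ (c * (‖x - y‖ / ρ)) ^ β := by
    refine Real.rpow_le_rpow (by positivity) ?_ hβ.le
    rw [mul_div_assoc']
    exact div_le_div_of_nonneg_right (hΦ x y) hρ.le
  rw [Real.mul_rpow (by linarith) (by positivity)] at h1
  have h2 : c ^ β ≤ c := by
    simpa using Real.rpow_le_rpow_of_exponent_le hc hβ1.le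
  calc A * (‖Φ x - Φ y‖ / ρ) ^ β ≤ A * (c ^ β * (‖x - y‖ / ρ) ^ β) := by gcongr
    _ ≤ A * (c * (‖x - y‖ / ρ) ^ β) := by gcongr
    _ = _ := by ring

/-- `t^β ≥ min 1 t`. -/
theorem min_one_le_rpow (hβ : 0 < β) (hβ1 : β < 1) {t : ℝ} (ht : 0 ≤ t) : min 1 t ≤ t ^ β := by
  rcases le_total t 1 with h | h
  · refine (min_le_right _ _).trans ?_
    rcases ht.eq_or_lt with rfl | h0
    · exact Real.rpow_nonneg le_rfl _
    · simpa using Real.rpow_le_rpow_of_exponent_ge h0 h hβ1.le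
  · exact (min_le_left _ _).trans (Real.one_le_rpow h hβ.le)

theorem HB.of_lipschitz (hβ : 0 < β) (hβ1 : β < 1) (hρ : 0 < ρ) (hb : ∀ x, ‖f x‖ ≤ A)
    (hl : ∀ x y, ‖f x - f y‖ ≤ A / ρ * ‖x - y‖) : HB β ρ (2 * A) f := by
  have hA : 0 ≤ A := (norm_nonneg _).trans (hb 0)
  refine ⟨fun x => (hb x).trans (by linarith), fun x y => ?_⟩
  have h1 := min_one_le_rpow hβ hβ1 (t := ‖x - y‖ / ρ) (by positivity)
  have h2 : ‖f x - f y‖ ≤ 2 * A * min 1 (‖x - y‖ / ρ) := by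
    rw [mul_min_of_nonneg _ _ (by positivity)]
    refine le_min ?_ ((hl x y).trans ?_)
    · have := norm_sub_le (f x) (f y); linarith [hb x, hb y]
    · rw [div_mul_eq_mul_div, mul_div_assoc]
      have : 0 ≤ A * (‖x - y‖ / ρ) := by positivity
      linarith
  exact h2.trans (by gcongr)

theorem HB.of_deriv [NormedSpace ℝ E] (hβ : 0 < β) (hβ1 : β < 1) (hρ : 0 < ρ)
    {f' : E → E →L[ℝ] G} (hd : ∀ x, HasFDerivAt f (f' x) x) (hb : ∀ x, ‖f x‖ ≤ A)
    (hl : ∀ x, ‖f' x‖ ≤ A / ρ) : HB β ρ (2 * A) f := by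
  refine HB.of_lipschitz hβ hβ1 hρ hb fun x y => ?_
  exact convex_univ.norm_image_sub_le_of_norm_hasFDerivWithin_le
    (fun z _ => (hd z).hasFDerivWithinAt) (fun z _ => hl z) (mem_univ y) (mem_univ x)

end HBalgebra

section HalfSpace

variable {E : Type} [NormedAddCommGroup E] [InnerProductSpace ℝ E] 

/-- The linear map `x ↦ x' - k xₙ e`. -/
def strch (e : E) (k : ℝ) : E →L[ℝ] E :=
  ContinuousLinearMap.id ℝ E - (1 + k) • (innerSL ℝ e).smulRight e

theorem strch_apply (e : E) (k : ℝ) (x : E) :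
    strch e k x = x - ((1 + k) * inner ℝ e x) • e := by
  simp [strch, mul_smul]

variable {e : E}

theorem inner_strch (he : ‖e‖ = 1) (k : ℝ) (x : E) : inner ℝ e (strch e k x) = -k * inner ℝ e x := by
  rw [strch_apply, inner_sub_right, inner_smul_right, real_inner_self_eq_norm_sq, he]; ring

theorem abs_inner_le (he : ‖e‖ = 1) (x : E) : |inner ℝ e x| ≤ ‖x‖ := by
  have := abs_real_inner_le_norm e x
  rwa [he, one_mul] at this

variable [FiniteDimensional ℝ E] [MeasurableSpace E] [BorelSpace E]

theorem sign_invariant (v x : E) (t : ℝ) :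
    Real.sign (inner ℝ e (x + t • strch e 0 v)) = Real.sign (inner ℝ e x) ∨ ‖e‖ ≠ 1 := by
  by_cases he : ‖e‖ = 1
  · left; rw [inner_add_right, inner_smul_right, inner_strch he]; simp
  · right; exact he

theorem pot_eq_zero (he : ‖e‖ = 1) {g : E → ℝ} (hodd : ∀ x, g (strch e 1 x) = - g x) {x : E}
    (hx : inner ℝ e x = 0) : pot g x = 0 := by
  set R := (ℝ ∙ e)ᗮ.reflection with hR
  have hRx : ∀ z, R z = strch e 1 z := by
    intro z
    rw [hR, Submodule.reflection_orthogonal_apply, Submodule.reflection_singleton_apply, strch_apply, he]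
    simp only [RCLike.ofReal_real_eq_id, id_eq, one_pow, div_one]
    module
  have hxx : strch e 1 x = x := by rw [strch_apply, hx]; simp
  have h0 : ∀ s, conv (gauss E) s g x = 0 := by
    intro s
    have h1 : conv (gauss E) s g x = ∫ z, g (x - s • R z) • gauss E (R z) :=
      ((R.measurePreserving).integral_comp R.toHomeomorph.measurableEmbedding
        (fun z => g (x - s • z) • gauss E z)).symm
    have h2 : ∀ z, g (x - s • R z) • gauss E (R z) = -(g (x - s • z) • gauss E z) := by
      intro z
      have h3 : x - s • R z = strch e 1 (x - s • z) := by
        rw [map_sub, map_smul, hxx, hRx]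
      rw [h3, hodd, gauss_apply, gauss_apply, R.norm_map]
      simp
    simp_rw [h2] at h1
    rw [integral_neg] at h1
    change _ = -conv (gauss E) s g x at h1
    linarith
  simp [pot, h0]

/-- Half-space data: `g = sign(xₙ) F` with `F` even Hölder. -/
theorem odd_holder (he : ‖e‖ = 1) {F : E → ℝ} {β A : ℝ} (hβ : 0 < β) (hF : HB β 1 A F) {δ : ℝ} (hδ : 0 < δ) {x : E}
    (hx : δ ≤ inner ℝ e x) (y : E) :
    |Real.sign (inner ℝ e y) * F y - Real.sign (inner ℝ e x) * F x| ≤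
      (A + 2 * A * (δ ^ β)⁻¹) * ‖y - x‖ ^ β := by
  have hA := hF.nonneg
  have hsx : Real.sign (inner ℝ e x) = 1 := Real.sign_of_pos (hδ.trans_le hx)
  rw [hsx, one_mul]
  rcases lt_or_ge 0 (inner ℝ e y) with h | h
  · rw [Real.sign_of_pos h, one_mul]
    have h1 := hF.2 y x
    rw [div_one] at h1
    have : 0 ≤ 2 * A * (δ ^ β)⁻¹ * ‖y - x‖ ^ β := by positivity
    rw [Real.norm_eq_abs] at h1
    linarith
  · have h1 : δ ≤ ‖y - x‖ := by
      have h2 := abs_inner_le he (y - x)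
      rw [inner_sub_right, abs_of_nonpos (by linarith)] at h2
      linarith
    have h2 : δ ^ β ≤ ‖y - x‖ ^ β := Real.rpow_le_rpow hδ.le h1 hβ.le
    have h3 : |Real.sign (inner ℝ e y) * F y - F x| ≤ 2 * A := by
      refine (abs_sub _ _).trans ?_
      have h4 : |Real.sign (inner ℝ e y)| ≤ 1 := by
        rcases Real.sign_apply_eq (inner ℝ e y) with h | h | h <;> simp [h]
      have h5 := hF.1 y
      have h6 := hF.1 x
      rw [Real.norm_eq_abs] at h5 h6
      rw [abs_mul]
      nlinarith [abs_nonneg (F y)]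
    have h4 : 0 < δ ^ β := by positivity
    have h5 : 1 ≤ (δ ^ β)⁻¹ * ‖y - x‖ ^ β := by
      rw [inv_mul_eq_div, le_div_iff₀ h4]; linarith
    have : 0 ≤ A * ‖y - x‖ ^ β := by positivity
    nlinarith

theorem measurable_real_sign : Measurable Real.sign := by
  unfold Real.sign
  exact Measurable.ite measurableSet_Iio measurable_const
    (Measurable.ite measurableSet_Ioi measurable_const measurable_const)

/-- Precomposition with the tangential projection. -/
def tproj (e : E) : (E →L[ℝ] ℝ) →L[ℝ] (E →L[ℝ] ℝ) :=
  (ContinuousLinearMap.compL ℝ E E ℝ).flip (strch e 0)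

theorem tproj_apply (φ : E →L[ℝ] ℝ) (v : E) : tproj e φ v = φ (strch e 0 v) := rfl

/-- The tangential part of the second Gaussian derivative. -/
def K1P (e : E) : 𝓢(E, E →L[ℝ] ℝ) := SchwartzMap.postcompCLM (tproj e) (K1 E)

/-- Its derivative. -/
def K2P (e : E) : 𝓢(E, E →L[ℝ] E →L[ℝ] ℝ) := SchwartzMap.fderivCLM ℝ E _ (K1P e)

theorem K2P_eq : K2P e = SchwartzMap.postcompCLM
    (ContinuousLinearMap.compL ℝ E (E →L[ℝ] ℝ) (E →L[ℝ] ℝ) (tproj e)) (K2 E) := by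
  ext1 z
  rw [SchwartzMap.postcompCLM_apply, K2P, SchwartzMap.fderivCLM_apply]
  have h : HasFDerivAt (K1 E) (K2 E z) z := by simpa [K2] using (K1 E).hasFDerivAt z
  exact ((tproj e).hasFDerivAt.comp z h).fderiv

theorem conv_K1P_sign (he : ‖e‖ = 1) {s : ℝ} (hs : s ≠ 0) (x : E) :
    conv (K1P e) s (fun y => Real.sign (inner ℝ e y)) x = 0 := by
  have hm : Measurable fun y : E => Real.sign (inner ℝ e y) :=
    measurable_real_sign.comp (by fun_prop)
  have hM : ∀ y : E, |Real.sign (inner ℝ e y)| ≤ 1 := fun y => by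
    rcases Real.sign_apply_eq (inner ℝ e y) with h | h | h <;> simp [h]
  rw [K1P, conv_postcomp _ _ hm hM]
  ext v
  rw [tproj_apply]
  refine conv_fderiv_eq_zero (gauss E) hs hm hM (v := strch e 0 v) (fun x t => ?_) x
  exact (sign_invariant v x t).resolve_right (by simpa using he)

theorem conv_fderivCLM_zero {F : Type} [NormedAddCommGroup F] [NormedSpace ℝ F] (θ : 𝓢(E, F))
    {g : E → ℝ} {M : ℝ} (hg : Measurable g) (hM : ∀ x, |g x| ≤ M) {s : ℝ} (hs : s ≠ 0)
    (h0 : ∀ x, conv θ s g x = 0) (x : E) : conv (SchwartzMap.fderivCLM ℝ E F θ) s g x = 0 := by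
  have h1 := hasFDerivAt_conv θ hg hM hs x
  have h2 : conv θ s g = fun _ => 0 := funext h0
  rw [h2] at h1
  have h3 := h1.unique (hasFDerivAt_const (0:F) x)
  exact (smul_eq_zero_iff_right (inv_ne_zero hs)).1 h3

theorem exists_tangential_bound (he : ‖e‖ = 1) {β : ℝ} (hβ : 0 < β) (hβ1 : β < 1) : ∃ c : ℝ, 0 ≤ c ∧
    ∀ (A : ℝ) (F : E → ℝ), HB β 1 A F →
      HB β 1 (c * A) fun x => ∫ s in Ioi (0:ℝ), wt s •
        conv (K2P e) s (fun y => Real.sign (inner ℝ e y) * F y) x := by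
  obtain ⟨c, hc, hcb⟩ := exists_singular_bound (K2P e) hβ hβ1
  set m := max (moment (K2P e) β) (moment (SchwartzMap.fderivCLM ℝ E _ (K2P e)) β)
  have hm0 : 0 ≤ m := (moment_nonneg _ _).trans (le_max_left _ _)
  refine ⟨c * m, by positivity, fun A F hF => ?_⟩
  have hA := hF.nonneg
  have hσm : Measurable fun y : E => Real.sign (inner ℝ e y) :=
    measurable_real_sign.comp (by fun_prop)
  have hσM : ∀ y : E, |Real.sign (inner ℝ e y)| ≤ 1 := fun y => by
    rcases Real.sign_apply_eq (inner ℝ e y) with h | h | h <;> simp [h]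
  have hFm : Measurable F := (hF.continuous hβ).measurable
  have hgM : ∀ y : E, |Real.sign (inner ℝ e y) * F y| ≤ A := fun y => by
    rw [abs_mul]
    have := hF.1 y
    rw [Real.norm_eq_abs] at this
    nlinarith [hσM y, abs_nonneg (F y)]
  have key : ∀ {F' : Type} [NormedAddCommGroup F'] [NormedSpace ℝ F'] (θ : 𝓢(E, F')) (s : ℝ) (x : E),
      0 < s → conv θ s (fun y => Real.sign (inner ℝ e y)) x = 0 →
      ‖conv θ s (fun y => Real.sign (inner ℝ e y) * F y) x‖ ≤ A * s ^ β * moment θ β := by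
    intro F' _ _ θ s x hs h0
    have h1 := conv_add θ (g := fun y => Real.sign (inner ℝ e y) * (F y - F x))
      (h := fun y => F x * Real.sign (inner ℝ e y)) (M := 1 * (A + A)) (M' := A * 1)
      (hσm.mul (hFm.sub_const _)) (fun y => by
        rw [abs_mul]
        refine mul_le_mul (hσM y) ?_ (abs_nonneg _) zero_le_one
        exact (abs_sub _ _).trans (add_le_add (hF.1 _) (hF.1 _)))
      (hσm.const_mul _) (fun y => by
        rw [abs_mul]; exact mul_le_mul (hF.1 _) (hσM y) (abs_nonneg _) hA) s x
    rw [conv_const_mul, h0, smul_zero, add_zero] at h1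
    have h2 : (fun y => Real.sign (inner ℝ e y) * (F y - F x) + F x * Real.sign (inner ℝ e y))
        = fun y => Real.sign (inner ℝ e y) * F y := by funext y; ring
    rw [h2] at h1
    rw [h1]
    refine conv_norm_le_moment θ hβ hβ1 (fun y => ?_) hs.le
    rw [abs_mul]
    have := hF.2 y x
    rw [div_one, Real.norm_eq_abs] at this
    nlinarith [hσM y, abs_nonneg (F y - F x)]
  have hz2 : ∀ s x, 0 < s → conv (K2P e) s (fun y => Real.sign (inner ℝ e y)) x = 0 := fun s x hs =>
    conv_fderivCLM_zero (K1P e) hσm hσM hs.ne' (fun x => conv_K1P_sign he hs.ne' x) x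
  have hz3 : ∀ s x, 0 < s → conv (SchwartzMap.fderivCLM ℝ E _ (K2P e)) s
      (fun y => Real.sign (inner ℝ e y)) x = 0 := fun s x hs =>
    conv_fderivCLM_zero (K2P e) hσm hσM hs.ne' (fun x => hz2 s x hs) x
  have := hcb (fun y => Real.sign (inner ℝ e y) * F y) A (A * m) (hσm.mul hFm) hgM
    (fun s x hs => (key _ s x hs (hz2 s x hs)).trans (by
      have : moment (K2P e) β ≤ m := le_max_left _ _
      have h0 : 0 ≤ A * s ^ β := by positivity
      nlinarith))
    (fun s x hs => (key _ s x hs (hz3 s x hs)).trans (by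
      have : moment (SchwartzMap.fderivCLM ℝ E _ (K2P e)) β ≤ m := le_max_right _ _
      have h0 : 0 ≤ A * s ^ β := by positivity
      nlinarith))
  rwa [show c * m * A = c * (A * m) by ring]

end HalfSpace

/-- `u` is twice differentiable with derivatives `u'`, `u''`, and scaled Hölder bounds. -/
structure C2 {E : Type} [NormedAddCommGroup E] [NormedSpace ℝ E] (β ρ K : ℝ) (u : E → ℝ)
    (u' : E → E →L[ℝ] ℝ) (u'' : E → E →L[ℝ] E →L[ℝ] ℝ) : Prop where
  d1 : ∀ x, HasFDerivAt u (u' x) x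
  d2 : ∀ x, HasFDerivAt u' (u'' x) x
  b0 : HB β ρ K u
  b1 : HB β ρ (K / ρ) u'
  b2 : HB β ρ (K / ρ ^ 2) u''

section Glue

variable {E : Type} [NormedAddCommGroup E] [InnerProductSpace ℝ E]
  {G : Type} [NormedAddCommGroup G] [NormedSpace ℝ G] {e : E}

theorem hasFDerivAt_glue {f1 f2 : E → G} {f1' f2' : E → E →L[ℝ] G}
    (h1 : ∀ x, 0 ≤ inner ℝ e x → HasFDerivWithinAt f1 (f1' x) {x | 0 ≤ inner ℝ e x} x)
    (h2 : ∀ x, inner ℝ e x ≤ 0 → HasFDerivWithinAt f2 (f2' x) {x | inner ℝ e x ≤ 0} x)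
    (e0 : ∀ x, inner ℝ e x = 0 → f1 x = f2 x) (e1 : ∀ x, inner ℝ e x = 0 → f1' x = f2' x) (x : E) :
    HasFDerivAt (fun x => if 0 ≤ inner ℝ e x then f1 x else f2 x)
      (if 0 ≤ inner ℝ e x then f1' x else f2' x) x := by
  have hu : ({x : E | 0 ≤ inner ℝ e x} ∪ {x | inner ℝ e x ≤ 0}) = univ :=
    eq_univ_of_forall fun x => by simpa using le_total 0 (inner ℝ e x)
  have hcl1 : IsClosed {x : E | 0 ≤ inner ℝ e x} := isClosed_le (by fun_prop) (by fun_prop)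
  have hcl2 : IsClosed {x : E | inner ℝ e x ≤ 0} := isClosed_le (by fun_prop) (by fun_prop)
  have k1 : ∀ y ∈ {x : E | 0 ≤ inner ℝ e x}, (if 0 ≤ inner ℝ e y then f1 y else f2 y) = f1 y :=
    fun y hy => if_pos hy
  have k2 : ∀ y ∈ {x : E | inner ℝ e x ≤ 0}, (if 0 ≤ inner ℝ e y then f1 y else f2 y) = f2 y := by
    intro y hy
    split_ifs with h
    · exact e0 y (le_antisymm hy h)
    · rfl
  rw [← hasFDerivWithinAt_univ, ← hu]
  refine HasFDerivWithinAt.union ?_ ?_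
  · by_cases hx : x ∈ {x : E | 0 ≤ inner ℝ e x}
    · have hx' : 0 ≤ inner ℝ e x := hx
      rw [if_pos hx']
      exact (h1 x hx).congr k1 (k1 x hx)
    · exact HasFDerivWithinAt.of_notMem_closure (by rwa [hcl1.closure_eq])
  · by_cases hx : x ∈ {x : E | inner ℝ e x ≤ 0}
    · have : (if 0 ≤ inner ℝ e x then f1' x else f2' x) = f2' x := by
        split_ifs with h
        · exact e1 x (le_antisymm hx h)
        · rfl
      rw [this]
      exact (h2 x hx).congr k2 (k2 x hx)
    · exact HasFDerivWithinAt.of_notMem_closure (by rwa [hcl2.closure_eq])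

theorem HB_glue {β ρ A : ℝ} (hβ : 0 < β) (hβ1 : β < 1) (hρ : 0 < ρ) (he : ‖e‖ = 1) {f1 f2 : E → G}
    (h1 : HB β ρ A f1) (h2 : HB β ρ A f2) (e0 : ∀ x, inner ℝ e x = 0 → f1 x = f2 x) :
    HB β ρ (3 * A) (fun x => if 0 ≤ inner ℝ e x then f1 x else f2 x) := by
  have hA := h1.nonneg
  have cross : ∀ x y, 0 ≤ inner ℝ e x → inner ℝ e y ≤ 0 →
      ‖f1 x - f2 y‖ ≤ 3 * A * (‖x - y‖ / ρ) ^ β := by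
    intro x y hx hy
    set z := strch e 0 x with hz
    have hz0 : inner ℝ e z = 0 := by rw [hz, inner_strch he]; simp
    have d1 : ‖x - z‖ ≤ ‖x - y‖ := by
      have h := abs_inner_le he (x - y)
      rw [inner_sub_right, abs_of_nonneg (by linarith)] at h
      have : x - z = (inner ℝ e x) • e := by rw [hz, strch_apply]; module
      rw [this, norm_smul, he, mul_one, Real.norm_of_nonneg hx]
      linarith
    have d2 : ‖z - y‖ ≤ 2 * ‖x - y‖ := by
      have : z - y = (x - y) - (x - z) := by abel
      rw [this]
      have := norm_sub_le (x - y) (x - z)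
      linarith
    have b1 : ‖f1 x - f1 z‖ ≤ A * (‖x - y‖ / ρ) ^ β := (h1.2 x z).trans (by gcongr)
    have b2 : ‖f2 z - f2 y‖ ≤ A * (2 * (‖x - y‖ / ρ) ^ β) := by
      refine (h2.2 z y).trans ?_
      gcongr
      have hh : (‖z - y‖ / ρ) ^ β ≤ (2 * (‖x - y‖ / ρ)) ^ β := by
        refine Real.rpow_le_rpow (by positivity) ?_ hβ.le
        rw [mul_div_assoc']; gcongr
      rw [Real.mul_rpow (by norm_num) (by positivity)] at hh
      have h2' : (2:ℝ) ^ β ≤ 2 := by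
        simpa using Real.rpow_le_rpow_of_exponent_le (x := 2) (by norm_num) hβ1.le
      have : 0 ≤ (‖x - y‖ / ρ) ^ β := by positivity
      nlinarith
    have : f1 x - f2 y = (f1 x - f1 z) + (f2 z - f2 y) := by rw [e0 z hz0]; abel
    rw [this]
    refine (norm_add_le _ _).trans ?_
    linarith
  have hmono : ∀ d : ℝ, 0 ≤ d → A * (d / ρ) ^ β ≤ 3 * A * (d / ρ) ^ β := fun d hd => by
    have : 0 ≤ A * (d / ρ) ^ β := by positivity
    linarith
  constructor
  · intro x
    dsimp only
    split_ifs
    · linarith [h1.1 x]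
    · linarith [h2.1 x]
  · intro x y
    dsimp only
    split_ifs with hx hy hy
    · exact (h1.2 x y).trans (hmono _ (norm_nonneg _))
    · exact cross x y hx (not_le.1 hy).le
    · rw [norm_sub_rev, norm_sub_rev x y]; exact cross y x hy (not_le.1 hx).le
    · exact (h2.2 x y).trans (hmono _ (norm_nonneg _))

end Glue

section HalfSpace

variable {E : Type} [NormedAddCommGroup E] [InnerProductSpace ℝ E] [FiniteDimensional ℝ E]
  [MeasurableSpace E] [BorelSpace E] {ι : Type} [Fintype ι] (b : OrthonormalBasis ι ℝ E)

/-- The trace of a bilinear form. -/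
def trL : (E →L[ℝ] E →L[ℝ] ℝ) →L[ℝ] ℝ :=
  ∑ i, (ContinuousLinearMap.apply ℝ ℝ (b i)).comp (ContinuousLinearMap.apply ℝ (E →L[ℝ] ℝ) (b i))

theorem trL_apply (A : E →L[ℝ] E →L[ℝ] ℝ) : trL b A = ∑ i, A (b i) (b i) := by
  simp [trL]

/-- The form `v ↦ w ↦ ⟪e,v⟫⟪e,w⟫`. -/
def nform (e : E) : E →L[ℝ] E →L[ℝ] ℝ := (innerSL ℝ e).smulRight (innerSL ℝ e)

theorem nform_apply (e v w : E) : nform e v w = inner ℝ e v * inner ℝ e w := by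
  simp [nform]

/-- Recovery of the full Hessian from its tangential part. -/
def recov (e : E) : (E →L[ℝ] E →L[ℝ] ℝ) →L[ℝ] (E →L[ℝ] E →L[ℝ] ℝ) :=
  LinearMap.toContinuousLinearMap
    { toFun := fun A => A + (A e).smulRight (innerSL ℝ e) - trL b A • nform e
      map_add' := fun A B => by ext w v; simp [add_mul]; ring
      map_smul' := fun c A => by ext w v; simp; ring }

theorem recov_apply (e : E) (A : E →L[ℝ] E →L[ℝ] ℝ) (w v : E) :
    recov b e A w v = A w v + A e w * inner ℝ e v - trL b A * (inner ℝ e w * inner ℝ e v) := by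
  simp [recov, nform_apply]

variable {e : E} 

theorem recov_tangential (T : E →L[ℝ] E →L[ℝ] ℝ) (hT : ∀ w, T w e = T e w) :
    recov b e (ContinuousLinearMap.compL ℝ E (E →L[ℝ] ℝ) (E →L[ℝ] ℝ) (tproj e) T)
      + trL b T • nform e = T := by
  have h1 : ∀ w v, ContinuousLinearMap.compL ℝ E (E →L[ℝ] ℝ) (E →L[ℝ] ℝ) (tproj e) T w v
      = T w v - inner ℝ e v * T w e := by
    intro w v
    change T w (strch e 0 v) = _
    rw [strch_apply]
    simp
  have h2 : trL b (ContinuousLinearMap.compL ℝ E (E →L[ℝ] ℝ) (E →L[ℝ] ℝ) (tproj e) T)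
      = trL b T - T e e := by
    rw [trL_apply, trL_apply]
    simp_rw [h1]
    rw [Finset.sum_sub_distrib]
    congr 1
    have h3 : T e e = T (∑ i, (inner ℝ (b i) e) • b i) e := by rw [b.sum_repr']
    rw [h3, map_sum]
    simp [real_inner_comm]
  ext w v
  simp only [add_apply, smul_apply, recov_apply, h1, h2,
    nform_apply, smul_eq_mul, hT w]
  ring

theorem potDD_symm {g : E → ℝ} {M : ℝ} (hg : Measurable g) (hM : ∀ x, |g x| ≤ M) {x : E}
    (hK : IntegrableOn (fun s => wt s • conv (K2 E) s g x) (Ioi 0)) (w v : E) :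
    potDD g x w v = potDD g x v w := by
  have h : ∀ w v, potDD g x w v = ∫ s in Ioi (0:ℝ), wt s * ∫ z, g (x - s • z) * K2 E z w v := by
    intro w v
    have h1 : potDD g x w v = ∫ s in Ioi (0:ℝ), wt s * conv (K2 E) s g x w v :=
      (((ContinuousLinearMap.apply ℝ ℝ v).comp
      (ContinuousLinearMap.apply ℝ (E →L[ℝ] ℝ) w)).integral_comp_comm hK).symm
    rw [h1]
    refine setIntegral_congr_fun measurableSet_Ioi fun s _ => ?_
    congr 1
    exact (((ContinuousLinearMap.apply ℝ ℝ v).comp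
        (ContinuousLinearMap.apply ℝ (E →L[ℝ] ℝ) w)).integral_comp_comm
          (conv_integrable (K2 E) hg hM s x)).symm
  rw [h, h]
  simp_rw [K2_symm _ w v]

theorem closure_half (he : ‖e‖ = 1) : {x : E | 0 ≤ inner ℝ e x} ⊆ closure {x : E | 0 < inner ℝ e x} := by
  intro x hx
  have h : Filter.Tendsto (fun t : ℝ => x + t • e) (nhdsWithin 0 (Ioi 0)) (nhds x) := by
    have : Continuous fun t : ℝ => x + t • e := by fun_prop
    have h := this.tendsto 0
    simp only [zero_smul, add_zero] at h
    exact h.mono_left nhdsWithin_le_nhds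
  refine mem_closure_of_tendsto h (eventually_nhdsWithin_of_forall fun t ht => ?_)
  have ht' : (0:ℝ) < t := ht
  have hx' : 0 ≤ inner ℝ e x := hx
  simp only [mem_ofPred_eq, inner_add_right, inner_smul_right, real_inner_self_eq_norm_sq, he]
  linarith

/-- Solvability of the Dirichlet problem for `1 - Δ` on a half space. -/
theorem exists_half_sol (he : ‖e‖ = 1) {β : ℝ} (hβ : 0 < β) (hβ1 : β < 1) : ∃ C : ℝ, 0 ≤ C ∧
    ∀ (A : ℝ) (f : E → ℝ), HB β 1 A f → ∃ (u : E → ℝ) (B : E → E →L[ℝ] ℝ) (T : E → E →L[ℝ] E →L[ℝ] ℝ),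
      (∀ x, HasFDerivAt u (B x) x) ∧ (∀ x, ‖u x‖ ≤ C * A) ∧ (∀ x, ‖B x‖ ≤ C * A) ∧
      HB β 1 (C * A) T ∧
      (∀ x, 0 ≤ inner ℝ e x → HasFDerivWithinAt B (T x) {x | 0 ≤ inner ℝ e x} x) ∧
      (∀ x, inner ℝ e x = 0 → u x = 0) ∧
      (∀ x, 0 < inner ℝ e x → u x - trL b (T x) = f x) := by
  obtain ⟨c, hc, hcb⟩ := exists_tangential_bound he hβ hβ1
  set c0 := (∫ s in Ioi (0:ℝ), 2 * s * Real.exp (-s ^ 2)) * (∫ z, ‖gauss E z‖)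
  set c1 := (∫ s in Ioi (0:ℝ), 2 * Real.exp (-s ^ 2)) * (∫ z, ‖K1 E z‖)
  set cc := max c0 c1 with hcc
  have hc0 : 0 ≤ c0 := mul_nonneg (setIntegral_nonneg measurableSet_Ioi fun s hs => by
    have : (0:ℝ) < s := hs
    positivity) (integral_nonneg fun _ => norm_nonneg _)
  have hcc0 : 0 ≤ cc := hc0.trans (le_max_left _ _)
  refine ⟨3 * (cc + (‖recov b e‖ * c + ‖(ContinuousLinearMap.id ℝ ℝ).smulRight (nform e)‖ * (2 * cc + 1))),
    by positivity, fun A f hf => ?_⟩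
  have hA := hf.nonneg
  set F : E → ℝ := fun x => f (x + (|inner ℝ e x| - inner ℝ e x) • e) with hFdef
  have hF : HB β 1 (3 * A) F := by
    refine hf.comp_lip hβ hβ1 one_pos (c := 3) (by norm_num) (fun x y => ?_)
    have h1 := abs_inner_le he (x - y)
    rw [inner_sub_right] at h1
    have h2 := abs_abs_sub_abs_le_abs_sub (inner ℝ e x) (inner ℝ e y)
    have h3 : x + (|inner ℝ e x| - inner ℝ e x) • e - (y + (|inner ℝ e y| - inner ℝ e y) • e)
        = (x - y) + ((|inner ℝ e x| - |inner ℝ e y|) - (inner ℝ e x - inner ℝ e y)) • e := by module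
    rw [h3]
    refine (norm_add_le _ _).trans ?_
    rw [norm_smul, he, mul_one, Real.norm_eq_abs]
    have h4 := abs_sub (|inner ℝ e x| - |inner ℝ e y|) (inner ℝ e x - inner ℝ e y)
    linarith
  have hFf : ∀ x, 0 ≤ inner ℝ e x → F x = f x := fun x hx => by
    simp only [hFdef, abs_of_nonneg hx, sub_self, zero_smul, add_zero]
  have hFe : ∀ x, F (strch e 1 x) = F x := fun x => by
    simp only [hFdef]
    rw [inner_strch he, neg_one_mul, abs_neg, strch_apply]
    congr 1
    module
  set g : E → ℝ := fun y => Real.sign (inner ℝ e y) * F y with hgdef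
  have hg : Measurable g := (measurable_real_sign.comp (by fun_prop)).mul (hF.continuous hβ).measurable
  have hgM : ∀ y : E, |g y| ≤ 3 * A := fun y => by
    have h1 : |Real.sign (inner ℝ e y)| ≤ 1 := by
      rcases Real.sign_apply_eq (inner ℝ e y) with h | h | h <;> simp [h]
    simp only [hgdef, abs_mul]
    have := hF.1 y
    rw [Real.norm_eq_abs] at this
    nlinarith [abs_nonneg (F y)]
  have hodd : ∀ x, g (strch e 1 x) = - g x := fun x => by
    simp only [hgdef, hFe, inner_strch he]
    rw [neg_mul, one_mul, Real.sign_neg]; ring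
  have hhol : ∀ x, 0 < inner ℝ e x → ∃ H, ∃ U ∈ nhds x, ∀ x ∈ U, ∀ y, |g y - g x| ≤ H * ‖y - x‖ ^ β := by
    intro x hx
    refine ⟨_, {z | inner ℝ e x / 2 < inner ℝ e z},
      (isOpen_lt (by fun_prop) (by fun_prop)).mem_nhds (by simp only [mem_ofPred_eq]; linarith),
      fun z hz y => odd_holder he hβ hF (δ := inner ℝ e x / 2) (by linarith) (le_of_lt hz) y⟩
  set TP : E → E →L[ℝ] E →L[ℝ] ℝ := fun x => ∫ s in Ioi (0:ℝ), wt s • conv (K2P e) s g x with hTP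
  have hTPb : HB β 1 (c * (3 * A)) TP := hcb _ F hF
  have hu0 : ∀ x, ‖pot g x‖ ≤ cc * (3 * A) := fun x => (norm_pot_le hg hgM x).trans (by
    gcongr; exact le_max_left _ _)
  have hu1 : ∀ x, ‖potD g x‖ ≤ cc * (3 * A) := fun x => (norm_potD_le hg hgM x).trans (by
    gcongr; exact le_max_right _ _)
  have hpot : HB β 1 (2 * (cc * (3 * A))) (pot g) :=
    HB.of_deriv hβ hβ1 one_pos (fun x => hasFDerivAt_pot hg hgM x) hu0 (by simpa using hu1)
  set T : E → E →L[ℝ] E →L[ℝ] ℝ := fun x =>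
    recov b e (TP x) + (ContinuousLinearMap.id ℝ ℝ).smulRight (nform e) (pot g x - F x) with hTdef
  have hTHB := (hTPb.clm (recov b e)).add
    ((hpot.sub hF).clm ((ContinuousLinearMap.id ℝ ℝ).smulRight (nform e)))
  have hTeq : ∀ x, 0 < inner ℝ e x → potDD g x = T x ∧ pot g x - trL b (potDD g x) = F x := by
    intro x hx
    obtain ⟨H, U, hU, hH⟩ := hhol x hx
    have hHx := hH x (mem_of_mem_nhds hU)
    have hK := integrable_K2 hg hgM hβ hβ1 hHx
    have htr := pot_sub_trace hg hgM hβ hβ1 hHx b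
    rw [← trL_apply] at htr
    have hgx : g x = F x := by simp only [hgdef, Real.sign_of_pos hx, one_mul]
    rw [hgx] at htr
    refine ⟨?_, htr⟩
    have h1 : TP x = ContinuousLinearMap.compL ℝ E (E →L[ℝ] ℝ) (E →L[ℝ] ℝ) (tproj e) (potDD g x) := by
      rw [potDD, ← ContinuousLinearMap.integral_comp_comm _ hK]
      refine setIntegral_congr_fun measurableSet_Ioi fun s _ => ?_
      simp only [map_smul]
      rw [K2P_eq, conv_postcomp _ _ hg hgM]
    simp only [hTdef, h1]
    rw [← recov_tangential b (potDD g x) (fun w => potDD_symm hg hgM hK w e)]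
    congr 1
    · rw [recov_tangential b (potDD g x) (fun w => potDD_symm hg hgM hK w e)]
    · rw [← htr]; simp
  refine ⟨pot g, potD g, T, fun x => hasFDerivAt_pot hg hgM x, fun x => (hu0 x).trans ?_,
    fun x => (hu1 x).trans ?_, hTHB.mono one_pos ?_, fun x hx => ?_, fun x hx => ?_, fun x hx => ?_⟩
  · have h0 : 0 ≤ (‖recov b e‖ * c + ‖(ContinuousLinearMap.id ℝ ℝ).smulRight (nform e)‖ * (2 * cc + 1)) := by positivity
    nlinarith
  · have h0 : 0 ≤ (‖recov b e‖ * c + ‖(ContinuousLinearMap.id ℝ ℝ).smulRight (nform e)‖ * (2 * cc + 1)) := by positivity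
    nlinarith
  · have : 0 ≤ cc * A := by positivity
    nlinarith
  · have hT := hTHB.continuous hβ
    have hd : ∀ y ∈ {x : E | 0 < inner ℝ e x}, HasFDerivAt (potD g) (T y) y := by
      intro y hy
      obtain ⟨H, U, hU, hH⟩ := hhol y hy
      rw [← (hTeq y hy).1]
      exact hasFDerivAt_potD hg hgM hβ hβ1 hU hH
    refine (hasFDerivWithinAt_closure_of_tendsto_fderiv (s := {x : E | 0 < inner ℝ e x})
      (fun y hy => (hd y hy).differentiableAt.differentiableWithinAt) ?_ ?_ ?_ ?_).mono (closure_half he)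
    · exact convex_halfSpace_gt (f := fun x => inner ℝ e x)
        ⟨fun x y => inner_add_right _ _ _, fun c x => inner_smul_right _ _ _⟩ 0
    · exact isOpen_lt (by fun_prop) (by fun_prop)
    · exact fun y _ => (continuous_potD hg hgM).continuousWithinAt
    · have h1 : Filter.Tendsto T (nhdsWithin x {x : E | 0 < inner ℝ e x}) (nhds (T x)) :=
        (hT.tendsto x).mono_left nhdsWithin_le_nhds
      exact h1.congr' (eventually_nhdsWithin_of_forall fun y hy => (hd y hy).fderiv.symm)
  · exact pot_eq_zero he hodd hx
  · rw [← (hTeq x hx).1, (hTeq x hx).2, hFf x hx.le]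

end HalfSpace

section Extension

variable {E : Type} [NormedAddCommGroup E] [InnerProductSpace ℝ E] 

/-- Pull-back of a linear form. -/
def pull (L : E →L[ℝ] E) : (E →L[ℝ] ℝ) →L[ℝ] (E →L[ℝ] ℝ) :=
  (ContinuousLinearMap.compL ℝ E E ℝ).flip L

theorem pull_apply (L : E →L[ℝ] E) (φ : E →L[ℝ] ℝ) (v : E) : pull L φ v = φ (L v) := rfl

/-- Pull-back of a bilinear form. -/
def pull2 (L : E →L[ℝ] E) : (E →L[ℝ] E →L[ℝ] ℝ) →L[ℝ] (E →L[ℝ] E →L[ℝ] ℝ) :=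
  (ContinuousLinearMap.compL ℝ E (E →L[ℝ] ℝ) (E →L[ℝ] ℝ) (pull L)).comp
    ((ContinuousLinearMap.compL ℝ E E (E →L[ℝ] ℝ)).flip L)

theorem pull2_apply (L : E →L[ℝ] E) (A : E →L[ℝ] E →L[ℝ] ℝ) (w v : E) :
    pull2 L A w v = A (L w) (L v) := rfl

theorem norm_strch_le {e : E} (he : ‖e‖ = 1) {k : ℝ} (hk : |k| ≤ 2) (x : E) :
    ‖strch e k x‖ ≤ 4 * ‖x‖ := by
  rw [strch_apply]
  refine (norm_sub_le _ _).trans ?_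
  rw [norm_smul, he, mul_one, norm_mul]
  have h1 := abs_inner_le he x
  have h2 : |1 + k| ≤ 3 := by
    rw [abs_le] at hk ⊢
    constructor <;> linarith
  simp only [Real.norm_eq_abs]
  nlinarith [abs_nonneg (1 + k), abs_nonneg (inner ℝ e x)]

variable [FiniteDimensional ℝ E]
  [MeasurableSpace E] [BorelSpace E] {ι : Type} [Fintype ι] (b : OrthonormalBasis ι ℝ E)

set_option maxHeartbeats 1000000 in
theorem exists_half_C2 {e : E} (he : ‖e‖ = 1) {β : ℝ} (hβ : 0 < β) (hβ1 : β < 1) : ∃ C : ℝ, 0 ≤ C ∧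
    ∀ (A : ℝ) (f : E → ℝ), HB β 1 A f → ∃ (u : E → ℝ) (u' : E → E →L[ℝ] ℝ)
      (u'' : E → E →L[ℝ] E →L[ℝ] ℝ), C2 β 1 (C * A) u u' u'' ∧
      (∀ x, inner ℝ e x = 0 → u x = 0) ∧
      (∀ x, 0 < inner ℝ e x → u x - trL b (u'' x) = f x) := by
  obtain ⟨C, hC, hsol⟩ := exists_half_sol b he hβ hβ1
  set p1 := ‖pull (strch e 1)‖
  set p2 := ‖pull (strch e 2)‖
  set q1 := ‖pull2 (strch e 1)‖
  set q2 := ‖pull2 (strch e 2)‖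
  set D := 1 + 3 * (4 + 3 * p1 + p2 + 4 * (3 * q1 + q2)) with hD
  have hp1 : 0 ≤ p1 := norm_nonneg _
  have hp2 : 0 ≤ p2 := norm_nonneg _
  have hq1 : 0 ≤ q1 := norm_nonneg _
  have hq2 : 0 ≤ q2 := norm_nonneg _
  have hD0 : 0 ≤ D := by positivity
  refine ⟨2 * (D * C), by positivity, fun A f hf => ?_⟩
  obtain ⟨u, B, T, hu, hub, hBb, hT, hBd, hz, hpde⟩ := hsol A f hf
  have hA := hf.nonneg
  have hCA : 0 ≤ C * A := by positivity
  have lip : ∀ k : ℝ, |k| ≤ 2 → ∀ x y, ‖strch e k x - strch e k y‖ ≤ 4 * ‖x - y‖ := fun k hk x y => by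
    rw [← map_sub]; exact norm_strch_le he hk _
  have hT1 : HB β 1 (4 * (C * A)) fun x => T (strch e 1 x) :=
    hT.comp_lip hβ hβ1 one_pos (by norm_num) (lip 1 (by norm_num))
  have hT2 : HB β 1 (4 * (C * A)) fun x => T (strch e 2 x) :=
    hT.comp_lip hβ hβ1 one_pos (by norm_num) (lip 2 (by norm_num))
  set v : E → ℝ := fun x => -3 * u (strch e 1 x) + u (strch e 2 x) with hv
  set v' : E → E →L[ℝ] ℝ := fun x =>
    (-3 : ℝ) • pull (strch e 1) (B (strch e 1 x)) + pull (strch e 2) (B (strch e 2 x)) with hv'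
  set v'' : E → E →L[ℝ] E →L[ℝ] ℝ := fun x =>
    ((-3 : ℝ) • pull2 (strch e 1)) (T (strch e 1 x)) + pull2 (strch e 2) (T (strch e 2 x)) with hv''
  have hn31 : ‖(-3 : ℝ) • pull2 (strch e 1)‖ = 3 * q1 := by rw [norm_smul]; norm_num; rfl
  have hv''HB : HB β 1 (4 * (3 * q1 + q2) * (C * A)) v'' := by
    have := (hT1.clm ((-3 : ℝ) • pull2 (strch e 1))).add (hT2.clm (pull2 (strch e 2)))
    rw [hn31] at this
    refine this.mono one_pos (le_of_eq ?_)
    ring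
  have hin : ∀ k : ℝ, 0 ≤ k → MapsTo (strch e k) {x | inner ℝ e x ≤ 0} {x | 0 ≤ inner ℝ e x} := by
    intro k hk x hx
    have hx' : inner ℝ e x ≤ 0 := hx
    have : 0 ≤ inner ℝ e (strch e k x) := by rw [inner_strch he]; nlinarith
    exact this
  have hvd : ∀ x, HasFDerivAt v (v' x) x := by
    intro x
    have h1 := (hu (strch e 1 x)).comp x (strch e 1).hasFDerivAt
    have h2 := (hu (strch e 2 x)).comp x (strch e 2).hasFDerivAt
    exact (h1.const_mul (-3)).add h2
  have hv'd : ∀ x, inner ℝ e x ≤ 0 → HasFDerivWithinAt v' (v'' x) {x | inner ℝ e x ≤ 0} x := by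
    intro x hx
    have h1 := (hBd (strch e 1 x) (hin 1 (by norm_num) hx)).comp x
      (strch e 1).hasFDerivWithinAt (hin 1 (by norm_num))
    have h2 := (hBd (strch e 2 x) (hin 2 (by norm_num) hx)).comp x
      (strch e 2).hasFDerivWithinAt (hin 2 (by norm_num))
    have h1' := (pull (strch e 1)).hasFDerivAt.comp_hasFDerivWithinAt x h1
    have h2' := (pull (strch e 2)).hasFDerivAt.comp_hasFDerivWithinAt x h2
    exact (h1'.const_smul (-3:ℝ)).add h2'
  have hfix : ∀ k x, inner ℝ e x = 0 → strch e k x = x := fun k x hx => by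
    rw [strch_apply, hx]; simp
  -- tangential derivatives vanish on the hyperplane
  have hBt : ∀ x, inner ℝ e x = 0 → ∀ w, inner ℝ e w = 0 → B x w = 0 := by
    intro x hx w hw
    have hc : HasDerivAt (fun t : ℝ => x + t • w) w 0 := by
      simpa using ((hasDerivAt_id (0:ℝ)).smul_const w).const_add x
    have h1 : HasDerivAt (fun t : ℝ => u (x + t • w)) (B x w) 0 := by
      have := (hu (x + (0:ℝ) • w)).comp_hasDerivAt (0:ℝ) hc
      rw [zero_smul, add_zero] at this
      exact this
    have h2 : (fun t : ℝ => u (x + t • w)) = fun _ => 0 := by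
      funext t; apply hz; rw [inner_add_right, inner_smul_right, hx, hw]; simp
    rw [h2] at h1
    exact h1.unique (hasDerivAt_const _ _)
  have hTt : ∀ x, inner ℝ e x = 0 → ∀ w z, inner ℝ e w = 0 → inner ℝ e z = 0 → T x w z = 0 := by
    intro x hx w z hw hzz
    have hc : HasDerivAt (fun t : ℝ => x + t • w) w 0 := by
      simpa using ((hasDerivAt_id (0:ℝ)).smul_const w).const_add x
    have hc0 : ∀ t : ℝ, inner ℝ e (x + t • w) = 0 := fun t => by
      rw [inner_add_right, inner_smul_right, hx, hw]; simp
    have hBx : HasFDerivWithinAt B (T x) {x | 0 ≤ inner ℝ e x} (x + (0:ℝ) • w) := by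
      simpa using hBd x hx.ge
    have h1 : HasDerivWithinAt (fun t : ℝ => B (x + t • w)) (T x w) univ 0 :=
      hBx.comp_hasDerivWithinAt (0:ℝ) hc.hasDerivWithinAt (fun t _ => (hc0 t).ge)
    have h2 : HasDerivAt (fun t : ℝ => B (x + t • w) z) (T x w z) 0 := by
      have := (ContinuousLinearMap.apply ℝ ℝ z).hasFDerivAt.comp_hasDerivWithinAt (0:ℝ) h1
      rw [hasDerivWithinAt_univ] at this
      exact this
    have h3 : (fun t : ℝ => B (x + t • w) z) = fun _ => 0 := funext fun t => hBt _ (hc0 t) _ hzz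
    rw [h3] at h2
    exact h2.unique (hasDerivAt_const _ _)
  have hdec : ∀ k w, strch e k w = strch e 0 w - (k * inner ℝ e w) • e := fun k w => by
    rw [strch_apply, strch_apply]; module
  have hdec' : ∀ w, w = strch e 0 w + (inner ℝ e w) • e := fun w => by
    rw [strch_apply]; module
  have hP : ∀ w, inner ℝ e (strch e 0 w) = 0 := fun w => by rw [inner_strch he]; simp
  have e0 : ∀ x, inner ℝ e x = 0 → u x = v x := by
    intro x hx
    simp only [hv, hfix _ x hx, hz x hx]; simp
  have e1 : ∀ x, inner ℝ e x = 0 → B x = v' x := by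
    intro x hx
    ext w
    have h0 := hBt x hx _ (hP w)
    simp only [hv', hfix _ x hx, add_apply, smul_apply, pull_apply, smul_eq_mul]
    conv_lhs => rw [hdec' w]
    rw [hdec 1 w, hdec 2 w]
    simp only [map_sub, map_add, map_smul, h0, smul_eq_mul]
    ring
  have e2 : ∀ x, inner ℝ e x = 0 → T x = v'' x := by
    intro x hx
    ext w z
    have h0 := hTt x hx _ _ (hP w) (hP z)
    simp only [hv'', hfix _ x hx, add_apply, smul_apply, pull2_apply, smul_eq_mul]
    conv_lhs => rw [hdec' w, hdec' z]
    rw [hdec 1 w, hdec 2 w, hdec 1 z, hdec 2 z]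
    simp only [map_sub, map_add, map_smul, add_apply, sub_apply, smul_apply, h0, smul_eq_mul]
    ring
  have d1 := hasFDerivAt_glue (e := e) (fun x _ => (hu x).hasFDerivWithinAt)
    (fun x _ => (hvd x).hasFDerivWithinAt) e0 e1
  have d2 := hasFDerivAt_glue (e := e) hBd hv'd e1 e2
  have hw'' := HB_glue hβ hβ1 one_pos he (hT.mono one_pos (A' := (1 + 4 * (3 * q1 + q2)) * (C * A))
    (by linarith [mul_nonneg hq1 hCA, mul_nonneg hq2 hCA]))
    (hv''HB.mono one_pos (A' := (1 + 4 * (3 * q1 + q2)) * (C * A)) (by linarith)) e2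
  have hvb : ∀ x, ‖v x‖ ≤ 4 * (C * A) := fun x => by
    refine (norm_add_le _ _).trans ?_
    rw [norm_mul]
    have h1 := hub (strch e 1 x)
    have h2 := hub (strch e 2 x)
    norm_num
    simp only [Real.norm_eq_abs] at h1 h2
    linarith
  have hv'b : ∀ x, ‖v' x‖ ≤ (3 * p1 + p2) * (C * A) := fun x => by
    refine (norm_add_le _ _).trans ?_
    rw [norm_smul]
    have h1 : ‖pull (strch e 1) (B (strch e 1 x))‖ ≤ p1 * (C * A) :=
      ((pull (strch e 1)).le_opNorm _).trans (by gcongr; exact hBb _)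
    have h2 : ‖pull (strch e 2) (B (strch e 2 x))‖ ≤ p2 * (C * A) :=
      ((pull (strch e 2)).le_opNorm _).trans (by gcongr; exact hBb _)
    norm_num
    linarith
  have n1 := mul_nonneg hp1 hCA
  have n2 := mul_nonneg hp2 hCA
  have n3 := mul_nonneg hq1 hCA
  have n4 := mul_nonneg hq2 hCA
  have hDexp : D * (C * A) = 13 * (C * A) + 9 * (p1 * (C * A)) + 3 * (p2 * (C * A))
      + 36 * (q1 * (C * A)) + 12 * (q2 * (C * A)) := by rw [hD]; ring
  have bu : ∀ x, ‖if 0 ≤ inner ℝ e x then u x else v x‖ ≤ D * (C * A) := fun x => by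
    split_ifs
    · refine (hub x).trans ?_; linarith
    · refine (hvb x).trans ?_; linarith
  have bu' : ∀ x, ‖if 0 ≤ inner ℝ e x then B x else v' x‖ ≤ D * (C * A) := fun x => by
    split_ifs
    · refine (hBb x).trans ?_; linarith
    · refine (hv'b x).trans ?_; linarith
  have hle : 3 * ((1 + 4 * (3 * q1 + q2)) * (C * A)) ≤ D * (C * A) := by linarith
  have hDCA : 0 ≤ D * (C * A) := by positivity
  refine ⟨_, _, _, ⟨d1, d2, ?_, ?_, ?_⟩, fun x hx => ?_, fun x hx => ?_⟩
  · exact (HB.of_deriv hβ hβ1 one_pos d1 bu (by simpa using bu')).mono one_pos (by linarith)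
  · rw [div_one]
    exact (HB.of_deriv hβ hβ1 one_pos d2 bu' (fun x => (hw''.1 x).trans (by rw [div_one]; exact hle))).mono
      one_pos (by linarith)
  · rw [one_pow, div_one]
    exact hw''.mono one_pos (by linarith)
  · rw [if_pos hx.ge]; exact hz x hx
  · rw [if_pos hx.le, if_pos hx.le]; exact hpde x hx

end Extension

section Products

variable {E : Type} [NormedAddCommGroup E] {β ρ A : ℝ}

theorem HB.smul_lip (hβ : 0 < β) (hβ1 : β < 1) (hρ : 0 < ρ) {h a : E → ℝ} {δ L : ℝ}
    (hh : HB β ρ A h) (ha : ∀ x, |a x| ≤ δ) (hL : ∀ x y, |a x - a y| ≤ L * ‖x - y‖) :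
    HB β ρ (A * (3 * δ + |L| * ρ)) fun x => a x * h x := by
  have hA := hh.nonneg
  have hδ : 0 ≤ δ := (abs_nonneg _).trans (ha 0)
  refine ⟨fun x => ?_, fun x y => ?_⟩
  · rw [norm_mul, Real.norm_eq_abs]
    calc |a x| * ‖h x‖ ≤ δ * A := mul_le_mul (ha x) (hh.1 x) (norm_nonneg _) hδ
      _ ≤ _ := by nlinarith [mul_nonneg hA (mul_nonneg (abs_nonneg L) hρ.le), mul_nonneg hA hδ]
  · set t := ‖x - y‖ / ρ with ht
    have ht0 : 0 ≤ t := by positivity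
    have hmin := min_one_le_rpow hβ hβ1 ht0
    have h1 : |a x - a y| ≤ (2 * δ + |L| * ρ) * t ^ β := by
      have h2 : |a x - a y| ≤ (2 * δ + |L| * ρ) * min 1 t := by
        rw [mul_min_of_nonneg _ _ (by positivity)]
        refine le_min ?_ ?_
        · have := abs_sub (a x) (a y)
          have := mul_nonneg (abs_nonneg L) hρ.le
          linarith [ha x, ha y]
        · refine (hL x y).trans ?_
          have h3 : ‖x - y‖ = ρ * t := by rw [ht]; field_simp
          rw [h3]
          have := le_abs_self L
          have h4 : 0 ≤ ρ * t := by positivity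
          have h5 : 0 ≤ δ * t := by positivity
          nlinarith
      exact h2.trans (by gcongr)
    have h3 : a x * h x - a y * h y = a x * (h x - h y) + (a x - a y) * h y := by ring
    rw [h3]
    refine (norm_add_le _ _).trans ?_
    rw [norm_mul, norm_mul, Real.norm_eq_abs, Real.norm_eq_abs (a x - a y)]
    have h4 : |a x| * ‖h x - h y‖ ≤ δ * (A * t ^ β) :=
      mul_le_mul (ha x) (hh.2 x y) (norm_nonneg _) hδ
    have h5 : |a x - a y| * ‖h y‖ ≤ ((2 * δ + |L| * ρ) * t ^ β) * A :=
      mul_le_mul h1 (hh.1 y) (norm_nonneg _) (by positivity)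
    linarith

theorem HB.sum {G : Type} [NormedAddCommGroup G] {ι : Type} [Fintype ι] {f : ι → E → G}
    {A : ℝ} (hf : ∀ i, HB β ρ A (f i)) : HB β ρ (Fintype.card ι * A) fun x => ∑ i, f i x := by
  refine ⟨fun x => ?_, fun x y => ?_⟩
  · refine (norm_sum_le _ _).trans ((Finset.sum_le_sum fun i _ => (hf i).1 x).trans ?_)
    simp
  · rw [← Finset.sum_sub_distrib]
    refine (norm_sum_le _ _).trans ((Finset.sum_le_sum fun i _ => (hf i).2 x y).trans ?_)
    simp [mul_assoc]

end Products

/-- `u` is of class `C²` with scaled sup bounds on the derivatives `u'`, `u''`. -/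
structure W2 {E : Type} [NormedAddCommGroup E] [NormedSpace ℝ E] (ρ K : ℝ) (u : E → ℝ)
    (u' : E → E →L[ℝ] ℝ) (u'' : E → E →L[ℝ] E →L[ℝ] ℝ) : Prop where
  d1 : ∀ x, HasFDerivAt u (u' x) x
  d2 : ∀ x, HasFDerivAt u' (u'' x) x
  c2 : Continuous u''
  n0 : ∀ x, ‖u x‖ ≤ K
  n1 : ∀ x, ‖u' x‖ ≤ K / ρ
  n2 : ∀ x, ‖u'' x‖ ≤ K / ρ ^ 2

section Main

variable {E : Type} [NormedAddCommGroup E] [InnerProductSpace ℝ E] [FiniteDimensional ℝ E]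
  [MeasurableSpace E] [BorelSpace E] {ι : Type} [Fintype ι] (b : OrthonormalBasis ι ℝ E)

theorem exists_half_scaled {e : E} (he : ‖e‖ = 1) {β : ℝ} (hβ : 0 < β) (hβ1 : β < 1) :
    ∃ C : ℝ, 0 ≤ C ∧ ∀ (ρ : ℝ), 0 < ρ →
    ∀ (A : ℝ) (f : E → ℝ), HB β ρ A f → ∃ (u : E → ℝ) (u' : E → E →L[ℝ] ℝ)
      (u'' : E → E →L[ℝ] E →L[ℝ] ℝ), C2 β ρ (C * A) u u' u'' ∧
      (∀ x, inner ℝ e x = 0 → u x = 0) ∧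
      (∀ x, 0 < inner ℝ e x → u x - ρ ^ 2 * trL b (u'' x) = f x) := by
  obtain ⟨C, hC, h⟩ := exists_half_C2 b he hβ hβ1
  refine ⟨C, hC, fun ρ hρ A f hf => ?_⟩
  have hA := hf.nonneg
  have hf1 : HB β 1 A fun y => f (ρ • y) := by
    refine ⟨fun x => hf.1 _, fun x y => (hf.2 _ _).trans (le_of_eq ?_)⟩
    rw [← smul_sub, norm_smul, Real.norm_of_nonneg hρ.le]
    congr 2
    field_simp
  obtain ⟨u, u', u'', hu, hz, hp⟩ := h A _ hf1
  have hsc : ∀ {G : Type} [NormedAddCommGroup G] {K : ℝ} {k : E → G}, HB β 1 K k →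
      HB β ρ K fun x => k (ρ⁻¹ • x) := by
    intro G _ K k hk
    refine ⟨fun x => hk.1 _, fun x y => (hk.2 _ _).trans (le_of_eq ?_)⟩
    rw [← smul_sub, norm_smul, Real.norm_of_nonneg (by positivity), div_one]
    congr 2
    field_simp
  have hlin : ∀ x : E, HasFDerivAt (fun x : E => ρ⁻¹ • x) (ρ⁻¹ • ContinuousLinearMap.id ℝ E) x :=
    fun x => (hasFDerivAt_id x).const_smul ρ⁻¹
  refine ⟨fun x => u (ρ⁻¹ • x), fun x => ρ⁻¹ • u' (ρ⁻¹ • x), fun x => (ρ⁻¹ * ρ⁻¹) • u'' (ρ⁻¹ • x),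
    ⟨fun x => ?_, fun x => ?_, hsc hu.b0, ?_, ?_⟩, fun x hx => ?_, fun x hx => ?_⟩
  · refine ((hu.d1 (ρ⁻¹ • x)).comp x (hlin x)).congr_fderiv ?_
    ext v; simp
  · refine (((hu.d2 (ρ⁻¹ • x)).comp x (hlin x)).const_smul ρ⁻¹).congr_fderiv ?_
    ext v w; simp [mul_assoc]
  · have := (hsc hu.b1).clm (ρ⁻¹ • ContinuousLinearMap.id ℝ (E →L[ℝ] ℝ))
    refine this.mono hρ ?_
    rw [norm_smul, Real.norm_of_nonneg (by positivity), div_one, div_eq_inv_mul, mul_assoc]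
    refine mul_le_mul_of_nonneg_left ?_ (by positivity)
    have := ContinuousLinearMap.norm_id_le (𝕜 := ℝ) (E := E →L[ℝ] ℝ)
    have : 0 ≤ C * A := by positivity
    nlinarith
  · have := (hsc hu.b2).clm ((ρ⁻¹ * ρ⁻¹) • ContinuousLinearMap.id ℝ (E →L[ℝ] E →L[ℝ] ℝ))
    refine this.mono hρ ?_
    rw [norm_smul, Real.norm_of_nonneg (by positivity), one_pow, div_one, div_eq_inv_mul, mul_assoc, sq,
      mul_inv]
    refine mul_le_mul_of_nonneg_left ?_ (by positivity)
    have := ContinuousLinearMap.norm_id_le (𝕜 := ℝ) (E := E →L[ℝ] E →L[ℝ] ℝ)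
    have : 0 ≤ C * A := by positivity
    nlinarith
  · apply hz; rw [inner_smul_right, hx, mul_zero]
  · have h1 := hp (ρ⁻¹ • x) (by rw [inner_smul_right]; positivity)
    rw [smul_smul, mul_inv_cancel₀ hρ.ne', one_smul] at h1
    rw [map_smul, smul_eq_mul, ← h1]
    field_simp

theorem W2.add_tsum {ρ K : ℝ} (hρ : 0 < ρ) {u : ℕ → E → ℝ} {u' : ℕ → E → E →L[ℝ] ℝ}
    {u'' : ℕ → E → E →L[ℝ] E →L[ℝ] ℝ}
    (h : ∀ n, W2 ρ (K * (1 / 2) ^ n) (u n) (u' n) (u'' n)) :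
    W2 ρ (2 * K) (fun x => ∑' n, u n x) (fun x => ∑' n, u' n x) (fun x => ∑' n, u'' n x) ∧
    (∀ x, Summable fun n => u n x) ∧ ∀ x, Summable fun n => u'' n x := by
  have hs : HasSum (fun n : ℕ => K * (1 / 2 : ℝ) ^ n) (2 * K) := by
    rw [mul_comm]; exact hasSum_geometric_two.mul_left K
  have hs1 : HasSum (fun n : ℕ => K * (1 / 2 : ℝ) ^ n / ρ) (2 * K / ρ) := hs.div_const _
  have hs2 : HasSum (fun n : ℕ => K * (1 / 2 : ℝ) ^ n / ρ ^ 2) (2 * K / ρ ^ 2) := hs.div_const _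
  have S0 : ∀ x, Summable fun n => u n x := fun x =>
    Summable.of_norm_bounded hs.summable fun n => (h n).n0 x
  have S1 : ∀ x, Summable fun n => u' n x := fun x =>
    Summable.of_norm_bounded hs1.summable fun n => (h n).n1 x
  have S2 : ∀ x, Summable fun n => u'' n x := fun x =>
    Summable.of_norm_bounded hs2.summable fun n => (h n).n2 x
  refine ⟨⟨fun x => ?_, fun x => ?_, ?_, fun x => ?_, fun x => ?_, fun x => ?_⟩, S0, S2⟩
  · exact hasFDerivAt_tsum hs1.summable (fun n x => (h n).d1 x) (fun n x => (h n).n1 x) (S0 x) x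
  · exact hasFDerivAt_tsum hs2.summable (fun n x => (h n).d2 x) (fun n x => (h n).n2 x) (S1 x) x
  · exact continuous_tsum (fun n => (h n).c2) hs2.summable fun n x => (h n).n2 x
  · exact tsum_of_norm_bounded hs fun n => (h n).n0 x
  · exact tsum_of_norm_bounded hs1 fun n => (h n).n1 x
  · exact tsum_of_norm_bounded hs2 fun n => (h n).n2 x

/-- Approximate solvability with a contraction factor implies exact solvability. -/
theorem exists_of_approx {β ρ C : ℝ} (hρ : 0 < ρ) {S Z : Set E}
    (h : ∀ (A : ℝ) (f : E → ℝ), HB β ρ A f → ∃ (u : E → ℝ) (u' : E → E →L[ℝ] ℝ)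
      (u'' : E → E →L[ℝ] E →L[ℝ] ℝ) (err : E → ℝ), W2 ρ (C * A) u u' u'' ∧
      (∀ x ∈ Z, u x = 0) ∧ (∀ x ∈ S, u x - ρ ^ 2 * trL b (u'' x) = f x - err x) ∧
      HB β ρ (A / 2) err) (A : ℝ) (f : E → ℝ) (hf : HB β ρ A f) :
    ∃ (u : E → ℝ) (u' : E → E →L[ℝ] ℝ)
      (u'' : E → E →L[ℝ] E →L[ℝ] ℝ), W2 ρ (2 * C * A) u u' u'' ∧
      (∀ x ∈ Z, u x = 0) ∧ (∀ x ∈ S, u x - ρ ^ 2 * trL b (u'' x) = f x) := by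
  choose U U' U'' R hW hZ hS hR using h
  let seq : ℕ → {q : ℝ × (E → ℝ) // HB β ρ q.1 q.2} := fun n => n.rec ⟨(A, f), hf⟩
    fun _ q => ⟨(q.1.1 / 2, R q.1.1 q.1.2 q.2), hR q.1.1 q.1.2 q.2⟩
  have hseq1 : ∀ n, (seq n).1.1 = A * (1 / 2) ^ n := by
    intro n
    induction n with
    | zero => simp [seq]
    | succ n ih =>
      change (seq n).1.1 / 2 = _
      rw [ih, pow_succ]; ring
  have hW' : ∀ n, W2 ρ (C * A * (1 / 2) ^ n) (U _ _ (seq n).2) (U' _ _ (seq n).2) (U'' _ _ (seq n).2) := by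
    intro n
    have : C * A * (1 / 2) ^ n = C * (seq n).1.1 := by rw [hseq1]; ring
    rw [this]; exact hW _ _ (seq n).2
  obtain ⟨hsum, hs0, hs2⟩ := W2.add_tsum hρ hW'
  refine ⟨_, _, _, by rw [mul_assoc]; exact hsum, fun x hx => ?_, fun x hx => ?_⟩
  · simp only [hZ _ _ _ x hx, tsum_zero]
  · have h1 : HasSum (fun n => U _ _ (seq n).2 x - ρ ^ 2 * trL b (U'' _ _ (seq n).2 x))
        ((∑' n, U _ _ (seq n).2 x) - ρ ^ 2 * trL b (∑' n, U'' _ _ (seq n).2 x)) :=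
      (hs0 x).hasSum.sub (((trL b).hasSum (hs2 x).hasSum).mul_left _)
    have h2 : ∀ n, ∑ k ∈ Finset.range n, (U _ _ (seq k).2 x - ρ ^ 2 * trL b (U'' _ _ (seq k).2 x))
        = f x - (seq n).1.2 x := by
      intro n
      induction n with
      | zero => simp [seq]
      | succ n ih =>
        rw [Finset.sum_range_succ, ih, hS _ _ (seq n).2 x hx]
        change _ = f x - R _ _ (seq n).2 x
        ring
    have h3 := h1.tendsto_sum_nat
    simp_rw [h2] at h3
    have h4 : Filter.Tendsto (fun n => (seq n).1.2 x) Filter.atTop (nhds 0) := by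
      refine squeeze_zero_norm (a := fun n => A * (1 / 2 : ℝ) ^ n) (fun n => ?_) ?_
      · rw [← hseq1]; exact (seq n).2.1 x
      · have := (tendsto_pow_atTop_nhds_zero_of_lt_one (r := (1 / 2 : ℝ)) (by norm_num) (by norm_num)).const_mul A
        rwa [mul_zero] at this
    have h5 := h4.const_sub (f x)
    rw [sub_zero] at h5
    exact tendsto_nhds_unique h3 h5

end Main

section Apply

variable {E X : Type} [NormedAddCommGroup E] [NormedSpace ℝ E] [NormedAddCommGroup X] {β ρ K : ℝ}

theorem HB.apply₁ (hρ : 0 < ρ) {u : X → E →L[ℝ] ℝ} (hu : HB β ρ K u) {v : E} (hv : ‖v‖ ≤ 1) :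
    HB β ρ K fun x => u x v := by
  have key : ∀ B : E →L[ℝ] ℝ, ‖B v‖ ≤ ‖B‖ := fun B =>
    (B.le_opNorm v).trans (mul_le_of_le_one_right (norm_nonneg _) hv)
  exact ⟨fun x => (key _).trans (hu.1 x), fun x y => (key (u x - u y)).trans (hu.2 x y)⟩

theorem HB.apply₂ (hρ : 0 < ρ) {u : X → E →L[ℝ] E →L[ℝ] ℝ} (hu : HB β ρ K u) {v w : E}
    (hv : ‖v‖ ≤ 1) (hw : ‖w‖ ≤ 1) : HB β ρ K fun x => u x v w := by
  have key : ∀ B : E →L[ℝ] E →L[ℝ] ℝ, ‖B v w‖ ≤ ‖B‖ := fun B =>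
    (B.le_opNorm₂ v w).trans (by
      rw [mul_assoc]
      exact mul_le_of_le_one_right (norm_nonneg _) (mul_le_one₀ hv (norm_nonneg _) hw))
  exact ⟨fun x => (key _).trans (hu.1 x), fun x y => (key (u x - u y)).trans (hu.2 x y)⟩

theorem HB.const_mul {f : X → ℝ} (hf : HB β ρ K f) {c : ℝ} (hc : 0 ≤ c) :
    HB β ρ (c * K) fun x => c * f x := by
  refine ⟨fun x => ?_, fun x y => ?_⟩
  · rw [norm_mul, Real.norm_of_nonneg hc]; gcongr; exact hf.1 x
  · rw [← mul_sub, norm_mul, Real.norm_of_nonneg hc, mul_assoc]; gcongr; exact hf.2 x y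

end Apply

section Graph

variable {E : Type} [NormedAddCommGroup E] [InnerProductSpace ℝ E] [FiniteDimensional ℝ E]

/-- The graph-type shear `x ↦ x - x₀ + g x • e`. -/
def shear (e x0 : E) (g : E → ℝ) (x : E) : E := x - x0 + g x • e

theorem shear_sub (e x0 : E) (g : E → ℝ) (x y : E) :
    shear e x0 g x - shear e x0 g y = (x - y) + (g x - g y) • e := by
  unfold shear; module

theorem shear_lip {e : E} (he : ‖e‖ = 1) (x0 : E) {g : E → ℝ} {δ : ℝ} (hδ : δ ≤ 1)
    (hg : ∀ x y, |g x - g y| ≤ δ * ‖x - y‖) (x y : E) :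
    ‖shear e x0 g x - shear e x0 g y‖ ≤ 2 * ‖x - y‖ := by
  rw [shear_sub]
  refine (norm_add_le _ _).trans ?_
  rw [norm_smul, he, mul_one, Real.norm_eq_abs]
  nlinarith [hg x y, norm_nonneg (x - y)]

theorem exists_shear_inverse {e : E} (he : ‖e‖ = 1) (x0 : E) {g : E → ℝ} {δ : ℝ} (hδ0 : 0 ≤ δ)
    (hδ : δ ≤ 1 / 2) (hg : ∀ x y, |g x - g y| ≤ δ * ‖x - y‖) :
    ∃ Ψ : E → E, (∀ x, Ψ (shear e x0 g x) = x) ∧ ∀ x y, ‖Ψ x - Ψ y‖ ≤ 2 * ‖x - y‖ := by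
  have hlow : ∀ x y, ‖x - y‖ ≤ 2 * ‖shear e x0 g x - shear e x0 g y‖ := by
    intro x y
    have h1 : x - y = (shear e x0 g x - shear e x0 g y) - (g x - g y) • e := by
      rw [shear_sub]; module
    have h2 := norm_sub_le (shear e x0 g x - shear e x0 g y) ((g x - g y) • e)
    rw [← h1, norm_smul, he, mul_one, Real.norm_eq_abs] at h2
    nlinarith [hg x y, norm_nonneg (x - y)]
  have hinj : Function.Injective (shear e x0 g) := by
    intro x y hxy
    have := hlow x y
    rw [hxy, sub_self, norm_zero, mul_zero] at this
    exact sub_eq_zero.1 (norm_le_zero_iff.1 this)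
  have happ : ApproximatesLinearOn (shear e x0 g)
      ((ContinuousLinearEquiv.refl ℝ E : E ≃L[ℝ] E) : E →L[ℝ] E) univ ⟨δ, hδ0⟩ := by
    refine fun x _ y _ => ?_
    rw [shear_sub]
    simp [norm_smul, he]
    exact hg x y
  have hsurj : Function.Surjective (shear e x0 g) := by
    refine happ.surjective ?_
    right
    have h1 : ‖((ContinuousLinearEquiv.refl ℝ E : E ≃L[ℝ] E).symm : E →L[ℝ] E)‖₊ ≤ 1 :=
      ContinuousLinearMap.norm_id_le
    have h0 : 0 < ‖((ContinuousLinearEquiv.refl ℝ E : E ≃L[ℝ] E).symm : E →L[ℝ] E)‖₊ := by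
      have : Nontrivial E := ⟨e, 0, by rintro rfl; simp at he⟩
      rw [← NNReal.coe_pos, coe_nnnorm]
      exact lt_of_lt_of_eq one_pos (ContinuousLinearMap.norm_id (𝕜 := ℝ) (E := E)).symm
    have h2 : (⟨δ, hδ0⟩ : NNReal) < 1 := by
      change δ < 1; linarith
    exact h2.trans_le ((one_le_inv₀ h0).2 h1)
  choose Ψ hΨ using hsurj
  refine ⟨Ψ, fun x => hinj (hΨ _), fun x y => ?_⟩
  have := hlow (Ψ x) (Ψ y)
  rwa [hΨ, hΨ] at this

end Graph

section Main

variable {E : Type} [NormedAddCommGroup E] [InnerProductSpace ℝ E] [FiniteDimensional ℝ E]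
  [MeasurableSpace E] [BorelSpace E] {ι : Type} [Fintype ι] (b : OrthonormalBasis ι ℝ E)

theorem hasFDerivAt_shear {e x0 : E} {g : E → ℝ} {g' : E → E →L[ℝ] ℝ}
    (hg : ∀ x, HasFDerivAt g (g' x) x) (x : E) :
    HasFDerivAt (shear e x0 g) (ContinuousLinearMap.id ℝ E + (g' x).smulRight e) x :=
  ((hasFDerivAt_id x).sub_const x0).add ((hg x).smul_const e)

/-- Second derivative of `v ∘ shear`. -/
def shear2 (e : E) (g' : E →L[ℝ] ℝ) (g'' : E →L[ℝ] E →L[ℝ] ℝ) (v' : E →L[ℝ] ℝ)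
    (v'' : E →L[ℝ] E →L[ℝ] ℝ) : E →L[ℝ] E →L[ℝ] ℝ :=
  v''.comp (ContinuousLinearMap.id ℝ E + g'.smulRight e) + (v' e • g'' +
    ((v''.comp (ContinuousLinearMap.id ℝ E + g'.smulRight e)).flip e).smulRight g')

theorem shear2_apply (e : E) (g' : E →L[ℝ] ℝ) (g'' : E →L[ℝ] E →L[ℝ] ℝ) (v' : E →L[ℝ] ℝ)
    (v'' : E →L[ℝ] E →L[ℝ] ℝ) (a c : E) : shear2 e g' g'' v' v'' a c =
      v'' a c + g' a * v'' e c + (v' e * g'' a c + (v'' a e + g' a * v'' e e) * g' c) := by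
  simp [shear2]

theorem trL_shear2 (e : E) (g' : E →L[ℝ] ℝ) (g'' : E →L[ℝ] E →L[ℝ] ℝ) (v' : E →L[ℝ] ℝ)
    (v'' : E →L[ℝ] E →L[ℝ] ℝ) : trL b (shear2 e g' g'' v' v'') =
      trL b v'' + (∑ i, g' (b i) * (v'' e (b i) + v'' (b i) e + g' (b i) * v'' e e)
        + trL b g'' * v' e) := by
  simp only [trL_apply, shear2_apply, Finset.sum_mul, ← Finset.sum_add_distrib]
  refine Finset.sum_congr rfl fun i _ => ?_
  ring

theorem hasFDerivAt_comp_shear {e x0 : E} {g : E → ℝ} {g' : E → E →L[ℝ] ℝ}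
    {g'' : E → E →L[ℝ] E →L[ℝ] ℝ} (hg : ∀ x, HasFDerivAt g (g' x) x)
    (hg' : ∀ x, HasFDerivAt g' (g'' x) x) {v : E → ℝ} {v' : E → E →L[ℝ] ℝ}
    {v'' : E → E →L[ℝ] E →L[ℝ] ℝ} (hv : ∀ x, HasFDerivAt v (v' x) x)
    (hv' : ∀ x, HasFDerivAt v' (v'' x) x) (x : E) :
    HasFDerivAt (fun x => v (shear e x0 g x))
      (v' (shear e x0 g x) + v' (shear e x0 g x) e • g' x) x ∧
    HasFDerivAt (fun x => v' (shear e x0 g x) + v' (shear e x0 g x) e • g' x)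
      (shear2 e (g' x) (g'' x) (v' (shear e x0 g x)) (v'' (shear e x0 g x))) x := by
  have hs := hasFDerivAt_shear (e := e) (x0 := x0) hg x
  constructor
  · refine ((hv _).comp x hs).congr_fderiv ?_
    ext a; simp [mul_comm]
  · have h1 : HasFDerivAt (fun x => v' (shear e x0 g x)) ((v'' (shear e x0 g x)).comp
      (ContinuousLinearMap.id ℝ E + (g' x).smulRight e)) x := (hv' _).comp x hs
    have h2 : HasFDerivAt (fun x => v' (shear e x0 g x) e) (((v'' (shear e x0 g x)).comp
      (ContinuousLinearMap.id ℝ E + (g' x).smulRight e)).flip e) x := by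
      have := ((ContinuousLinearMap.apply ℝ ℝ e).hasFDerivAt (x := v' (shear e x0 g x))).comp x h1
      refine this.congr_fderiv ?_
      ext a; simp
    exact h1.add (h2.fun_smul (hg' x))

theorem norm_shear2_le {e : E} (he : ‖e‖ = 1) (g' : E →L[ℝ] ℝ) (g'' : E →L[ℝ] E →L[ℝ] ℝ)
    (v' : E →L[ℝ] ℝ) (v'' : E →L[ℝ] E →L[ℝ] ℝ) (hg : ‖g'‖ ≤ 1) :
    ‖shear2 e g' g'' v' v''‖ ≤ 4 * ‖v''‖ + ‖v'‖ * ‖g''‖ := by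
  refine ContinuousLinearMap.opNorm_le_bound₂ _ (by positivity) fun a c => ?_
  rw [shear2_apply]
  have hga : ‖g' a‖ ≤ ‖a‖ := (g'.le_opNorm a).trans (mul_le_of_le_one_left (norm_nonneg _) hg)
  have hgc : ‖g' c‖ ≤ ‖c‖ := (g'.le_opNorm c).trans (mul_le_of_le_one_left (norm_nonneg _) hg)
  have h1 := v''.le_opNorm₂ a c
  have h2 := v''.le_opNorm₂ e c
  have h3 := v''.le_opNorm₂ a e
  have h4 := v''.le_opNorm₂ e e
  have h5 := v'.le_opNorm e
  have h6 := g''.le_opNorm₂ a c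
  rw [he, mul_one] at h2 h3 h4 h5
  rw [mul_one] at h4
  have k1 : ‖g' a * v'' e c‖ ≤ ‖a‖ * (‖v''‖ * ‖c‖) := by rw [norm_mul]; gcongr
  have k2 : ‖v' e * g'' a c‖ ≤ ‖v'‖ * (‖g''‖ * ‖a‖ * ‖c‖) := by rw [norm_mul]; gcongr
  have k3 : ‖g' a * v'' e e‖ ≤ ‖a‖ * ‖v''‖ := by rw [norm_mul]; gcongr
  have k4 : ‖(v'' a e + g' a * v'' e e) * g' c‖ ≤ (‖v''‖ * ‖a‖ + ‖a‖ * ‖v''‖) * ‖c‖ := by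
    rw [norm_mul]; gcongr; exact (norm_add_le _ _).trans (add_le_add h3 k3)
  refine (norm_add_le _ _).trans ((add_le_add (norm_add_le _ _) (norm_add_le _ _)).trans ?_)
  linarith

set_option maxHeartbeats 1000000 in
theorem exists_chart {e : E} (he : ‖e‖ = 1) {β : ℝ} (hβ : 0 < β) (hβ1 : β < 1) :
    ∃ δ : ℝ, 0 < δ ∧ ∀ (g : E → ℝ) (g' : E → E →L[ℝ] ℝ) (g'' : E → E →L[ℝ] E →L[ℝ] ℝ) (x0 : E)
      (L : ℝ), (∀ x, HasFDerivAt g (g' x) x) → (∀ x, HasFDerivAt g' (g'' x) x) →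
      Continuous g'' → (∀ x, ‖g' x‖ ≤ δ) → (∀ x, ‖g'' x‖ ≤ L) →
      (∀ x, |trL b (g'' x)| ≤ L) →
      (∀ x y, |trL b (g'' x) - trL b (g'' y)| ≤ L * ‖x - y‖) →
      ∃ C ρ0 : ℝ, 0 ≤ C ∧ 0 < ρ0 ∧ ∀ ρ, 0 < ρ → ρ ≤ ρ0 → ∀ (A : ℝ) (f : E → ℝ), HB β ρ A f →
        ∃ (u : E → ℝ) (u' : E → E →L[ℝ] ℝ) (u'' : E → E →L[ℝ] E →L[ℝ] ℝ),
          W2 ρ (C * A) u u' u'' ∧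
          (∀ x, inner ℝ e (shear e x0 g x) = 0 → u x = 0) ∧
          (∀ x, 0 < inner ℝ e (shear e x0 g x) → u x - ρ ^ 2 * trL b (u'' x) = f x) := by
  obtain ⟨C0, hC0, hhalf⟩ := exists_half_scaled b he hβ hβ1
  set n : ℝ := (Fintype.card ι : ℝ) with hn
  have hn0 : 0 ≤ n := by positivity
  set D := n * C0 + C0 + 1 with hD
  have hD1 : 1 ≤ D := by have : 0 ≤ n * C0 := by positivity
                         linarith
  have hDpos : 0 < D := by linarith
  set δ := 1 / (288 * D) with hδ
  have hδpos : 0 < δ := by positivity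
  have hδD : δ * D = 1 / 288 := by rw [hδ]; field_simp
  have hδs : δ ≤ 1 / 288 := by nlinarith
  refine ⟨δ, hδpos, fun g g' g'' x0 L hg hg' hgc hgb hg2 htr htrL => ?_⟩
  have hL : 0 ≤ L := (norm_nonneg _).trans (hg2 0)
  set ρ0 := min 1 (1 / (144 * D * (L + 1))) with hρ0
  have hρ0pos : 0 < ρ0 := lt_min one_pos (by positivity)
  refine ⟨2 * (10 * C0), ρ0, by positivity, hρ0pos, fun ρ hρ hρle A f hf => ?_⟩
  have hρ1 : ρ ≤ 1 := hρle.trans (min_le_left _ _)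
  have hρL : ρ * (L + 1) * D ≤ 1 / 144 := by
    have : ρ ≤ 1 / (144 * D * (L + 1)) := hρle.trans (min_le_right _ _)
    rw [le_div_iff₀ (by positivity)] at this
    linarith
  have hρLs : L * ρ ≤ 1 / 144 := by
    have h1 : 0 ≤ ρ * (L + 1) := by positivity
    nlinarith
  have hglip : ∀ x y, |g x - g y| ≤ δ * ‖x - y‖ := fun x y =>
    Convex.norm_image_sub_le_of_norm_hasFDerivWithin_le (s := univ)
      (fun z _ => (hg z).hasFDerivWithinAt) (fun z _ => hgb z) convex_univ (mem_univ y) (mem_univ x)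
  have hg'lip : ∀ x y, ‖g' x - g' y‖ ≤ L * ‖x - y‖ := fun x y =>
    Convex.norm_image_sub_le_of_norm_hasFDerivWithin_le (s := univ)
      (fun z _ => (hg' z).hasFDerivWithinAt) (fun z _ => hg2 z) convex_univ (mem_univ y) (mem_univ x)
  have hlip := shear_lip he x0 (by linarith : δ ≤ 1) hglip
  obtain ⟨Ψ, hΨ, hΨl⟩ := exists_shear_inverse he x0 hδpos.le (by linarith : δ ≤ 1 / 2) hglip
  refine exists_of_approx b hρ (C := 10 * C0) (S := {x | 0 < inner ℝ e (shear e x0 g x)})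
    (Z := {x | inner ℝ e (shear e x0 g x) = 0}) (fun A f hf => ?_) A f hf
  have hA := hf.nonneg
  obtain ⟨v, v', v'', hv, hz, hp⟩ := hhalf ρ hρ (2 * A) _ (hf.comp_lip hβ hβ1 hρ one_le_two hΨl)
  set K := C0 * (2 * A) with hK
  have hK0 : 0 ≤ K := by positivity
  set Φ := shear e x0 g with hΦ
  have hbi : ∀ i, ‖b i‖ ≤ 1 := fun i => (b.orthonormal.1 i).le
  have hder := hasFDerivAt_comp_shear (e := e) (x0 := x0) hg hg' hv.d1 hv.d2
  have hΦc : Continuous Φ := by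
    rw [continuous_iff_continuousAt]
    exact fun x => (hasFDerivAt_shear (e := e) (x0 := x0) hg x).continuousAt
  have q2 : ∀ a c : E, ‖a‖ ≤ 1 → ‖c‖ ≤ 1 →
      HB β ρ (2 * K) fun x => ρ ^ 2 * v'' (Φ x) a c := by
    intro a c ha hc
    have := ((hv.b2.apply₂ hρ ha hc).const_mul (sq_nonneg ρ)).comp_lip hβ hβ1 hρ one_le_two hlip
    exact this.mono hρ (le_of_eq (by field_simp))
  have q1 : HB β ρ (2 * K) fun x => ρ * v' (Φ x) e := by
    have := ((hv.b1.apply₁ hρ he.le).const_mul hρ.le).comp_lip hβ hβ1 hρ one_le_two hlip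
    exact this.mono hρ (le_of_eq (by field_simp))
  have hgi : ∀ i x, |g' x (b i)| ≤ δ := fun i x =>
    ((g' x).le_opNorm _).trans ((mul_le_of_le_one_right (norm_nonneg _) (hbi i)).trans (hgb x))
  have hgil : ∀ i x y, |g' x (b i) - g' y (b i)| ≤ L * ‖x - y‖ := fun i x y =>
    ((g' x - g' y).le_opNorm _).trans
      ((mul_le_of_le_one_right (norm_nonneg _) (hbi i)).trans (hg'lip x y))
  set θ := 3 * δ + |L| * ρ with hθ
  have hθ0 : 0 ≤ θ := by positivity
  have hθD : θ * D ≤ 1 / 48 := by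
    rw [hθ, abs_of_nonneg hL]
    have : 0 ≤ ρ * D := by positivity
    linarith
  have hθ1 : θ ≤ 1 := by nlinarith
  have e1 : ∀ i, HB β ρ (6 * K * θ) fun x => g' x (b i) * (ρ ^ 2 * v'' (Φ x) e (b i)
      + ρ ^ 2 * v'' (Φ x) (b i) e + g' x (b i) * (ρ ^ 2 * v'' (Φ x) e e)) := by
    intro i
    have h1 := (q2 e e he.le he.le).smul_lip hβ hβ1 hρ (hgi i) (hgil i)
    have h2 := ((q2 e (b i) he.le (hbi i)).add (q2 (b i) e (hbi i) he.le)).add h1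
    have h3 : HB β ρ (6 * K) _ := h2.mono hρ (A' := 6 * K) (by nlinarith)
    exact h3.smul_lip hβ hβ1 hρ (hgi i) (hgil i)
  have e2 : HB β ρ (2 * K * (3 * (ρ * L) + |ρ * L| * ρ)) fun x =>
      (ρ * trL b (g'' x)) * (ρ * v' (Φ x) e) := by
    refine q1.smul_lip hβ hβ1 hρ (fun x => ?_) (fun x y => ?_)
    · rw [abs_mul, abs_of_pos hρ]; gcongr; exact htr x
    · rw [← mul_sub, abs_mul, abs_of_pos hρ, mul_assoc]; gcongr; exact htrL x y
  refine ⟨fun x => v (Φ x), _, _, fun x => ∑ i, g' x (b i) * (ρ ^ 2 * v'' (Φ x) e (b i)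
      + ρ ^ 2 * v'' (Φ x) (b i) e + g' x (b i) * (ρ ^ 2 * v'' (Φ x) e e)) +
      (ρ * trL b (g'' x)) * (ρ * v' (Φ x) e),
    ⟨fun x => (hder x).1, fun x => (hder x).2, ?_, fun x => ?_, fun x => ?_, fun x => ?_⟩,
    fun x hx => hz _ hx, fun x hx => ?_, ((HB.sum e1).add e2).mono hρ ?_⟩
  · have c1 : Continuous g' := by
      rw [continuous_iff_continuousAt]; exact fun x => (hg' x).continuousAt
    have c2 : Continuous fun x => v' (Φ x) := (hv.b1.continuous hβ).comp hΦc
    have c3 : Continuous fun x => v'' (Φ x) := (hv.b2.continuous hβ).comp hΦc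
    have c4 : Continuous fun x => ContinuousLinearMap.id ℝ E + (g' x).smulRight e :=
      continuous_const.add
        ((ContinuousLinearMap.smulRightL ℝ E E).flip e |>.continuous.comp c1)
    have c5 : Continuous fun x => (v'' (Φ x)).comp (ContinuousLinearMap.id ℝ E + (g' x).smulRight e) :=
      c3.clm_comp c4
    have c6 : Continuous fun x => ((v'' (Φ x)).comp
        (ContinuousLinearMap.id ℝ E + (g' x).smulRight e)).flip e := by
      have : Continuous fun B : E →L[ℝ] E →L[ℝ] ℝ => B.flip e :=
        ((ContinuousLinearMap.apply ℝ (E →L[ℝ] ℝ) e).comp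
          (ContinuousLinearMap.flipₗᵢ ℝ E E ℝ).toContinuousLinearEquiv.toContinuousLinearMap).continuous
      exact this.comp c5
    refine c5.add ((((ContinuousLinearMap.apply ℝ ℝ e).continuous.comp c2).smul hgc).add ?_)
    exact ((ContinuousLinearMap.smulRightL ℝ E (E →L[ℝ] ℝ)).continuous.comp c6).clm_apply c1
  · exact (hv.b0.1 _).trans (by rw [hK]; nlinarith)
  · refine (norm_add_le _ _).trans ?_
    have h1 := hv.b1.1 (Φ x)
    have h2 : ‖v' (Φ x) e • g' x‖ ≤ K / ρ := by
      rw [norm_smul]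
      have h3 := (v' (Φ x)).le_opNorm e
      rw [he, mul_one] at h3
      have h4 : ‖g' x‖ ≤ 1 := (hgb x).trans (by linarith)
      calc _ ≤ ‖v' (Φ x)‖ * 1 := by gcongr
        _ ≤ _ := by rw [mul_one]; exact h1
    have h5 : 10 * C0 * A / ρ = 5 * (K / ρ) := by rw [hK]; ring
    have h6 : 0 ≤ K / ρ := by positivity
    rw [h5]; change _ + _ ≤ _; linarith
  · refine (norm_shear2_le he _ _ _ _ ((hgb x).trans (by linarith))).trans ?_
    have h1 := hv.b1.1 (Φ x)
    have h2 := hv.b2.1 (Φ x)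
    have h3 : ‖v' (Φ x)‖ * ‖g'' x‖ ≤ K / ρ * L :=
      mul_le_mul h1 (hg2 x) (norm_nonneg _) (by positivity)
    have h4 : K / ρ * L ≤ K / ρ ^ 2 := by
      have : K / ρ * L = K / ρ ^ 2 * (L * ρ) := by field_simp
      rw [this]
      exact mul_le_of_le_one_right (by positivity) (by linarith)
    have h5 : 10 * C0 * A / ρ ^ 2 = 5 * (K / ρ ^ 2) := by rw [hK]; ring
    rw [h5]; linarith
  · have h1 := hp _ hx
    rw [hΨ] at h1
    rw [trL_shear2, ← h1]
    have : ∀ i, g' x (b i) * (ρ ^ 2 * v'' (Φ x) e (b i) + ρ ^ 2 * v'' (Φ x) (b i) e +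
        g' x (b i) * (ρ ^ 2 * v'' (Φ x) e e)) = ρ ^ 2 * (g' x (b i) * (v'' (Φ x) e (b i)
        + v'' (Φ x) (b i) e + g' x (b i) * v'' (Φ x) e e)) := fun i => by ring
    simp only [this, ← Finset.mul_sum]
    ring
  · rw [abs_of_nonneg (by positivity : 0 ≤ ρ * L), ← hn]
    have hC0n : 0 ≤ n * C0 := by positivity
    have a1 : n * C0 * θ ≤ 1 / 48 := by nlinarith
    have a2 : C0 * (L * ρ) ≤ 1 / 144 := by
      have h1 : 0 ≤ L * ρ := by positivity
      have h2 : C0 * (L * ρ) ≤ D * (ρ * (L + 1)) := by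
        have : C0 ≤ D := by linarith
        calc C0 * (L * ρ) ≤ D * (L * ρ) := by gcongr
          _ ≤ _ := by nlinarith [mul_pos hDpos hρ]
      linarith
    have a3 : C0 * (L * ρ) * ρ ≤ 1 / 144 := by
      have h1 : 0 ≤ C0 * (L * ρ) := by positivity
      nlinarith
    have : n * (6 * K * θ) + 2 * K * (3 * (ρ * L) + ρ * L * ρ) =
        A * (12 * (n * C0 * θ) + 12 * (C0 * (L * ρ)) + 4 * (C0 * (L * ρ) * ρ)) := by
      rw [hK]; ring
    rw [this, div_eq_mul_inv]
    gcongr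
    norm_num; linarith

end Main

section CompactlySupported

variable {E : Type} [NormedAddCommGroup E] [InnerProductSpace ℝ E] [FiniteDimensional ℝ E]
  [MeasurableSpace E] [BorelSpace E]
  {ι : Type} [Fintype ι] (b : OrthonormalBasis ι ℝ E)

/-- `g` is `C²` with bounds `L` on its derivatives and on the Lipschitz constant of its
Laplacian. -/
structure Cutoff (L : ℝ) (g : E → ℝ) (g' : E → E →L[ℝ] ℝ) (g'' : E → E →L[ℝ] E →L[ℝ] ℝ) :
    Prop where
  d1 : ∀ x, HasFDerivAt g (g' x) x
  d2 : ∀ x, HasFDerivAt g' (g'' x) x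
  c2 : Continuous g''
  n0 : ∀ x, |g x| ≤ L
  n1 : ∀ x, ‖g' x‖ ≤ L
  n2 : ∀ x, ‖g'' x‖ ≤ L
  tr : ∀ x, |trL b (g'' x)| ≤ L
  tl : ∀ x y, |trL b (g'' x) - trL b (g'' y)| ≤ L * ‖x - y‖

theorem exists_cutoff {g : E → ℝ} (hg : ContDiff ℝ 3 g) (hs : HasCompactSupport g) :
    ∃ L, 0 ≤ L ∧ Cutoff b L g (fderiv ℝ g) (fderiv ℝ (fderiv ℝ g)) := by
  have h1 : ContDiff ℝ 2 (fderiv ℝ g) := hg.fderiv_right (by norm_num)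
  have h2 : ContDiff ℝ 1 (fderiv ℝ (fderiv ℝ g)) := h1.fderiv_right (by norm_num)
  have s1 := hs.fderiv (𝕜 := ℝ)
  have s2 := s1.fderiv (𝕜 := ℝ)
  have h3 : ContDiff ℝ 1 fun x => trL b (fderiv ℝ (fderiv ℝ g) x) := (trL b).contDiff.comp h2
  have s3 : HasCompactSupport fun x => trL b (fderiv ℝ (fderiv ℝ g) x) :=
    s2.comp_left (g := fun B => trL b B) (map_zero _)
  obtain ⟨L0, b0⟩ := hg.continuous.bounded_above_of_compact_support hs
  obtain ⟨L1, b1⟩ := h1.continuous.bounded_above_of_compact_support s1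
  obtain ⟨L2, b2⟩ := h2.continuous.bounded_above_of_compact_support s2
  obtain ⟨L3, b3⟩ := h3.continuous.bounded_above_of_compact_support s3
  obtain ⟨L4, b4⟩ := ContDiff.lipschitzWith_of_hasCompactSupport s3 h3 (by norm_num)
  have p0 := (norm_nonneg _).trans (b0 0)
  have p1 := (norm_nonneg _).trans (b1 0)
  have p2 := (norm_nonneg _).trans (b2 0)
  have p3 := (norm_nonneg _).trans (b3 0)
  have p4 := L4.2
  have p4' : (0 : ℝ) ≤ L4 := p4
  refine ⟨L0 + L1 + L2 + L3 + L4, by linarith, fun x => ?_, fun x => ?_, h2.continuous,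
    fun x => ?_, fun x => ?_, fun x => ?_, fun x => ?_, fun x y => ?_⟩
  · exact (hg.differentiable (by norm_num) x).hasFDerivAt
  · exact (h1.differentiable (by norm_num) x).hasFDerivAt
  · have := b0 x; rw [Real.norm_eq_abs] at this; linarith
  · linarith [b1 x]
  · linarith [b2 x]
  · have := b3 x; rw [Real.norm_eq_abs] at this; linarith
  · have := b4.norm_sub_le x y
    rw [Real.norm_eq_abs] at this
    refine this.trans ?_
    gcongr
    linarith

theorem Cutoff.lip0 {L : ℝ} {g : E → ℝ} {g' : E → E →L[ℝ] ℝ} {g'' : E → E →L[ℝ] E →L[ℝ] ℝ}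
    (h : Cutoff b L g g' g'') (x y : E) : |g x - g y| ≤ L * ‖x - y‖ :=
  Convex.norm_image_sub_le_of_norm_hasFDerivWithin_le (s := univ)
    (fun z _ => (h.d1 z).hasFDerivWithinAt) (fun z _ => h.n1 z) convex_univ (mem_univ y) (mem_univ x)

theorem Cutoff.lip1 {L : ℝ} {g : E → ℝ} {g' : E → E →L[ℝ] ℝ} {g'' : E → E →L[ℝ] E →L[ℝ] ℝ}
    (h : Cutoff b L g g' g'') (x y : E) : ‖g' x - g' y‖ ≤ L * ‖x - y‖ :=
  Convex.norm_image_sub_le_of_norm_hasFDerivWithin_le (s := univ)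
    (fun z _ => (h.d2 z).hasFDerivWithinAt) (fun z _ => h.n2 z) convex_univ (mem_univ y) (mem_univ x)

/-- The second derivative of a product. -/
def mul2 (z u : ℝ) (z' u' : E →L[ℝ] ℝ) (z'' u'' : E →L[ℝ] E →L[ℝ] ℝ) : E →L[ℝ] E →L[ℝ] ℝ :=
  (z • u'' + z'.smulRight u') + (u • z'' + u'.smulRight z')

theorem trL_mul2 (z u : ℝ) (z' u' : E →L[ℝ] ℝ) (z'' u'' : E →L[ℝ] E →L[ℝ] ℝ) :
    trL b (mul2 z u z' u' z'' u'') =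
      z * trL b u'' + (2 * ∑ i, z' (b i) * u' (b i) + trL b z'' * u) := by
  rw [trL_apply, trL_apply, trL_apply, Finset.mul_sum, Finset.mul_sum, Finset.sum_mul,
    ← Finset.sum_add_distrib, ← Finset.sum_add_distrib]
  refine Finset.sum_congr rfl fun i _ => ?_
  simp [mul2]
  ring

theorem W2.cutoff {L ρ K : ℝ} (hρ : 0 < ρ) (hρ1 : ρ ≤ 1) (hL : 0 ≤ L) {g u : E → ℝ}
    {g' u' : E → E →L[ℝ] ℝ} {g'' u'' : E → E →L[ℝ] E →L[ℝ] ℝ} (hg : Cutoff b L g g' g'')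
    (hu : W2 ρ K u u' u'') :
    W2 ρ (4 * L * K) (fun x => g x * u x) (fun x => g x • u' x + u x • g' x)
      (fun x => mul2 (g x) (u x) (g' x) (u' x) (g'' x) (u'' x)) := by
  have hK : 0 ≤ K := (norm_nonneg _).trans (hu.n0 0)
  have hLK : 0 ≤ L * K := by positivity
  have k1 : K ≤ K / ρ := by rw [le_div_iff₀ hρ]; nlinarith
  have k2 : K / ρ ≤ K / ρ ^ 2 := by rw [div_le_div_iff₀ hρ (by positivity)]; nlinarith [mul_nonneg hK hρ.le]
  have c0 : Continuous g := by rw [continuous_iff_continuousAt]; exact fun x => (hg.d1 x).continuousAt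
  have c1 : Continuous u := by rw [continuous_iff_continuousAt]; exact fun x => (hu.d1 x).continuousAt
  have c2 : Continuous g' := by rw [continuous_iff_continuousAt]; exact fun x => (hg.d2 x).continuousAt
  have c3 : Continuous u' := by rw [continuous_iff_continuousAt]; exact fun x => (hu.d2 x).continuousAt
  refine ⟨fun x => (hg.d1 x).mul (hu.d1 x), fun x => ?_, ?_, fun x => ?_, fun x => ?_, fun x => ?_⟩
  · exact ((hg.d1 x).fun_smul (hu.d2 x)).add ((hu.d1 x).fun_smul (hg.d2 x))
  · refine ((c0.smul hu.c2).add ?_).add ((c1.smul hg.c2).add ?_)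
    · exact ((ContinuousLinearMap.smulRightL ℝ E (E →L[ℝ] ℝ)).continuous.comp c2).clm_apply c3
    · exact ((ContinuousLinearMap.smulRightL ℝ E (E →L[ℝ] ℝ)).continuous.comp c3).clm_apply c2
  · rw [norm_mul, Real.norm_eq_abs]
    calc |g x| * ‖u x‖ ≤ L * K := mul_le_mul (hg.n0 x) (hu.n0 x) (norm_nonneg _) hL
      _ ≤ _ := by linarith
  · refine (norm_add_le _ _).trans ?_
    rw [norm_smul, norm_smul, Real.norm_eq_abs]
    have h1 := mul_le_mul (hg.n0 x) (hu.n1 x) (norm_nonneg _) hL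
    have h2 := mul_le_mul (hu.n0 x) (hg.n1 x) (norm_nonneg _) hK
    have h3 : 4 * L * K / ρ = 4 * (L * (K / ρ)) := by ring
    have h4 : L * K ≤ L * (K / ρ) := by gcongr
    rw [h3]; linarith
  · refine (norm_add_le _ _).trans ((add_le_add (norm_add_le _ _) (norm_add_le _ _)).trans ?_)
    rw [norm_smul, norm_smul, Real.norm_eq_abs, ContinuousLinearMap.norm_smulRight_apply,
      ContinuousLinearMap.norm_smulRight_apply]
    have h1 := mul_le_mul (hg.n0 x) (hu.n2 x) (norm_nonneg _) hL
    have h2 := mul_le_mul (hu.n0 x) (hg.n2 x) (norm_nonneg _) hK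
    have h5 := mul_le_mul (hg.n1 x) (hu.n1 x) (norm_nonneg _) hL
    have h3 : 4 * L * K / ρ ^ 2 = 4 * (L * (K / ρ ^ 2)) := by ring
    have h4 : L * (K / ρ) ≤ L * (K / ρ ^ 2) := by gcongr
    have h6 : L * K ≤ L * (K / ρ) := by gcongr
    have h7 : ‖u' x‖ * ‖g' x‖ = ‖g' x‖ * ‖u' x‖ := mul_comm _ _
    rw [h3]; linarith

theorem W2.hb0 {β ρ K : ℝ} (hβ : 0 < β) (hβ1 : β < 1) (hρ : 0 < ρ) {u : E → ℝ}
    {u' : E → E →L[ℝ] ℝ} {u'' : E → E →L[ℝ] E →L[ℝ] ℝ} (hu : W2 ρ K u u' u'') :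
    HB β ρ (2 * K) u := HB.of_deriv hβ hβ1 hρ hu.d1 hu.n0 hu.n1

theorem W2.hb1 {β ρ K : ℝ} (hβ : 0 < β) (hβ1 : β < 1) (hρ : 0 < ρ) {u : E → ℝ}
    {u' : E → E →L[ℝ] ℝ} {u'' : E → E →L[ℝ] E →L[ℝ] ℝ} (hu : W2 ρ K u u' u'') :
    HB β ρ (2 * (K / ρ)) u' :=
  HB.of_deriv hβ hβ1 hρ hu.d2 hu.n1 fun x => (hu.n2 x).trans (le_of_eq (by field_simp))

end CompactlySupported

section LocalSolvers

variable {E : Type} [NormedAddCommGroup E] [InnerProductSpace ℝ E] [FiniteDimensional ℝ E]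
  [MeasurableSpace E] [BorelSpace E] {ι : Type} [Fintype ι] (b : OrthonormalBasis ι ℝ E)

theorem exists_small_cutoff {h : E → ℝ} (hh : ContDiff ℝ 3 h) {x0 : E} (h0 : h x0 = 0)
    (h1 : fderiv ℝ h x0 = 0) {δ R : ℝ} (hδ : 0 < δ) (hR : 0 < R) :
    ∃ r : ℝ, 0 < r ∧ r ≤ R ∧ ∃ g : E → ℝ, ContDiff ℝ 3 g ∧ HasCompactSupport g ∧
      (∀ x, ‖x - x0‖ < r → g x = h x) ∧ ∀ x, ‖fderiv ℝ g x‖ ≤ δ := by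
  let χ : ContDiffBump (0 : E) := ⟨1, 2, one_pos, one_lt_two⟩
  have hχ : ContDiff ℝ 3 χ := χ.contDiff
  obtain ⟨M', hM'⟩ := (hχ.continuous_fderiv (by norm_num)).bounded_above_of_compact_support
    (χ.hasCompactSupport.fderiv (𝕜 := ℝ))
  have hM'0 := (norm_nonneg _).trans (hM' 0)
  have hh1 : ContDiff ℝ 2 (fderiv ℝ h) := hh.fderiv_right (by norm_num)
  have hh2 : ContDiff ℝ 1 (fderiv ℝ (fderiv ℝ h)) := hh1.fderiv_right (by norm_num)
  obtain ⟨M, hM⟩ := (isCompact_closedBall x0 2).exists_bound_of_continuousOn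
    hh2.continuous.continuousOn
  have hM0 : 0 ≤ M := (norm_nonneg _).trans (hM x0 (by simp))
  have hd1 : ∀ x, HasFDerivAt h (fderiv ℝ h x) x := fun x =>
    (hh.differentiable (by norm_num) x).hasFDerivAt
  have hd2 : ∀ x, HasFDerivAt (fderiv ℝ h) (fderiv ℝ (fderiv ℝ h) x) x := fun x =>
    (hh1.differentiable (by norm_num) x).hasFDerivAt
  have b1 : ∀ x, ‖x - x0‖ ≤ 2 → ‖fderiv ℝ h x‖ ≤ M * ‖x - x0‖ := by
    intro x hx
    have := (convex_closedBall x0 2).norm_image_sub_le_of_norm_hasFDerivWithin_le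
      (fun z _ => (hd2 z).hasFDerivWithinAt) hM (mem_closedBall_self (by norm_num))
      (mem_closedBall_iff_norm.2 hx)
    rwa [h1, sub_zero] at this
  have b0 : ∀ x, ‖x - x0‖ ≤ 2 → ‖h x‖ ≤ M * ‖x - x0‖ * ‖x - x0‖ := by
    intro x hx
    have := (convex_closedBall x0 ‖x - x0‖).norm_image_sub_le_of_norm_hasFDerivWithin_le
      (fun z _ => (hd1 z).hasFDerivWithinAt) (C := M * ‖x - x0‖) (fun z hz => by
        rw [mem_closedBall_iff_norm] at hz
        exact (b1 z (hz.trans hx)).trans (by gcongr))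
      (mem_closedBall_self (norm_nonneg _)) (mem_closedBall_iff_norm.2 le_rfl)
    rwa [h0, sub_zero] at this
  set Q := 2 * M + 4 * M * M' + 1 with hQ
  have hQ1 : 0 < Q := by positivity
  set r := min (min 1 R) (δ / Q) with hr
  have hrpos : 0 < r := lt_min (lt_min one_pos hR) (by positivity)
  have hr1 : r ≤ 1 := (min_le_left _ _).trans (min_le_left _ _)
  have hrQ : r * Q ≤ δ := by rw [← le_div_iff₀ hQ1]; exact min_le_right _ _
  have hsc : ContDiff ℝ 3 fun x : E => r⁻¹ • (x - x0) := (contDiff_id.sub contDiff_const).const_smul _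
  have hns : ∀ x : E, ‖r⁻¹ • (x - x0)‖ = ‖x - x0‖ / r := fun x => by
    rw [norm_smul, Real.norm_of_nonneg (by positivity)]; field_simp
  have hz : ∀ x, 2 * r ≤ ‖x - x0‖ → χ (r⁻¹ • (x - x0)) = 0 := fun x hx => by
    apply χ.zero_of_le_dist
    rw [dist_zero_right, hns, le_div_iff₀ hrpos]
    exact hx
  refine ⟨r, hrpos, (min_le_left _ _).trans (min_le_right _ _),
    fun x => χ (r⁻¹ • (x - x0)) * h x, (hχ.comp hsc).mul hh, ?_, fun x hx => ?_, fun x => ?_⟩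
  · refine HasCompactSupport.intro (isCompact_closedBall x0 (2 * r)) fun x hx => ?_
    rw [mem_closedBall_iff_norm, not_le] at hx
    rw [hz x hx.le, zero_mul]
  · change χ (r⁻¹ • (x - x0)) * h x = h x
    rw [χ.one_of_mem_closedBall, one_mul]
    rw [mem_closedBall_zero_iff, hns, div_le_iff₀ hrpos]
    change _ ≤ 1 * r
    linarith
  · by_cases hx : 2 * r < ‖x - x0‖
    · have : (fun x => χ (r⁻¹ • (x - x0)) * h x) =ᶠ[nhds x] fun _ => 0 := by
        have ho : IsOpen {x : E | 2 * r < ‖x - x0‖} := isOpen_lt continuous_const (by fun_prop)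
        filter_upwards [ho.mem_nhds hx] with y hy
        have hy' : 2 * r < ‖y - x0‖ := hy
        rw [hz y hy'.le, zero_mul]
      rw [this.fderiv_eq]
      simp [hδ.le]
    · rw [not_lt] at hx
      have hd : HasFDerivAt (fun x => χ (r⁻¹ • (x - x0)) * h x)
          (χ (r⁻¹ • (x - x0)) • fderiv ℝ h x + h x • (r⁻¹ • fderiv ℝ χ (r⁻¹ • (x - x0)))) x := by
        have e1 : HasFDerivAt (fun x => χ (r⁻¹ • (x - x0))) (r⁻¹ • fderiv ℝ χ (r⁻¹ • (x - x0))) x := by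
          have := ((hχ.differentiable (by norm_num) (r⁻¹ • (x - x0))).hasFDerivAt).comp x
            (((hasFDerivAt_id x).sub_const x0).const_smul r⁻¹)
          refine this.congr_fderiv ?_
          ext v; simp
        exact e1.mul (hd1 x)
      rw [hd.fderiv]
      refine (norm_add_le _ _).trans ?_
      rw [norm_smul, norm_smul, norm_smul, Real.norm_of_nonneg χ.nonneg, norm_inv,
        Real.norm_of_nonneg hrpos.le]
      have hx2 : ‖x - x0‖ ≤ 2 := by linarith
      have k1 : χ (r⁻¹ • (x - x0)) * ‖fderiv ℝ h x‖ ≤ 1 * (M * (2 * r)) :=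
        mul_le_mul χ.le_one ((b1 x hx2).trans (by gcongr)) (norm_nonneg _) zero_le_one
      have k2 : ‖h x‖ * (r⁻¹ * ‖fderiv ℝ χ (r⁻¹ • (x - x0))‖) ≤ (M * (2 * r) * (2 * r)) * (r⁻¹ * M') := by
        gcongr
        · exact (b0 x hx2).trans (by gcongr)
        · exact hM' _
      have k3 : (M * (2 * r) * (2 * r)) * (r⁻¹ * M') = r * (4 * M * M') := by field_simp; ring
      have k4 : r * Q = r * (2 * M) + r * (4 * M * M') + r := by rw [hQ]; ring
      linarith

/-- Solvability of the rescaled Dirichlet problem on `Ω ∩ ball x₀ r`. -/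
def LocalSolver (β : ℝ) (Ω : Set E) (x0 : E) (r : ℝ) : Prop :=
  ∃ C ρ0 : ℝ, 0 ≤ C ∧ 0 < ρ0 ∧ ∀ ρ, 0 < ρ → ρ ≤ ρ0 → ∀ (A : ℝ) (f : E → ℝ), HB β ρ A f →
    ∃ (u : E → ℝ) (u' : E → E →L[ℝ] ℝ) (u'' : E → E →L[ℝ] E →L[ℝ] ℝ),
      W2 ρ (C * A) u u' u'' ∧
      (∀ x ∈ frontier Ω, ‖x - x0‖ < r → u x = 0) ∧
      (∀ x ∈ Ω, ‖x - x0‖ < r → u x - ρ ^ 2 * trL b (u'' x) = f x)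

theorem exists_localSolver_interior [Nontrivial E] {β : ℝ} (hβ : 0 < β) (hβ1 : β < 1) {Ω : Set E}
    (ho : IsOpen Ω) {x0 : E} (hx : x0 ∈ Ω) : ∃ r, 0 < r ∧ LocalSolver b β Ω x0 r := by
  obtain ⟨e, he⟩ := exists_norm_eq E (zero_le_one (α := ℝ))
  obtain ⟨δ, hδ, hch⟩ := exists_chart b he hβ hβ1
  obtain ⟨r, hr, hrb⟩ := Metric.isOpen_iff.1 ho x0 hx
  obtain ⟨C, ρ0, hC, hρ0, h⟩ := hch (fun _ => r) (fun _ => 0) (fun _ => 0) x0 0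
    (fun x => hasFDerivAt_const _ _) (fun x => hasFDerivAt_const _ _) continuous_const
    (by simp [hδ.le]) (by simp) (by simp) (by simp)
  refine ⟨r, hr, C, ρ0, hC, hρ0, fun ρ hρ hρ1 A f hf => ?_⟩
  obtain ⟨u, u', u'', hw, hz, hs⟩ := h ρ hρ hρ1 A f hf
  refine ⟨u, u', u'', hw, fun x hx hxr => ?_, fun x hx hxr => hs x ?_⟩
  · rw [ho.frontier_eq] at hx
    exact absurd (hrb (mem_ball_iff_norm.2 hxr)) hx.2
  · unfold shear
    rw [inner_add_right, inner_smul_right, real_inner_self_eq_norm_sq, he]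
    have := abs_real_inner_le_norm e (x - x0)
    rw [he, one_mul] at this
    have := neg_abs_le (inner ℝ e (x - x0))
    linarith

theorem exists_localSolver_boundary {β : ℝ} (hβ : 0 < β) (hβ1 : β < 1) {Ω : Set E}
    (ho : IsOpen Ω) {x0 : E} (hx : x0 ∈ frontier Ω) {U : Set E} {f : E → ℝ} (hU : IsOpen U)
    (hxU : x0 ∈ U) (hf : ContDiff ℝ 3 f) (hd : fderiv ℝ f x0 ≠ 0)
    (hΩ : Ω ∩ U = {y ∈ U | f y < 0}) : ∃ r, 0 < r ∧ LocalSolver b β Ω x0 r := by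
  have hsub : ∀ y ∈ U, y ∈ Ω → f y < 0 := fun y hy hyΩ => by
    have : y ∈ Ω ∩ U := ⟨hyΩ, hy⟩
    rw [hΩ] at this; exact this.2
  have hsub' : ∀ y ∈ U, f y < 0 → y ∈ Ω := fun y hy hyf => by
    have : y ∈ {y ∈ U | f y < 0} := ⟨hy, hyf⟩
    rw [← hΩ] at this; exact this.1
  have hfr : ∀ y ∈ U, y ∈ frontier Ω → f y = 0 := by
    intro y hy hyf
    rw [ho.frontier_eq] at hyf
    have h1 : 0 ≤ f y := by
      by_contra hlt
      exact hyf.2 (hsub' y hy (not_le.1 hlt))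
    refine le_antisymm ?_ h1
    have h2 : y ∈ closure (Ω ∩ U) := by
      rw [inter_comm]; exact hU.inter_closure ⟨hy, hyf.1⟩
    have h3 : closure (Ω ∩ U) ⊆ {z | f z ≤ 0} := by
      refine closure_minimal (fun z hz => (hsub z hz.2 hz.1).le) (isClosed_le hf.continuous continuous_const)
    exact h3 h2
  set T := fderiv ℝ f x0 with hT
  set c := ‖T‖ with hc
  have hcpos : 0 < c := norm_pos_iff.2 hd
  set e : E := (-c⁻¹) • (InnerProductSpace.toDual ℝ E).symm T with he_def
  have he : ‖e‖ = 1 := by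
    rw [he_def, norm_smul, LinearIsometryEquiv.norm_map, norm_neg, norm_inv,
      Real.norm_of_nonneg hcpos.le, ← hc, inv_mul_cancel₀ hcpos.ne']
  have hei : ∀ v, inner ℝ e v = -c⁻¹ * T v := fun v => by
    rw [he_def, inner_smul_left, InnerProductSpace.toDual_symm_apply]; simp
  obtain ⟨δ, hδ, hch⟩ := exists_chart b he hβ hβ1
  obtain ⟨R, hR, hRb⟩ := Metric.isOpen_iff.1 hU x0 hxU
  set h : E → ℝ := fun x => -c⁻¹ * (f x - T (x - x0)) with hh
  have hhc : ContDiff ℝ 3 h :=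
    contDiff_const.mul (hf.sub (T.contDiff.comp (contDiff_id.sub contDiff_const)))
  have hh0 : h x0 = 0 := by simp [hh, hfr x0 hxU hx]
  have hh1 : fderiv ℝ h x0 = 0 := by
    have h1 : HasFDerivAt f T x0 := (hf.differentiable (by norm_num) x0).hasFDerivAt
    have h2 : HasFDerivAt (fun x => T (x - x0)) T x0 := by
      have := (T.hasFDerivAt (x := id x0 - x0)).comp (f := fun x => id x - x0) x0
        ((hasFDerivAt_id x0).sub_const x0)
      exact this
    have := (h1.sub h2).const_mul (-c⁻¹)
    rw [sub_self, smul_zero] at this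
    exact this.fderiv
  obtain ⟨r, hr, hrR, g, hg, hgs, hgh, hgδ⟩ := exists_small_cutoff hhc hh0 hh1 hδ hR
  obtain ⟨L, hL, hcut⟩ := exists_cutoff b hg hgs
  obtain ⟨C, ρ0, hC, hρ0, hsol⟩ := hch g _ _ x0 L hcut.d1 hcut.d2 hcut.c2 hgδ hcut.n2 hcut.tr hcut.tl
  refine ⟨r, hr, C, ρ0, hC, hρ0, fun ρ hρ hρ1 A k hk => ?_⟩
  obtain ⟨u, u', u'', hw, hz, hs⟩ := hsol ρ hρ hρ1 A k hk
  have key : ∀ x, ‖x - x0‖ < r → inner ℝ e (shear e x0 g x) = -c⁻¹ * f x := by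
    intro x hxr
    unfold shear
    rw [inner_add_right, inner_smul_right, real_inner_self_eq_norm_sq, he, hei, hgh x hxr, hh]
    ring
  have hmem : ∀ x, ‖x - x0‖ < r → x ∈ U := fun x hxr =>
    hRb (mem_ball_iff_norm.2 (hxr.trans_le hrR))
  refine ⟨u, u', u'', hw, fun x hx hxr => hz x ?_, fun x hx hxr => hs x ?_⟩
  · rw [key x hxr, hfr x (hmem x hxr) hx, mul_zero]
  · rw [key x hxr]
    have := hsub x (hmem x hxr) hx
    have := inv_pos.2 hcpos
    nlinarith

end LocalSolvers

section Globalize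

variable {E : Type} [NormedAddCommGroup E] [InnerProductSpace ℝ E] [FiniteDimensional ℝ E]
  [MeasurableSpace E] [BorelSpace E] {ι : Type} [Fintype ι] (b : OrthonormalBasis ι ℝ E)

theorem W2.mono {ρ K K' : ℝ} (hρ : 0 < ρ) {u : E → ℝ} {u' : E → E →L[ℝ] ℝ}
    {u'' : E → E →L[ℝ] E →L[ℝ] ℝ} (h : W2 ρ K u u' u'') (hK : K ≤ K') : W2 ρ K' u u' u'' :=
  ⟨h.d1, h.d2, h.c2, fun x => (h.n0 x).trans hK, fun x => (h.n1 x).trans (by gcongr),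
    fun x => (h.n2 x).trans (by gcongr)⟩

theorem W2.sum {κ : Type} [Fintype κ] {ρ K : ℝ} {u : κ → E → ℝ} {u' : κ → E → E →L[ℝ] ℝ}
    {u'' : κ → E → E →L[ℝ] E →L[ℝ] ℝ} (h : ∀ k, W2 ρ K (u k) (u' k) (u'' k)) :
    W2 ρ (Fintype.card κ * K) (fun x => ∑ k, u k x) (fun x => ∑ k, u' k x)
      (fun x => ∑ k, u'' k x) := by
  refine ⟨fun x => HasFDerivAt.fun_sum fun k _ => (h k).d1 x,
    fun x => HasFDerivAt.fun_sum fun k _ => (h k).d2 x,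
    continuous_finsetSum _ fun k _ => (h k).c2, fun x => ?_, fun x => ?_, fun x => ?_⟩
  · refine (norm_sum_le _ _).trans ((Finset.sum_le_sum fun k _ => (h k).n0 x).trans ?_)
    simp
  · refine (norm_sum_le _ _).trans ((Finset.sum_le_sum fun k _ => (h k).n1 x).trans ?_)
    simp [mul_div_assoc]
  · refine (norm_sum_le _ _).trans ((Finset.sum_le_sum fun k _ => (h k).n2 x).trans ?_)
    simp [mul_div_assoc]

set_option maxHeartbeats 1000000 in
theorem LocalSolver.localized {β : ℝ} (hβ : 0 < β) (hβ1 : β < 1) {Ω : Set E} {x0 : E} {r : ℝ}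
    (hr : 0 < r) (h : LocalSolver b β Ω x0 r) {ξ : E → ℝ} {M : ℝ} (hξ : ∀ x, |ξ x| ≤ 1)
    (hξl : ∀ x y, |ξ x - ξ y| ≤ M * ‖x - y‖) (hξ0 : ∀ x, r / 2 ≤ ‖x - x0‖ → ξ x = 0) :
    ∃ C, 0 ≤ C ∧ ∀ ε, 0 < ε → ∃ ρ0, 0 < ρ0 ∧ ∀ ρ, 0 < ρ → ρ ≤ ρ0 → ∀ (A : ℝ) (f : E → ℝ),
      HB β ρ A f → ∃ (u : E → ℝ) (u' : E → E →L[ℝ] ℝ) (u'' : E → E →L[ℝ] E →L[ℝ] ℝ) (err : E → ℝ),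
        W2 ρ (C * A) u u' u'' ∧ (∀ x ∈ frontier Ω, u x = 0) ∧
        (∀ x ∈ Ω, u x - ρ ^ 2 * trL b (u'' x) = ξ x * f x - err x) ∧ HB β ρ (ε * A) err := by
  obtain ⟨C1, ρ1, hC1, hρ1, hsol⟩ := h
  let ζ : ContDiffBump x0 := ⟨r / 2, r, by positivity, by linarith⟩
  obtain ⟨L, hL, hcut⟩ := exists_cutoff b (g := ζ) ζ.contDiff ζ.hasCompactSupport
  set n : ℝ := (Fintype.card ι : ℝ) with hn
  have hn0 : 0 ≤ n := by positivity
  refine ⟨4 * L * (C1 * 4), by positivity, fun ε hε => ?_⟩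
  set Q := (64 * n + 32) * C1 * L + 1 with hQ
  have hQ0 : 0 < Q := by positivity
  refine ⟨min (min 1 ρ1) (min (1 / (|M| + 1)) (ε / Q)), by positivity,
    fun ρ hρ hρle A f hf => ?_⟩
  have r1 : ρ ≤ 1 := hρle.trans ((min_le_left _ _).trans (min_le_left _ _))
  have r2 : ρ ≤ ρ1 := hρle.trans ((min_le_left _ _).trans (min_le_right _ _))
  have r3 : ρ * (|M| + 1) ≤ 1 := by
    rw [← le_div_iff₀ (by positivity)]; exact hρle.trans ((min_le_right _ _).trans (min_le_left _ _))
  have r4 : ρ * Q ≤ ε := by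
    rw [← le_div_iff₀ hQ0]; exact hρle.trans ((min_le_right _ _).trans (min_le_right _ _))
  have hA := hf.nonneg
  have hF : HB β ρ (4 * A) fun x => ξ x * f x :=
    (hf.smul_lip hβ hβ1 hρ hξ hξl).mono hρ (by nlinarith)
  obtain ⟨u, u', u'', hw, hz, hs⟩ := hsol ρ hρ r2 _ _ hF
  set K := C1 * (4 * A) with hK
  have hK0 : 0 ≤ K := by positivity
  have hbi : ∀ i, ‖b i‖ ≤ 1 := fun i => (b.orthonormal.1 i).le
  set ζ' := fderiv ℝ ζ with hζ'
  set ζ'' := fderiv ℝ ζ' with hζ''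
  have q1 : ∀ i, HB β ρ (2 * K) fun x => ρ * u' x (b i) := fun i =>
    (((hw.hb1 hβ hβ1 hρ).apply₁ hρ (hbi i)).const_mul hρ.le).mono hρ (le_of_eq (by field_simp))
  have q0 : HB β ρ (2 * K) fun x => ρ * u x :=
    ((hw.hb0 hβ hβ1 hρ).const_mul hρ.le).mono hρ (by nlinarith)
  have e1 : ∀ i, HB β ρ (16 * (K * (ρ * L))) fun x => (2 * ρ * ζ' x (b i)) * (ρ * u' x (b i)) := by
    intro i
    have h1 : ∀ B : E →L[ℝ] ℝ, |B (b i)| ≤ ‖B‖ := fun B =>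
      (B.le_opNorm _).trans (mul_le_of_le_one_right (norm_nonneg _) (hbi i))
    have := (q1 i).smul_lip hβ hβ1 hρ (a := fun x => 2 * ρ * ζ' x (b i)) (δ := 2 * ρ * L)
      (L := 2 * ρ * L) (fun x => ?_) fun x y => ?_
    · refine this.mono hρ ?_
      rw [abs_of_nonneg (by positivity)]
      have : 0 ≤ K * (ρ * L) := by positivity
      nlinarith
    · rw [abs_mul, abs_of_pos (by positivity : 0 < 2 * ρ)]
      gcongr
      exact (h1 _).trans (hcut.n1 x)
    · rw [← mul_sub, abs_mul, abs_of_pos (by positivity : 0 < 2 * ρ), mul_assoc (2 * ρ)]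
      gcongr
      exact (h1 (ζ' x - ζ' y)).trans (hcut.lip1 b x y)
  have e2 : HB β ρ (8 * (K * (ρ * L))) fun x => (ρ * trL b (ζ'' x)) * (ρ * u x) := by
    have := q0.smul_lip hβ hβ1 hρ (a := fun x => ρ * trL b (ζ'' x)) (δ := ρ * L)
      (L := ρ * L) (fun x => ?_) fun x y => ?_
    · refine this.mono hρ ?_
      rw [abs_of_nonneg (by positivity)]
      have : 0 ≤ K * (ρ * L) := by positivity
      nlinarith
    · rw [abs_mul, abs_of_pos hρ]
      gcongr
      exact hcut.tr x
    · rw [← mul_sub, abs_mul, abs_of_pos hρ, mul_assoc]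
      gcongr
      exact hcut.tl x y
  refine ⟨_, _, _, _, (hw.cutoff b hρ r1 hL hcut).mono hρ (le_of_eq (by rw [hK]; ring)),
    fun x hx => ?_, fun x hx => ?_, ((HB.sum e1).add e2).mono hρ ?_⟩
  · by_cases hxr : ‖x - x0‖ < r
    · rw [hz x hx hxr, mul_zero]
    · have : ζ x = 0 := ζ.zero_of_le_dist (by rw [dist_eq_norm]; exact not_lt.1 hxr)
      rw [this, zero_mul]
  · rw [trL_mul2]
    have hsum : ∀ i, 2 * ρ * ζ' x (b i) * (ρ * u' x (b i)) =
      (2 * ρ ^ 2) * (ζ' x (b i) * u' x (b i)) := fun i => by ring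
    simp only [hsum, ← Finset.mul_sum]
    have hmain : ζ x * (u x - ρ ^ 2 * trL b (u'' x)) = ξ x * f x := by
      by_cases hxr : ‖x - x0‖ < r
      · rw [hs x hx hxr]
        by_cases hxr2 : r / 2 ≤ ‖x - x0‖
        · rw [hξ0 x hxr2]; ring
        · have : ζ x = 1 := ζ.one_of_mem_closedBall
            (mem_closedBall_iff_norm.2 (not_le.1 hxr2).le)
          rw [this, one_mul]
      · have : ζ x = 0 := ζ.zero_of_le_dist (by rw [dist_eq_norm]; exact not_lt.1 hxr)
        rw [this, hξ0 x (by linarith [not_lt.1 hxr])]; ring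
    rw [← hmain]
    ring
  · rw [← hn]
    have : n * (16 * (K * (ρ * L))) + 8 * (K * (ρ * L)) = A * (ρ * ((64 * n + 32) * C1 * L)) := by
      rw [hK]; ring
    rw [this, mul_comm ε]
    gcongr
    have : ρ * Q = ρ * ((64 * n + 32) * C1 * L) + ρ := by rw [hQ]; ring
    linarith

theorem exists_uniform_scale {κ : Type} [Finite κ] {P : κ → ℝ → Prop}
    (h : ∀ k, ∃ ρ0, 0 < ρ0 ∧ ∀ ρ, 0 < ρ → ρ ≤ ρ0 → P k ρ) : ∃ ρ, 0 < ρ ∧ ∀ k, P k ρ := by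
  have h1 : ∀ᶠ ρ in nhdsWithin (0 : ℝ) (Ioi 0), ∀ k, P k ρ := by
    rw [Filter.eventually_all]
    intro k
    obtain ⟨ρ0, hρ0, hk⟩ := h k
    filter_upwards [Ioc_mem_nhdsGT hρ0] with ρ hρ using hk ρ hρ.1 hρ.2
  obtain ⟨ρ, hρ, hρ0⟩ := (h1.and self_mem_nhdsWithin).exists
  exact ⟨ρ, hρ0, hρ⟩

theorem exists_lipschitz_partition {K : Set E} (hK : IsCompact K) {r : E → ℝ}
    (hr : ∀ x ∈ K, 0 < r x) : ∃ (t : Finset E) (ξ : t → E → ℝ) (M : ℝ), (∀ k : t, (k : E) ∈ K) ∧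
      (∀ k x, |ξ k x| ≤ 1) ∧ (∀ k x y, |ξ k x - ξ k y| ≤ M * ‖x - y‖) ∧
      (∀ (k : t) (x : E), r k / 2 ≤ ‖x - (k : E)‖ → ξ k x = 0) ∧ ∀ x ∈ K, ∑ k, ξ k x = 1 := by
  obtain ⟨t, htK, hcov⟩ := hK.elim_nhds_subcover (fun x => ball x (r x / 4))
    fun x hx => ball_mem_nhds x (by have := hr x hx; positivity)
  have hrk : ∀ k : t, 0 < r k := fun k => hr k (htK k k.2)
  let η : t → E → ℝ := fun k x => max 0 (min 1 (2 - 4 / r k * ‖x - k‖))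
  have hη0 : ∀ k x, 0 ≤ η k x := fun k x => le_max_left _ _
  have hη1 : ∀ k x, η k x ≤ 1 := fun k x => max_le zero_le_one (min_le_left _ _)
  let L : t → ℝ := fun k => 4 / r k
  have hL0 : ∀ k, 0 ≤ L k := fun k => by have := hrk k; positivity
  have hηl : ∀ k x y, |η k x - η k y| ≤ L k * ‖x - y‖ := by
    intro k x y
    refine (abs_max_sub_max_le_max _ _ _ _).trans ?_
    rw [sub_self, abs_zero]
    refine max_le (mul_nonneg (hL0 k) (norm_nonneg _)) ((abs_min_sub_min_le_max _ _ _ _).trans ?_)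
    rw [sub_self, abs_zero]
    refine max_le (mul_nonneg (hL0 k) (norm_nonneg _)) ?_
    have h1 : 2 - 4 / r k * ‖x - k‖ - (2 - 4 / r k * ‖y - k‖) = L k * (‖y - k‖ - ‖x - k‖) := by
      change _ = 4 / r k * _; ring
    rw [h1, abs_mul, abs_of_nonneg (hL0 k)]
    refine mul_le_mul_of_nonneg_left ?_ (hL0 k)
    have := abs_norm_sub_norm_le (y - k) (x - k : E)
    rw [sub_sub_sub_cancel_right] at this
    rwa [norm_sub_rev x y]
  let S : E → ℝ := fun x => max 1 (∑ k, η k x)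
  have hS1 : ∀ x, 1 ≤ S x := fun x => le_max_left _ _
  have hSl : ∀ x y, |S x - S y| ≤ (∑ k, L k) * ‖x - y‖ := by
    intro x y
    refine (abs_max_sub_max_le_max _ _ _ _).trans ?_
    rw [sub_self, abs_zero]
    refine max_le (mul_nonneg (Finset.sum_nonneg fun k _ => hL0 k) (norm_nonneg _)) ?_
    rw [← Finset.sum_sub_distrib, Finset.sum_mul]
    exact (Finset.abs_sum_le_sum_abs _ _).trans (Finset.sum_le_sum fun k _ => hηl k x y)
  refine ⟨t, fun k x => η k x / S x, (∑ k, L k) + ∑ k, L k, fun k => htK k k.2, fun k x => ?_,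
    fun k x y => ?_, fun k x hx => ?_, fun x hx => ?_⟩
  · rw [abs_div, abs_of_nonneg (hη0 k x), abs_of_nonneg (by linarith [hS1 x])]
    rw [div_le_one (by linarith [hS1 x])]
    exact (hη1 k x).trans (hS1 x)
  · have sx := hS1 x
    have sy := hS1 y
    have h1 : η k x / S x - η k y / S y =
        (η k x - η k y) * (S y)⁻¹ + (S y - S x) * (η k x * (S x)⁻¹ * (S y)⁻¹) := by
      field_simp
      ring
    have i1 : (S x)⁻¹ ≤ 1 := inv_le_one_of_one_le₀ sx
    have i2 : (S y)⁻¹ ≤ 1 := inv_le_one_of_one_le₀ sy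
    have j1 : 0 ≤ (S x)⁻¹ := by positivity
    have j2 : 0 ≤ (S y)⁻¹ := by positivity
    rw [h1]
    refine (abs_add_le _ _).trans ?_
    rw [abs_mul, abs_mul, abs_of_nonneg j2, abs_of_nonneg
      (mul_nonneg (mul_nonneg (hη0 k x) j1) j2), add_mul]
    refine add_le_add ?_ ?_
    · refine (mul_le_of_le_one_right (abs_nonneg _) i2).trans ((hηl k x y).trans ?_)
      gcongr
      exact Finset.single_le_sum (fun k _ => hL0 k) (Finset.mem_univ k)
    · have i3 : η k x * (S x)⁻¹ * (S y)⁻¹ ≤ 1 :=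
        mul_le_one₀ (mul_le_one₀ (hη1 k x) j1 i1) j2 i2
      refine (mul_le_of_le_one_right (abs_nonneg _) i3).trans ?_
      have := hSl y x
      rwa [norm_sub_rev] at this
  · have : η k x = 0 := by
      apply max_eq_left
      refine (min_le_right _ _).trans ?_
      have h1 : 4 / r k * (r k / 2) ≤ 4 / r k * ‖x - k‖ := mul_le_mul_of_nonneg_left hx (hL0 k)
      have h2 : 4 / r k * (r k / 2) = 2 := by have := (hrk k).ne'; field_simp; norm_num
      linarith
    change η k x / S x = 0
    rw [this, zero_div]
  · obtain ⟨y, hy⟩ := mem_iUnion.1 (hcov hx)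
    obtain ⟨hyt, hxy⟩ := mem_iUnion.1 hy
    have hone : η ⟨y, hyt⟩ x = 1 := by
      have h2 : 4 / r y * ‖x - y‖ ≤ 1 := by
        have h3 := (mem_ball_iff_norm.1 hxy).le
        have h4 := hrk ⟨y, hyt⟩
        calc 4 / r y * ‖x - y‖ ≤ 4 / r y * (r y / 4) :=
              mul_le_mul_of_nonneg_left h3 (hL0 ⟨y, hyt⟩)
          _ = 1 := by have := h4.ne'; field_simp
      change max 0 (min 1 (2 - 4 / r y * ‖x - y‖)) = 1
      rw [min_eq_left (by linarith), max_eq_right zero_le_one]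
    have hge : 1 ≤ ∑ k, η k x := by
      rw [← hone]
      exact Finset.single_le_sum (f := fun k => η k x) (fun k _ => hη0 k x) (Finset.mem_univ _)
    change ∑ k, η k x / S x = 1
    rw [← Finset.sum_div]
    have : S x = ∑ k, η k x := max_eq_right hge
    rw [this, div_self (by linarith)]

/-- Solvability of the rescaled Dirichlet problem with Hölder data. -/
theorem exists_global {β : ℝ} (hβ : 0 < β) (hβ1 : β < 1) {Ω : Set E}
    (hb : Bornology.IsBounded Ω) (hloc : ∀ x ∈ closure Ω, ∃ r, 0 < r ∧ LocalSolver b β Ω x r) :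
    ∃ ρ C : ℝ, 0 < ρ ∧ ∀ (A : ℝ) (f : E → ℝ), HB β ρ A f →
      ∃ (u : E → ℝ) (u' : E → E →L[ℝ] ℝ) (u'' : E → E →L[ℝ] E →L[ℝ] ℝ), W2 ρ (C * A) u u' u'' ∧
        (∀ x ∈ frontier Ω, u x = 0) ∧ (∀ x ∈ Ω, u x - ρ ^ 2 * trL b (u'' x) = f x) := by
  have hK : IsCompact (closure Ω) := hb.isCompact_closure
  choose! r hr hls using hloc
  obtain ⟨t, ξ, M, htK, hξ1, hξl, hξ0, hξs⟩ := exists_lipschitz_partition hK hr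
  choose C hC h using fun k : t => (hls k (htK k)).localized b hβ hβ1 (hr k (htK k)) (hξ1 k)
    (hξl k) (hξ0 k)
  set n : ℝ := (Fintype.card t : ℝ) with hn
  have hn0 : 0 ≤ n := by positivity
  obtain ⟨ρ, hρ, hsol⟩ := exists_uniform_scale fun k => h k (1 / (2 * (n + 1))) (by positivity)
  refine ⟨ρ, 2 * (n * ∑ k, C k), hρ, fun A f hf => ?_⟩
  refine exists_of_approx b hρ (C := n * ∑ k, C k) (S := Ω) (Z := frontier Ω) (fun A f hf => ?_) A f hf
  have hA := hf.nonneg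
  choose u u' u'' err hw hz hs he using fun k => hsol k A f hf
  have hw' : ∀ k, W2 ρ ((∑ k, C k) * A) (u k) (u' k) (u'' k) := fun k => (hw k).mono hρ (by
    gcongr
    exact Finset.single_le_sum (fun k _ => hC k) (Finset.mem_univ k))
  refine ⟨_, _, _, fun x => ∑ k, err k x, (W2.sum hw').mono hρ (le_of_eq (by rw [← hn]; ring)),
    fun x hx => Finset.sum_eq_zero fun k _ => hz k x hx, fun x hx => ?_, (HB.sum he).mono hρ ?_⟩
  · rw [map_sum, Finset.mul_sum, ← Finset.sum_sub_distrib,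
      Finset.sum_congr rfl fun k _ => hs k x hx, Finset.sum_sub_distrib, ← Finset.sum_mul,
      hξs x (subset_closure hx), one_mul]
  · rw [← hn]
    have : n * (1 / (2 * (n + 1)) * A) = A / 2 * (n / (n + 1)) := by field_simp
    rw [this]
    refine mul_le_of_le_one_right (by positivity) ?_
    rw [div_le_one (by positivity)]
    linarith

end Globalize

theorem second_deriv_nonpos_of_isLocalMax {φ φ' : ℝ → ℝ} {d : ℝ}
    (h1 : ∀ t, HasDerivAt φ (φ' t) t) (h2 : HasDerivAt φ' d 0) (hm : IsLocalMax φ 0) : d ≤ 0 := by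
  by_contra hd
  rw [not_le] at hd
  have e1 : deriv φ = φ' := funext fun t => (h1 t).deriv
  have e2 : deriv (deriv φ) 0 = d := by rw [e1, h2.deriv]
  have e3 : deriv φ 0 = 0 := hm.deriv_eq_zero
  have hmin : IsLocalMin φ 0 := isLocalMin_of_deriv_deriv_pos (by rw [e2]; exact hd) e3
    (h1 0).continuousAt
  have hc : φ =ᶠ[nhds 0] fun _ => φ 0 := by
    filter_upwards [hm, hmin] with t ht ht' using le_antisymm ht ht'
  have hc' : deriv φ =ᶠ[nhds 0] fun _ => 0 := by
    filter_upwards [hc.eventuallyEq_nhds] with t ht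
    rw [ht.deriv_eq, deriv_const]
  have : deriv (deriv φ) 0 = 0 := by rw [hc'.deriv_eq, deriv_const]
  linarith

section MaxPrinciple

variable {E : Type} [NormedAddCommGroup E] [InnerProductSpace ℝ E] [FiniteDimensional ℝ E]
  [MeasurableSpace E] [BorelSpace E] {ι : Type} [Fintype ι] (b : OrthonormalBasis ι ℝ E)

/-- `u` is of class `C²` with derivatives `u'`, `u''`. -/
structure CC (u : E → ℝ) (u' : E → E →L[ℝ] ℝ) (u'' : E → E →L[ℝ] E →L[ℝ] ℝ) : Prop where
  d1 : ∀ x, HasFDerivAt u (u' x) x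
  d2 : ∀ x, HasFDerivAt u' (u'' x) x
  c2 : Continuous u''

variable {u v : E → ℝ} {u' v' : E → E →L[ℝ] ℝ} {u'' v'' : E → E →L[ℝ] E →L[ℝ] ℝ}

theorem W2.cc {ρ K : ℝ} (h : W2 ρ K u u' u'') : CC u u' u'' := ⟨h.d1, h.d2, h.c2⟩

theorem CC.cont (h : CC u u' u'') : Continuous u := by
  rw [continuous_iff_continuousAt]; exact fun x => (h.d1 x).continuousAt

theorem CC.cont' (h : CC u u' u'') : Continuous u' := by
  rw [continuous_iff_continuousAt]; exact fun x => (h.d2 x).continuousAt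

theorem CC.sub (h : CC u u' u'') (h' : CC v v' v'') :
    CC (fun x => u x - v x) (fun x => u' x - v' x) fun x => u'' x - v'' x :=
  ⟨fun x => (h.d1 x).sub (h'.d1 x), fun x => (h.d2 x).sub (h'.d2 x), h.c2.sub h'.c2⟩

theorem CC.add (h : CC u u' u'') (h' : CC v v' v'') :
    CC (fun x => u x + v x) (fun x => u' x + v' x) fun x => u'' x + v'' x :=
  ⟨fun x => (h.d1 x).add (h'.d1 x), fun x => (h.d2 x).add (h'.d2 x), h.c2.add h'.c2⟩

theorem CC.const_smul (h : CC u u' u'') (c : ℝ) :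
    CC (fun x => c * u x) (fun x => c • u' x) fun x => c • u'' x :=
  ⟨fun x => (h.d1 x).const_mul c, fun x => (h.d2 x).const_smul c, h.c2.const_smul c⟩

theorem CC.line (h : CC u u' u'') (x a : E) :
    (∀ t : ℝ, HasDerivAt (fun t : ℝ => u (x + t • a)) (u' (x + t • a) a) t) ∧
    ∀ t : ℝ, HasDerivAt (fun t : ℝ => u' (x + t • a) a) (u'' (x + t • a) a a) t := by
  have hl : ∀ t : ℝ, HasDerivAt (fun t : ℝ => x + t • a) a t := fun t => by
    have := ((hasDerivAt_id t).smul_const a).const_add x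
    rwa [one_smul] at this
  refine ⟨fun t => (h.d1 _).comp_hasDerivAt t (hl t), fun t => ?_⟩
  have h1 := (h.d2 _).comp_hasDerivAt t (hl t)
  exact ((ContinuousLinearMap.apply ℝ ℝ a).hasFDerivAt).comp_hasDerivAt t h1

theorem CC.second_nonpos (h : CC u u' u'') {x : E} (hx : IsLocalMax u x) (a : E) :
    u'' x a a ≤ 0 := by
  obtain ⟨h1, h2⟩ := h.line x a
  have h3 := h2 0
  rw [zero_smul, add_zero] at h3
  refine second_deriv_nonpos_of_isLocalMax h1 h3 ?_
  have hc : ContinuousAt (fun t : ℝ => x + t • a) 0 := by fun_prop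
  have hx' : IsLocalMax u (x + (0 : ℝ) • a) := by simpa using hx
  exact IsLocalMax.comp_continuous (f := u) (g := fun t : ℝ => x + t • a) (b := 0) hx' hc

theorem CC.trL_nonpos (h : CC u u' u'') {x : E} (hx : IsLocalMax u x) : trL b (u'' x) ≤ 0 := by
  rw [trL_apply]
  exact Finset.sum_nonpos fun i _ => h.second_nonpos hx _

theorem exists_interior_max {Ω : Set E} (ho : IsOpen Ω) (hb : Bornology.IsBounded Ω)
    (hu : Continuous u) (hf : ∀ x ∈ frontier Ω, u x ≤ 0) {y : E} (hy : y ∈ closure Ω)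
    (hpos : 0 < u y) : ∃ x ∈ Ω, 0 < u x ∧ IsLocalMax u x := by
  obtain ⟨x, hx, hmax⟩ := hb.isCompact_closure.exists_isMaxOn ⟨y, hy⟩ hu.continuousOn
  have hpx : 0 < u x := hpos.trans_le (hmax hy)
  have hxΩ : x ∈ Ω := by
    by_contra hn
    have := hf x (by rw [ho.frontier_eq]; exact ⟨hx, hn⟩)
    linarith
  exact ⟨x, hxΩ, hpx, hmax.isLocalMax (Filter.mem_of_superset (ho.mem_nhds hxΩ) subset_closure)⟩

/-- Maximum principle for the resolvent. -/
theorem CC.max_resolvent {Ω : Set E} (ho : IsOpen Ω) (hb : Bornology.IsBounded Ω)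
    (h : CC u u' u'') {ρ : ℝ} (hf : ∀ x ∈ frontier Ω, u x ≤ 0)
    (hs : ∀ x ∈ Ω, u x - ρ ^ 2 * trL b (u'' x) ≤ 0) {x : E} (hx : x ∈ closure Ω) : u x ≤ 0 := by
  by_contra hn
  obtain ⟨y, hy, hpy, hm⟩ := exists_interior_max ho hb h.cont hf hx (not_le.1 hn)
  have h1 := h.trL_nonpos b hm
  have h2 := hs y hy
  nlinarith [sq_nonneg ρ]

theorem cc_normSq : CC (fun x : E => ‖x‖ ^ 2) (fun x => (2 : ℝ) • innerSL ℝ x)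
    fun _ => (2 : ℝ) • innerSL ℝ := by
  refine ⟨fun x => ?_, fun x => ?_, continuous_const⟩
  · exact (hasStrictFDerivAt_norm_sq x).hasFDerivAt.congr_fderiv (by ext v; simp [two_nsmul]; ring)
  · exact ((innerSL ℝ (E := E)).hasFDerivAt).const_smul (2 : ℝ)

/-- Maximum principle for subharmonic functions. -/
theorem CC.max_subharmonic [Nontrivial E] {Ω : Set E} (ho : IsOpen Ω) (hb : Bornology.IsBounded Ω)
    (h : CC u u' u'') (hf : ∀ x ∈ frontier Ω, u x ≤ 0)
    (hs : ∀ x ∈ Ω, 0 ≤ trL b (u'' x)) {x : E} (hx : x ∈ closure Ω) : u x ≤ 0 := by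
  obtain ⟨R, hR⟩ := hb.isCompact_closure.isBounded.exists_norm_le
  by_contra hn
  rw [not_le] at hn
  set ε := u x / (2 * (R ^ 2 + 1)) with hε
  have hεpos : 0 < ε := by positivity
  have hεR : ε * R ^ 2 < u x := by
    have : ε * (2 * (R ^ 2 + 1)) = u x := by rw [hε]; field_simp
    nlinarith [sq_nonneg R]
  have hcc := (h.add (cc_normSq.const_smul ε)).sub
    (⟨fun x => hasFDerivAt_const (ε * R ^ 2) x, fun x => hasFDerivAt_const _ x, continuous_const⟩ :
      CC (fun _ : E => ε * R ^ 2) (fun _ => 0) (fun _ => 0))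
  obtain ⟨y, hy, hpy, hm⟩ := exists_interior_max ho hb hcc.cont (fun z hz => by
    have h1 := hf z hz
    have h2 := hR z (frontier_subset_closure hz)
    have h3 : ‖z‖ ^ 2 ≤ R ^ 2 := by gcongr
    nlinarith) hx (by nlinarith [sq_nonneg ‖x‖])
  have h1 := hcc.trL_nonpos b hm
  have h2 := hs y hy
  have h3 : 0 < trL b ((2 : ℝ) • innerSL ℝ : E →L[ℝ] E →L[ℝ] ℝ) := by
    have : Nonempty ι := by
      by_contra hne
      rw [not_nonempty_iff] at hne
      obtain ⟨z, hz⟩ := exists_ne (0 : E)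
      apply hz
      have := b.sum_repr z
      rw [← this]; simp
    rw [map_smul, trL_apply, smul_eq_mul]
    have : ∀ i, innerSL ℝ (b i) (b i) = (1 : ℝ) := fun i => by simp
    simp only [this]
    simp [Fintype.card_pos]
  rw [map_sub, map_add, map_smul, map_zero, smul_eq_mul] at h1
  nlinarith

theorem sum_reflect (B : E →L[ℝ] E →L[ℝ] ℝ) (e : E) :
    ∑ i, B (b i - (2 * inner ℝ (b i) e) • e) (b i - (2 * inner ℝ (b i) e) • e) =
      trL b B + 4 * (‖e‖ ^ 2 - 1) * B e e := by
  have h1 : ∑ i, inner ℝ (b i) e • b i = e := b.sum_repr' e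
  have h2 : ∑ i, inner ℝ (b i) e * B e (b i) = B e e := by
    have : B e e = B e (∑ i, inner ℝ (b i) e • b i) := by rw [h1]
    rw [this, map_sum]; simp
  have h3 : ∑ i, inner ℝ (b i) e * B (b i) e = B e e := by
    have : B e e = B (∑ i, inner ℝ (b i) e • b i) e := by rw [h1]
    rw [this, map_sum, sum_apply]; simp
  have h4 : ∑ i, inner ℝ (b i) e ^ 2 = ‖e‖ ^ 2 := by
    have := b.sum_sq_norm_inner_right e
    simpa using this
  have h5 : ∀ i, B (b i - (2 * inner ℝ (b i) e) • e) (b i - (2 * inner ℝ (b i) e) • e) =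
      B (b i) (b i) - 2 * (inner ℝ (b i) e * B e (b i)) - 2 * (inner ℝ (b i) e * B (b i) e)
      + 4 * B e e * inner ℝ (b i) e ^ 2 := by
    intro i
    simp only [map_sub, map_smul, sub_apply, smul_apply, smul_eq_mul]
    ring
  simp only [h5, Finset.sum_add_distrib, Finset.sum_sub_distrib, ← Finset.mul_sum]
  rw [h2, h3, h4, trL_apply]
  ring

set_option maxHeartbeats 1000000 in
/-- Lipschitz estimate by doubling of variables. -/
theorem CC.lipschitz_of_boundary {Ω : Set E} (ho : IsOpen Ω) (hb : Bornology.IsBounded Ω)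
    (h : CC u u' u'') {A B D : ℝ} (hA : 0 < A) (hB : 0 ≤ B)
    (hD : ∀ x ∈ closure Ω, ∀ y ∈ closure Ω, ‖x - y‖ ≤ D)
    (hs : ∀ x ∈ Ω, |trL b (u'' x)| ≤ A) (hf : ∀ x ∈ frontier Ω, u x = 0)
    (hbd : ∀ x ∈ closure Ω, ∀ y ∈ frontier Ω, |u x| ≤ B * ‖x - y‖) :
    ∀ x ∈ closure Ω, ∀ y ∈ closure Ω, u x - u y ≤ (B + A * D) * ‖x - y‖ := by
  set κ := 3 / 8 * A with hκ
  have hκ0 : 0 < κ := by positivity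
  set M := B + κ * D with hM
  have key : ∀ x ∈ closure Ω, ∀ y ∈ closure Ω,
      u x - u y ≤ M * ‖x - y‖ - κ * ‖x - y‖ ^ 2 := by
    by_contra hcon
    push Not at hcon
    obtain ⟨x1, hx1, y1, hy1, hlt⟩ := hcon
    have hcomp := hb.isCompact_closure.prod hb.isCompact_closure
    let Φ : E × E → ℝ := fun q => u q.1 - u q.2 - (M * ‖q.1 - q.2‖ - κ * ‖q.1 - q.2‖ ^ 2)
    have hΦc : Continuous Φ := by
      have := h.cont
      fun_prop
    obtain ⟨⟨x, y⟩, ⟨hx, hy⟩, hmax⟩ := hcomp.exists_isMaxOn ⟨(x1, y1), hx1, hy1⟩ hΦc.continuousOn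
    have hpos : 0 < Φ (x, y) :=
      lt_of_lt_of_le (by change 0 < u x1 - u y1 - _; linarith) (hmax (Set.mk_mem_prod hx1 hy1))
    have hpos' : M * ‖x - y‖ - κ * ‖x - y‖ ^ 2 < u x - u y := by
      have : 0 < u x - u y - (M * ‖x - y‖ - κ * ‖x - y‖ ^ 2) := hpos
      linarith
    have hs0 : 0 ≤ ‖x - y‖ := norm_nonneg _
    have hMs : B * ‖x - y‖ ≤ M * ‖x - y‖ - κ * ‖x - y‖ ^ 2 := by
      have := hD x hx y hy
      have : 0 ≤ κ * ‖x - y‖ * (D - ‖x - y‖) := by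
        have : 0 ≤ D - ‖x - y‖ := by linarith
        positivity
      rw [hM]; nlinarith
    have hne : x ≠ y := by
      rintro rfl
      simp at hpos'
    have hspos : 0 < ‖x - y‖ := norm_pos_iff.2 (sub_ne_zero.2 hne)
    have hxΩ : x ∈ Ω := by
      by_contra hn
      have hxf : x ∈ frontier Ω := by rw [ho.frontier_eq]; exact ⟨hx, hn⟩
      have h1 := hbd y hy x hxf
      rw [hf x hxf] at hpos'
      have := neg_abs_le (u y)
      rw [norm_sub_rev] at h1
      linarith
    have hyΩ : y ∈ Ω := by
      by_contra hn
      have hyf : y ∈ frontier Ω := by rw [ho.frontier_eq]; exact ⟨hy, hn⟩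
      have h1 := hbd x hx y hyf
      rw [hf y hyf] at hpos'
      have := le_abs_self (u x)
      linarith
    set s := ‖x - y‖ with hs_def
    set e : E := s⁻¹ • (x - y) with he_def
    have he : ‖e‖ = 1 := by
      rw [he_def, norm_smul, norm_inv, norm_norm, ← hs_def, inv_mul_cancel₀ hspos.ne']
    have hse : x - y = s • e := by rw [he_def, smul_smul, mul_inv_cancel₀ hspos.ne', one_smul]
    have hmain : ∀ i, u'' x (b i) (b i) - u'' y (b i - (2 * inner ℝ (b i) e) • e)
        (b i - (2 * inner ℝ (b i) e) • e) + 8 * κ * inner ℝ (b i) e ^ 2 ≤ 0 := by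
      intro i
      set c : ℝ := inner ℝ (b i) e with hc
      set a' := b i - (2 * c) • e with ha'
      obtain ⟨l1, l2⟩ := h.line x (b i)
      obtain ⟨m1, m2⟩ := h.line y a'
      have hlin : ∀ t : ℝ, HasDerivAt (fun t : ℝ => s + 2 * t * c) (2 * c) t := fun t => by
        have := (((hasDerivAt_id t).const_mul 2).mul_const c).const_add s
        rwa [mul_one] at this
      have p1 : ∀ t : ℝ, HasDerivAt (fun t => u (x + t • b i) - u (y + t • a') -
          (M * (s + 2 * t * c) - κ * (s + 2 * t * c) ^ 2))
          (u' (x + t • b i) (b i) - u' (y + t • a') a' -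
          (M * (2 * c) - κ * (2 * (s + 2 * t * c) * (2 * c)))) t := by
        intro t
        have := ((l1 t).sub (m1 t)).sub (((hlin t).const_mul M).sub (((hlin t).pow 2).const_mul κ))
        refine this.congr_deriv ?_
        simp
      have p2 : HasDerivAt (fun t => u' (x + t • b i) (b i) - u' (y + t • a') a' -
          (M * (2 * c) - κ * (2 * (s + 2 * t * c) * (2 * c))))
          (u'' x (b i) (b i) - u'' y a' a' + 8 * κ * c ^ 2) 0 := by
        have h1 := l2 0
        have h2 := m2 0
        have h3 := (((hlin 0).const_mul 2).mul_const (2 * c)).const_mul κ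
        have := (h1.sub h2).sub (h3.const_sub (M * (2 * c)))
        refine this.congr_deriv ?_
        rw [zero_smul, zero_smul, add_zero, add_zero]
        ring
      refine second_deriv_nonpos_of_isLocalMax p1 p2 ?_
      have n1 : ∀ᶠ t : ℝ in nhds 0, x + t • b i ∈ Ω := by
        have hc : ContinuousAt (fun t : ℝ => x + t • b i) 0 := by fun_prop
        exact hc.eventually_mem (ho.mem_nhds (by simpa using hxΩ))
      have n2 : ∀ᶠ t : ℝ in nhds 0, y + t • a' ∈ Ω := by
        have hc : ContinuousAt (fun t : ℝ => y + t • a') 0 := by fun_prop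
        exact hc.eventually_mem (ho.mem_nhds (by simpa using hyΩ))
      have n3 : ∀ᶠ t : ℝ in nhds 0, 0 < s + 2 * t * c := by
        have hc : ContinuousAt (fun t : ℝ => s + 2 * t * c) 0 := by fun_prop
        exact hc.eventually_mem (Ioi_mem_nhds (by simpa using hspos))
      filter_upwards [n1, n2, n3] with t t1 t2 t3
      have q1 : ‖x + t • b i - (y + t • a')‖ = s + 2 * t * c := by
        have : x + t • b i - (y + t • a') = (s + 2 * t * c) • e := by
          rw [ha', add_sub_add_comm, hse]; module
        rw [this, norm_smul, he, mul_one, Real.norm_of_nonneg t3.le]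
      have q2 : Φ (x + t • b i, y + t • a') ≤ Φ (x, y) :=
        hmax (Set.mk_mem_prod (subset_closure t1) (subset_closure t2))
      change u (x + t • b i) - u (y + t • a') - (M * ‖x + t • b i - (y + t • a')‖ -
        κ * ‖x + t • b i - (y + t • a')‖ ^ 2) ≤ u x - u y - (M * s - κ * s ^ 2) at q2
      rw [q1] at q2
      simpa using q2
    have hsum := Finset.sum_nonpos fun i (_ : i ∈ Finset.univ) => hmain i
    rw [Finset.sum_add_distrib, Finset.sum_sub_distrib, sum_reflect, ← Finset.mul_sum, he] at hsum
    have h4 : ∑ i, inner ℝ (b i) e ^ 2 = (1 : ℝ) := by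
      have := b.sum_sq_norm_inner_right e
      rw [he] at this
      simpa using this
    rw [h4, ← trL_apply] at hsum
    have h5 := abs_le.1 (hs x hxΩ)
    have h6 := abs_le.1 (hs y hyΩ)
    rw [hκ] at hsum
    linarith [h5.1, h6.2]
  intro x hx y hy
  refine (key x hx y hy).trans ?_
  have h1 := hD x hx y hy
  have h2 := norm_nonneg (x - y)
  have h3 : 0 ≤ A * D * ‖x - y‖ := by
    have : 0 ≤ D := h2.trans h1
    positivity
  have h4 : 0 ≤ κ * ‖x - y‖ ^ 2 := by positivity
  rw [hM, hκ] at *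
  nlinarith

end MaxPrinciple

section Abstract

variable {K : Type} [MetricSpace K] [CompactSpace K]

theorem isCompactOperator_of_lipschitz (T : C(K, ℝ) →L[ℝ] C(K, ℝ)) {L : ℝ}
    (hT : ∀ f x y, |T f x - T f y| ≤ L * ‖f‖ * dist x y) : IsCompactOperator T := by
  refine (isCompactOperator_iff_isCompact_closure_image_ball (T : C(K, ℝ) →ₗ[ℝ] C(K, ℝ))
    (one_pos (α := ℝ))).2 ?_
  let e := (ContinuousMap.isometryEquivBoundedOfCompact K ℝ)
  have hc : IsCompact (closure (e '' (T '' ball 0 1))) := by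
    refine BoundedContinuousFunction.arzela_ascoli (closedBall 0 ‖T‖) (isCompact_closedBall _ _) _
      ?_ ?_
    · rintro _ x ⟨_, ⟨f, hf, rfl⟩, rfl⟩
      rw [mem_closedBall_zero_iff]
      rw [mem_ball_zero_iff] at hf
      calc ‖T f x‖ ≤ ‖T f‖ := ContinuousMap.norm_coe_le_norm _ _
        _ ≤ ‖T‖ * ‖f‖ := T.le_opNorm _
        _ ≤ ‖T‖ := by nlinarith [norm_nonneg T]
    · refine LipschitzWith.uniformEquicontinuous _ (Real.toNNReal |L|) ?_ |>.equicontinuous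
      rintro ⟨_, _, ⟨f, hf, rfl⟩, rfl⟩
      rw [mem_ball_zero_iff] at hf
      refine LipschitzWith.of_dist_le_mul fun x y => ?_
      rw [Real.coe_toNNReal _ (abs_nonneg L), Real.dist_eq]
      refine (hT f x y).trans ?_
      have h1 : L * ‖f‖ ≤ |L| := by
        calc L * ‖f‖ ≤ |L| * ‖f‖ := by gcongr; exact le_abs_self L
          _ ≤ |L| * 1 := by gcongr
          _ = |L| := mul_one _
      exact mul_le_mul_of_nonneg_right h1 dist_nonneg
  have h2 : e.symm '' closure (e '' (T '' ball 0 1)) = closure (T '' ball 0 1) := by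
    have h3 := e.symm.toHomeomorph.image_closure (e '' (T '' ball 0 1))
    have h4 : e.symm '' (e '' (T '' ball 0 1)) = T '' ball 0 1 := by
      rw [← Set.image_comp]
      have : (e.symm ∘ e : C(K, ℝ) → C(K, ℝ)) = id := funext fun f => e.symm_apply_apply f
      rw [this, Set.image_id]
    refine Eq.trans h3 ?_
    exact congrArg closure h4
  have h3 := hc.image e.symm.continuous
  rwa [h2] at h3

end Abstract

theorem isUnit_one_sub {X : Type} [NormedAddCommGroup X] [NormedSpace ℝ X] [CompleteSpace X]
    {T : X →L[ℝ] X} (hT : IsCompactOperator T) (h : ∀ f, T f = f → f = 0) : IsUnit (1 - T) := by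
  rcases hT.hasEigenvalue_or_mem_resolventSet (one_ne_zero (α := ℝ)) with h1 | h1
  · obtain ⟨v, hv⟩ := h1.exists_hasEigenvector
    exact absurd (h v (by simpa using hv.apply_eq_smul)) hv.2
  · rw [spectrum.mem_resolventSet_iff] at h1
    simpa using h1

section Holder

variable {E : Type} [NormedAddCommGroup E] {β ρ A B : ℝ}

theorem HB.mul (hρ : 0 < ρ) {f g : E → ℝ} (hf : HB β ρ A f) (hg : HB β ρ B g) :
    HB β ρ (2 * (A * B)) fun x => f x * g x := by
  have hA := hf.nonneg
  have hB := hg.nonneg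
  have hAB := mul_nonneg hA hB
  refine ⟨fun x => ?_, fun x y => ?_⟩
  · rw [norm_mul]
    have := mul_le_mul (hf.1 x) (hg.1 x) (norm_nonneg _) hA
    linarith
  · have h1 : f x * g x - f y * g y = f x * (g x - g y) + (f x - f y) * g y := by ring
    rw [h1]
    refine (norm_add_le _ _).trans ?_
    rw [norm_mul, norm_mul]
    have h2 := mul_le_mul (hf.1 x) (hg.2 x y) (norm_nonneg _) hA
    have h3 := mul_le_mul (hf.2 x y) (hg.1 y) (norm_nonneg _) (by positivity)
    linarith

theorem HB.rescale (hβ : 0 < β) (hρ : 0 < ρ) {f : E → ℝ} (hf : HB β 1 A f) :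
    HB β ρ (A * max 1 (ρ ^ β)) f := by
  have hA := hf.nonneg
  refine ⟨fun x => (hf.1 x).trans (le_mul_of_one_le_right hA (le_max_left _ _)), fun x y => ?_⟩
  refine (hf.2 x y).trans ?_
  rw [mul_assoc]
  gcongr
  rw [div_one, Real.div_rpow (norm_nonneg _) hρ.le]
  have h1 : 0 < ρ ^ β := Real.rpow_pos_of_pos hρ _
  have h2 : 0 ≤ ‖x - y‖ ^ β := by positivity
  calc ‖x - y‖ ^ β = ρ ^ β * (‖x - y‖ ^ β / ρ ^ β) := by field_simp
    _ ≤ _ := by gcongr; exact le_max_right _ _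

theorem abs_rpow_sub_rpow_le (hβ : 0 ≤ β) (hβ1 : β ≤ 1) {a c : ℝ} (ha : 0 ≤ a) (hc : 0 ≤ c) :
    |a ^ β - c ^ β| ≤ |a - c| ^ β := by
  wlog h : c ≤ a generalizing a c
  · rw [abs_sub_comm, abs_sub_comm a]
    exact this hc ha (le_of_not_ge h)
  have h1 := Real.rpow_le_rpow hc h hβ
  rw [abs_of_nonneg (by linarith), abs_of_nonneg (by linarith)]
  have h2 := Real.rpow_add_le_add_rpow hc (sub_nonneg.2 h) hβ hβ1
  rw [add_sub_cancel] at h2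
  linarith

theorem abs_rpow_sub_rpow_le' {s M : ℝ} (hs : 1 ≤ s) {a c : ℝ} (ha : 0 ≤ a) (hc : 0 ≤ c)
    (haM : a ≤ M) (hcM : c ≤ M) : |a ^ s - c ^ s| ≤ s * M ^ (s - 1) * |a - c| := by
  have hd : ∀ x ∈ Icc (0 : ℝ) M, HasDerivWithinAt (fun x : ℝ => x ^ s) (s * x ^ (s - 1))
      (Icc 0 M) x := fun x _ => (Real.hasDerivAt_rpow_const (Or.inr hs)).hasDerivWithinAt
  have := Convex.norm_image_sub_le_of_norm_hasDerivWithin_le (C := s * M ^ (s - 1)) hd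
    (fun x hx => by
      rw [Real.norm_of_nonneg (mul_nonneg (by linarith) (Real.rpow_nonneg hx.1 _))]
      exact mul_le_mul_of_nonneg_left (Real.rpow_le_rpow hx.1 hx.2 (by linarith)) (by linarith))
      (convex_Icc 0 M) ⟨hc, hcM⟩ ⟨ha, haM⟩
  simpa using this

variable {Ω : Set E}

/-- A continuous function on `closure Ω` which extends to a bounded Hölder function. -/
def IsHol (β : ℝ) (f : C(closure Ω, ℝ)) : Prop :=
  ∃ (A : ℝ) (F : E → ℝ), HB β 1 A F ∧ ∀ x : closure Ω, F x = f x

theorem IsHol.add {f g : C(closure Ω, ℝ)} (hf : IsHol β f) (hg : IsHol β g) : IsHol β (f + g) := by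
  obtain ⟨A, F, hF, h⟩ := hf
  obtain ⟨B, G, hG, h'⟩ := hg
  exact ⟨_, _, hF.add hG, fun x => by simp [h, h']⟩

theorem IsHol.mul {f g : C(closure Ω, ℝ)} (hf : IsHol β f) (hg : IsHol β g) : IsHol β (f * g) := by
  obtain ⟨A, F, hF, h⟩ := hf
  obtain ⟨B, G, hG, h'⟩ := hg
  exact ⟨_, _, hF.mul one_pos hG, fun x => by simp [h, h']⟩

theorem isHol_const (c : ℝ) : IsHol β (algebraMap ℝ C(closure Ω, ℝ) c) :=
  ⟨|c|, fun _ => c, ⟨fun _ => le_rfl, fun x y => by rw [sub_self, norm_zero]; positivity⟩,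
    fun x => by simp [algebraMap_apply]⟩

theorem exists_lipschitz_extension {f : C(closure Ω, ℝ)} [CompactSpace (closure Ω)] {L : ℝ}
    (hL : 0 ≤ L) (hf : ∀ x y, |f x - f y| ≤ L * dist x y) :
    ∃ F : E → ℝ, (∀ x, |F x| ≤ ‖f‖) ∧ (∀ x y, |F x - F y| ≤ L * ‖x - y‖) ∧
      ∀ x : closure Ω, F x = f x := by
  classical
  let f0 : E → ℝ := fun x => if h : x ∈ closure Ω then f ⟨x, h⟩ else 0
  have h0 : LipschitzOnWith (Real.toNNReal L) f0 (closure Ω) := by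
    refine LipschitzOnWith.of_dist_le_mul fun x hx y hy => ?_
    rw [Real.coe_toNNReal _ hL, Real.dist_eq]
    have e1 : f0 x = f ⟨x, hx⟩ := dif_pos hx
    have e2 : f0 y = f ⟨y, hy⟩ := dif_pos hy
    rw [e1, e2]
    exact hf ⟨x, hx⟩ ⟨y, hy⟩
  obtain ⟨F, hF, hFe⟩ := h0.extend_real
  have hn := norm_nonneg f
  refine ⟨fun x => max (-‖f‖) (min ‖f‖ (F x)), fun x => ?_, fun x y => ?_, fun x => ?_⟩
  · rw [abs_le]
    exact ⟨le_max_left _ _, max_le (by linarith) (min_le_left _ _)⟩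
  · have h1 := hF.dist_le_mul x y
    rw [Real.coe_toNNReal _ hL, Real.dist_eq, dist_eq_norm] at h1
    refine (abs_max_sub_max_le_max _ _ _ _).trans ?_
    rw [sub_self, abs_zero]
    refine max_le (by positivity) ((abs_min_sub_min_le_max _ _ _ _).trans ?_)
    rw [sub_self, abs_zero]
    exact max_le (by positivity) h1
  · have h1 : F x = f x := by
      rw [← hFe x.2]; simp [f0]
    have h2 := abs_le.1 (f.norm_coe_le_norm x)
    change max (-‖f‖) (min ‖f‖ (F x)) = f x
    rw [h1, min_eq_right h2.2, max_eq_right h2.1]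

theorem IsHol.of_lipschitz [CompactSpace (closure Ω)] (hβ : 0 < β) (hβ1 : β < 1)
    {f : C(closure Ω, ℝ)} {L : ℝ} (hf : ∀ x y, |f x - f y| ≤ L * dist x y) : IsHol β f := by
  obtain ⟨F, h1, h2, h3⟩ := exists_lipschitz_extension (L := max L 0) (le_max_right _ _)
    fun x y => (hf x y).trans (by gcongr; exact le_max_left _ _)
  refine ⟨_, F, HB.of_lipschitz (A := ‖f‖ + max L 0) hβ hβ1 one_pos (fun x => ?_) (fun x y => ?_),
    h3⟩
  · have := h1 x
    rw [Real.norm_eq_abs]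
    linarith [le_max_right L 0]
  · rw [div_one]
    refine (h2 x y).trans ?_
    gcongr
    linarith [norm_nonneg f]

theorem IsHol.rpow [CompactSpace (closure Ω)] (hβ : 0 < β) (hβ1 : β < 1)
    {f g : C(closure Ω, ℝ)} {L γ : ℝ} (hγ : β ≤ γ) (hf : ∀ x y, |f x - f y| ≤ L * dist x y)
    (hg : ∀ x, g x = max (f x) 0 ^ γ) : IsHol β g := by
  obtain ⟨F, h1, h2, h3⟩ := exists_lipschitz_extension (L := max L 0) (le_max_right _ _)
    fun x y => (hf x y).trans (by gcongr; exact le_max_left _ _)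
  set L' := max L 0
  have hL' : 0 ≤ L' := le_max_right _ _
  set M := ‖f‖ with hM
  have hM0 : 0 ≤ M := norm_nonneg f
  set s := γ / β with hs
  have hs1 : 1 ≤ s := (one_le_div hβ).2 hγ
  have hb : ∀ x, 0 ≤ max (F x) 0 ∧ max (F x) 0 ≤ M := fun x =>
    ⟨le_max_right _ _, max_le ((le_abs_self _).trans (h1 x)) hM0⟩
  have he : ∀ x, max (F x) 0 ^ γ = (max (F x) 0 ^ s) ^ β := fun x => by
    rw [← Real.rpow_mul (hb x).1, hs, div_mul_cancel₀ _ hβ.ne']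
  have hMs : 0 ≤ M ^ (s - 1) := Real.rpow_nonneg hM0 _
  refine ⟨M ^ γ + (s * M ^ (s - 1) * L') ^ β, fun x => max (F x) 0 ^ γ, ⟨fun x => ?_, fun x y => ?_⟩,
    fun x => by beta_reduce; rw [h3, hg]⟩
  · rw [Real.norm_of_nonneg (Real.rpow_nonneg (hb x).1 _)]
    have h5 := Real.rpow_le_rpow (hb x).1 (hb x).2 (hβ.le.trans hγ)
    have : 0 ≤ (s * M ^ (s - 1) * L') ^ β := by positivity
    linarith
  · beta_reduce
    rw [Real.norm_eq_abs, he, he, div_one]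
    refine (abs_rpow_sub_rpow_le hβ.le hβ1.le (Real.rpow_nonneg (hb x).1 _)
      (Real.rpow_nonneg (hb y).1 _)).trans ?_
    have h4 : |max (F x) 0 - max (F y) 0| ≤ L' * ‖x - y‖ :=
      (abs_max_sub_max_le_max _ _ _ _).trans (by
        rw [sub_self, abs_zero]; exact max_le (h2 x y) (by positivity))
    have h5 := (abs_rpow_sub_rpow_le' hs1 (hb x).1 (hb y).1 (hb x).2 (hb y).2).trans
      (mul_le_mul_of_nonneg_left h4 (by positivity))
    refine (Real.rpow_le_rpow (abs_nonneg _) h5 hβ.le).trans ?_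
    rw [← mul_assoc, Real.mul_rpow (by positivity) (norm_nonneg _)]
    gcongr
    have : 0 ≤ M ^ γ := Real.rpow_nonneg hM0 _
    linarith

/-- The subalgebra of Hölder functions. -/
def holSubalgebra (Ω : Set E) (β : ℝ) : Subalgebra ℝ C(closure Ω, ℝ) where
  carrier := {f | IsHol β f}
  mul_mem' := IsHol.mul
  add_mem' := IsHol.add
  algebraMap_mem' := isHol_const

theorem holSubalgebra_dense [CompactSpace (closure Ω)] (hβ : 0 < β) (hβ1 : β < 1) :
    Dense (holSubalgebra Ω β : Set C(closure Ω, ℝ)) := by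
  have h := ContinuousMap.subalgebra_topologicalClosure_eq_top_of_separatesPoints
    (holSubalgebra Ω β) (fun x y hxy => by
      let g : C(closure Ω, ℝ) := ⟨fun z => dist z x, by fun_prop⟩
      refine ⟨g, ⟨g, IsHol.of_lipschitz (L := 1) hβ hβ1 fun z w => ?_, rfl⟩, ?_⟩
      · rw [one_mul]; exact abs_dist_sub_le z w x
      · change dist x x ≠ dist y x
        rw [dist_self]
        exact (dist_pos.2 hxy.symm).ne)
  rw [dense_iff_closure_eq, ← Subalgebra.topologicalClosure_coe, h]
  rfl

end Holder

section Resolvent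

variable {E : Type} [NormedAddCommGroup E] [InnerProductSpace ℝ E] [FiniteDimensional ℝ E]
  [MeasurableSpace E] [BorelSpace E] {ι : Type} [Fintype ι] (b : OrthonormalBasis ι ℝ E)
  {Ω : Set E} {ρ β : ℝ}

theorem cc_const (c : ℝ) : CC (fun _ : E => c) (fun _ => 0) fun _ => 0 :=
  ⟨fun x => hasFDerivAt_const c x, fun x => hasFDerivAt_const _ x, continuous_const⟩

/-- `g` is the restriction of a `C²` solution of `u - ρ² Δ u = f`, `u = 0` on the boundary. -/
def IsRes (Ω : Set E) (ρ : ℝ) (f g : C(closure Ω, ℝ)) : Prop :=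
  ∃ (u : E → ℝ) (u' : E → E →L[ℝ] ℝ) (u'' : E → E →L[ℝ] E →L[ℝ] ℝ), CC u u' u'' ∧
    (∀ x ∈ frontier Ω, u x = 0) ∧
    (∀ x : closure Ω, (x : E) ∈ Ω → u x - ρ ^ 2 * trL b (u'' x) = f x) ∧
    ∀ x : closure Ω, u x = g x

variable {b}

theorem IsRes.add {f g f' g' : C(closure Ω, ℝ)} (h : IsRes b Ω ρ f g) (h' : IsRes b Ω ρ f' g') :
    IsRes b Ω ρ (f + f') (g + g') := by
  obtain ⟨u, u', u'', h1, h2, h3, h4⟩ := h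
  obtain ⟨v, v', v'', k1, k2, k3, k4⟩ := h'
  refine ⟨_, _, _, h1.add k1, fun x hx => by rw [h2 x hx, k2 x hx, add_zero],
    fun x hx => ?_, fun x => by rw [h4, k4]; rfl⟩
  rw [ContinuousMap.add_apply, ← h3 x hx, ← k3 x hx, map_add]
  ring

theorem IsRes.smul {f g : C(closure Ω, ℝ)} (h : IsRes b Ω ρ f g) (c : ℝ) :
    IsRes b Ω ρ (c • f) (c • g) := by
  obtain ⟨u, u', u'', h1, h2, h3, h4⟩ := h
  refine ⟨_, _, _, h1.const_smul c, fun x hx => by rw [h2 x hx, mul_zero],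
    fun x hx => ?_, fun x => by rw [h4]; rfl⟩
  rw [ContinuousMap.smul_apply, ← h3 x hx, map_smul]
  simp only [smul_eq_mul]
  ring

theorem IsRes.mono (ho : IsOpen Ω) (hb : Bornology.IsBounded Ω) {f g f' g' : C(closure Ω, ℝ)}
    (h : IsRes b Ω ρ f g) (h' : IsRes b Ω ρ f' g') (hff : ∀ x, f x ≤ f' x) (x : closure Ω) :
    g x ≤ g' x := by
  obtain ⟨u, u', u'', h1, h2, h3, h4⟩ := h
  obtain ⟨v, v', v'', k1, k2, k3, k4⟩ := h'
  have := (h1.sub k1).max_resolvent b (ρ := ρ) ho hb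
    (fun x hx => by rw [h2 x hx, k2 x hx, sub_zero]) (fun x hx => by
      have e1 := h3 ⟨x, subset_closure hx⟩ hx
      have e2 := k3 ⟨x, subset_closure hx⟩ hx
      have e3 := hff ⟨x, subset_closure hx⟩
      rw [map_sub]
      dsimp only at e1 e2
      linarith) x.2
  rw [h4, k4] at this
  linarith

theorem IsRes.le_const (ho : IsOpen Ω) (hb : Bornology.IsBounded Ω) {f g : C(closure Ω, ℝ)}
    (h : IsRes b Ω ρ f g) {c : ℝ} (hc : 0 ≤ c) (hff : ∀ x, f x ≤ c) (x : closure Ω) :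
    g x ≤ c := by
  obtain ⟨u, u', u'', h1, h2, h3, h4⟩ := h
  have := (h1.sub (cc_const c)).max_resolvent b (ρ := ρ) ho hb
    (fun x hx => by rw [h2 x hx]; linarith) (fun x hx => by
      have e1 := h3 ⟨x, subset_closure hx⟩ hx
      have e3 := hff ⟨x, subset_closure hx⟩
      rw [sub_zero]
      dsimp only at e1
      linarith) x.2
  rw [h4] at this
  linarith

theorem IsRes.const_le (ho : IsOpen Ω) (hb : Bornology.IsBounded Ω) {f g : C(closure Ω, ℝ)}
    (h : IsRes b Ω ρ f g) {c : ℝ} (hc : 0 ≤ c) (hff : ∀ x, -c ≤ f x) (x : closure Ω) :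
    -c ≤ g x := by
  have := (h.smul (-1)).le_const ho hb hc (fun x => by simpa using neg_le.1 (hff x)) x
  simp only [ContinuousMap.smul_apply, smul_eq_mul] at this
  linarith

theorem IsRes.unique (ho : IsOpen Ω) (hb : Bornology.IsBounded Ω) {f g g' : C(closure Ω, ℝ)}
    (h : IsRes b Ω ρ f g) (h' : IsRes b Ω ρ f g') : g = g' :=
  ContinuousMap.ext fun x => le_antisymm (h.mono ho hb h' (fun _ => le_rfl) x)
    (h'.mono ho hb h (fun _ => le_rfl) x)

theorem IsRes.lipschitz [CompactSpace (closure Ω)] (ho : IsOpen Ω) (hb : Bornology.IsBounded Ω)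
    (hρ : 0 < ρ) {g1 : C(closure Ω, ℝ)} (h1 : IsRes b Ω ρ 1 g1) {B : ℝ} (hB : 0 ≤ B)
    (hg1 : ∀ x y, |g1 x - g1 y| ≤ B * dist x y) :
    ∃ L, ∀ f g : C(closure Ω, ℝ), IsRes b Ω ρ f g → ∀ x y, |g x - g y| ≤ L * ‖f‖ * dist x y := by
  obtain ⟨D, hD⟩ := isBounded_iff.1 hb.isCompact_closure.isBounded
  refine ⟨B + 2 / ρ ^ 2 * D, fun f g h => ?_⟩
  have hbd : ∀ x, |g x| ≤ ‖f‖ * g1 x := fun x => by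
    have hf := fun x => abs_le.1 (f.norm_coe_le_norm x)
    rw [abs_le]
    have e1 := h.mono ho hb (h1.smul ‖f‖) (fun x => by simpa using (hf x).2) x
    have e2 := (h1.smul (-‖f‖)).mono ho hb h (fun x => by simpa using (hf x).1) x
    simp only [ContinuousMap.smul_apply, smul_eq_mul] at e1 e2
    constructor <;> linarith
  have hgf : ∀ x, |g x| ≤ ‖f‖ := fun x => by
    have hf := fun x => abs_le.1 (f.norm_coe_le_norm x)
    rw [abs_le]
    exact ⟨h.const_le ho hb (norm_nonneg f) (fun x => (hf x).1) x,
      h.le_const ho hb (norm_nonneg f) (fun x => (hf x).2) x⟩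
  rcases (norm_nonneg f).eq_or_lt with h0 | h0
  · intro x y
    have e1 := hgf x
    have e2 := hgf y
    rw [← h0] at e1 e2 ⊢
    rw [abs_nonpos_iff.1 e1, abs_nonpos_iff.1 e2]
    simp
  obtain ⟨u, u', u'', k1, k2, k3, k4⟩ := h
  obtain ⟨v, v', v'', m1, m2, m3, m4⟩ := h1
  have hA : 0 < 2 * ‖f‖ / ρ ^ 2 := by positivity
  have key := k1.lipschitz_of_boundary b ho hb (B := B * ‖f‖) (D := D) hA (by positivity)
    (fun x hx y hy => by rw [← dist_eq_norm]; exact hD hx hy) (fun x hx => by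
      have e1 := k3 ⟨x, subset_closure hx⟩ hx
      have e2 := hgf ⟨x, subset_closure hx⟩
      rw [← k4] at e2
      have e3 := f.norm_coe_le_norm ⟨x, subset_closure hx⟩
      rw [le_div_iff₀ (by positivity), ← abs_of_pos (show 0 < ρ ^ 2 by positivity), ← abs_mul]
      have e4 : trL b (u'' x) * ρ ^ 2 = u x - f ⟨x, subset_closure hx⟩ := by
        dsimp only at e1; linarith
      rw [e4]
      refine (abs_sub _ _).trans ?_
      rw [Real.norm_eq_abs] at e3
      dsimp only at e2
      linarith) k2 (fun x hx y hy => by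
      have e1 := hbd ⟨x, hx⟩
      rw [← k4] at e1
      have e2 := hg1 ⟨x, hx⟩ ⟨y, frontier_subset_closure hy⟩
      rw [← m4, ← m4, m2 y hy, sub_zero] at e2
      have e3 := (abs_le.1 e2).2
      rw [Subtype.dist_eq, dist_eq_norm] at e3
      rw [← m4] at e1
      dsimp only at e1 e3
      refine e1.trans ?_
      have := mul_le_mul_of_nonneg_left e3 h0.le
      linarith)
  have key' : ∀ x y : closure Ω, g x - g y ≤ (B + 2 / ρ ^ 2 * D) * ‖f‖ * dist x y := fun x y => by
    have := key x x.2 y y.2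
    rw [k4, k4, ← dist_eq_norm] at this
    refine this.trans (le_of_eq ?_)
    rw [Subtype.dist_eq]
    ring
  intro x y
  rw [abs_le]
  have e1 := key' x y
  have e2 := key' y x
  rw [dist_comm] at e2
  constructor <;> linarith

end Resolvent

section Green

variable {E : Type} [NormedAddCommGroup E] [InnerProductSpace ℝ E] [FiniteDimensional ℝ E]
  [MeasurableSpace E] [BorelSpace E] {ι : Type} [Fintype ι] (b : OrthonormalBasis ι ℝ E)
  {Ω : Set E} {ρ β : ℝ}

/-- `g` is the restriction of a `C²` solution of `- Δ u = f`, `u = 0` on the boundary. -/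
def IsPot (Ω : Set E) (f g : C(closure Ω, ℝ)) : Prop :=
  ∃ (u : E → ℝ) (u' : E → E →L[ℝ] ℝ) (u'' : E → E →L[ℝ] E →L[ℝ] ℝ), CC u u' u'' ∧
    (∀ x ∈ frontier Ω, u x = 0) ∧
    (∀ x : closure Ω, (x : E) ∈ Ω → -trL b (u'' x) = f x) ∧
    ∀ x : closure Ω, u x = g x

variable {b}

theorem IsPot.mono [Nontrivial E] (ho : IsOpen Ω) (hb : Bornology.IsBounded Ω)
    {f g f' g' : C(closure Ω, ℝ)}
    (h : IsPot b Ω f g) (h' : IsPot b Ω f' g') (hff : ∀ x, f x ≤ f' x) (x : closure Ω) :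
    g x ≤ g' x := by
  obtain ⟨u, u', u'', h1, h2, h3, h4⟩ := h
  obtain ⟨v, v', v'', k1, k2, k3, k4⟩ := h'
  have := (h1.sub k1).max_subharmonic b ho hb
    (fun x hx => by rw [h2 x hx, k2 x hx, sub_zero]) (fun x hx => by
      have e1 := h3 ⟨x, subset_closure hx⟩ hx
      have e2 := k3 ⟨x, subset_closure hx⟩ hx
      have e3 := hff ⟨x, subset_closure hx⟩
      rw [map_sub]
      dsimp only at e1 e2
      linarith) x.2
  rw [h4, k4] at this
  linarith

theorem IsPot.unique [Nontrivial E] (ho : IsOpen Ω) (hb : Bornology.IsBounded Ω)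
    {f g g' : C(closure Ω, ℝ)} (h : IsPot b Ω f g) (h' : IsPot b Ω f g') : g = g' :=
  ContinuousMap.ext fun x => le_antisymm (h.mono ho hb h' (fun _ => le_rfl) x)
    (h'.mono ho hb h (fun _ => le_rfl) x)

theorem isPot_zero : IsPot b Ω 0 0 :=
  ⟨_, _, _, cc_const 0, fun _ _ => rfl, fun _ _ => by simp, fun _ => rfl⟩

variable (b)

theorem exists_resolvent [CompactSpace (closure Ω)] (ho : IsOpen Ω) (hb : Bornology.IsBounded Ω)
    (hβ : 0 < β) (hβ1 : β < 1) (hloc : ∀ x ∈ closure Ω, ∃ r, 0 < r ∧ LocalSolver b β Ω x r) :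
    ∃ (ρ : ℝ) (R : C(closure Ω, ℝ) →L[ℝ] C(closure Ω, ℝ)) (L : ℝ), 0 < ρ ∧
      (∀ f x y, |R f x - R f y| ≤ L * ‖f‖ * dist x y) ∧ ∀ f, IsHol β f → IsRes b Ω ρ f (R f) := by
  obtain ⟨ρ, C, hρ, hsol⟩ := exists_global b hβ hβ1 hb hloc
  have hex : ∀ f : C(closure Ω, ℝ), IsHol β f → ∃ g, IsRes b Ω ρ f g ∧
      ∃ B, 0 ≤ B ∧ ∀ x y, |g x - g y| ≤ B * dist x y := by
    rintro f ⟨A, F, hF, hFf⟩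
    obtain ⟨u, u', u'', hu, hu0, hueq⟩ := hsol _ F (hF.rescale hβ hρ)
    have hcont := hu.cc.cont
    refine ⟨⟨fun x => u x, by fun_prop⟩, ⟨u, u', u'', hu.cc, hu0, fun x hx => ?_, fun _ => rfl⟩,
      C * (A * max 1 (ρ ^ β)) / ρ, (norm_nonneg _).trans (hu.n1 0), fun x y => ?_⟩
    · rw [hueq x hx, hFf]
    · have := Convex.norm_image_sub_le_of_norm_hasFDerivWithin_le
        (fun x _ => (hu.d1 x).hasFDerivWithinAt) (fun x _ => hu.n1 x) convex_univ
        (mem_univ (y : E)) (mem_univ (x : E))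
      rw [Subtype.dist_eq, dist_eq_norm]
      exact this
  obtain ⟨g1, hg1, B, hB, hg1B⟩ := hex 1 (by simpa using isHol_const (Ω := Ω) (β := β) 1)
  obtain ⟨L, hL⟩ := hg1.lipschitz ho hb hρ hB hg1B
  choose! R0 hR0 _ using hex
  let S := (holSubalgebra Ω β).toSubmodule
  have hS : ∀ f : S, IsHol β (f : C(closure Ω, ℝ)) := fun f => f.2
  let Rl : S →ₗ[ℝ] C(closure Ω, ℝ) :=
    { toFun := fun f => R0 f
      map_add' := fun f g => (hR0 _ (hS (f + g))).unique ho hb ((hR0 _ (hS f)).add (hR0 _ (hS g)))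
      map_smul' := fun c f => (hR0 _ (hS (c • f))).unique ho hb ((hR0 _ (hS f)).smul c) }
  let Rc : S →L[ℝ] C(closure Ω, ℝ) := Rl.mkContinuous 1 fun f => by
    rw [one_mul, ContinuousMap.norm_le _ (norm_nonneg _)]
    intro x
    have hf := fun x => abs_le.1 ((f : C(closure Ω, ℝ)).norm_coe_le_norm x)
    rw [Real.norm_eq_abs, abs_le]
    exact ⟨(hR0 _ (hS f)).const_le ho hb (norm_nonneg _) (fun x => (hf x).1) x,
      (hR0 _ (hS f)).le_const ho hb (norm_nonneg _) (fun x => (hf x).2) x⟩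
  have hdense : DenseRange (S.subtypeL) := by
    have := holSubalgebra_dense (Ω := Ω) hβ hβ1
    rw [DenseRange]
    convert! this
    ext f
    simp [S]
  have hui : IsUniformInducing (S.subtypeL) := isUniformEmbedding_subtype_val.isUniformInducing
  let R := Rc.extend S.subtypeL
  have hR : ∀ f, IsHol β f → R f = R0 f := fun f hf =>
    ContinuousLinearMap.extend_eq (f := Rc) (e := S.subtypeL) hdense hui ⟨f, hf⟩
  refine ⟨ρ, R, L, hρ, fun f x y => ?_, fun f hf => by rw [hR f hf]; exact hR0 f hf⟩
  refine hdense.induction_on (p := fun f => |R f x - R f y| ≤ L * ‖f‖ * dist x y) f ?_ ?_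
  · refine isClosed_le ?_ ?_ <;> fun_prop
  · intro f
    have := hL _ _ (hR0 _ (hS f)) x y
    rw [← hR _ (hS f)] at this
    exact this

theorem exists_green [Nontrivial E] [CompactSpace (closure Ω)] (ho : IsOpen Ω)
    (hb : Bornology.IsBounded Ω)
    (hβ : 0 < β) (hβ1 : β < 1) (hloc : ∀ x ∈ closure Ω, ∃ r, 0 < r ∧ LocalSolver b β Ω x r) :
    ∃ G : C(closure Ω, ℝ) →L[ℝ] C(closure Ω, ℝ), IsCompactOperator G ∧
      (∀ f, ∃ L, ∀ x y, |G f x - G f y| ≤ L * dist x y) ∧ (∀ f, 0 ≤ f → 0 ≤ G f) ∧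
      ∀ f, IsHol β f → IsPot b Ω f (G f) := by
  obtain ⟨ρ, R, L, hρ, hL, hR⟩ := exists_resolvent b ho hb hβ hβ1 hloc
  have hRc : IsCompactOperator R := isCompactOperator_of_lipschitz R hL
  have hRh : ∀ f, IsHol β (R f) := fun f => IsHol.of_lipschitz hβ hβ1 (hL f)
  have hunit : IsUnit (1 - R) := by
    refine isUnit_one_sub hRc fun f hf => ?_
    have h1 : IsHol β f := by rw [← hf]; exact hRh f
    obtain ⟨u, u', u'', h2, h3, h4, h5⟩ := hR f h1
    have h6 : IsPot b Ω 0 f := ⟨u, u', u'', h2, h3, fun x hx => by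
      have := h4 x hx
      rw [h5, hf] at this
      have : ρ ^ 2 * trL b (u'' x) = 0 := by linarith
      rw [mul_eq_zero] at this
      rcases this with h | h
      · exact absurd h (by positivity)
      · rw [h]; simp, fun x => by rw [h5, hf]⟩
    exact h6.unique ho hb isPot_zero
  obtain ⟨Q, hQ⟩ := hunit
  let G : C(closure Ω, ℝ) →L[ℝ] C(closure Ω, ℝ) := ρ ^ 2 • ((↑Q⁻¹ : C(closure Ω, ℝ) →L[ℝ] _) * R)
  have hG : ∀ f, G f = R (ρ ^ 2 • f + G f) := by
    intro f
    have h1 : (1 - R) * G = ρ ^ 2 • R := by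
      rw [← hQ]
      simp only [G]
      rw [mul_smul_comm, ← mul_assoc, Units.mul_inv, one_mul]
    have h2 : G f - R (G f) = ρ ^ 2 • R f := by
      have := congrArg (fun T : C(closure Ω, ℝ) →L[ℝ] C(closure Ω, ℝ) => T f) h1
      simpa [sub_mul] using this
    rw [map_add, map_smul, ← h2]
    abel
  have hGL : ∀ f x y, |G f x - G f y| ≤ |L| * (ρ ^ 2 + ‖G‖) * ‖f‖ * dist x y := by
    intro f x y
    have h1 := hL (ρ ^ 2 • f + G f) x y
    rw [← hG] at h1
    refine h1.trans ?_
    have h2 : ‖ρ ^ 2 • f + G f‖ ≤ (ρ ^ 2 + ‖G‖) * ‖f‖ := by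
      refine (norm_add_le _ _).trans ?_
      rw [norm_smul, Real.norm_of_nonneg (by positivity), add_mul]
      gcongr
      exact G.le_opNorm f
    calc L * ‖ρ ^ 2 • f + G f‖ * dist x y ≤ |L| * ((ρ ^ 2 + ‖G‖) * ‖f‖) * dist x y := by
          gcongr
          exact le_abs_self L
      _ = _ := by ring
  have hGh : ∀ f, IsHol β (G f) := fun f => IsHol.of_lipschitz hβ hβ1 (hGL f)
  have hGp : ∀ f, IsHol β f → IsPot b Ω f (G f) := by
    intro f hf
    have h0 : IsHol β (ρ ^ 2 • f + G f) :=
      ((holSubalgebra Ω β).add_mem ((holSubalgebra Ω β).smul_mem hf _) (hGh f))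
    obtain ⟨u, u', u'', h2, h3, h4, h5⟩ := hR _ h0
    refine ⟨u, u', u'', h2, h3, fun x hx => ?_, fun x => by rw [h5, ← hG]⟩
    have := h4 x hx
    rw [h5, ← hG] at this
    simp only [ContinuousMap.add_apply, ContinuousMap.smul_apply, smul_eq_mul] at this
    have h6 : ρ ^ 2 * (-trL b (u'' x)) = ρ ^ 2 * f x := by linarith
    exact mul_left_cancel₀ (by positivity) h6
  refine ⟨G, isCompactOperator_of_lipschitz G hGL, fun f => ⟨_, hGL f⟩, fun f hf => ?_, hGp⟩
  have hdense := holSubalgebra_dense (Ω := Ω) hβ hβ1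
  have h1H : IsHol β (1 : C(closure Ω, ℝ)) := (holSubalgebra Ω β).one_mem
  intro x
  have hne : (nhdsWithin f (holSubalgebra Ω β : Set C(closure Ω, ℝ))).NeBot :=
    mem_closure_iff_nhdsWithin_neBot.1 (hdense f)
  have hcont : Continuous fun g : C(closure Ω, ℝ) =>
      G (g + ‖g - f‖ • (1 : C(closure Ω, ℝ))) x := by fun_prop
  have hlim := hcont.continuousWithinAt (s := (holSubalgebra Ω β : Set C(closure Ω, ℝ))) (x := f)
  have h0 := ge_of_tendsto (b := 0) hlim (by
    filter_upwards [self_mem_nhdsWithin] with g hg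
    have h2 : IsHol β (g + ‖g - f‖ • (1 : C(closure Ω, ℝ))) :=
      (holSubalgebra Ω β).add_mem hg ((holSubalgebra Ω β).smul_mem h1H _)
    refine isPot_zero.mono ho hb (hGp _ h2) (fun y => ?_) x
    have h4 := (abs_le.1 ((g - f).norm_coe_le_norm y)).1
    have h5 : 0 ≤ f y := hf y
    simp only [ContinuousMap.zero_apply, ContinuousMap.add_apply, ContinuousMap.smul_apply,
      ContinuousMap.one_apply, smul_eq_mul, mul_one, ContinuousMap.sub_apply] at h4 ⊢
    linarith)
  simpa using h0

end Green

theorem hasDerivAt_comp_max {F F' : ℝ → ℝ} (h : ∀ s, HasDerivAt F (F' s) s) (h0 : F' 0 = 0) (s : ℝ) :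
    HasDerivAt (fun s => F (max s 0)) (F' (max s 0)) s := by
  rcases lt_trichotomy s 0 with hs | rfl | hs
  · rw [max_eq_right hs.le, h0]
    refine (hasDerivAt_const s (F 0)).congr_of_eventuallyEq ?_
    filter_upwards [Iio_mem_nhds hs] with t ht
    rw [max_eq_right (le_of_lt ht)]
  · have h1 := h 0
    rw [max_self]
    rw [h0] at h1 ⊢
    rw [hasDerivAt_iff_isLittleO] at h1 ⊢
    refine Asymptotics.IsLittleO.congr' (f₁ := fun t => F (max t 0) - F 0) (g₁ := fun t => t - 0)
      ?_ (by filter_upwards with t; simp) (by rfl)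
    refine Asymptotics.IsBigO.trans_isLittleO (Asymptotics.IsBigO.of_bound 1 ?_) h1
    filter_upwards with t
    rcases le_total t 0 with ht | ht
    · rw [max_eq_right ht]; simp
    · rw [max_eq_left ht]; simp
  · rw [max_eq_left hs.le]
    refine (h s).congr_of_eventuallyEq ?_
    filter_upwards [Ioi_mem_nhds hs] with t ht
    rw [max_eq_left (le_of_lt ht)]

/-- Smooth convex approximations of the positive part, vanishing near `(-∞, 0]`. -/
theorem exists_convex_approx : ∃ h h' h'' : ℕ → ℝ → ℝ,
    (∀ n t, HasDerivAt (h n) (h' n t) t) ∧ (∀ n t, HasDerivAt (h' n) (h'' n t) t) ∧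
    (∀ n, Continuous (h'' n)) ∧ (∀ n t, 0 ≤ h'' n t) ∧ (∀ n t, 0 ≤ h' n t) ∧ (∀ n t, h' n t ≤ 1) ∧
    (∀ n, ∃ δ > 0, ∀ t ≤ δ, h n t = 0) ∧ (∀ n t, |h n t| ≤ |t|) ∧
    ∀ t, Filter.Tendsto (fun n => h n t) Filter.atTop (nhds (max t 0)) := by
  have d1 : ∀ s : ℝ, HasDerivAt (fun s => s - Real.arctan s) (s ^ 2 / (1 + s ^ 2)) s := fun s => by
    refine ((hasDerivAt_id s).sub (Real.hasDerivAt_arctan s)).congr_deriv ?_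
    field_simp; ring
  have d2 : ∀ s : ℝ, HasDerivAt (fun s => s ^ 2 / (1 + s ^ 2)) (2 * s / (1 + s ^ 2) ^ 2) s :=
    fun s => by
      have := (hasDerivAt_pow 2 s).div ((hasDerivAt_pow 2 s).const_add 1) (by positivity)
      refine this.congr_deriv ?_
      field_simp; ring
  have e1 := hasDerivAt_comp_max d1 (by simp)
  have e2 := hasDerivAt_comp_max d2 (by simp)
  have hat : ∀ s : ℝ, 0 ≤ s → 0 ≤ Real.arctan s ∧ Real.arctan s ≤ s := fun s hs =>
    ⟨Real.arctan_nonneg.2 hs, by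
      have hmono : Monotone fun s : ℝ => s - Real.arctan s :=
        monotone_of_deriv_nonneg (fun s => (d1 s).differentiableAt) fun s => by
          rw [(d1 s).deriv]; positivity
      have := hmono hs
      simpa using this⟩
  have hl : ∀ (n : ℕ) (t : ℝ), HasDerivAt (fun t : ℝ => (n + 1 : ℝ) * t - 1) (n + 1 : ℝ) t :=
    fun n t => by
      have := ((hasDerivAt_id t).const_mul (n + 1 : ℝ)).sub_const 1
      rwa [mul_one] at this
  have hm : ∀ (n : ℕ) (t : ℝ), 0 ≤ max ((n + 1 : ℝ) * t - 1) 0 := fun n t => le_max_right _ _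
  have hmt : ∀ (n : ℕ) (t : ℝ), max ((n + 1 : ℝ) * t - 1) 0 ≤ (n + 1) * |t| := fun n t =>
    max_le (by nlinarith [le_abs_self t, n.cast_nonneg (α := ℝ)]) (by positivity)
  have hn : ∀ n : ℕ, (0 : ℝ) < n + 1 := fun n => by positivity
  refine ⟨fun n t => (n + 1 : ℝ)⁻¹ * (max ((n + 1 : ℝ) * t - 1) 0 -
      Real.arctan (max ((n + 1 : ℝ) * t - 1) 0)),
    fun n t => max ((n + 1 : ℝ) * t - 1) 0 ^ 2 / (1 + max ((n + 1 : ℝ) * t - 1) 0 ^ 2),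
    fun n t => 2 * max ((n + 1 : ℝ) * t - 1) 0 / (1 + max ((n + 1 : ℝ) * t - 1) 0 ^ 2) ^ 2 *
      (n + 1), fun n t => ?_, fun n t => ?_, fun n => ?_, fun n t => ?_, fun n t => ?_,
      fun n t => ?_, fun n => ?_, fun n t => ?_, fun t => ?_⟩
  · refine (((e1 _).comp t (hl n t)).const_mul (n + 1 : ℝ)⁻¹).congr_deriv ?_
    have := hn n
    field_simp
  · exact (e2 _).comp t (hl n t)
  · refine Continuous.mul (Continuous.div ?_ ?_ fun t => by positivity) continuous_const <;> fun_prop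
  · have := hm n t; have := hn n; positivity
  · positivity
  · rw [div_le_one (by positivity)]; linarith
  · refine ⟨(n + 1 : ℝ)⁻¹, inv_pos.2 (hn n), fun t ht => ?_⟩
    have : (n + 1 : ℝ) * t - 1 ≤ 0 := by
      have := mul_le_mul_of_nonneg_left ht (hn n).le
      rw [mul_inv_cancel₀ (hn n).ne'] at this
      linarith
    dsimp only
    rw [max_eq_right this]; simp
  · obtain ⟨k1, k2⟩ := hat _ (hm n t)
    rw [abs_of_nonneg (mul_nonneg (inv_nonneg.2 (hn n).le) (by linarith)),
      inv_mul_le_iff₀ (hn n)]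
    linarith [hmt n t]
  · have l1 : Filter.Tendsto (fun n : ℕ => ((n : ℝ) + 1)⁻¹) Filter.atTop (nhds 0) := by
      simpa using tendsto_one_div_add_atTop_nhds_zero_nat (𝕜 := ℝ)
    have l2 : Filter.Tendsto (fun n : ℕ => max (t - ((n : ℝ) + 1)⁻¹) 0) Filter.atTop
        (nhds (max t 0)) := by
      have := (l1.const_sub t).max (tendsto_const_nhds (x := (0 : ℝ)))
      rwa [sub_zero] at this
    have l3 : Filter.Tendsto (fun n : ℕ => ((n : ℝ) + 1)⁻¹ *
        Real.arctan (max ((n + 1 : ℝ) * t - 1) 0)) Filter.atTop (nhds 0) := by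
      refine squeeze_zero (fun n => mul_nonneg (inv_nonneg.2 (hn n).le) (hat _ (hm n t)).1)
        (fun n => mul_le_mul_of_nonneg_left (Real.arctan_lt_pi_div_two _).le
          (inv_nonneg.2 (hn n).le)) ?_
      simpa using l1.mul_const (Real.pi / 2)
    have := l2.sub l3
    rw [sub_zero] at this
    refine this.congr fun n => ?_
    beta_reduce
    rw [mul_sub, mul_max_of_nonneg _ _ (inv_nonneg.2 (hn n).le), mul_zero, mul_sub, ← mul_assoc,
      inv_mul_cancel₀ (hn n).ne', one_mul, mul_one]

section Energy

variable {E : Type} [NormedAddCommGroup E] [InnerProductSpace ℝ E] [FiniteDimensional ℝ E]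
  [MeasurableSpace E] [BorelSpace E] {ι : Type} [Fintype ι] (b : OrthonormalBasis ι ℝ E)
  {Ω : Set E} {ρ β : ℝ} {u v : E → ℝ} {u' v' : E → E →L[ℝ] ℝ} {u'' v'' : E → E →L[ℝ] E →L[ℝ] ℝ}

theorem CC.comp {h h' h'' : ℝ → ℝ} (hu : CC u u' u'') (h1 : ∀ x, HasDerivAt h (h' (u x)) (u x))
    (h2 : ∀ x, HasDerivAt h' (h'' (u x)) (u x)) (h3 : Continuous fun x => h'' (u x)) :
    CC (fun x => h (u x)) (fun x => h' (u x) • u' x)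
      fun x => h' (u x) • u'' x + (h'' (u x) • u' x).smulRight (u' x) := by
  refine ⟨fun x => (h1 x).comp_hasFDerivAt x (hu.d1 x), fun x => ?_, ?_⟩
  · exact ((h2 x).comp_hasFDerivAt x (hu.d1 x)).smul (hu.d2 x)
  · have c1 := hu.cont
    have c2 := hu.cont'
    have c3 := hu.c2
    have c4 : Continuous fun x => h' (u x) := by
      rw [continuous_iff_continuousAt]
      exact fun x => (h2 x).continuousAt.comp (f := u) c1.continuousAt
    have : (fun x => (h'' (u x) • u' x).smulRight (u' x)) =
        fun x => ContinuousLinearMap.smulRightL ℝ E (E →L[ℝ] ℝ) (h'' (u x) • u' x) (u' x) := rfl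
    refine (c4.smul c3).add ?_
    rw [this]
    have c5 := h3.smul c2
    exact ((ContinuousLinearMap.smulRightL ℝ E (E →L[ℝ] ℝ)).continuous.comp c5).clm_apply c2

/-- Truncation to `Ω` of a function which vanishes near the boundary. -/
theorem CC.indicator (ho : IsOpen Ω) (hu : CC u u' u'')
    (h0 : ∀ x ∈ frontier Ω, ∀ᶠ y in nhds x, u y = 0) :
    CC (Ω.indicator u) (Ω.indicator u') (Ω.indicator u'') := by
  have h0' : ∀ x ∈ frontier Ω, ∀ᶠ y in nhds x, u' y = 0 := fun x hx => by
    filter_upwards [(h0 x hx).eventually_nhds] with y hy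
    exact (hu.d1 y).unique ((hasFDerivAt_const (0 : ℝ) y).congr_of_eventuallyEq hy)
  have h0'' : ∀ x ∈ frontier Ω, ∀ᶠ y in nhds x, u'' y = 0 := fun x hx => by
    filter_upwards [(h0' x hx).eventually_nhds] with y hy
    exact (hu.d2 y).unique ((hasFDerivAt_const (0 : E →L[ℝ] ℝ) y).congr_of_eventuallyEq hy)
  have hcases : ∀ x, x ∈ Ω ∨ x ∈ frontier Ω ∨ x ∈ (closure Ω)ᶜ := fun x => by
    rw [ho.frontier_eq]
    by_cases h1 : x ∈ Ω <;> by_cases h2 : x ∈ closure Ω <;> simp [h1, h2]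
  have hin : ∀ x ∈ Ω, ∀ {G : Type} [Zero G] (f : E → G), Ω.indicator f =ᶠ[nhds x] f :=
    fun x hx G _ f => by
      filter_upwards [ho.mem_nhds hx] with y hy using indicator_of_mem hy f
  have hout : ∀ x ∈ (closure Ω)ᶜ, ∀ {G : Type} [Zero G] (f : E → G),
      Ω.indicator f =ᶠ[nhds x] fun _ => 0 :=
    fun x hx G _ f => by
      filter_upwards [isClosed_closure.isOpen_compl.mem_nhds hx] with y hy
      exact indicator_of_notMem (fun h => hy (subset_closure h)) f
  have hfr : ∀ x ∈ frontier Ω, ∀ {G : Type} [Zero G] (f : E → G), (∀ᶠ y in nhds x, f y = 0) →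
      Ω.indicator f =ᶠ[nhds x] fun _ => 0 :=
    fun x hx G _ f hf => by
      filter_upwards [hf] with y hy
      by_cases h : y ∈ Ω <;> simp [h, hy]
  refine ⟨fun x => ?_, fun x => ?_, ?_⟩
  · rcases hcases x with h | h | h
    · rw [indicator_of_mem h]
      exact (hu.d1 x).congr_of_eventuallyEq (hin x h u)
    · have e := hfr x h u' (h0' x h)
      rw [e.self_of_nhds]
      exact (hasFDerivAt_const 0 x).congr_of_eventuallyEq (hfr x h u (h0 x h))
    · rw [(hout x h u').self_of_nhds]
      exact (hasFDerivAt_const 0 x).congr_of_eventuallyEq (hout x h u)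
  · rcases hcases x with h | h | h
    · rw [indicator_of_mem h]
      exact (hu.d2 x).congr_of_eventuallyEq (hin x h u')
    · have e := hfr x h u'' (h0'' x h)
      rw [e.self_of_nhds]
      exact (hasFDerivAt_const 0 x).congr_of_eventuallyEq (hfr x h u' (h0' x h))
    · rw [(hout x h u'').self_of_nhds]
      exact (hasFDerivAt_const 0 x).congr_of_eventuallyEq (hout x h u')
  · rw [continuous_iff_continuousAt]
    intro x
    rcases hcases x with h | h | h
    · exact hu.c2.continuousAt.congr (hin x h u'').symm
    · exact continuousAt_const.congr (hfr x h u'' (h0'' x h)).symm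
    · exact continuousAt_const.congr (hout x h u'').symm

variable (ν : Measure E) [ν.IsAddHaarMeasure]

theorem CC.green_identity (hu : CC u u' u'') (hc : HasCompactSupport u) (hv : CC v v' v'') :
    ∫ x, u x * trL b (v'' x) ∂ν = -∫ x, ∑ i, u' x (b i) * v' x (b i) ∂ν ∧
    ∫ x, u x * trL b (v'' x) ∂ν = ∫ x, trL b (u'' x) * v x ∂ν := by
  have hu1 : u' = fderiv ℝ u := funext fun x => (hu.d1 x).fderiv.symm
  have hu2 : u'' = fderiv ℝ u' := funext fun x => (hu.d2 x).fderiv.symm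
  have hc1 : HasCompactSupport u' := by rw [hu1]; exact hc.fderiv ℝ
  have hc2 : HasCompactSupport u'' := by rw [hu2]; exact hc1.fderiv ℝ
  have c0 := hu.cont
  have c1 := hu.cont'
  have c2 := hu.c2
  have k0 := hv.cont
  have k1 := hv.cont'
  have k2 := hv.c2
  have i1 : ∀ i, Integrable (fun x => u x * v'' x (b i) (b i)) ν := fun i =>
    Continuous.integrable_of_hasCompactSupport (by fun_prop) hc.mul_right
  have hc1' : ∀ i, HasCompactSupport fun x => u' x (b i) := fun i =>
    hc1.comp_left (g := fun A : E →L[ℝ] ℝ => A (b i)) rfl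
  have hc2' : ∀ i, HasCompactSupport fun x => u'' x (b i) (b i) := fun i =>
    hc2.comp_left (g := fun A : E →L[ℝ] E →L[ℝ] ℝ => A (b i) (b i)) rfl
  have i2 : ∀ i, Integrable (fun x => u' x (b i) * v' x (b i)) ν := fun i =>
    Continuous.integrable_of_hasCompactSupport (by fun_prop) (hc1' i).mul_right
  have i3 : ∀ i, Integrable (fun x => u'' x (b i) (b i) * v x) ν := fun i =>
    Continuous.integrable_of_hasCompactSupport (by fun_prop) (hc2' i).mul_right
  have i4 : ∀ i, Integrable (fun x => u x * v' x (b i)) ν := fun i =>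
    Continuous.integrable_of_hasCompactSupport (by fun_prop) hc.mul_right
  have i5 : ∀ i, Integrable (fun x => u' x (b i) * v x) ν := fun i =>
    Continuous.integrable_of_hasCompactSupport (by fun_prop) (hc1' i).mul_right
  have dv : ∀ i x, HasFDerivAt (fun x => v' x (b i)) ((v'' x).flip (b i)) x := fun i x =>
    ((ContinuousLinearMap.apply ℝ ℝ (b i)).hasFDerivAt.comp x (hv.d2 x)).congr_fderiv (by ext; rfl)
  have du : ∀ i x, HasFDerivAt (fun x => u' x (b i)) ((u'' x).flip (b i)) x := fun i x =>
    ((ContinuousLinearMap.apply ℝ ℝ (b i)).hasFDerivAt.comp x (hu.d2 x)).congr_fderiv (by ext; rfl)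
  have p1 : ∀ i, ∫ x, u x * v'' x (b i) (b i) ∂ν = -∫ x, u' x (b i) * v' x (b i) ∂ν := fun i => by
    have := integral_mul_fderiv_eq_neg_fderiv_mul_of_integrable (μ := ν) (v := b i) (f := u)
      (g := fun x => v' x (b i)) (by simpa only [(hu.d1 _).fderiv] using i2 i)
      (by simpa only [(dv i _).fderiv, ContinuousLinearMap.flip_apply] using i1 i) (i4 i) (fun x _ => (hu.d1 x).differentiableAt)
      (fun x _ => (dv i x).differentiableAt)
    simpa only [(dv i _).fderiv, ContinuousLinearMap.flip_apply, (hu.d1 _).fderiv] using this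
  have p2 : ∀ i, ∫ x, u' x (b i) * v' x (b i) ∂ν = -∫ x, u'' x (b i) (b i) * v x ∂ν := fun i => by
    have := integral_mul_fderiv_eq_neg_fderiv_mul_of_integrable (μ := ν) (v := b i)
      (f := fun x => u' x (b i))
      (g := v) (by simpa only [(du i _).fderiv, ContinuousLinearMap.flip_apply] using i3 i)
      (by simpa only [(hv.d1 _).fderiv] using i2 i) (i5 i) (fun x _ => (du i x).differentiableAt)
      (fun x _ => (hv.d1 x).differentiableAt)
    simpa only [(du i _).fderiv, ContinuousLinearMap.flip_apply, (hv.d1 _).fderiv] using this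
  simp only [trL_apply, Finset.mul_sum, Finset.sum_mul]
  rw [integral_finsetSum _ fun i _ => i1 i, integral_finsetSum _ fun i _ => i2 i,
    integral_finsetSum _ fun i _ => i3 i, ← Finset.sum_neg_distrib]
  exact ⟨Finset.sum_congr rfl fun i _ => p1 i, Finset.sum_congr rfl fun i _ => by
    rw [p1, p2, neg_neg]⟩

end Energy

section Energy

variable {E : Type} [NormedAddCommGroup E] [InnerProductSpace ℝ E] [FiniteDimensional ℝ E]
  [MeasurableSpace E] [BorelSpace E] {ι : Type} [Fintype ι] (b : OrthonormalBasis ι ℝ E)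
  {Ω : Set E} {ρ β : ℝ} {u v : E → ℝ} {u' v' : E → E →L[ℝ] ℝ} {u'' v'' : E → E →L[ℝ] E →L[ℝ] ℝ}
  (ν : Measure E) [ν.IsAddHaarMeasure]

theorem integrableOn_of_bounded (hb : Bornology.IsBounded Ω) (hu : Continuous u) :
    IntegrableOn u Ω ν :=
  (hu.continuousOn.integrableOn_compact hb.isCompact_closure).mono_set subset_closure

theorem tendsto_setIntegral_of_pointwise (ho : IsOpen Ω) (hb : Bornology.IsBounded Ω)
    {h : ℕ → ℝ → ℝ} (hc : ∀ n, Continuous (h n)) (h1 : ∀ n t, |h n t| ≤ |t|)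
    (h2 : ∀ t, Filter.Tendsto (fun n => h n t) Filter.atTop (nhds (max t 0)))
    (hu : Continuous u) (hv : Continuous v) :
    Filter.Tendsto (fun n => ∫ x in Ω, h n (u x) * v x ∂ν) Filter.atTop
      (nhds (∫ x in Ω, max (u x) 0 * v x ∂ν)) := by
  refine tendsto_integral_of_dominated_convergence (fun x => |u x| * |v x|)
    (fun n => ?_) (integrableOn_of_bounded ν hb (by fun_prop)) (fun n => ?_) ?_
  · have := hc n
    exact Continuous.aestronglyMeasurable (by fun_prop)
  · filter_upwards with x
    rw [Real.norm_eq_abs, abs_mul]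
    exact mul_le_mul_of_nonneg_right (h1 _ _) (abs_nonneg _)
  · filter_upwards with x
    exact (h2 _).mul_const _

theorem CC.truncate (ho : IsOpen Ω) (hu : CC u u' u'') (h0 : ∀ x ∈ frontier Ω, u x = 0)
    {h h' h'' : ℝ → ℝ} (h1 : ∀ t, HasDerivAt h (h' t) t)
    (h2 : ∀ t, HasDerivAt h' (h'' t) t) (h3 : Continuous h'') (h4 : ∃ δ > 0, ∀ t ≤ δ, h t = 0) :
    CC (Ω.indicator fun x => h (u x)) (Ω.indicator fun x => h' (u x) • u' x)
      (Ω.indicator fun x => h' (u x) • u'' x + (h'' (u x) • u' x).smulRight (u' x)) := by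
  refine (hu.comp (fun _ => h1 _) (fun _ => h2 _) (h3.comp hu.cont)).indicator ho fun x hx => ?_
  obtain ⟨δ, hδ, hd⟩ := h4
  have : ∀ᶠ y in nhds x, u y < δ := hu.cont.continuousAt.eventually_lt_const (by rwa [h0 x hx])
  filter_upwards [this] with y hy using hd _ hy.le

theorem CC.integral_max_mul_le (ho : IsOpen Ω) (hb : Bornology.IsBounded Ω) (hu : CC u u' u'')
    (hv : CC v v' v'') (h0 : ∀ x ∈ frontier Ω, u x = 0) (hs : ∀ x ∈ Ω, trL b (u'' x) ≤ 0)
    (hv0 : ∀ x ∈ Ω, 0 ≤ v x) :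
    ∫ x in Ω, max (u x) 0 * -trL b (v'' x) ∂ν ≤ ∫ x in Ω, -trL b (u'' x) * v x ∂ν := by
  obtain ⟨h, h', h'', a1, a2, a3, a4, a5, a6, a7, a8, a9⟩ := exists_convex_approx
  have k0 := hu.cont
  have k1 := hu.c2
  have k2 := hv.cont
  have k3 := hv.c2
  have ch : ∀ n, Continuous (h n) := fun n => by
    rw [continuous_iff_continuousAt]; exact fun x => (a1 n x).continuousAt
  refine le_of_tendsto (tendsto_setIntegral_of_pointwise ν ho hb ch a8 a9 hu.cont
    (v := fun x => -trL b (v'' x)) (by fun_prop)) (Filter.Eventually.of_forall fun n => ?_)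
  have hw := hu.truncate ho h0 (a1 n) (a2 n) (a3 n) (a7 n)
  have hc : HasCompactSupport (Ω.indicator fun x => h n (u x)) :=
    HasCompactSupport.intro hb.isCompact_closure fun x hx =>
      indicator_of_notMem (fun h => hx (subset_closure h)) _
  have := (CC.green_identity b ν hw hc hv).2
  have e1 : ∫ x in Ω, h n (u x) * -trL b (v'' x) ∂ν =
      -∫ x, (Ω.indicator fun x => h n (u x)) x * trL b (v'' x) ∂ν := by
    rw [← integral_indicator ho.measurableSet, ← integral_neg]
    congr 1
    ext x
    by_cases hx : x ∈ Ω <;> simp [hx]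
  rw [e1, this, ← integral_neg, ← integral_indicator ho.measurableSet]
  have c2 := hw.c2
  refine integral_mono ?_ ?_ fun x => ?_
  · refine Integrable.neg (Continuous.integrable_of_hasCompactSupport (by fun_prop) ?_)
    refine HasCompactSupport.intro hb.isCompact_closure fun x hx => ?_
    rw [indicator_of_notMem (fun h => hx (subset_closure h)), map_zero, zero_mul]
  · rw [integrable_indicator_iff ho.measurableSet]
    exact integrableOn_of_bounded ν hb (by fun_prop)
  · by_cases hx : x ∈ Ω
    · simp only [indicator_of_mem hx, map_add, map_smul, smul_eq_mul]
      have q1 : 0 ≤ trL b ((h'' n (u x) • u' x).smulRight (u' x)) := by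
        rw [trL_apply]
        refine Finset.sum_nonneg fun i _ => ?_
        simp only [ContinuousLinearMap.smulRight_apply, smul_apply, smul_eq_mul]
        rw [mul_assoc]
        exact mul_nonneg (a4 _ _) (mul_self_nonneg _)
      have q2 : h' n (u x) * -trL b (u'' x) ≤ -trL b (u'' x) :=
        mul_le_of_le_one_left (by linarith [hs x hx]) (a6 _ _)
      nlinarith [hv0 x hx]
    · simp [hx]

theorem CC.integral_max_mul_nonneg (ho : IsOpen Ω) (hb : Bornology.IsBounded Ω) (hu : CC u u' u'')
    (h0 : ∀ x ∈ frontier Ω, u x = 0) :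
    0 ≤ ∫ x in Ω, max (u x) 0 * -trL b (u'' x) ∂ν := by
  obtain ⟨h, h', h'', a1, a2, a3, a4, a5, a6, a7, a8, a9⟩ := exists_convex_approx
  have k0 := hu.cont
  have k1 := hu.c2
  have ch : ∀ n, Continuous (h n) := fun n => by
    rw [continuous_iff_continuousAt]; exact fun x => (a1 n x).continuousAt
  refine ge_of_tendsto (tendsto_setIntegral_of_pointwise ν ho hb ch a8 a9 hu.cont
    (v := fun x => -trL b (u'' x)) (by fun_prop)) (Filter.Eventually.of_forall fun n => ?_)
  have hw := hu.truncate ho h0 (a1 n) (a2 n) (a3 n) (a7 n)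
  have hc : HasCompactSupport (Ω.indicator fun x => h n (u x)) :=
    HasCompactSupport.intro hb.isCompact_closure fun x hx =>
      indicator_of_notMem (fun h => hx (subset_closure h)) _
  have := (CC.green_identity b ν hw hc hu).1
  have e1 : ∫ x in Ω, h n (u x) * -trL b (u'' x) ∂ν =
      -∫ x, (Ω.indicator fun x => h n (u x)) x * trL b (u'' x) ∂ν := by
    rw [← integral_indicator ho.measurableSet, ← integral_neg]
    congr 1
    ext x
    by_cases hx : x ∈ Ω <;> simp [hx]
  rw [e1, this, neg_neg]
  refine integral_nonneg fun x => Finset.sum_nonneg fun i _ => ?_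
  by_cases hx : x ∈ Ω
  · simp only [indicator_of_mem hx, smul_apply, smul_eq_mul]
    rw [mul_assoc]
    exact mul_nonneg (a5 _ _) (mul_self_nonneg _)
  · simp [hx]

theorem CC.integral_mul_nonneg (ho : IsOpen Ω) (hb : Bornology.IsBounded Ω) (hu : CC u u' u'')
    (h0 : ∀ x ∈ frontier Ω, u x = 0) :
    0 ≤ ∫ x in Ω, u x * -trL b (u'' x) ∂ν := by
  have h1 := hu.integral_max_mul_nonneg b ν ho hb h0
  have h2 := (hu.const_smul (-1)).integral_max_mul_nonneg b ν ho hb fun x hx => by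
    simp [h0 x hx]
  have k0 := hu.cont
  have k1 := hu.c2
  have := add_nonneg h1 h2
  rw [← integral_add (integrableOn_of_bounded ν hb (by fun_prop))
    (integrableOn_of_bounded ν hb (by fun_prop))] at this
  refine this.trans_eq (integral_congr_ae (Filter.Eventually.of_forall fun x => ?_))
  simp only [smul_eq_mul, map_smul]
  rcases le_total (u x) 0 with h | h
  · rw [max_eq_right h, max_eq_left (by linarith)]; ring
  · rw [max_eq_left h, max_eq_right (by linarith)]; ring

/-- The restriction of `ν` to `Ω`, as a measure on the closure. -/
def muC (Ω : Set E) (ν : Measure E) : Measure (closure Ω) :=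
  (ν.restrict Ω).comap Subtype.val

theorem integral_muC (f : E → ℝ) : ∫ x : closure Ω, f x ∂muC Ω ν = ∫ x in Ω, f x ∂ν := by
  rw [muC, integral_subtype_comap isClosed_closure.measurableSet,
    Measure.restrict_restrict isClosed_closure.measurableSet,
    inter_eq_right.2 subset_closure]

theorem muC_apply (A : Set E) (hA : MeasurableSet A) :
    muC Ω ν (Subtype.val ⁻¹' A) = ν (A ∩ Ω) := by
  rw [muC, (MeasurableEmbedding.subtype_coe isClosed_closure.measurableSet).comap_apply,
    Subtype.image_preimage_coe, Measure.restrict_apply (isClosed_closure.measurableSet.inter hA)]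
  congr 1
  ext x
  have := @subset_closure _ _ Ω x
  simp only [mem_inter_iff]
  tauto

theorem integral_muC_congr (ho : IsOpen Ω) {f : closure Ω → ℝ} {g : E → ℝ}
    (h : ∀ x : closure Ω, (x : E) ∈ Ω → f x = g x) :
    ∫ x, f x ∂muC Ω ν = ∫ x in Ω, g x ∂ν := by
  rw [← integral_muC]
  refine integral_congr_ae ?_
  have : ∀ᵐ x : closure Ω ∂(muC Ω ν), (x : E) ∈ Ω := by
    have := muC_apply (Ω := Ω) ν Ωᶜ ho.measurableSet.compl
    rwa [compl_inter_self, measure_empty] at this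
  filter_upwards [this] with x hx using h x hx

end Energy

section IntL

variable {K : Type} [TopologicalSpace K] [CompactSpace K] [MeasurableSpace K] [OpensMeasurableSpace K]
  (μ : Measure K) [IsFiniteMeasure μ]

theorem integrable_cont {μ : Measure K} [IsFiniteMeasure μ] (f : C(K, ℝ)) :
    Integrable (fun x => f x) μ :=
  f.continuous.integrable_of_hasCompactSupport (HasCompactSupport.of_compactSpace _)

/-- Integration as a continuous linear functional on continuous functions. -/
def intL : C(K, ℝ) →L[ℝ] ℝ :=
  LinearMap.mkContinuous
    { toFun := fun f => ∫ x, f x ∂μ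
      map_add' := fun f g => integral_add (integrable_cont f) (integrable_cont g)
      map_smul' := fun c f => integral_const_mul c _ } (μ.real univ) fun f => by
    have := norm_integral_le_of_norm_le_const (μ := μ) (f := fun x => f x) (C := ‖f‖)
      (Filter.Eventually.of_forall fun x => f.norm_coe_le_norm x)
    rwa [mul_comm] at this

theorem intL_apply (f : C(K, ℝ)) : intL μ f = ∫ x, f x ∂μ := rfl

theorem intL_mono {f g : C(K, ℝ)} (h : f ≤ g) : intL μ f ≤ intL μ g :=
  integral_mono (integrable_cont f) (integrable_cont g) h

theorem intL_nonneg {f : C(K, ℝ)} (h : ∀ x, 0 ≤ f x) : 0 ≤ intL μ f := integral_nonneg h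

theorem intL_pos [μ.IsOpenPosMeasure] {f : C(K, ℝ)} (h : ∀ x, 0 ≤ f x) (x : K) (hx : f x ≠ 0) :
    0 < intL μ f :=
  f.continuous.integral_pos_of_hasCompactSupport_nonneg_nonzero
    (HasCompactSupport.of_compactSpace _) h hx

end IntL

section Symm

variable {E : Type} [NormedAddCommGroup E] [InnerProductSpace ℝ E] [FiniteDimensional ℝ E]
  [MeasurableSpace E] [BorelSpace E] {ι : Type} [Fintype ι] (b : OrthonormalBasis ι ℝ E)
  {Ω : Set E} {ρ β : ℝ} (ν : Measure E) [ν.IsAddHaarMeasure] [CompactSpace (closure Ω)]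
  {G : C(closure Ω, ℝ) →L[ℝ] C(closure Ω, ℝ)}

theorem muC_finite (hb : Bornology.IsBounded Ω) : IsFiniteMeasure (muC Ω ν) := by
  constructor
  have := muC_apply (Ω := Ω) ν univ MeasurableSet.univ
  rw [preimage_univ, univ_inter] at this
  rw [this]
  exact hb.measure_lt_top

theorem isOpenPosMeasure_muC (ho : IsOpen Ω) : (muC Ω ν).IsOpenPosMeasure := by
  constructor
  rintro U hU ⟨x, hx⟩
  obtain ⟨A, hA, rfl⟩ := isOpen_induced_iff.1 hU
  rw [muC_apply ν A hA.measurableSet]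
  refine (hA.inter ho).measure_ne_zero ν ?_
  exact mem_closure_iff.1 x.2 A hA hx

theorem IsPot.intL_le [IsFiniteMeasure (muC Ω ν)] (ho : IsOpen Ω) (hb : Bornology.IsBounded Ω)
    {f g h k : C(closure Ω, ℝ)} (hf : IsPot b Ω f h) (hg : IsPot b Ω g k)
    (hf0 : 0 ≤ f) (hh0 : 0 ≤ h) (hk0 : 0 ≤ k) :
    intL (muC Ω ν) (h * g) ≤ intL (muC Ω ν) (f * k) := by
  obtain ⟨u, u', u'', a1, a2, a3, a4⟩ := hf
  obtain ⟨v, v', v'', b1, b2, b3, b4⟩ := hg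
  have := a1.integral_max_mul_le b ν ho hb b1 a2 (fun x hx => by
    have h1 := a3 ⟨x, subset_closure hx⟩ hx
    have h2 : 0 ≤ f ⟨x, subset_closure hx⟩ := hf0 ⟨x, subset_closure hx⟩
    dsimp only at h1
    linarith) (fun x hx => by
    have h2 : 0 ≤ k ⟨x, subset_closure hx⟩ := hk0 ⟨x, subset_closure hx⟩
    rw [← b4] at h2
    exact h2)
  rw [intL_apply, intL_apply, integral_muC_congr ν ho (g := fun x => max (u x) 0 * -trL b (v'' x)),
    integral_muC_congr ν ho (g := fun x => -trL b (u'' x) * v x)]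
  · exact this
  · intro x hx
    rw [ContinuousMap.mul_apply, a3 x hx, b4]
  · intro x hx
    have h2 : 0 ≤ h x := hh0 x
    rw [ContinuousMap.mul_apply, b3 x hx, a4, max_eq_left h2]

theorem green_symm [IsFiniteMeasure (muC Ω ν)] (ho : IsOpen Ω) (hb : Bornology.IsBounded Ω)
    (hd : Dense (holSubalgebra Ω β : Set C(closure Ω, ℝ)))
    (hpos : ∀ f, 0 ≤ f → 0 ≤ G f) (hpot : ∀ f, IsHol β f → IsPot b Ω f (G f)) (f g : C(closure Ω, ℝ)) :
    intL (muC Ω ν) (f * G g) = intL (muC Ω ν) (G f * g) := by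
  have h0 : ∀ f g, IsHol β f → IsHol β g → 0 ≤ f → 0 ≤ g →
      intL (muC Ω ν) (f * G g) = intL (muC Ω ν) (G f * g) := fun f g hf hg h1 h2 => by
    refine le_antisymm ?_ ((hpot f hf).intL_le b ν ho hb (hpot g hg) h1 (hpos f h1) (hpos g h2))
    rw [mul_comm f, mul_comm _ g]
    exact (hpot g hg).intL_le b ν ho hb (hpot f hf) h2 (hpos g h2) (hpos f h1)
  have hshift : ∀ f : C(closure Ω, ℝ), IsHol β f → ∃ c : C(closure Ω, ℝ), IsHol β c ∧ 0 ≤ c ∧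
      IsHol β (f + c) ∧ 0 ≤ f + c := fun f hf => by
    refine ⟨algebraMap ℝ _ ‖f‖, isHol_const _, fun x => ?_, hf.add (isHol_const _), fun x => ?_⟩
    · exact norm_nonneg f
    · have := neg_le_of_abs_le (f.norm_coe_le_norm x)
      change 0 ≤ f x + ‖f‖
      linarith
  have h1 : ∀ f g, IsHol β f → IsHol β g → 0 ≤ g →
      intL (muC Ω ν) (f * G g) = intL (muC Ω ν) (G f * g) := fun f g hf hg hg0 => by
    obtain ⟨c, c1, c2, c3, c4⟩ := hshift f hf
    have e1 := h0 _ _ c3 hg c4 hg0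
    have e2 := h0 _ _ c1 hg c2 hg0
    rw [add_mul, map_add, map_add, add_mul, map_add] at e1
    linarith
  have h2 : ∀ f g, IsHol β f → IsHol β g →
      intL (muC Ω ν) (f * G g) = intL (muC Ω ν) (G f * g) := fun f g hf hg => by
    obtain ⟨c, c1, c2, c3, c4⟩ := hshift g hg
    have e1 := h1 _ _ hf c3 c4
    have e2 := h1 _ _ hf c1 c2
    rw [map_add, mul_add, map_add, mul_add, map_add] at e1
    linarith
  have h3 : ∀ f, IsHol β f → ∀ g, intL (muC Ω ν) (f * G g) = intL (muC Ω ν) (G f * g) :=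
    fun f hf => congrFun (Continuous.ext_on hd (by fun_prop) (by fun_prop) fun g hg => h2 f g hf hg)
  exact congrFun (Continuous.ext_on hd (f := fun f => intL (muC Ω ν) (f * G g))
    (g := fun f => intL (muC Ω ν) (G f * g)) (by fun_prop) (by fun_prop) fun f hf => h3 f hf g) f

theorem green_nonneg [IsFiniteMeasure (muC Ω ν)] (ho : IsOpen Ω) (hb : Bornology.IsBounded Ω)
    (hd : Dense (holSubalgebra Ω β : Set C(closure Ω, ℝ)))
    (hpot : ∀ f, IsHol β f → IsPot b Ω f (G f)) (f : C(closure Ω, ℝ)) :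
    0 ≤ intL (muC Ω ν) (f * G f) := by
  have hcl : IsClosed {f : C(closure Ω, ℝ) | 0 ≤ intL (muC Ω ν) (f * G f)} :=
    isClosed_le (by fun_prop) (by fun_prop)
  refine hcl.closure_subset_iff.2 (fun f hf => ?_) (hd f)
  obtain ⟨u, u', u'', a1, a2, a3, a4⟩ := hpot f hf
  refine (a1.integral_mul_nonneg b ν ho hb a2).trans_eq ?_
  rw [intL_apply, integral_muC_congr ν ho (g := fun x => u x * -trL b (u'' x))]
  intro x hx
  rw [ContinuousMap.mul_apply, a3 x hx, a4, mul_comm]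

end Symm

theorem exists_radial_profile {n : ℕ} (hn : 2 ≤ n) {p : ℝ} (hp : 1 < p)
    (hpn : n = 2 ∨ p < (n : ℝ) / ((n : ℝ) - 2)) {T : ℝ} (hT : 0 < T) :
    ∃ (H : ℝ → ℝ) (q s C : ℝ), p < q ∧ 0 ≤ s ∧ s * q < n ∧ 0 ≤ C ∧
      (∀ t, 0 < t → HasDerivAt H (-t ^ (-(n : ℝ) / 2)) t) ∧
      ∀ t, 0 < t → t ≤ T → 0 ≤ H t ∧ H t ≤ C * t ^ (-s / 2) := by
  rcases hn.eq_or_lt with rfl | hn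
  · have hs : (0 : ℝ) < 1 / (p + 1) / 2 := by positivity
    refine ⟨fun t => Real.log T - Real.log t, p + 1, 1 / (p + 1), T ^ (1 / (p + 1) / 2) /
      (1 / (p + 1) / 2), by linarith, by positivity, ?_, by positivity, fun t ht => ?_,
      fun t ht htT => ⟨?_, ?_⟩⟩
    · rw [one_div_mul_cancel (by positivity)]; norm_num
    · refine ((Real.hasDerivAt_log ht.ne').const_sub _).congr_deriv ?_
      norm_num [Real.rpow_neg_one]
    · linarith [Real.log_le_log ht htT]
    · dsimp only
      rw [← Real.log_div hT.ne' ht.ne']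
      refine (Real.log_le_rpow_div (by positivity) hs).trans (le_of_eq ?_)
      rw [Real.div_rpow hT.le ht.le, neg_div, Real.rpow_neg ht.le]
      ring
  · have h2 : (0 : ℝ) < (n : ℝ) - 2 := by
      have : ((2 : ℕ) : ℝ) < n := by exact_mod_cast hn
      push_cast at this; linarith
    have hp2 : p < (n : ℝ) / ((n : ℝ) - 2) := hpn.resolve_left (by omega)
    refine ⟨fun t => 2 / ((n : ℝ) - 2) * t ^ (-((n : ℝ) - 2) / 2), (p + (n : ℝ) / ((n : ℝ) - 2)) / 2,
      (n : ℝ) - 2, 2 / ((n : ℝ) - 2), by linarith, h2.le, ?_, by positivity, fun t ht => ?_,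
      fun t ht htT => ⟨by positivity, le_rfl⟩⟩
    · have : (n : ℝ) / ((n : ℝ) - 2) * ((n : ℝ) - 2) = n := div_mul_cancel₀ _ h2.ne'
      nlinarith
    · refine ((Real.hasDerivAt_rpow_const (Or.inl ht.ne')).const_mul _).congr_deriv ?_
      rw [show -((n : ℝ) - 2) / 2 - 1 = -(n : ℝ) / 2 by ring]
      field_simp

section Kernel

variable {E : Type} [NormedAddCommGroup E] [InnerProductSpace ℝ E] [FiniteDimensional ℝ E]
  [MeasurableSpace E] [BorelSpace E] {ι : Type} [Fintype ι] (b : OrthonormalBasis ι ℝ E)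
  {Ω : Set E} {ρ β : ℝ}

theorem cc_sqDist (x0 : E) (c : ℝ) : CC (fun x : E => ‖x - x0‖ ^ 2 + c)
    (fun x => (2 : ℝ) • innerSL ℝ (x - x0)) fun _ => (2 : ℝ) • innerSL ℝ := by
  have hs : ∀ x : E, HasFDerivAt (fun x => x - x0) (ContinuousLinearMap.id ℝ E) x := fun x =>
    (hasFDerivAt_id x).sub_const x0
  refine ⟨fun x => ?_, fun x => ?_, continuous_const⟩
  · exact (((cc_normSq.d1 (x - x0)).comp x (hs x)).add_const c).congr_fderiv
      (ContinuousLinearMap.comp_id _)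
  · exact ((cc_normSq.d2 (x - x0)).comp x (hs x)).congr_fderiv (ContinuousLinearMap.comp_id _)

theorem trL_innerSL : trL b (innerSL ℝ : E →L[ℝ] E →L[ℝ] ℝ) = Fintype.card ι := by
  rw [trL_apply]
  change ∑ i, inner ℝ (b i) (b i) = _
  simp

theorem cc_radial {H : ℝ → ℝ} {a : ℝ} (hH : ∀ t, 0 < t → HasDerivAt H (-t ^ (-a)) t)
    (ha : a = (Fintype.card ι : ℝ) / 2) (x0 : E) {ε : ℝ} (hε : 0 < ε) :
    ∃ u' u'', CC (fun x : E => H (‖x - x0‖ ^ 2 + ε ^ 2)) u' u'' ∧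
      ∀ x, -trL b (u'' x) = 4 * a * ε ^ 2 * (‖x - x0‖ ^ 2 + ε ^ 2) ^ (-a - 1) := by
  have hu := cc_sqDist x0 (ε ^ 2)
  have hpos : ∀ x : E, 0 < ‖x - x0‖ ^ 2 + ε ^ 2 := fun x => by positivity
  refine ⟨_, _, hu.comp (h := H) (h' := fun t => -t ^ (-a)) (h'' := fun t => a * t ^ (-a - 1))
    (fun x => hH _ (hpos x)) (fun x => ?_) ?_, fun x => ?_⟩
  · refine (Real.hasDerivAt_rpow_const (Or.inl (hpos x).ne')).neg.congr_deriv ?_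
    ring
  · refine continuous_const.mul ?_
    exact hu.cont.rpow_const fun x => Or.inl (hpos x).ne'
  · rw [map_add, map_smul, map_smul, trL_innerSL, trL_apply]
    simp only [ContinuousLinearMap.smulRight_apply, smul_apply, smul_eq_mul]
    change -(-(‖x - x0‖ ^ 2 + ε ^ 2) ^ (-a) * (2 * (Fintype.card ι : ℝ)) +
      ∑ i, a * (‖x - x0‖ ^ 2 + ε ^ 2) ^ (-a - 1) * (2 * inner ℝ (x - x0) (b i)) *
        (2 * inner ℝ (x - x0) (b i))) = _
    have h1 : ∑ i, a * (‖x - x0‖ ^ 2 + ε ^ 2) ^ (-a - 1) * (2 * inner ℝ (x - x0) (b i)) *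
        (2 * inner ℝ (x - x0) (b i)) = a * (‖x - x0‖ ^ 2 + ε ^ 2) ^ (-a - 1) * 4 * ‖x - x0‖ ^ 2 := by
      rw [← b.sum_sq_norm_inner_left, Finset.mul_sum]
      refine Finset.sum_congr rfl fun i _ => ?_
      rw [Real.norm_eq_abs, sq_abs]
      ring
    have h2 : (‖x - x0‖ ^ 2 + ε ^ 2) ^ (-a) =
        (‖x - x0‖ ^ 2 + ε ^ 2) ^ (-a - 1) * (‖x - x0‖ ^ 2 + ε ^ 2) := by
      rw [← Real.rpow_add_one (hpos x).ne']; congr 1; ring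
    rw [h1, h2, show (Fintype.card ι : ℝ) = 2 * a by rw [ha]; ring]
    ring

variable (ν : Measure E) [ν.IsAddHaarMeasure]

/-- Uniform integrability of weakly singular kernels. -/
theorem exists_integral_rpow_le [Nontrivial E] {γ R : ℝ} (hγ : γ < Module.finrank ℝ E) (hR : 0 < R)
    (hγ0 : 0 ≤ γ) : ∃ C, 0 ≤ C ∧ ∀ (x0 : E) (ε : ℝ) (Ω : Set E), 0 < ε → MeasurableSet Ω →
      (∀ x ∈ Ω, ‖x - x0‖ < R) →
      ∫ x in Ω, (‖x - x0‖ ^ 2 + ε ^ 2) ^ (-γ / 2) ∂ν ≤ C := by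
  have hi : Integrable (fun x : E => (Iio R).indicator (fun r : ℝ => r ^ (-γ)) ‖x‖) ν := by
    rw [integrable_fun_norm_addHaar (μ := ν) (f := (Iio R).indicator fun r : ℝ => r ^ (-γ))]
    have h1 : IntegrableOn (fun y : ℝ => y ^ ((Module.finrank ℝ E : ℝ) - 1 - γ)) (Ioo 0 R) :=
      (intervalIntegral.integrableOn_Ioo_rpow_iff hR).2 (by linarith)
    have h2 : IntegrableOn ((Iio R).indicator
        fun y : ℝ => y ^ ((Module.finrank ℝ E : ℝ) - 1 - γ)) (Ioi 0) := by
      rw [IntegrableOn, integrable_indicator_iff measurableSet_Iio, IntegrableOn,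
        Measure.restrict_restrict measurableSet_Iio]
      rwa [Iio_inter_Ioi]
    refine h2.congr_fun (fun y hy => ?_) measurableSet_Ioi
    by_cases hyR : y < R
    · simp only [indicator_of_mem (mem_Iio.2 hyR), smul_eq_mul]
      rw [sub_eq_add_neg _ γ, Real.rpow_add hy, ← Real.rpow_natCast,
        Nat.cast_sub Module.finrank_pos, Nat.cast_one]
    · simp [hyR]
  refine ⟨∫ x, (Iio R).indicator (fun r : ℝ => r ^ (-γ)) ‖x‖ ∂ν, integral_nonneg fun x => ?_,
    fun x0 ε Ω hε hm hΩ => ?_⟩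
  · by_cases hx : ‖x‖ < R
    · rw [indicator_of_mem (mem_Iio.2 hx)]; positivity
    · rw [indicator_of_notMem (by simpa using hx), Pi.zero_apply]
  rw [← integral_indicator hm, ← integral_sub_right_eq_self (μ := ν)
    (fun x => (Iio R).indicator (fun r : ℝ => r ^ (-γ)) ‖x‖) x0]
  refine integral_mono_of_nonneg (Filter.Eventually.of_forall fun x => ?_)
    (hi.comp_sub_right x0) ?_
  · exact indicator_apply_nonneg fun _ => by positivity
  · filter_upwards [compl_mem_ae_iff.2 (measure_singleton x0)] with x hx
    by_cases h : x ∈ Ω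
    · have h0 : 0 < ‖x - x0‖ := norm_sub_pos_iff.2 hx
      rw [indicator_of_mem h, indicator_of_mem (mem_Iio.2 (hΩ x h))]
      calc (‖x - x0‖ ^ 2 + ε ^ 2) ^ (-γ / 2) ≤ (‖x - x0‖ ^ 2) ^ (-γ / 2) :=
            Real.rpow_le_rpow_of_nonpos (by positivity) (by nlinarith) (by linarith)
        _ = _ := by rw [← Real.rpow_natCast, ← Real.rpow_mul h0.le]; congr 1; push_cast; ring
    · rw [indicator_of_notMem h]
      exact indicator_apply_nonneg fun _ => by positivity

theorem CC.kernel_bound [Nontrivial E] (ho : IsOpen Ω) (hb : Bornology.IsBounded Ω)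
    (hn : 2 ≤ Fintype.card ι) {p : ℝ} (hp : 1 < p)
    (hpn : Fintype.card ι = 2 ∨ p < (Fintype.card ι : ℝ) / ((Fintype.card ι : ℝ) - 2)) :
    ∃ q C, p < q ∧ 0 ≤ C ∧ ∀ (u : E → ℝ) (u' : E → E →L[ℝ] ℝ) (u'' : E → E →L[ℝ] E →L[ℝ] ℝ),
      CC u u' u'' → (∀ x ∈ frontier Ω, u x = 0) → (∀ x ∈ Ω, 0 ≤ u x) →
      ∀ M T : ℝ, 0 < T → (∀ x ∈ Ω, 0 ≤ -trL b (u'' x)) → (∀ x ∈ Ω, -trL b (u'' x) ≤ M) →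
      ∀ x ∈ Ω, u x ≤ C * (T * ∫ x in Ω, -trL b (u'' x) ∂ν + M * T ^ (1 - q)) := by
  have hfr : Module.finrank ℝ E = Fintype.card ι := Module.finrank_eq_card_basis b.toBasis
  obtain ⟨R, hR0, hR⟩ : ∃ R, 0 < R ∧ ∀ x ∈ Ω, ∀ y ∈ Ω, ‖x - y‖ < R := by
    obtain ⟨R, hR⟩ := hb.exists_norm_le
    refine ⟨2 * |R| + 1, by positivity, fun x hx y hy => ?_⟩
    have := norm_sub_le x y
    linarith [hR x hx, hR y hy, le_abs_self R]
  obtain ⟨H, q, s, C₁, hpq, hs, hsq, hC₁, hH, hHb⟩ := exists_radial_profile hn hp hpn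
    (show 0 < R ^ 2 + 1 by positivity)
  have hq : 1 < q := hp.trans hpq
  obtain ⟨C₂, hC₂, hK⟩ := exists_integral_rpow_le (E := E) ν (γ := s * q) (R := R)
    (by rw [hfr]; exact hsq) hR0 (by positivity)
  set a : ℝ := (Fintype.card ι : ℝ) / 2 with ha
  have ha1 : 1 ≤ a := by
    have : (2 : ℝ) ≤ Fintype.card ι := by exact_mod_cast hn
    rw [ha]; linarith
  set c : ℝ := 4 * a * 2 ^ (-a - 1) * ν.real (ball 0 1) with hc
  have hc0 : 0 < c := by
    have : 0 < ν.real (ball (0 : E) 1) := ENNReal.toReal_pos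
      (measure_ball_pos ν 0 one_pos).ne' measure_ball_lt_top.ne
    positivity
  refine ⟨q, (1 + C₁ ^ q * C₂) / c, hpq, by positivity, fun u u' u'' hu h0 hu0 M T hT hρ0 hρM x0 hx0 => ?_⟩
  have k0 := hu.cont
  have k2 := hu.c2
  have hM : 0 ≤ M := (hρ0 x0 hx0).trans (hρM x0 hx0)
  have hρi : 0 ≤ ∫ x in Ω, -trL b (u'' x) ∂ν := setIntegral_nonneg ho.measurableSet hρ0
  rw [div_mul_eq_mul_div, le_div_iff₀ hc0, mul_comm]
  refine le_of_forall_pos_le_add fun η hη => ?_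
  rcases le_or_gt (u x0) (η / c) with hlt | hlt
  · have : c * u x0 ≤ η := by rwa [le_div_iff₀' hc0] at hlt
    have : 0 ≤ (1 + C₁ ^ q * C₂) * (T * ∫ x in Ω, -trL b (u'' x) ∂ν + M * T ^ (1 - q)) := by
      positivity
    linarith
  obtain ⟨ε, hε, hε1, hball⟩ : ∃ ε, 0 < ε ∧ ε ≤ 1 ∧
      ∀ x, ‖x - x0‖ < ε → x ∈ Ω ∧ u x0 - η / c < u x := by
    have e1 : ∀ᶠ x in nhds x0, x ∈ Ω ∧ u x0 - η / c < u x :=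
      Filter.Eventually.and (ho.mem_nhds hx0) (k0.continuousAt.eventually_const_lt (by
        have : 0 < η / c := by positivity
        linarith))
    obtain ⟨ε, hε, h⟩ := Metric.eventually_nhds_iff.1 e1
    exact ⟨min ε 1, lt_min hε one_pos, min_le_right _ _, fun x hx =>
      h (by rw [dist_eq_norm]; exact hx.trans_le (min_le_left _ _))⟩
  obtain ⟨v', v'', hv, hvt⟩ := cc_radial b (H := H) (a := a)
    (fun t ht => by have := hH t ht; rwa [neg_div] at this) ha x0 hε
  have l0 := hv.cont
  have l2 := hv.c2
  have hpos : ∀ x : E, 0 < ‖x - x0‖ ^ 2 + ε ^ 2 := fun x => by positivity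
  have hvb : ∀ x ∈ Ω, 0 ≤ H (‖x - x0‖ ^ 2 + ε ^ 2) ∧
      H (‖x - x0‖ ^ 2 + ε ^ 2) ≤ C₁ * (‖x - x0‖ ^ 2 + ε ^ 2) ^ (-s / 2) := fun x hx => by
    refine hHb _ (hpos x) (add_le_add ?_ ?_)
    · have := (hR x hx x0 hx0).le
      gcongr
    · nlinarith
  have main := hu.integral_max_mul_le b ν ho hb hv h0 (fun x hx => by linarith [hρ0 x hx])
    fun x hx => (hvb x hx).1
  have lower : c * (u x0 - η / c) ≤ ∫ x in Ω, max (u x) 0 * -trL b (v'' x) ∂ν := by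
    have hsub : ball x0 ε ⊆ Ω := fun x hx => (hball x (by rwa [← dist_eq_norm])).1
    have hnn : ∀ x, 0 ≤ -trL b (v'' x) := fun x => by
      have := hpos x
      rw [hvt]; positivity
    calc c * (u x0 - η / c)
        = ∫ x in ball x0 ε, (u x0 - η / c) * (4 * a * ε ^ 2 * (2 * ε ^ 2) ^ (-a - 1)) ∂ν := by
          generalize u x0 - η / c = d
          rw [setIntegral_const, smul_eq_mul, Measure.real, Measure.addHaar_ball _ _ hε.le,
            ENNReal.toReal_mul, ENNReal.toReal_ofReal (by positivity), hfr, hc, Measure.real,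
            Real.mul_rpow (by norm_num) (by positivity)]
          have e2 : ε ^ Fintype.card ι * ε ^ 2 * (ε ^ 2) ^ (-a - 1) = 1 := by
            rw [← Real.rpow_natCast, ← Real.rpow_natCast ε 2, ← Real.rpow_mul hε.le,
              ← Real.rpow_add hε, ← Real.rpow_add hε]
            rw [show (Fintype.card ι : ℝ) = 2 * a by rw [ha]; ring]
            push_cast
            rw [show 2 * a + 2 + 2 * (-a - 1) = 0 by ring, Real.rpow_zero]
          linear_combination (-(4 * a * 2 ^ (-a - 1) * (ν (ball 0 1)).toReal) * d) * e2
      _ ≤ ∫ x in ball x0 ε, max (u x) 0 * -trL b (v'' x) ∂ν := by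
          refine setIntegral_mono_on (integrableOn_const measure_ball_lt_top.ne) ?_
            measurableSet_ball fun x hx => ?_
          · exact integrableOn_of_bounded ν isBounded_ball (by fun_prop)
          · have hx' : ‖x - x0‖ < ε := by rwa [← dist_eq_norm]
            rw [hvt]
            refine mul_le_mul ((hball x hx').2.le.trans (le_max_left _ _)) ?_ (by positivity)
              (le_max_right _ _)
            refine mul_le_mul_of_nonneg_left ?_ (by positivity)
            refine Real.rpow_le_rpow_of_nonpos (hpos x) ?_ (by linarith)
            nlinarith [norm_nonneg (x - x0)]
      _ ≤ _ := by
          refine setIntegral_mono_set (integrableOn_of_bounded ν hb (by fun_prop))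
            (Filter.Eventually.of_forall fun x => mul_nonneg (le_max_right _ _) (hnn x))
            (Filter.Eventually.of_forall hsub)
  have upper : ∫ x in Ω, -trL b (u'' x) * H (‖x - x0‖ ^ 2 + ε ^ 2) ∂ν ≤
      T * (∫ x in Ω, -trL b (u'' x) ∂ν) + M * T ^ (1 - q) * C₁ ^ q * C₂ := by
    have hc3 : Continuous fun x : E => (‖x - x0‖ ^ 2 + ε ^ 2) ^ (-(s * q) / 2) :=
      Continuous.rpow_const (by fun_prop) fun x => Or.inl (hpos x).ne'
    calc _ ≤ ∫ x in Ω, (T * -trL b (u'' x) +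
          M * T ^ (1 - q) * C₁ ^ q * (‖x - x0‖ ^ 2 + ε ^ 2) ^ (-(s * q) / 2)) ∂ν := by
          refine setIntegral_mono_on
            (integrableOn_of_bounded ν hb (((trL b).continuous.comp k2).neg.mul l0))
            (integrableOn_of_bounded ν hb (by fun_prop)) ho.measurableSet fun x hx => ?_
          obtain ⟨g1, g2⟩ := hvb x hx
          set Φ := H (‖x - x0‖ ^ 2 + ε ^ 2)
          have g3 := hρ0 x hx
          have g4 := hρM x hx
          have g5 : Φ ^ q ≤ C₁ ^ q * (‖x - x0‖ ^ 2 + ε ^ 2) ^ (-(s * q) / 2) := by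
            refine (Real.rpow_le_rpow g1 g2 (by linarith)).trans (le_of_eq ?_)
            rw [Real.mul_rpow hC₁ (by have := hpos x; positivity), ← Real.rpow_mul (hpos x).le]
            congr 2; ring
          have g6 : Φ ≤ T + T ^ (1 - q) * Φ ^ q := by
            rcases le_or_gt Φ T with h | h
            · have : 0 ≤ T ^ (1 - q) * Φ ^ q := by positivity
              linarith
            · have hΦ : 0 < Φ := hT.trans h
              have e1 : Φ ^ (1 - q) ≤ T ^ (1 - q) :=
                Real.rpow_le_rpow_of_nonpos hT h.le (by linarith)
              have e2 : Φ ^ (1 - q) * Φ ^ q = Φ := by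
                rw [← Real.rpow_add hΦ]; norm_num
              nlinarith [Real.rpow_nonneg g1 q]
          have g7 : 0 ≤ T ^ (1 - q) := by positivity
          calc -trL b (u'' x) * Φ ≤ -trL b (u'' x) * (T + T ^ (1 - q) * Φ ^ q) :=
                mul_le_mul_of_nonneg_left g6 g3
            _ = T * -trL b (u'' x) + -trL b (u'' x) * (T ^ (1 - q) * Φ ^ q) := by ring
            _ ≤ T * -trL b (u'' x) + M * (T ^ (1 - q) *
                (C₁ ^ q * (‖x - x0‖ ^ 2 + ε ^ 2) ^ (-(s * q) / 2))) := by
              have : 0 ≤ Φ ^ q := by positivity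
              gcongr
            _ = _ := by ring
      _ = T * (∫ x in Ω, -trL b (u'' x) ∂ν) + M * T ^ (1 - q) * C₁ ^ q *
          ∫ x in Ω, (‖x - x0‖ ^ 2 + ε ^ 2) ^ (-(s * q) / 2) ∂ν := by
          rw [integral_add, integral_const_mul, integral_const_mul]
          · exact integrableOn_of_bounded ν hb (by fun_prop)
          · exact integrableOn_of_bounded ν hb (by fun_prop)
      _ ≤ _ := by
          have := hK x0 ε Ω hε ho.measurableSet fun x hx => hR x hx x0 hx0
          gcongr
  have e3 : c * (u x0 - η / c) = c * u x0 - η := by field_simp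
  have f1 : 0 ≤ C₁ ^ q * C₂ * (T * ∫ x in Ω, -trL b (u'' x) ∂ν) := by positivity
  have f2 : 0 ≤ M * T ^ (1 - q) := by positivity
  linarith [main, lower, upper]

end Kernel

section Bound

variable {E : Type} [NormedAddCommGroup E] [InnerProductSpace ℝ E] [FiniteDimensional ℝ E]
  [MeasurableSpace E] [BorelSpace E] {ι : Type} [Fintype ι] (b : OrthonormalBasis ι ℝ E)
  {Ω : Set E} {ρ β : ℝ} (ν : Measure E) [ν.IsAddHaarMeasure] [CompactSpace (closure Ω)]
  {G : C(closure Ω, ℝ) →L[ℝ] C(closure Ω, ℝ)}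

theorem green_kernel_bound [Nontrivial E] [IsFiniteMeasure (muC Ω ν)]
    (ho : IsOpen Ω) (hb : Bornology.IsBounded Ω)
    (hd : Dense (holSubalgebra Ω β : Set C(closure Ω, ℝ)))
    (hpos : ∀ f, 0 ≤ f → 0 ≤ G f) (hpot : ∀ f, IsHol β f → IsPot b Ω f (G f))
    (hn : 2 ≤ Fintype.card ι) {p : ℝ} (hp : 1 < p)
    (hpn : Fintype.card ι = 2 ∨ p < (Fintype.card ι : ℝ) / ((Fintype.card ι : ℝ) - 2)) :
    ∃ q C, p < q ∧ 0 ≤ C ∧ ∀ (f : C(closure Ω, ℝ)) (M T : ℝ), 0 < T → (∀ x, 0 ≤ f x) →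
      (∀ x, f x ≤ M) → ∀ x, G f x ≤ C * (T * intL (muC Ω ν) f + M * T ^ (1 - q)) := by
  obtain ⟨q, C, hpq, hC, hk⟩ := CC.kernel_bound b ν ho hb hn hp hpn
  refine ⟨q, C, hpq, hC, ?_⟩
  have h1 : ∀ (f : C(closure Ω, ℝ)) (M T : ℝ), IsHol β f → 0 < T → (∀ x, 0 ≤ f x) →
      (∀ x, f x ≤ M) → ∀ x, G f x ≤ C * (T * intL (muC Ω ν) f + M * T ^ (1 - q)) := by
    intro f M T hf hT h0 hM x
    obtain ⟨u, u', u'', a1, a2, a3, a4⟩ := hpot f hf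
    by_cases hx : (x : E) ∈ Ω
    · have := hk u u' u'' a1 a2 (fun y hy => by
        rw [a4 ⟨y, subset_closure hy⟩]; exact hpos f h0 ⟨y, subset_closure hy⟩) M T hT
        (fun y hy => by rw [a3 ⟨y, subset_closure hy⟩ hy]; exact h0 _)
        (fun y hy => by rw [a3 ⟨y, subset_closure hy⟩ hy]; exact hM _) x hx
      rwa [a4, ← integral_muC_congr ν ho (f := fun x => f x)
        fun y hy => (a3 y hy).symm] at this
    · rw [← a4, a2 x (by rw [ho.frontier_eq]; exact ⟨x.2, hx⟩)]
      have e1 := intL_nonneg (muC Ω ν) h0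
      have e2 := (h0 x).trans (hM x)
      positivity
  intro f M T hT h0 hM x
  set F : ℝ → ℝ := fun δ => C * (T * (intL (muC Ω ν) f + 2 * δ * intL (muC Ω ν) 1) +
    (M + 2 * δ) * T ^ (1 - q)) with hF
  have hFc : Continuous F := by fun_prop
  have hF0 : F 0 = C * (T * intL (muC Ω ν) f + M * T ^ (1 - q)) := by simp [hF]
  rw [← hF0]
  refine ge_of_tendsto (hFc.continuousWithinAt (s := Ioi 0) (x := 0)) ?_
  filter_upwards [self_mem_nhdsWithin] with δ hδ
  obtain ⟨g, hg, hfg⟩ := Metric.mem_closure_iff.1 (hd f) δ hδ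
  have hfg' : ∀ x, |f x - g x| < δ := fun x => by
    rw [dist_eq_norm] at hfg
    exact ((f - g).norm_coe_le_norm x).trans_lt hfg
  have hg' : ∀ x, (g + algebraMap ℝ C(closure Ω, ℝ) δ) x = g x + δ := fun x => rfl
  have h2 := h1 (g + algebraMap ℝ _ δ) (M + 2 * δ) T (IsHol.add hg (isHol_const δ)) hT
    (fun x => by rw [hg']; linarith [h0 x, abs_lt.1 (hfg' x)])
    (fun x => by rw [hg']; linarith [hM x, abs_lt.1 (hfg' x)]) x
  have h3 : G f x ≤ G (g + algebraMap ℝ _ δ) x := by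
    have := hpos (g + algebraMap ℝ _ δ - f) fun x => by
      change 0 ≤ g x + δ - f x
      linarith [abs_lt.1 (hfg' x)]
    rw [map_sub] at this
    exact sub_nonneg.1 (this x)
  have h4 : intL (muC Ω ν) (g + algebraMap ℝ _ δ) ≤
      intL (muC Ω ν) f + 2 * δ * intL (muC Ω ν) 1 := by
    rw [← smul_eq_mul (2 * δ), ← map_smul, ← map_add]
    refine intL_mono _ fun x => ?_
    change g x + δ ≤ f x + 2 * δ * 1
    linarith [abs_lt.1 (hfg' x)]
  refine h3.trans (h2.trans ?_)
  exact mul_le_mul_of_nonneg_left (add_le_add (mul_le_mul_of_nonneg_left h4 hT.le) le_rfl) hC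

end Bound

section Abstract

variable {K : Type} [TopologicalSpace K] [CompactSpace K] [MeasurableSpace K]
  [OpensMeasurableSpace K] (μ : Measure K) [IsFiniteMeasure μ]

/-- The properties of the solution operator of the Dirichlet problem used in the continuation
argument. -/
structure GreenOp (p : ℝ) (G : C(K, ℝ) →L[ℝ] C(K, ℝ)) : Prop where
  cpt : IsCompactOperator G
  pos : ∀ f, 0 ≤ f → 0 ≤ G f
  symm : ∀ f g, intL μ (f * G g) = intL μ (G f * g)
  nonneg : ∀ f, 0 ≤ intL μ (f * G f)
  strict : 0 < intL μ (G 1)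
  bound : ∃ q C, p < q ∧ 0 ≤ C ∧ ∀ (f : C(K, ℝ)) (M T : ℝ), 0 < T → (∀ x, 0 ≤ f x) →
      (∀ x, f x ≤ M) → ∀ x, G f x ≤ C * (T * intL μ f + M * T ^ (1 - q))

/-- The truncated power `t ↦ max t 0 ^ r`. -/
def ppow {r : ℝ} (hr : 0 ≤ r) : C(ℝ, ℝ) :=
  ⟨fun t => max t 0 ^ r, (continuous_id.max continuous_const).rpow_const fun _ => Or.inr hr⟩

theorem hasStrictFDerivAt_comp {φ φ' : C(ℝ, ℝ)} (h : ∀ t, HasDerivAt φ (φ' t) t) (w : C(K, ℝ)) :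
    HasStrictFDerivAt (fun w : C(K, ℝ) => φ.comp w)
      (ContinuousLinearMap.mul ℝ C(K, ℝ) (φ'.comp w)) w := by
  rw [hasStrictFDerivAt_iff_isLittleO, Asymptotics.isLittleO_iff]
  intro ε hε
  have hc : Continuous fun w : C(K, ℝ) => φ'.comp w := φ'.continuous_postcomp
  obtain ⟨δ, hδ, hd⟩ := Metric.continuous_iff.1 hc w ε hε
  have hd' : ∀ x s, |s - w x| < δ → |φ' s - φ' (w x)| ≤ ε := fun x s hs => by
    have h1 := hd (w + algebraMap ℝ _ (s - w x)) (by
      rw [dist_eq_norm, add_sub_cancel_left]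
      exact (ContinuousMap.norm_lt_iff _ hδ).2 fun _ => hs)
    have h2 := (ContinuousMap.dist_apply_le_dist x).trans h1.le
    have h3 : (w + algebraMap ℝ C(K, ℝ) (s - w x)) x = s := by
      change w x + (s - w x) = s; ring
    rwa [ContinuousMap.comp_apply, ContinuousMap.comp_apply, h3] at h2
  have hball : ball w δ ×ˢ ball w δ ∈ nhds (w, w) :=
    prod_mem_nhds (ball_mem_nhds w hδ) (ball_mem_nhds w hδ)
  filter_upwards [hball] with ⟨u, v⟩ ⟨hu, hv⟩
  refine (ContinuousMap.norm_le _ (by positivity)).2 fun x => ?_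
  have hu' : u x ∈ ball (w x) δ := (ContinuousMap.dist_apply_le_dist x).trans_lt hu
  have hv' : v x ∈ ball (w x) δ := (ContinuousMap.dist_apply_le_dist x).trans_lt hv
  have key := (convex_ball (w x) δ).norm_image_sub_le_of_norm_hasDerivWithin_le
    (f := fun s => φ s - φ' (w x) * s) (f' := fun s => φ' s - φ' (w x)) (C := ε)
    (fun s _ => (((h s).sub ((hasDerivAt_id s).const_mul (φ' (w x)))).congr_deriv
      (by ring)).hasDerivWithinAt) (fun s hs => hd' x s hs) hv' hu'
  have e : ‖(φ.comp u - φ.comp v - ContinuousLinearMap.mul ℝ C(K, ℝ) (φ'.comp w) (u - v)) x‖ =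
      ‖φ (u x) - φ' (w x) * u x - (φ (v x) - φ' (w x) * v x)‖ := by
    congr 1
    change φ (u x) - φ (v x) - φ' (w x) * (u x - v x) = _
    ring
  dsimp only at key ⊢
  rw [e]
  refine key.trans (mul_le_mul_of_nonneg_left ?_ hε.le)
  exact (u - v).norm_coe_le_norm x

theorem hasDerivAt_ppow {r : ℝ} (hr : 1 < r) (t : ℝ) :
    HasDerivAt (ppow (show 0 ≤ r by linarith))
      ((r • ppow (show 0 ≤ r - 1 by linarith) : C(ℝ, ℝ)) t) t :=
  hasDerivAt_comp_max (F := fun s => s ^ r) (F' := fun s => r * s ^ (r - 1))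
    (fun s => Real.hasDerivAt_rpow_const (Or.inr hr.le))
    (by rw [Real.zero_rpow (by linarith), mul_zero]) t

end Abstract

section Weighted

variable {K : Type} [TopologicalSpace K] [CompactSpace K] [MeasurableSpace K]
  [OpensMeasurableSpace K] (μ : Measure K) [IsFiniteMeasure μ]

/-- Subtraction of the average with respect to the weight `V`. -/
def projV (V : C(K, ℝ)) : C(K, ℝ) →L[ℝ] C(K, ℝ) :=
  ContinuousLinearMap.id ℝ _ -
    (((intL μ V)⁻¹ • (intL μ ∘L ContinuousLinearMap.mul ℝ C(K, ℝ) V)).smulRight (1 : C(K, ℝ)))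

theorem projV_apply (V h : C(K, ℝ)) :
    projV μ V h = h - (intL μ (V * h) / intL μ V) • (1 : C(K, ℝ)) := by
  change h - ((intL μ V)⁻¹ * intL μ (V * h)) • (1 : C(K, ℝ)) = _
  rw [div_eq_inv_mul]

variable {μ} {V : C(K, ℝ)}

theorem intL_mul_projV (hm : 0 < intL μ V) (h : C(K, ℝ)) : intL μ (V * projV μ V h) = 0 := by
  rw [projV_apply, mul_sub, mul_smul_comm, mul_one, map_sub, map_smul, smul_eq_mul,
    div_mul_cancel₀ _ hm.ne', sub_self]

theorem projV_of_eq_zero {h : C(K, ℝ)} (hh : intL μ (V * h) = 0) : projV μ V h = h := by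
  rw [projV_apply, hh, zero_div, zero_smul, sub_zero]

theorem projV_projV (hm : 0 < intL μ V) (h : C(K, ℝ)) : projV μ V (projV μ V h) = projV μ V h :=
  projV_of_eq_zero (intL_mul_projV hm h)

theorem intL_projV_symm (f g : C(K, ℝ)) :
    intL μ (V * (projV μ V f * g)) = intL μ (V * (f * projV μ V g)) := by
  rw [projV_apply, projV_apply, sub_mul, mul_sub, mul_sub, mul_sub, smul_mul_assoc, one_mul,
    mul_smul_comm, mul_smul_comm, mul_smul_comm, mul_one, map_sub, map_sub, map_smul, map_smul,
    smul_eq_mul, smul_eq_mul]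
  ring

variable {p : ℝ} {G : C(K, ℝ) →L[ℝ] C(K, ℝ)}

variable (μ V G) in
/-- The linearized operator, compressed to functions with vanishing weighted average. -/
def compr : C(K, ℝ) →L[ℝ] C(K, ℝ) :=
  projV μ V ∘L G ∘L ContinuousLinearMap.mul ℝ C(K, ℝ) V ∘L projV μ V

theorem compr_apply (h : C(K, ℝ)) : compr μ V G h = projV μ V (G (V * projV μ V h)) := rfl

theorem GreenOp.compr_symm (hG : GreenOp μ p G) (f g : C(K, ℝ)) :
    intL μ (V * (f * compr μ V G g)) = intL μ (V * (compr μ V G f * g)) := by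
  rw [compr_apply, compr_apply, ← intL_projV_symm, intL_projV_symm _ g, ← mul_assoc, hG.symm,
    mul_left_comm]

theorem GreenOp.compr_nonneg (hG : GreenOp μ p G) (f : C(K, ℝ)) :
    0 ≤ intL μ (V * (f * compr μ V G f)) := by
  rw [compr_apply, ← intL_projV_symm, ← mul_assoc]
  exact hG.nonneg _

theorem GreenOp.isCompactOperator_compr (hG : GreenOp μ p G) :
    IsCompactOperator (compr μ V G) :=
  (hG.cpt.comp_clm _).clm_comp (projV μ V)

variable {τ : ℝ}

theorem GreenOp.isUnit_one_sub_compr (hG : GreenOp μ p G) (hm : 0 < intL μ V) {t : ℝ}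
    (hker : ∀ φ, φ = t • G (V * projV μ V φ) → φ = 0) : IsUnit (1 - t • compr μ V G) := by
  refine isUnit_one_sub (hG.isCompactOperator_compr.smul t) fun h hh => ?_
  have hh' : t • projV μ V (G (V * projV μ V h)) = h := hh
  have h1 : projV μ V h = h := by
    nth_rw 1 [← hh']
    rw [map_smul, projV_projV hm, hh']
  rw [h1] at hh'
  have h2 : projV μ V (t • G (V * h)) = h := by rw [map_smul, hh']
  have h3 := hker (t • G (V * h)) (by rw [h2])
  rw [h3, map_zero] at h2
  exact h2.symm

theorem GreenOp.mul_compr_le (hG : GreenOp μ p G) (hV : ∀ x, 0 ≤ V x)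
    (hτ : 0 ≤ τ) (hu : ∀ t ∈ Icc 0 τ, IsUnit (1 - t • compr μ V G)) (h : C(K, ℝ)) :
    τ * intL μ (V * (h * compr μ V G h)) ≤ intL μ (V * (h * h)) := by
  set A := compr μ V G with hA
  set k := h - τ • A h with hk
  set R : ℝ → C(K, ℝ) →L[ℝ] C(K, ℝ) := fun t => Ring.inverse (1 - t • A) with hR
  set B : C(K, ℝ) →L[ℝ] ℝ := intL μ ∘L ContinuousLinearMap.mul ℝ C(K, ℝ) V ∘L
    ContinuousLinearMap.mul ℝ C(K, ℝ) k with hB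
  have hR1 : ∀ t ∈ Icc 0 τ, ∀ f, R t f - t • A (R t f) = f := fun t ht f => by
    have := Ring.mul_inverse_cancel _ (hu t ht)
    exact congrArg (fun T : C(K, ℝ) →L[ℝ] C(K, ℝ) => T f) this
  have hR2 : ∀ t ∈ Icc 0 τ, ∀ f, R t (f - t • A f) = f := fun t ht f => by
    have := Ring.inverse_mul_cancel _ (hu t ht)
    exact congrArg (fun T : C(K, ℝ) →L[ℝ] C(K, ℝ) => T f) this
  have hsA := hG.compr_symm (V := V)
  have hsR : ∀ t ∈ Icc 0 τ, ∀ f g, intL μ (V * (f * R t g)) = intL μ (V * (R t f * g)) := by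
    intro t ht f g
    nth_rw 1 [← hR1 t ht f]
    nth_rw 2 [← hR1 t ht g]
    rw [sub_mul, mul_sub, mul_sub, mul_sub, smul_mul_assoc, mul_smul_comm, mul_smul_comm,
      mul_smul_comm, map_sub, map_sub, map_smul, map_smul, ← hsA]
  have hd : ∀ t ∈ Icc 0 τ, HasDerivAt (fun t => B (R t k)) (B (R t (A (R t k)))) t := by
    intro t ht
    obtain ⟨x, hx⟩ := hu t ht
    have h1 : HasDerivAt (fun t : ℝ => 1 - t • A) (-A) t := by
      simpa using ((hasDerivAt_id t).smul_const A).const_sub 1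
    have h2 := (hx ▸ hasFDerivAt_ringInverse (𝕜 := ℝ) x).comp_hasDerivAt t h1
    have h3 : R t = (x⁻¹ : (C(K, ℝ) →L[ℝ] C(K, ℝ))ˣ) := by
      rw [hR]; dsimp only; rw [← hx, Ring.inverse_unit]
    refine (B.hasFDerivAt.comp_hasDerivAt t (h2.clm_apply (hasDerivAt_const t k))).congr_deriv ?_
    rw [h3]
    simp
  have hmono : MonotoneOn (fun t => B (R t k)) (Icc 0 τ) := by
    refine monotoneOn_of_deriv_nonneg (convex_Icc 0 τ)
      (fun t ht => (hd t ht).continuousAt.continuousWithinAt)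
      (fun t ht => (hd t (interior_subset ht)).differentiableAt.differentiableWithinAt)
      fun t ht => ?_
    rw [(hd t (interior_subset ht)).deriv]
    change 0 ≤ intL μ (V * (k * R t (A (R t k))))
    rw [hsR t (interior_subset ht)]
    exact hG.compr_nonneg _
  have h0 : (0 : ℝ) ∈ Icc 0 τ := ⟨le_rfl, hτ⟩
  have h1 : τ ∈ Icc 0 τ := ⟨hτ, le_rfl⟩
  have h2 := hmono h0 h1 hτ
  have h3 : R 0 k = k := by
    have := hR1 0 h0 k
    rwa [zero_smul, sub_zero] at this
  have h4 : R τ k = h := hR2 τ h1 h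
  dsimp only at h2
  rw [h3, h4] at h2
  change intL μ (V * (k * k)) ≤ intL μ (V * (k * h)) at h2
  have h5 : 0 ≤ intL μ (V * (k * k)) :=
    intL_nonneg μ fun x => mul_nonneg (hV x) (mul_self_nonneg (k x))
  have h6 : intL μ (V * (k * h)) = intL μ (V * (h * h)) - τ * intL μ (V * (h * A h)) := by
    rw [hk, sub_mul, mul_sub, smul_mul_assoc, mul_smul_comm, map_sub, map_smul, smul_eq_mul,
      mul_comm (A h)]
  linarith

variable (μ V G p τ) in
/-- The derivative of the problem with respect to the unknowns. -/
def linP : ℝ × C(K, ℝ) →L[ℝ] ℝ × C(K, ℝ) :=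
  (p • (intL μ ∘L ContinuousLinearMap.mul ℝ C(K, ℝ) V ∘L
      ContinuousLinearMap.snd ℝ ℝ C(K, ℝ))).prod
    (ContinuousLinearMap.snd ℝ ℝ C(K, ℝ) -
      (ContinuousLinearMap.fst ℝ ℝ C(K, ℝ)).smulRight (1 : C(K, ℝ)) -
      τ • (G ∘L ContinuousLinearMap.mul ℝ C(K, ℝ) V ∘L ContinuousLinearMap.snd ℝ ℝ C(K, ℝ)))

theorem linP_isInvertible (hp : 0 < p) (hm : 0 < intL μ V)
    (hu : IsUnit (1 - τ • compr μ V G)) : (linP μ V p G τ).IsInvertible := by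
  have h1 : (1 : C(K, ℝ)) ≠ 0 := fun h => by
    rw [← mul_one V, h, mul_zero, map_zero] at hm
    exact hm.false
  have hP1 : projV μ V 1 = 0 := by
    rw [projV_apply, mul_one, div_self hm.ne', one_smul, sub_self]
  have hR1 : ∀ f, Ring.inverse (1 - τ • compr μ V G) f -
      τ • compr μ V G (Ring.inverse (1 - τ • compr μ V G) f) = f := fun f =>
    congrArg (fun T : C(K, ℝ) →L[ℝ] C(K, ℝ) => T f) (Ring.mul_inverse_cancel _ hu)
  have hR2 : ∀ f, Ring.inverse (1 - τ • compr μ V G) (f - τ • compr μ V G f) = f := fun f =>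
    congrArg (fun T : C(K, ℝ) →L[ℝ] C(K, ℝ) => T f) (Ring.inverse_mul_cancel _ hu)
  refine ⟨ContinuousLinearEquiv.ofBijective (linP μ V p G τ) ?_ ?_, ContinuousLinearMap.ext fun _ => rfl⟩
  · refine (LinearMap.ker_eq_bot' (f := (linP μ V p G τ).toLinearMap)).2 fun ⟨β, h⟩ hz => ?_
    have hz' : (p * intL μ (V * h), h - β • (1 : C(K, ℝ)) - τ • G (V * h)) = 0 := hz
    obtain ⟨e1, e2⟩ := Prod.mk.inj hz'
    have e3 : projV μ V h = h :=
      projV_of_eq_zero ((mul_eq_zero.1 e1).resolve_left hp.ne')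
    have e4 : h - τ • compr μ V G h = 0 := by
      have := congrArg (projV μ V) e2
      rwa [map_sub, map_sub, map_smul, map_smul, hP1, smul_zero, sub_zero, e3, map_zero,
        ← e3, ← compr_apply, e3] at this
    have e5 : h = 0 := by rw [← hR2 h, e4, map_zero]
    rw [e5, mul_zero, map_zero, smul_zero, sub_zero, zero_sub, neg_eq_zero] at e2
    rw [e5, (smul_eq_zero.1 e2).resolve_right h1]
    rfl
  · refine LinearMap.range_eq_top.2 fun ⟨j, k⟩ => ?_
    set c := j / (p * intL μ V) with hc
    set h0 := Ring.inverse (1 - τ • compr μ V G)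
      (projV μ V (k + τ • G (V * c • (1 : C(K, ℝ))))) with hh0
    have e1 : h0 = τ • compr μ V G h0 + projV μ V (k + τ • G (V * c • (1 : C(K, ℝ)))) := by
      rw [← hR1 (projV μ V (k + τ • G (V * c • (1 : C(K, ℝ))))), ← hh0]
      abel
    have e2 : projV μ V h0 = h0 := by
      rw [e1, map_add, map_smul, compr_apply, projV_projV hm, projV_projV hm]
    set h := h0 + c • (1 : C(K, ℝ)) with hh
    have e3 : h0 = projV μ V (τ • G (V * h) + k) := by
      nth_rw 1 [e1]
      rw [compr_apply, e2, hh, mul_add, map_add G, smul_add, ← map_smul, ← map_add]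
      congr 1
      abel
    refine ⟨(c - intL μ (V * (τ • G (V * h) + k)) / intL μ V, h), ?_⟩
    refine Prod.ext ?_ ?_
    · change p * intL μ (V * h) = j
      rw [hh, mul_add, map_add, ← e2, intL_mul_projV hm, mul_smul_comm, mul_one, map_smul,
        smul_eq_mul, hc]
      field_simp
      ring
    · change h - (c - intL μ (V * (τ • G (V * h) + k)) / intL μ V) • (1 : C(K, ℝ)) -
        τ • G (V * h) = k
      rw [projV_apply] at e3
      nth_rw 1 [hh]
      rw [e3]
      module

end Weighted

section Continuation

variable {Y W : Type} [NormedAddCommGroup Y] [NormedSpace ℝ Y] [CompleteSpace Y]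
  [NormedAddCommGroup W] [NormedSpace ℝ W] [CompleteSpace W]
  {F : ℝ × Y → W} {F' : ℝ × Y → ℝ × Y →L[ℝ] W}

theorem exists_local_branch {l : ℝ} {z : Y} (hz : F (l, z) = 0)
    (hF : HasStrictFDerivAt F (F' (l, z)) (l, z))
    (hi : (F' (l, z) ∘L .inr ℝ ℝ Y).IsInvertible) :
    ∃ ψ : ℝ → Y, ψ l = z ∧ DifferentiableAt ℝ ψ l ∧ (∀ᶠ v in nhds (l, z), F v = 0 → ψ v.1 = v.2) ∧
      ∀ᶠ t in nhds l, F (t, ψ t) = 0 := by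
  have h1 := hF.eventually_apply_eq_iff_implicitFunctionOfProdDomain hi
  have h2 := hF.eventually_apply_implicitFunctionOfProdDomain hi
  refine ⟨hF.implicitFunctionOfProdDomain hi, h1.self_of_nhds.1 rfl,
    (hF.hasStrictFDerivAt_implicitFunctionOfProdDomain hi).hasFDerivAt.differentiableAt, ?_, ?_⟩
  · filter_upwards [h1] with v hv h
    exact hv.1 (h.trans hz.symm)
  · filter_upwards [h2] with t ht
    exact ht.trans hz

theorem existsUnique_continuation
    (hF : ∀ l z, 0 ≤ l → F (l, z) = 0 → HasStrictFDerivAt F (F' (l, z)) (l, z))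
    (hi : ∀ l z, 0 ≤ l → F (l, z) = 0 → (F' (l, z) ∘L .inr ℝ ℝ Y).IsInvertible)
    (hcpt : ∀ L, IsCompact {v : ℝ × Y | v.1 ∈ Icc 0 L ∧ F v = 0})
    (h0 : ∃! z, F (0, z) = 0) : ∀ l, 0 ≤ l → ∃! z, F (l, z) = 0 := by
  intro L hL
  set s : Set ℝ := {l | ∃! z, F (l, z) = 0} with hs
  have key : Icc 0 L ⊆ s := by
    refine IsClosed.Icc_subset_of_forall_mem_nhdsWithin ?_ h0 ?_
    · refine isClosed_of_closure_subset fun l hl => ?_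
      have hl1 : l ∈ Icc 0 L := closure_minimal inter_subset_right isClosed_Icc hl
      refine ⟨?_, hl1⟩
      have hex : l ∈ Prod.fst '' {v : ℝ × Y | v.1 ∈ Icc 0 L ∧ F v = 0} := by
        refine closure_minimal ?_ ((hcpt L).image continuous_fst).isClosed hl
        rintro t ⟨⟨z, hz, -⟩, ht⟩
        exact ⟨(t, z), ⟨ht, hz⟩, rfl⟩
      obtain ⟨⟨t, z⟩, ⟨-, hz⟩, ht⟩ := hex
      change t = l at ht
      rw [ht] at hz
      refine ⟨z, hz, fun w hw => ?_⟩
      obtain ⟨ψ, a1, a2, -, a4⟩ := exists_local_branch hz (hF _ z hl1.1 hz) (hi _ z hl1.1 hz)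
      obtain ⟨χ, b1, b2, -, b4⟩ := exists_local_branch hw (hF _ w hl1.1 hw) (hi _ w hl1.1 hw)
      by_contra hne
      have h3 : ∀ᶠ t in nhds l, ψ t ≠ χ t :=
        (a2.continuousAt.prodMk b2.continuousAt).eventually
          (isOpen_ne_fun continuous_fst continuous_snd |>.mem_nhds
            (show ψ l ≠ χ l by rw [a1, b1]; exact Ne.symm hne))
      obtain ⟨t, ⟨ht1, ht2, ht3⟩, ht, -⟩ := mem_closure_iff_nhds.1 hl _ (a4.and (b4.and h3))
      exact ht3 (ht.unique ht1 ht2)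
    · rintro l ⟨⟨z, hz, hu⟩, hl⟩
      obtain ⟨ψ, a1, a2, a3, a4⟩ := exists_local_branch hz (hF _ z hl.1 hz) (hi _ z hl.1 hz)
      obtain ⟨N, hN, hNo, hzN⟩ := _root_.mem_nhds_iff.1 a3
      have hc := (((hcpt L).diff hNo).image continuous_fst).isClosed
      have hl' : l ∉ Prod.fst '' ({v : ℝ × Y | v.1 ∈ Icc 0 L ∧ F v = 0} \ N) := by
        rintro ⟨⟨_, w⟩, ⟨⟨-, hw⟩, hwN⟩, rfl⟩
        rw [hu w hw] at hwN
        exact hwN hzN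
      have hlt : ∀ᶠ t in nhds l, t < L := gt_mem_nhds hl.2
      filter_upwards [nhdsWithin_le_nhds (hc.isOpen_compl.mem_nhds hl'), nhdsWithin_le_nhds a4,
        nhdsWithin_le_nhds hlt, self_mem_nhdsWithin] with t h1 h2 h3 h4
      refine ⟨ψ t, h2, fun w hw => ?_⟩
      have h5 : (t, w) ∈ N := by
        by_contra h
        exact h1 ⟨(t, w), ⟨⟨⟨hl.1.trans h4.le, h3.le⟩, hw⟩, h⟩, rfl⟩
      exact (hN h5 hw).symm
  exact key ⟨hL, le_rfl⟩

theorem hasDerivWithinAt_branch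
    (hF : ∀ l z, 0 ≤ l → F (l, z) = 0 → HasStrictFDerivAt F (F' (l, z)) (l, z))
    (hi : ∀ l z, 0 ≤ l → F (l, z) = 0 → (F' (l, z) ∘L .inr ℝ ℝ Y).IsInvertible)
    {Z : ℝ → Y} (hZ : ∀ l, 0 ≤ l → F (l, Z l) = 0)
    (hu : ∀ l z, 0 ≤ l → F (l, z) = 0 → z = Z l) {l : ℝ} (hl : 0 ≤ l) :
    ∃ z', HasDerivWithinAt Z z' (Ici 0) l ∧ F' (l, Z l) (1, z') = 0 := by
  obtain ⟨ψ, a1, a2, -, a4⟩ := exists_local_branch (hZ l hl) (hF _ _ hl (hZ l hl))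
    (hi _ _ hl (hZ l hl))
  have h1 : HasDerivWithinAt Z (deriv ψ l) (Ici 0) l := by
    refine a2.hasDerivAt.hasDerivWithinAt.congr_of_eventuallyEq ?_ a1.symm
    filter_upwards [nhdsWithin_le_nhds a4, self_mem_nhdsWithin] with t h1 h2
    exact (hu t _ h2 h1).symm
  refine ⟨_, h1, ?_⟩
  have h2 : HasDerivWithinAt (fun t => F (t, Z t)) (F' (l, Z l) (1, deriv ψ l)) (Ici 0) l :=
    (hF _ _ hl (hZ l hl)).hasFDerivAt.comp_hasDerivWithinAt l
      ((hasDerivWithinAt_id l (Ici 0)).prodMk h1)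
  have h3 : HasDerivWithinAt (fun t => F (t, Z t)) 0 (Ici 0) l :=
    (hasDerivWithinAt_const l (Ici 0) (0 : W)).congr (fun t ht => hZ t ht) (hZ l hl)
  exact (uniqueDiffOn_Ici 0 l hl).eq_deriv _ h2 h3

end Continuation

section Problem

variable {K : Type} [TopologicalSpace K] [CompactSpace K] [MeasurableSpace K]
  [OpensMeasurableSpace K] (μ : Measure K) [IsFiniteMeasure μ] {p : ℝ} (hp : 1 < p)
  (G : C(K, ℝ) →L[ℝ] C(K, ℝ))

/-- The density `w₊ ^ p`. -/
def dens (w : C(K, ℝ)) : C(K, ℝ) := (ppow (show 0 ≤ p by linarith)).comp w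

/-- The weight `w₊ ^ (p - 1)`. -/
def pwt (w : C(K, ℝ)) : C(K, ℝ) := (ppow (show 0 ≤ p - 1 by linarith)).comp w

theorem dens_apply (w : C(K, ℝ)) (x : K) : dens hp w x = max (w x) 0 ^ p := rfl

theorem pwt_apply (w : C(K, ℝ)) (x : K) : pwt hp w x = max (w x) 0 ^ (p - 1) := rfl

theorem dens_nonneg (w : C(K, ℝ)) (x : K) : 0 ≤ dens hp w x :=
  Real.rpow_nonneg (le_max_right _ _) _

theorem pwt_nonneg (w : C(K, ℝ)) (x : K) : 0 ≤ pwt hp w x := Real.rpow_nonneg (le_max_right _ _) _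

theorem pwt_mul (w : C(K, ℝ)) : pwt hp w * w = dens hp w := by
  ext x
  rw [ContinuousMap.mul_apply, pwt_apply, dens_apply]
  rcases le_or_gt (w x) 0 with h | h
  · rw [max_eq_right h, Real.zero_rpow (by linarith), Real.zero_rpow (by linarith), zero_mul]
  · rw [max_eq_left h.le]
    nth_rw 2 [← Real.rpow_one (w x)]
    rw [← Real.rpow_add h, sub_add_cancel]

theorem hasStrictFDerivAt_dens (w : C(K, ℝ)) :
    HasStrictFDerivAt (dens hp) (p • ContinuousLinearMap.mul ℝ C(K, ℝ) (pwt hp w)) w := by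
  have := hasStrictFDerivAt_comp (hasDerivAt_ppow hp) w
  rw [← map_smul]
  exact this

/-- The problem as a zero set: unknowns `λ` and `(α, w)` with `w = α + λ G (w₊ ^ p)`. -/
def probF (z : ℝ × (ℝ × C(K, ℝ))) : ℝ × C(K, ℝ) :=
  (intL μ (dens hp z.2.2) - 1, z.2.2 - z.2.1 • (1 : C(K, ℝ)) - z.1 • G (dens hp z.2.2))

/-- The derivative of `probF`. -/
def probF' (z : ℝ × (ℝ × C(K, ℝ))) : ℝ × (ℝ × C(K, ℝ)) →L[ℝ] ℝ × C(K, ℝ) :=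
  linP μ (pwt hp z.2.2) p G (p * z.1) ∘L .snd ℝ ℝ (ℝ × C(K, ℝ)) -
    (ContinuousLinearMap.inr ℝ ℝ C(K, ℝ)) ∘L
      (ContinuousLinearMap.fst ℝ ℝ (ℝ × C(K, ℝ))).smulRight (G (dens hp z.2.2))

theorem hasStrictFDerivAt_probF (z : ℝ × (ℝ × C(K, ℝ))) :
    HasStrictFDerivAt (probF μ hp G) (probF' μ hp G z) z := by
  have h1 : HasStrictFDerivAt (fun z : ℝ × (ℝ × C(K, ℝ)) => z.2.2)
    (ContinuousLinearMap.snd ℝ ℝ C(K, ℝ) ∘L .snd ℝ ℝ (ℝ × C(K, ℝ))) z :=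
    ContinuousLinearMap.hasStrictFDerivAt (E := ℝ × (ℝ × C(K, ℝ)))
      (ContinuousLinearMap.snd ℝ ℝ C(K, ℝ) ∘L .snd ℝ ℝ (ℝ × C(K, ℝ)))
  have h2 : HasStrictFDerivAt (fun z : ℝ × (ℝ × C(K, ℝ)) => z.2.1 • (1 : C(K, ℝ)))
    ((ContinuousLinearMap.fst ℝ ℝ C(K, ℝ) ∘L .snd ℝ ℝ (ℝ × C(K, ℝ))).smulRight 1) z :=
    ContinuousLinearMap.hasStrictFDerivAt (E := ℝ × (ℝ × C(K, ℝ)))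
      ((ContinuousLinearMap.fst ℝ ℝ C(K, ℝ) ∘L .snd ℝ ℝ (ℝ × C(K, ℝ))).smulRight 1)
  have h3 := (hasStrictFDerivAt_dens hp z.2.2).comp z h1
  have h4 := (intL μ).hasStrictFDerivAt.comp z h3
  have h5 := G.hasStrictFDerivAt.comp z h3
  have h6 := (hasStrictFDerivAt_fst (𝕜 := ℝ) (p := z)).smul h5
  refine ((h4.sub_const 1).prodMk ((h1.sub h2).sub h6)).congr_fderiv ?_
  refine ContinuousLinearMap.ext fun ⟨l, β, h⟩ => ?_
  refine Prod.ext ?_ ?_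
  · change intL μ (p • (pwt hp z.2.2 * h)) = p * intL μ (pwt hp z.2.2 * h) - 0
    rw [map_smul, smul_eq_mul, sub_zero]
  · change h - β • (1 : C(K, ℝ)) - (z.1 • G (p • (pwt hp z.2.2 * h)) + l • G (dens hp z.2.2)) =
      (h - β • (1 : C(K, ℝ)) - (p * z.1) • G (pwt hp z.2.2 * h)) - l • G (dens hp z.2.2)
    rw [map_smul]
    module

theorem probF'_comp_inr (z : ℝ × (ℝ × C(K, ℝ))) :
    probF' μ hp G z ∘L .inr ℝ ℝ (ℝ × C(K, ℝ)) = linP μ (pwt hp z.2.2) p G (p * z.1) := by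
  refine ContinuousLinearMap.ext fun y => ?_
  change linP μ (pwt hp z.2.2) p G (p * z.1) y -
    ContinuousLinearMap.inr ℝ ℝ C(K, ℝ) ((0 : ℝ) • G (dens hp z.2.2)) = _
  rw [zero_smul, map_zero, sub_zero]

variable {μ G} {l α : ℝ} {w : C(K, ℝ)}

theorem probF_eq_zero_iff :
    probF μ hp G (l, α, w) = 0 ↔
      intL μ (dens hp w) = 1 ∧ w = α • (1 : C(K, ℝ)) + l • G (dens hp w) := by
  rw [probF, Prod.mk_eq_zero, sub_eq_zero, sub_sub, sub_eq_zero]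

theorem exists_pos_of_probF (h : probF μ hp G (l, α, w) = 0) : ∃ x, 0 < w x := by
  by_contra! hc
  have h1 : dens hp w = 0 := by
    ext x
    rw [dens_apply, max_eq_right (hc x), Real.zero_rpow (by linarith)]
    rfl
  have h2 := ((probF_eq_zero_iff hp).1 h).1
  rw [h1, map_zero] at h2
  exact zero_ne_one h2

theorem intL_pwt_pos [μ.IsOpenPosMeasure] (h : probF μ hp G (l, α, w) = 0) :
    0 < intL μ (pwt hp w) := by
  obtain ⟨x, hx⟩ := exists_pos_of_probF hp h
  refine intL_pos μ (pwt_nonneg hp w) x ?_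
  rw [pwt_apply, max_eq_left hx.le]
  exact (Real.rpow_pos_of_pos hx _).ne'

end Problem

section Apriori

variable {K : Type} [TopologicalSpace K] [CompactSpace K] [MeasurableSpace K]
  [OpensMeasurableSpace K] {μ : Measure K} [IsFiniteMeasure μ] {p : ℝ} (hp : 1 < p)
  {G : C(K, ℝ) →L[ℝ] C(K, ℝ)} {l α : ℝ} {w : C(K, ℝ)}

theorem exists_bound_of_le (L C : ℝ) {q : ℝ} (hL : 0 ≤ L) (hC : 0 ≤ C) (hpq : p < q) :
    ∃ M₀ : ℝ, 1 ≤ M₀ ∧ ∀ M, 1 ≤ M →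
      (∀ T, 0 < T → M ≤ 1 + L * (C * (T + M ^ p * T ^ (1 - q)))) → M ≤ M₀ := by
  set ε := 1 / (2 * (L * C + 1)) with hε
  have hLC : 0 ≤ L * C := mul_nonneg hL hC
  have hε0 : 0 < ε := by positivity
  set D := L * C * ε ^ (1 - q) with hD
  have ht : Filter.Tendsto (fun M : ℝ => M ^ (-1 : ℝ) + D * M ^ (-(q - p))) Filter.atTop
      (nhds (0 + D * 0)) :=
    (tendsto_rpow_neg_atTop one_pos).add ((tendsto_rpow_neg_atTop (by linarith)).const_mul D)
  rw [mul_zero, add_zero] at ht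
  obtain ⟨M₀, hM₀⟩ := Filter.eventually_atTop.1 (ht.eventually (gt_mem_nhds (show (0 : ℝ) < 1 / 2
    by norm_num)))
  refine ⟨max M₀ 1, le_max_right _ _, fun M hM h => ?_⟩
  by_contra! hlt
  have h1 := hM₀ M ((le_max_left _ _).trans hlt.le)
  have hM0 : 0 < M := by linarith
  have h2 := h (ε * M) (by positivity)
  have e1 : L * C * ε ≤ 1 / 2 := by
    rw [hε, mul_one_div, div_le_iff₀ (by positivity)]
    linarith
  have e2 : M ^ p * (ε * M) ^ (1 - q) = ε ^ (1 - q) * (M * M ^ (-(q - p))) := by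
    rw [Real.mul_rpow hε0.le hM0.le, mul_left_comm, ← Real.rpow_add hM0]
    congr 1
    nth_rw 2 [← Real.rpow_one M]
    rw [← Real.rpow_add hM0]
    congr 1
    ring
  have e3 : M * M ^ (-1 : ℝ) = 1 := by rw [Real.rpow_neg_one, mul_inv_cancel₀ hM0.ne']
  have e4 : 1 + L * (C * (ε * M + M ^ p * (ε * M) ^ (1 - q))) =
      M * (M ^ (-1 : ℝ) + D * M ^ (-(q - p))) + (L * C * ε) * M := by
    rw [e2, mul_add M, e3, hD]
    ring
  rw [e4] at h2
  have e5 := mul_lt_mul_of_pos_left h1 hM0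
  have e6 := mul_le_mul_of_nonneg_right e1 hM0.le
  linarith

theorem le_one_of_probF (hG : GreenOp μ p G) (h1 : intL μ 1 = 1) (hl : 0 ≤ l)
    (h : probF μ hp G (l, α, w) = 0) : α ≤ 1 := by
  by_contra! hα
  obtain ⟨h2, h3⟩ := (probF_eq_zero_iff hp).1 h
  have h4 : α • (1 : C(K, ℝ)) ≤ dens hp w := fun x => by
    have h5 : 0 ≤ G (dens hp w) x := hG.pos _ (dens_nonneg hp w) x
    have h6 : w x = α * 1 + l * G (dens hp w) x := by nth_rw 1 [h3]; rfl
    have h7 : α ≤ w x := by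
      have := mul_nonneg hl h5
      linarith
    change α * 1 ≤ dens hp w x
    rw [dens_apply, max_eq_left (by linarith), mul_one]
    exact h7.trans (Real.self_le_rpow_of_one_le (by linarith) hp.le)
  have h8 := intL_mono μ h4
  rw [map_smul, h1, h2, smul_eq_mul] at h8
  linarith

theorem dens_le {M : ℝ} (hw : ∀ x, w x ≤ M) (hM : 0 ≤ M) (x : K) : dens hp w x ≤ M ^ p :=
  Real.rpow_le_rpow (le_max_right _ _) (max_le (hw x) hM) (by linarith)

theorem norm_dens_le {M : ℝ} (hw : ∀ x, w x ≤ M) (hM : 0 ≤ M) : ‖dens hp w‖ ≤ M ^ p :=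
  (ContinuousMap.norm_le _ (Real.rpow_nonneg hM _)).2 fun x => by
    rw [Real.norm_eq_abs, abs_of_nonneg (dens_nonneg hp w x)]
    exact dens_le hp hw hM x

theorem exists_apriori (hG : GreenOp μ p G) (h1 : intL μ 1 = 1) {L : ℝ} (hL : 0 ≤ L) :
    ∃ M₀ : ℝ, 1 ≤ M₀ ∧ ∀ l α w, l ∈ Icc 0 L → probF μ hp G (l, α, w) = 0 → ∀ x, w x ≤ M₀ := by
  obtain ⟨q, C, hpq, hC, hb⟩ := hG.bound
  obtain ⟨M₀, hM₀, hM⟩ := exists_bound_of_le L C hL hC hpq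
  refine ⟨M₀, hM₀, fun l α w hl h => ?_⟩
  obtain ⟨h2, h3⟩ := (probF_eq_zero_iff hp).1 h
  obtain ⟨y, -⟩ := exists_pos_of_probF hp h
  obtain ⟨x, -, hx⟩ := isCompact_univ.exists_isMaxOn ⟨y, Set.mem_univ y⟩ w.continuous.continuousOn
  have hx' : ∀ z, w z ≤ w x := fun z => hx (Set.mem_univ z)
  intro z
  refine (hx' z).trans ?_
  rcases le_total (w x) 1 with h4 | h4
  · linarith
  refine hM (w x) h4 fun T hT => ?_
  have h5 := hb (dens hp w) (w x ^ p) T hT (dens_nonneg hp w) (dens_le hp hx' (by linarith)) x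
  rw [h2, mul_one] at h5
  have h6 : w x = α * 1 + l * G (dens hp w) x := by nth_rw 1 [h3]; rfl
  have h7 : 0 ≤ G (dens hp w) x := hG.pos _ (dens_nonneg hp w) x
  have h8 := le_one_of_probF hp hG h1 hl.1 h
  have h9 := mul_le_mul hl.2 h5 h7 hL
  linarith

theorem continuous_probF : Continuous (probF μ hp G) :=
  continuous_iff_continuousAt.2 fun z => (hasStrictFDerivAt_probF μ hp G z).continuousAt

theorem isCompact_solutions (hG : GreenOp μ p G) (h1 : intL μ 1 = 1) (L : ℝ) :
    IsCompact {v : ℝ × (ℝ × C(K, ℝ)) | v.1 ∈ Icc 0 L ∧ probF μ hp G v = 0} := by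
  have hcl : IsClosed {v : ℝ × (ℝ × C(K, ℝ)) | v.1 ∈ Icc 0 L ∧ probF μ hp G v = 0} :=
    (isClosed_Icc.preimage continuous_fst).inter
      (isClosed_singleton.preimage (continuous_probF hp))
  rcases lt_or_ge L 0 with hL | hL
  · rw [Icc_eq_empty (not_le.2 hL)]
    convert! isCompact_empty
    simp
  obtain ⟨M₀, hM₀, hM⟩ := exists_apriori hp hG h1 hL
  set B := ‖G‖ * M₀ ^ p with hB
  have hc1 : IsCompact (closure (G '' closedBall 0 (M₀ ^ p))) :=
    hG.cpt.isCompact_closure_image_closedBall _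
  have hc2 := (isCompact_Icc (a := (0 : ℝ)) (b := L)).prod
    ((isCompact_Icc (a := -(L * B)) (b := 1)).prod hc1)
  have hc3 := hc2.image (f := fun v : ℝ × (ℝ × C(K, ℝ)) =>
    ((v.1, v.2.1, v.2.1 • (1 : C(K, ℝ)) + v.1 • v.2.2) : ℝ × (ℝ × C(K, ℝ)))) (by fun_prop)
  refine hc3.of_isClosed_subset hcl ?_
  rintro ⟨l, α, w⟩ ⟨hl, h⟩
  obtain ⟨h2, h3⟩ := (probF_eq_zero_iff hp).1 h
  have h4 := hM l α w hl h
  have h5 := norm_dens_le hp h4 (by linarith)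
  refine ⟨(l, α, G (dens hp w)), ⟨hl, ⟨?_, le_one_of_probF hp hG h1 hl.1 h⟩,
    subset_closure ⟨_, mem_closedBall_zero_iff.2 h5, rfl⟩⟩, ?_⟩
  · obtain ⟨x, hx⟩ := exists_pos_of_probF hp h
    have h6 : w x = α * 1 + l * G (dens hp w) x := by nth_rw 1 [h3]; rfl
    have h7 : G (dens hp w) x ≤ B :=
      (le_abs_self _).trans (((G (dens hp w)).norm_coe_le_norm x).trans
        ((G.le_opNorm _).trans (mul_le_mul_of_nonneg_left h5 (norm_nonneg _))))
    have h8 : 0 ≤ G (dens hp w) x := hG.pos _ (dens_nonneg hp w) x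
    have h9 := mul_le_mul hl.2 h7 h8 hL
    dsimp only
    linarith
  · rw [Prod.mk.injEq, Prod.mk.injEq]
    exact ⟨rfl, rfl, h3.symm⟩

theorem existsUnique_probF_zero (h1 : intL μ 1 = 1) : ∃! z, probF μ hp G (0, z) = 0 := by
  have hα : ∀ α : ℝ, dens hp (α • (1 : C(K, ℝ))) = (max α 0 ^ p) • (1 : C(K, ℝ)) := fun α => by
    ext x
    change max (α * 1) 0 ^ p = max α 0 ^ p * 1
    rw [mul_one, mul_one]
  refine ⟨(1, 1), ?_, ?_⟩
  · change probF μ hp G (0, 1, 1) = 0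
    rw [probF_eq_zero_iff, zero_smul, add_zero, one_smul]
    refine ⟨?_, rfl⟩
    have := hα 1
    rw [one_smul, max_eq_left zero_le_one, Real.one_rpow, one_smul] at this
    rw [this, h1]
  · rintro ⟨α, w⟩ h
    obtain ⟨h2, h3⟩ := (probF_eq_zero_iff hp).1 h
    rw [zero_smul, add_zero] at h3
    rw [h3, hα, map_smul, h1, smul_eq_mul, mul_one] at h2
    have h4 : α = 1 := by
      have h5 : max α 0 = 1 := by
        have := (Real.rpow_left_inj (le_max_right α 0) zero_le_one (by linarith : p ≠ 0)).1
          (h2.trans (Real.one_rpow p).symm)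
        exact this
      rcases max_choice α 0 with h6 | h6 <;> rw [h6] at h5
      · exact h5
      · norm_num at h5
    rw [h3, h4, one_smul]

end Apriori

section Branch

variable {K : Type} [TopologicalSpace K] [CompactSpace K] [MeasurableSpace K]
  [OpensMeasurableSpace K] {μ : Measure K} [IsFiniteMeasure μ] {p : ℝ} (hp : 1 < p)
  {G : C(K, ℝ) →L[ℝ] C(K, ℝ)}

theorem deriv_identities (hG : GreenOp μ p G) {l α β : ℝ} {w h : C(K, ℝ)} (hl : 0 ≤ l)
    (hm : 0 < intL μ (pwt hp w)) (hz : probF μ hp G (l, α, w) = 0)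
    (hu : ∀ t ∈ Icc 0 (p * l), IsUnit (1 - t • compr μ (pwt hp w) G))
    (hd : probF' μ hp G (l, α, w) (1, β, h) = 0) :
    0 ≤ intL μ (p • (pwt hp w * h) * G (dens hp w)) ∧
      β ≤ -intL μ (dens hp w * G (dens hp w)) := by
  have hp0 : 0 < p := by linarith
  obtain ⟨h2, h3⟩ := (probF_eq_zero_iff hp).1 hz
  have hd' : (p * intL μ (pwt hp w * h) - 0, (h - β • (1 : C(K, ℝ)) -
      (p * l) • G (pwt hp w * h)) - (1 : ℝ) • G (dens hp w)) = 0 := hd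
  obtain ⟨e1, e2⟩ := Prod.mk.inj hd'
  rw [sub_zero] at e1
  have e3 : intL μ (pwt hp w * h) = 0 := (mul_eq_zero.1 e1).resolve_left hp0.ne'
  have e4 : projV μ (pwt hp w) h = h := projV_of_eq_zero e3
  have e5 : G (dens hp w) = h - β • (1 : C(K, ℝ)) - (p * l) • G (pwt hp w * h) := by
    rw [one_smul, sub_eq_zero] at e2
    exact e2.symm
  have e6 := hG.mul_compr_le (pwt_nonneg hp w) (mul_nonneg hp0.le hl) hu h
  rw [compr_apply, ← intL_projV_symm, e4, ← mul_assoc (pwt hp w), ← mul_assoc (pwt hp w)] at e6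
  set v := pwt hp w * h with hv
  have e7 : intL μ (v * G (dens hp w)) = intL μ (v * h) - (p * l) * intL μ (v * G v) := by
    rw [e5, mul_sub, mul_sub, mul_smul_comm, mul_smul_comm, mul_one, map_sub, map_sub, map_smul,
      map_smul, e3, smul_zero, sub_zero, smul_eq_mul]
  have e8 : 0 ≤ intL μ (v * G (dens hp w)) := by linarith
  refine ⟨by rw [smul_mul_assoc, map_smul, smul_eq_mul]; positivity, ?_⟩
  have e9 : intL μ (dens hp w * h) = l * intL μ (v * G (dens hp w)) := by
    have : dens hp w * h = α • v + l • (v * G (dens hp w)) := by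
      have e : dens hp w * h = v * w := by rw [hv, mul_right_comm, pwt_mul]
      rw [e]
      nth_rw 1 [h3]
      rw [mul_add, mul_smul_comm, mul_smul_comm, mul_one]
    rw [this, map_add, map_smul, map_smul, e3, smul_zero, zero_add, smul_eq_mul]
  have e10 : intL μ (dens hp w * G (dens hp w)) =
      intL μ (dens hp w * h) - β - (p * l) * intL μ (dens hp w * G v) := by
    rw [e5]
    rw [mul_sub, mul_sub, mul_smul_comm, mul_smul_comm, mul_one, map_sub, map_sub, map_smul,
      map_smul, h2, smul_eq_mul, smul_eq_mul, mul_one]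
  have e11 : intL μ (dens hp w * G v) = intL μ (v * G (dens hp w)) := by
    rw [hG.symm, mul_comm]
  rw [e9, e11] at e10
  have e12 : 0 ≤ (p - 1) * (l * intL μ (v * G (dens hp w))) :=
    mul_nonneg (by linarith) (mul_nonneg hl e8)
  linarith

theorem existsUnique_zero_level [μ.IsOpenPosMeasure] (hG : GreenOp μ p G) (h1 : intL μ 1 = 1)
    (hall : ∀ l α w, 0 ≤ l → probF μ hp G (l, α, w) = 0 → ∀ t, 0 ≤ t → t ≤ p * l →
      ∀ φ, φ = t • G (pwt hp w * projV μ (pwt hp w) φ) → φ = 0) :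
    ∃ l₀ w₀, 0 < l₀ ∧ probF μ hp G (l₀, 0, w₀) = 0 ∧
      ∀ l w, 0 ≤ l → probF μ hp G (l, 0, w) = 0 → l = l₀ ∧ w = w₀ := by
  have hp0 : 0 < p := by linarith
  have hu : ∀ l α w, 0 ≤ l → probF μ hp G (l, α, w) = 0 → ∀ t ∈ Icc 0 (p * l),
      IsUnit (1 - t • compr μ (pwt hp w) G) := fun l α w hl hz t ht =>
    hG.isUnit_one_sub_compr (intL_pwt_pos hp hz) (hall l α w hl hz t ht.1 ht.2)
  have hF : ∀ l z, 0 ≤ l → probF μ hp G (l, z) = 0 →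
      HasStrictFDerivAt (probF μ hp G) (probF' μ hp G (l, z)) (l, z) := fun l z _ _ =>
    hasStrictFDerivAt_probF μ hp G (l, z)
  have hi : ∀ l z, 0 ≤ l → probF μ hp G (l, z) = 0 →
      (probF' μ hp G (l, z) ∘L .inr ℝ ℝ (ℝ × C(K, ℝ))).IsInvertible := fun l z hl hz => by
    rw [probF'_comp_inr]
    exact linP_isInvertible hp0 (intL_pwt_pos hp (α := z.1) hz)
      (hu l z.1 z.2 hl hz _ ⟨mul_nonneg hp0.le hl, le_rfl⟩)
  have hex := existsUnique_continuation hF hi (isCompact_solutions hp hG h1)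
    (existsUnique_probF_zero hp h1)
  have hex' : ∀ l, ∃ z, 0 ≤ l → probF μ hp G (l, z) = 0 ∧ ∀ z', probF μ hp G (l, z') = 0 → z' = z :=
    fun l => by
      by_cases hl : 0 ≤ l
      · obtain ⟨z, a, b⟩ := hex l hl
        exact ⟨z, fun _ => ⟨a, b⟩⟩
      · exact ⟨0, fun h => absurd h hl⟩
  choose Z hZ using hex'
  have hZ1 : ∀ l, 0 ≤ l → probF μ hp G (l, Z l) = 0 := fun l hl => (hZ l hl).1
  have hZu : ∀ l z, 0 ≤ l → probF μ hp G (l, z) = 0 → z = Z l := fun l z hl => (hZ l hl).2 z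
  set D : ℝ → C(K, ℝ) := fun l => dens hp (Z l).2 with hD
  have hder : ∀ l, 0 ≤ l → ∃ a' e', HasDerivWithinAt (fun t => (Z t).1) a' (Ici 0) l ∧
      HasDerivWithinAt (fun t => intL μ (D t * G (D t))) e' (Ici 0) l ∧ 0 ≤ e' ∧
      a' ≤ -intL μ (D l * G (D l)) := by
    intro l hl
    obtain ⟨⟨β, h⟩, b1, b2⟩ := hasDerivWithinAt_branch hF hi hZ1 hZu hl
    obtain ⟨c1, c2⟩ := deriv_identities hp hG (α := (Z l).1) (w := (Z l).2) hl
      (intL_pwt_pos hp (hZ1 l hl)) (hZ1 l hl) (hu l _ _ hl (hZ1 l hl)) b2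
    have d1 : HasDerivWithinAt (fun t => (Z t).1) β (Ici 0) l :=
      (ContinuousLinearMap.fst ℝ ℝ C(K, ℝ)).hasFDerivAt.comp_hasDerivWithinAt l b1
    have d2 : HasDerivWithinAt (fun t => (Z t).2) h (Ici 0) l :=
      (ContinuousLinearMap.snd ℝ ℝ C(K, ℝ)).hasFDerivAt.comp_hasDerivWithinAt l b1
    have d3 : HasDerivWithinAt D (p • (pwt hp (Z l).2 * h)) (Ici 0) l :=
      HasFDerivAt.comp_hasDerivWithinAt (l := dens hp) (f := fun t => (Z t).2) l
        (hasStrictFDerivAt_dens hp (Z l).2).hasFDerivAt d2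
    have d4 : HasDerivWithinAt (fun t => G (D t)) (G (p • (pwt hp (Z l).2 * h))) (Ici 0) l :=
      G.hasFDerivAt.comp_hasDerivWithinAt l d3
    have d5 : HasDerivWithinAt (fun t => intL μ (D t * G (D t))) _ (Ici 0) l :=
      (intL μ).hasFDerivAt.comp_hasDerivWithinAt l (d3.mul d4)
    refine ⟨β, _, d1, d5, ?_, c2⟩
    rw [map_add, hG.symm (D l), mul_comm (G (D l))]
    exact add_nonneg c1 c1
  have hmono : MonotoneOn (fun t => intL μ (D t * G (D t))) (Ici 0) := by
    refine monotoneOn_of_deriv_nonneg (convex_Ici 0) (fun t ht => ?_) (fun t ht => ?_)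
      fun t ht => ?_
    · obtain ⟨a', e', -, h2, -, -⟩ := hder t ht
      exact h2.continuousWithinAt
    · obtain ⟨a', e', -, h2, -, -⟩ := hder t (interior_subset ht)
      exact (h2.mono interior_subset).differentiableWithinAt
    · obtain ⟨a', e', -, h2, h3, -⟩ := hder t (interior_subset ht)
      rwa [(h2.hasDerivAt (mem_interior_iff_mem_nhds.1 ht)).deriv]
  have hZ0 : Z 0 = (1, 1) := by
    refine (hZu 0 (1, 1) le_rfl ?_).symm
    rw [probF_eq_zero_iff, zero_smul, add_zero, one_smul]
    refine ⟨?_, rfl⟩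
    have : dens hp (1 : C(K, ℝ)) = 1 := by
      ext x
      change max 1 0 ^ p = (1 : ℝ)
      rw [max_eq_left zero_le_one, Real.one_rpow]
    rw [this, h1]
  have hD0 : D 0 = 1 := by
    ext x
    rw [hD]
    dsimp only
    rw [hZ0]
    change max 1 0 ^ p = (1 : ℝ)
    rw [max_eq_left zero_le_one, Real.one_rpow]
  set κ := intL μ (G 1) with hκ
  have hκ0 : 0 < κ := hG.strict
  have hanti : StrictAntiOn (fun t => (Z t).1 + κ / 2 * t) (Ici 0) := by
    refine strictAntiOn_of_deriv_neg (convex_Ici 0) (fun t ht => ?_) fun t ht => ?_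
    · obtain ⟨a', e', h1, -, -, -⟩ := hder t ht
      exact h1.continuousWithinAt.add (by fun_prop)
    · obtain ⟨a', e', h1, h2, h3, h4⟩ := hder t (interior_subset ht)
      have h5 := (h1.hasDerivAt (mem_interior_iff_mem_nhds.1 ht)).add
        ((hasDerivAt_id t).const_mul (κ / 2))
      refine (h5.deriv).trans_lt ?_
      have h6 := hmono (Set.mem_Ici.2 le_rfl) (interior_subset ht) (interior_subset ht)
      dsimp only at h6
      rw [hD0, one_mul] at h6
      linarith
  have hanti' : StrictAntiOn (fun t => (Z t).1) (Ici 0) := fun s hs t ht hst => by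
    have := hanti hs ht hst
    dsimp only at this ⊢
    nlinarith
  have hcont : ContinuousOn (fun t => (Z t).1) (Icc 0 (2 / κ)) := fun t ht => by
    obtain ⟨a', e', h1, -, -, -⟩ := hder t ht.1
    exact h1.continuousWithinAt.mono Icc_subset_Ici_self
  have h2κ : 0 < 2 / κ := by positivity
  have hend : (Z (2 / κ)).1 ≤ 0 := by
    have := hanti (Set.mem_Ici.2 le_rfl) (Set.mem_Ici.2 h2κ.le) h2κ
    dsimp only at this
    rw [hZ0, mul_zero] at this
    have h3 : κ / 2 * (2 / κ) = 1 := by field_simp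
    rw [h3] at this
    norm_num at this
    linarith
  obtain ⟨l₀, hl₀, h0⟩ := intermediate_value_Icc' h2κ.le hcont
    ⟨hend, by rw [hZ0]; exact zero_le_one⟩
  dsimp only at h0
  have hne : l₀ ≠ 0 := fun h => by
    rw [h, hZ0] at h0
    exact one_ne_zero h0
  refine ⟨l₀, (Z l₀).2, lt_of_le_of_ne hl₀.1 hne.symm, ?_, fun l w hl hw => ?_⟩
  · have := hZ1 l₀ hl₀.1
    rwa [show Z l₀ = (0, (Z l₀).2) from Prod.ext h0 rfl] at this
  · have h3 := hZu l _ hl hw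
    have h4 : l = l₀ := hanti'.injOn hl hl₀.1 (by
      rw [← h3, h0])
    refine ⟨h4, ?_⟩
    rw [← h4, ← h3]

end Branch

section StrongMax

variable {E : Type} [NormedAddCommGroup E] [InnerProductSpace ℝ E] [FiniteDimensional ℝ E]
  [MeasurableSpace E] [BorelSpace E] {ι : Type} [Fintype ι] (b : OrthonormalBasis ι ℝ E)
  {Ω : Set E} {β : ℝ} {u : E → ℝ} {u' : E → E →L[ℝ] ℝ} {u'' : E → E →L[ℝ] E →L[ℝ] ℝ}

theorem cc_gaussian (y : E) (a c k : ℝ) :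
    ∃ v' v'', CC (fun x : E => c * (Real.exp (-a * (‖x - y‖ ^ 2 + 0)) - k)) v' v'' ∧
      ∀ x, trL b (v'' x) = c * a * Real.exp (-a * (‖x - y‖ ^ 2 + 0)) *
        (4 * a * ‖x - y‖ ^ 2 - 2 * Fintype.card ι) := by
  have hu := cc_sqDist y 0
  have he : ∀ t : ℝ, HasDerivAt (fun t => Real.exp (-a * t)) (-a * Real.exp (-a * t)) t := fun t =>
    (((hasDerivAt_id t).const_mul (-a)).exp).congr_deriv (by simp; ring)
  refine ⟨_, _, hu.comp (h := fun t => c * (Real.exp (-a * t) - k))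
    (h' := fun t => c * (-a * Real.exp (-a * t)))
    (h'' := fun t => c * (-a * (-a * Real.exp (-a * t))))
    (fun x => ((he _).sub_const k).const_mul c) (fun x => ((he _).const_mul (-a)).const_mul c) ?_,
    fun x => ?_⟩
  · have := hu.cont
    exact continuous_const.mul (continuous_const.mul (continuous_const.mul
      (Real.continuous_exp.comp (continuous_const.mul this))))
  · rw [map_add, map_smul, map_smul, trL_innerSL, trL_apply]
    simp only [ContinuousLinearMap.smulRight_apply, smul_apply, smul_eq_mul]
    generalize Real.exp (-a * (‖x - y‖ ^ 2 + 0)) = e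
    change c * (-a * e) * (2 * (Fintype.card ι : ℝ)) +
      ∑ i, c * (-a * (-a * e)) * (2 * inner ℝ (x - y) (b i)) *
        (2 * inner ℝ (x - y) (b i)) = _
    have h1 : ∑ i, c * (-a * (-a * e)) * (2 * inner ℝ (x - y) (b i)) *
        (2 * inner ℝ (x - y) (b i)) = c * (-a * (-a * e)) * 4 * ‖x - y‖ ^ 2 := by
      rw [← b.sum_sq_norm_inner_left, Finset.mul_sum]
      refine Finset.sum_congr rfl fun i _ => ?_
      rw [Real.norm_eq_abs, sq_abs]
      ring
    rw [h1]
    ring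

theorem CC.pos_of_mem_ball [Nontrivial E] (h : CC u u' u'') (h0 : ∀ x ∈ closure Ω, 0 ≤ u x)
    (hs : ∀ x ∈ Ω, trL b (u'' x) ≤ 0) {y : E} (hy : 0 < u y) {R : ℝ} (hR : ball y R ⊆ Ω) {x : E}
    (hx : x ∈ ball y R) : 0 < u x := by
  have hR0 : 0 < R := Metric.pos_of_mem_ball hx
  obtain ⟨s', hs', hc⟩ := Metric.continuous_iff.1 h.cont y (u y / 2) (by positivity)
  have hlow : ∀ z, ‖z - y‖ < s' → u y / 2 < u z := fun z hz => by
    have := (abs_lt.1 (Real.dist_eq _ _ ▸ hc z (by rwa [dist_eq_norm]))).1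
    linarith
  obtain ⟨s, hs0, hss, hsR⟩ : ∃ s, 0 < s ∧ s < s' ∧ s < R :=
    ⟨min s' R / 2, by positivity, by linarith [min_le_left s' R, lt_min hs' hR0],
      by linarith [min_le_right s' R, lt_min hs' hR0]⟩
  by_cases hxs : ‖x - y‖ < s'
  · linarith [hlow x hxs]
  have hxR : ‖x - y‖ < R := mem_ball_iff_norm.1 hx
  set A : Set E := {z | s < ‖z - y‖ ∧ ‖z - y‖ < R} with hA
  have hn : Continuous fun z : E => ‖z - y‖ := by fun_prop
  have hAo : IsOpen A := (isOpen_lt continuous_const hn).inter (isOpen_lt hn continuous_const)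
  have hAb : Bornology.IsBounded A := isBounded_ball.subset fun z hz => mem_ball_iff_norm.2 hz.2
  have hAc : ∀ z ∈ closure A, s ≤ ‖z - y‖ ∧ ‖z - y‖ ≤ R := fun z hz => by
    have hcl : IsClosed {z : E | s ≤ ‖z - y‖ ∧ ‖z - y‖ ≤ R} :=
      (isClosed_le continuous_const hn).inter (isClosed_le hn continuous_const)
    have hsub : A ⊆ {z : E | s ≤ ‖z - y‖ ∧ ‖z - y‖ ≤ R} := fun w hw => ⟨hw.1.le, hw.2.le⟩
    exact closure_minimal hsub hcl hz
  have hAΩ : A ⊆ Ω := fun z hz => hR (mem_ball_iff_norm.2 hz.2)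
  set a : ℝ := Fintype.card ι / (2 * s ^ 2) with ha
  have hcard : 0 < (Fintype.card ι : ℝ) := by
    rw [← Module.finrank_eq_card_basis b.toBasis]; exact_mod_cast Module.finrank_pos
  have ha0 : 0 < a := by positivity
  obtain ⟨v', v'', hv, htr⟩ := cc_gaussian b y a (u y / 2) (Real.exp (-a * R ^ 2))
  have key := (hv.sub h).max_subharmonic b hAo hAb (fun z hz => ?_) (fun z hz => ?_)
    (subset_closure (show x ∈ A from ⟨hss.trans_le (not_lt.1 hxs), hxR⟩))
  · have h1 : Real.exp (-a * R ^ 2) < Real.exp (-a * (‖x - y‖ ^ 2 + 0)) := by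
      rw [Real.exp_lt_exp, add_zero]
      have : ‖x - y‖ ^ 2 < R ^ 2 := by gcongr
      nlinarith
    have h2 : 0 < u y / 2 * (Real.exp (-a * (‖x - y‖ ^ 2 + 0)) - Real.exp (-a * R ^ 2)) :=
      mul_pos (by positivity) (by linarith)
    linarith
  · have hzc := hAc z hz.1
    have hz0 : 0 ≤ u z := h0 z (closure_mono hAΩ hz.1)
    have hzA : z ∉ A := by rw [hAo.frontier_eq] at hz; exact hz.2
    rcases hzc.1.eq_or_lt with h1 | h1
    · have h3 := hlow z (h1 ▸ hss)
      have h4 : Real.exp (-a * (‖z - y‖ ^ 2 + 0)) ≤ 1 := Real.exp_le_one_iff.2 (by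
        have : 0 ≤ a * (‖z - y‖ ^ 2 + 0) := by positivity
        linarith)
      have h5 : u y / 2 * (Real.exp (-a * (‖z - y‖ ^ 2 + 0)) - Real.exp (-a * R ^ 2)) ≤ u y / 2 :=
        mul_le_of_le_one_right (by positivity) (by linarith [Real.exp_pos (-a * R ^ 2)])
      linarith
    · have h3 : ‖z - y‖ = R := le_antisymm hzc.2 (not_lt.1 fun h => hzA ⟨h1, h⟩)
      rw [h3, add_zero, sub_self, mul_zero]
      linarith
  · rw [map_sub, htr]
    have h1 := hs z (hAΩ hz)
    have h2 : 0 ≤ 4 * a * ‖z - y‖ ^ 2 - 2 * Fintype.card ι := by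
      have h3 : s ^ 2 ≤ ‖z - y‖ ^ 2 := by have := hz.1; gcongr
      have h4 : 4 * a * s ^ 2 = 2 * Fintype.card ι := by rw [ha]; field_simp; ring
      have h5 : 4 * a * s ^ 2 ≤ 4 * a * ‖z - y‖ ^ 2 := by gcongr
      linarith
    have h3 : 0 ≤ u y / 2 * a * Real.exp (-a * (‖z - y‖ ^ 2 + 0)) *
        (4 * a * ‖z - y‖ ^ 2 - 2 * Fintype.card ι) := mul_nonneg (by positivity) h2
    linarith

/-- The strong maximum principle for nonnegative superharmonic functions. -/
theorem CC.pos_of_superharmonic [Nontrivial E] (ho : IsOpen Ω) (hc : IsPreconnected Ω)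
    (h : CC u u' u'') (h0 : ∀ x ∈ closure Ω, 0 ≤ u x) (hs : ∀ x ∈ Ω, trL b (u'' x) ≤ 0)
    (hex : ∃ x ∈ Ω, 0 < u x) {x : E} (hx : x ∈ Ω) : 0 < u x := by
  have hS : IsOpen (Ω ∩ {x | 0 < u x}) := ho.inter (isOpen_lt continuous_const h.cont)
  obtain ⟨z, hz, hz0⟩ := hex
  refine (hc.subset_of_closure_inter_subset hS ⟨z, hz, hz, hz0⟩ (fun y hy => ⟨hy.2, ?_⟩) hx).2
  obtain ⟨r, hr, hrb⟩ := Metric.isOpen_iff.1 ho y hy.2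
  obtain ⟨w, hw, hyw⟩ := Metric.mem_closure_iff.1 hy.1 (r / 2) (by positivity)
  refine h.pos_of_mem_ball b h0 hs hw.2 (R := r / 2) (fun t ht => hrb ?_) hyw
  rw [mem_ball] at ht ⊢
  have := dist_triangle t w y
  rw [dist_comm w y] at this
  linarith

variable (ν : Measure E) [ν.IsAddHaarMeasure]

theorem greenOp_muC [Nontrivial E] [CompactSpace (closure Ω)] [IsFiniteMeasure (muC Ω ν)]
    (ho : IsOpen Ω) (hb : Bornology.IsBounded Ω) (hne : Ω.Nonempty)
    (hβ : 0 < β) (hβ1 : β < 1) {G : C(closure Ω, ℝ) →L[ℝ] C(closure Ω, ℝ)}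
    (hcpt : IsCompactOperator G) (hpos : ∀ f, 0 ≤ f → 0 ≤ G f)
    (hpot : ∀ f, IsHol β f → IsPot b Ω f (G f))
    (hn : 2 ≤ Fintype.card ι) {p : ℝ} (hp : 1 < p)
    (hpn : Fintype.card ι = 2 ∨ p < (Fintype.card ι : ℝ) / ((Fintype.card ι : ℝ) - 2)) :
    GreenOp (muC Ω ν) p G where
  cpt := hcpt
  pos := hpos
  symm := green_symm b ν ho hb (holSubalgebra_dense hβ hβ1) hpos hpot
  nonneg := green_nonneg b ν ho hb (holSubalgebra_dense hβ hβ1) hpot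
  bound := green_kernel_bound b ν ho hb (holSubalgebra_dense hβ hβ1) hpos hpot hn hp hpn
  strict := by
    have := isOpenPosMeasure_muC ν ho
    have h1 : (0 : C(closure Ω, ℝ)) ≤ G 1 := hpos 1 fun _ => zero_le_one
    by_contra hcon
    have hz : ∀ x, G 1 x = 0 := fun x => by
      by_contra hx
      exact hcon (intL_pos _ (fun x => h1 x) x hx)
    have hh : IsHol β (1 : C(closure Ω, ℝ)) := by
      rw [← map_one (algebraMap ℝ C(closure Ω, ℝ))]; exact isHol_const 1
    obtain ⟨u, u', u'', a1, a2, a3, a4⟩ := hpot 1 hh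
    obtain ⟨x, hx⟩ := hne
    have e1 : ∀ y ∈ Ω, u y = 0 := fun y hy => by
      rw [a4 ⟨y, subset_closure hy⟩, hz]
    have e2 : ∀ y ∈ Ω, u' y = 0 := fun y hy => by
      refine (a1.d1 y).unique ((hasFDerivAt_const (0 : ℝ) y).congr_of_eventuallyEq ?_)
      filter_upwards [ho.mem_nhds hy] with z hz using e1 z hz
    have e3 : u'' x = 0 := by
      refine (a1.d2 x).unique ((hasFDerivAt_const 0 x).congr_of_eventuallyEq ?_)
      filter_upwards [ho.mem_nhds hx] with z hz using e2 z hz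
    have := a3 ⟨x, subset_closure hx⟩ hx
    rw [e3, map_zero] at this
    simp at this

end StrongMax

section Translation

variable {N : ℕ} {Ω : Set (EuclideanSpace ℝ (Fin N))}

theorem _root_.ContDiff.cc {u : EuclideanSpace ℝ (Fin N) → ℝ} (h : ContDiff ℝ 2 u) :
    CC u (fderiv ℝ u) (fderiv ℝ (fderiv ℝ u)) := by
  have h1 : ContDiff ℝ 1 (fderiv ℝ u) := h.fderiv_right (by norm_num)
  exact ⟨fun x => (h.differentiable (by norm_num) x).hasFDerivAt,
    fun x => (h1.differentiable (by norm_num) x).hasFDerivAt, h1.continuous_fderiv (by norm_num)⟩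

theorem CC.contDiff {u : EuclideanSpace ℝ (Fin N) → ℝ} {u' u''} (h : CC u u' u'') :
    ContDiff ℝ 2 u := by
  refine contDiff_succ_iff_hasFDerivAt (n := 1).2 ⟨u', ?_, h.d1⟩
  exact contDiff_one_iff_hasFDerivAt.2 ⟨u'', h.c2, h.d2⟩

theorem CC.lapl_eq {u : EuclideanSpace ℝ (Fin N) → ℝ} {u' u''} (h : CC u u' u'')
    (x : EuclideanSpace ℝ (Fin N)) :
    lapl u x = trL (EuclideanSpace.basisFun (Fin N) ℝ) (u'' x) := by
  rw [trL_apply, lapl]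
  refine Finset.sum_congr rfl fun i _ => ?_
  have h1 : fderiv ℝ u = u' := funext fun y => (h.d1 y).fderiv
  rw [h1, EuclideanSpace.basisFun_apply,
    ((h.d2 x).clm_apply (hasFDerivAt_const (EuclideanSpace.single i (1 : ℝ)) x)).fderiv]
  simp

theorem isPot_iff {f g : C(closure Ω, ℝ)} :
    IsPot (EuclideanSpace.basisFun (Fin N) ℝ) Ω f g ↔ ∃ u : EuclideanSpace ℝ (Fin N) → ℝ,
      ContDiff ℝ 2 u ∧ (∀ x ∈ frontier Ω, u x = 0) ∧
      (∀ x : closure Ω, (x : EuclideanSpace ℝ (Fin N)) ∈ Ω → -lapl u x = f x) ∧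
      ∀ x : closure Ω, u x = g x := by
  constructor
  · rintro ⟨u, u', u'', h1, h2, h3, h4⟩
    exact ⟨u, h1.contDiff, h2, fun x hx => by rw [h1.lapl_eq, h3 x hx], h4⟩
  · rintro ⟨u, h1, h2, h3, h4⟩
    exact ⟨u, _, _, h1.cc, h2, fun x hx => by rw [← h1.cc.lapl_eq, h3 x hx], h4⟩

variable [CompactSpace (closure Ω)] {p : ℝ} (hp : 1 < p) {β : ℝ}
  {G : C(closure Ω, ℝ) →L[ℝ] C(closure Ω, ℝ)} {w : C(closure Ω, ℝ)} {L : ℝ}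

theorem isHol_dens (hβ : 0 < β) (hβ1 : β < 1) (hw : ∀ x y, |w x - w y| ≤ L * dist x y) :
    IsHol β (dens hp w) :=
  IsHol.rpow hβ hβ1 (hβ1.le.trans hp.le) hw fun x => dens_apply hp w x

theorem isHol_pwt (hβ : 0 < β) (hβ1 : β < 1) (hβp : β ≤ p - 1)
    (hw : ∀ x y, |w x - w y| ≤ L * dist x y) : IsHol β (pwt hp w) :=
  IsHol.rpow hβ hβ1 hβp hw fun x => pwt_apply hp w x

theorem isHol_smul {f : C(closure Ω, ℝ)} (hf : IsHol β f) (c : ℝ) : IsHol β (c • f) := by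
  rw [Algebra.smul_def]
  exact (isHol_const c).mul hf

variable [IsFiniteMeasure (muC Ω volume)]

theorem lipschitz_of_probF (hlip : ∀ f, ∃ L, ∀ x y, |G f x - G f y| ≤ L * dist x y) {l α : ℝ}
    (hz : probF (muC Ω volume) hp G (l, α, w) = 0) :
    ∃ L, ∀ x y, |w x - w y| ≤ L * dist x y := by
  obtain ⟨-, h2⟩ := (probF_eq_zero_iff hp).1 hz
  obtain ⟨L, hL⟩ := hlip (dens hp w)
  have hwx : ∀ x, w x = α + l * G (dens hp w) x := fun x => by
    conv_lhs => rw [h2]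
    simp
  refine ⟨|l| * L, fun x y => ?_⟩
  rw [hwx x, hwx y, add_sub_add_left_eq_sub, ← mul_sub, abs_mul, mul_assoc]
  exact mul_le_mul_of_nonneg_left (hL x y) (abs_nonneg l)

theorem exists_isSol_of_probF (ho : IsOpen Ω) (hβ : 0 < β) (hβ1 : β < 1)
    (hlip : ∀ f, ∃ L, ∀ x y, |G f x - G f y| ≤ L * dist x y)
    (hpot : ∀ f, IsHol β f → IsPot (EuclideanSpace.basisFun (Fin N) ℝ) Ω f (G f)) {l α : ℝ}
    (hz : probF (muC Ω volume) hp G (l, α, w) = 0) :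
    ∃ ψ, IsSol Ω p l α ψ ∧ ∀ x : closure Ω, α + l * ψ x = w x := by
  obtain ⟨L, hL⟩ := lipschitz_of_probF hp hlip hz
  obtain ⟨h1, h2⟩ := (probF_eq_zero_iff hp).1 hz
  obtain ⟨ψ, a1, a2, a3, a4⟩ := isPot_iff.1 (hpot _ (isHol_dens hp hβ hβ1 hL))
  have hw : ∀ x : closure Ω, α + l * ψ x = w x := fun x => by
    conv_rhs => rw [h2]
    rw [a4]
    simp
  refine ⟨ψ, ⟨a1, fun x hx => ?_, a2, ?_⟩, hw⟩
  · rw [a3 ⟨x, subset_closure hx⟩ hx, dens_apply, ← hw]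
  · rw [← h1, intL_apply]
    refine (integral_muC_congr volume ho fun x _ => ?_).symm
    rw [dens_apply, ← hw]

theorem eq_zero_of_isEigen_pos (ho : IsOpen Ω) (hβ : 0 < β) (hβ1 : β < 1) (hβp : β ≤ p - 1)
    (hlip : ∀ f, ∃ L, ∀ x y, |G f x - G f y| ≤ L * dist x y)
    (hpot : ∀ f, IsHol β f → IsPot (EuclideanSpace.basisFun (Fin N) ℝ) Ω f (G f)) {l α : ℝ}
    (hall : ∀ ψ, IsSol Ω p l α ψ → ∀ σ, IsEigen Ω p l α ψ σ → 0 < σ)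
    (hz : probF (muC Ω volume) hp G (l, α, w) = 0) {t : ℝ} (ht : t ≤ p * l)
    {φ : C(closure Ω, ℝ)}
    (hφ : φ = t • G (pwt hp w * projV (muC Ω volume) (pwt hp w) φ)) : φ = 0 := by
  obtain ⟨ψ, hψ, hw⟩ := exists_isSol_of_probF hp ho hβ hβ1 hlip hpot hz
  obtain ⟨L, hL⟩ := lipschitz_of_probF hp hlip hz
  by_contra hne
  obtain ⟨x₀, hx₀⟩ : ∃ x, φ x ≠ 0 := by
    by_contra! h
    exact hne (ContinuousMap.ext h)
  have hV : ∀ x : closure Ω, pwt hp w x = Vfun p l α ψ x := fun x => by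
    rw [pwt_apply, Vfun, hw]
  set V := pwt hp w with hVdef
  set f := V * projV (muC Ω volume) V φ with hf
  obtain ⟨M, hM⟩ := hlip f
  have hφL : ∀ x y, |φ x - φ y| ≤ |t| * M * dist x y := fun x y => by
    rw [hφ]
    simp only [ContinuousMap.smul_apply, smul_eq_mul]
    rw [← mul_sub, abs_mul, mul_assoc]
    exact mul_le_mul_of_nonneg_left (hM x y) (abs_nonneg t)
  have hfh : IsHol β f := by
    refine (isHol_pwt hp hβ hβ1 hβp hL).mul (IsHol.of_lipschitz (L := |t| * M) hβ hβ1 fun x y => ?_)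
    rw [projV_apply]
    simpa using hφL x y
  have hpt := hpot (t • f) (isHol_smul hfh t)
  rw [map_smul, ← hφ] at hpt
  obtain ⟨χ, a1, a2, a3, a4⟩ := isPot_iff.1 hpt
  have havg : avgV Ω p l α ψ χ = intL (muC Ω volume) (V * φ) / intL (muC Ω volume) V := by
    rw [avgV, mV, intL_apply, intL_apply,
      integral_muC_congr volume ho (g := fun x => Vfun p l α ψ x * χ x) fun x _ => ?_,
      integral_muC_congr volume ho fun x _ => hV x]
    rw [ContinuousMap.mul_apply, hV, a4]
  have := hall ψ hψ (t - p * l) ⟨χ, a1, ⟨x₀, x₀.2, by rwa [a4]⟩, a2, fun x hx => ?_⟩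
  · linarith
  · rw [a3 ⟨x, subset_closure hx⟩ hx, havg, a4 ⟨x, subset_closure hx⟩, hf, projV_apply,
      ← hV ⟨x, subset_closure hx⟩]
    simp

end Translation

section Emden

variable {N : ℕ} {Ω : Set (EuclideanSpace ℝ (Fin N))} [CompactSpace (closure Ω)] {p : ℝ}
  (hp : 1 < p) {β : ℝ} {G : C(closure Ω, ℝ) →L[ℝ] C(closure Ω, ℝ)}

theorem exists_lipschitz_closure {u : EuclideanSpace ℝ (Fin N) → ℝ} (h : ContDiff ℝ 2 u) :
    ∃ L : ℝ, ∀ x y : closure Ω, |u x - u y| ≤ L * dist x y := by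
  have h1 : LocallyLipschitz u := (h.of_le (by norm_num)).locallyLipschitz (𝕂 := ℝ)
  have hK : IsCompact (closure Ω) := isCompact_iff_compactSpace.2 inferInstance
  obtain ⟨K, hK⟩ := h1.locallyLipschitzOn.exists_lipschitzOnWith_of_compact hK
  exact ⟨K, fun x y => by
    rw [← Real.dist_eq]
    exact hK.dist_le_mul _ x.2 _ y.2⟩

theorem exists_isEmden [Nontrivial (EuclideanSpace ℝ (Fin N))] [IsFiniteMeasure (muC Ω volume)]
    (ho : IsOpen Ω) (hc : IsPreconnected Ω) (hβ : 0 < β) (hβ1 : β < 1)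
    (hlip : ∀ f, ∃ L, ∀ x y, |G f x - G f y| ≤ L * dist x y) (hpos : ∀ f, 0 ≤ f → 0 ≤ G f)
    (hpot : ∀ f, IsHol β f → IsPot (EuclideanSpace.basisFun (Fin N) ℝ) Ω f (G f)) {l : ℝ}
    (hl : 0 < l) {w : C(closure Ω, ℝ)} (hz : probF (muC Ω volume) hp G (l, 0, w) = 0) :
    ∃ u, IsEmden Ω p u := by
  obtain ⟨ψ, ⟨a1, a2, a3, -⟩, a5⟩ := exists_isSol_of_probF hp ho hβ hβ1 hlip hpot hz
  have hψ0 : ∀ x ∈ closure Ω, 0 ≤ ψ x := fun x hx => by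
    have h1 : 0 ≤ G (dens hp w) ⟨x, hx⟩ := hpos _ (fun y => dens_nonneg hp w y) ⟨x, hx⟩
    have h2 := a5 ⟨x, hx⟩
    rw [((probF_eq_zero_iff hp).1 hz).2] at h2
    simp only [zero_add, zero_smul, ContinuousMap.smul_apply, smul_eq_mul] at h2
    rwa [mul_left_cancel₀ hl.ne' h2]
  have hex : ∃ x ∈ Ω, 0 < ψ x := by
    obtain ⟨x, hx⟩ := exists_pos_of_probF hp hz
    rw [← a5, zero_add] at hx
    have hx' := pos_of_mul_pos_right hx hl.le
    refine ⟨x, ?_, hx'⟩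
    by_contra hxΩ
    have : (x : EuclideanSpace ℝ (Fin N)) ∈ frontier Ω := by
      rw [ho.frontier_eq]; exact ⟨x.2, hxΩ⟩
    rw [a3 _ this] at hx'
    exact lt_irrefl _ hx'
  have hψ : ∀ x ∈ Ω, 0 < ψ x := fun x hx =>
    a1.cc.pos_of_superharmonic (EuclideanSpace.basisFun (Fin N) ℝ) ho hc hψ0 (fun y hy => by
      have h1 := a2 y hy
      rw [a1.cc.lapl_eq] at h1
      have h2 : 0 ≤ max (0 + l * ψ y) 0 ^ p := by positivity
      linarith) hex hx
  set c : ℝ := l ^ (p / (p - 1)) with hcdef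
  have hc0 : 0 < c := by positivity
  have hcp : c * l ^ p = c ^ p := by
    rw [hcdef, ← Real.rpow_mul hl.le, ← Real.rpow_add hl]
    congr 1
    have : p - 1 ≠ 0 := by linarith
    field_simp
    ring
  have hcc := a1.cc.const_smul c
  refine ⟨_, hcc.contDiff, fun x hx => ?_, fun x hx => mul_pos hc0 (hψ x hx),
    fun x hx => by rw [a3 x hx, mul_zero]⟩
  rw [hcc.lapl_eq, map_smul, smul_eq_mul, ← a1.cc.lapl_eq, ← mul_neg, a2 x hx, zero_add,
    max_eq_left (mul_pos hl (hψ x hx)).le, Real.mul_rpow hl.le (hψ x hx).le,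
    Real.mul_rpow hc0.le (hψ x hx).le, ← hcp, mul_assoc]

theorem _root_.IsEmden.exists_probF [Nontrivial (EuclideanSpace ℝ (Fin N))]
    [IsFiniteMeasure (muC Ω volume)]
    (ho : IsOpen Ω) (hb : Bornology.IsBounded Ω) (hne : Ω.Nonempty) (hβ : 0 < β) (hβ1 : β < 1)
    (hpot : ∀ f, IsHol β f → IsPot (EuclideanSpace.basisFun (Fin N) ℝ) Ω f (G f))
    {u : EuclideanSpace ℝ (Fin N) → ℝ} (hu : IsEmden Ω p u) {uc : C(closure Ω, ℝ)}
    (huc : ∀ x, uc x = u x) :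
    ∃ k : ℝ, 0 < k ∧ probF (muC Ω volume) hp G (k ^ (1 - p), 0, k • uc) = 0 := by
  obtain ⟨a1, a2, a3, a4⟩ := hu
  have := isOpenPosMeasure_muC (volume : Measure (EuclideanSpace ℝ (Fin N))) ho
  have hpot' : IsPot (EuclideanSpace.basisFun (Fin N) ℝ) Ω (dens hp uc) uc :=
    isPot_iff.2 ⟨u, a1, a4, fun x hx => by
      rw [dens_apply, huc, a2 _ hx, max_eq_left (a3 _ hx).le], fun x => (huc x).symm⟩
  obtain ⟨L, hL⟩ := exists_lipschitz_closure (Ω := Ω) a1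
  have hG : G (dens hp uc) = uc := (hpot _ (isHol_dens (L := L) hp hβ hβ1 fun x y => by
    rw [huc, huc]; exact hL x y)).unique ho hb hpot'
  obtain ⟨x, hx⟩ := hne
  have hI : 0 < intL (muC Ω volume) (dens hp uc) := by
    refine intL_pos _ (dens_nonneg hp uc) ⟨x, subset_closure hx⟩ ?_
    rw [dens_apply, huc, max_eq_left (a3 x hx).le]
    exact (Real.rpow_pos_of_pos (a3 x hx) _).ne'
  set I := intL (muC Ω volume) (dens hp uc)
  have hp0 : p ≠ 0 := by linarith
  refine ⟨I ^ (-1 / p), by positivity, ?_⟩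
  set k : ℝ := I ^ (-1 / p) with hk
  have hk0 : 0 < k := by positivity
  have hkp : k ^ p = I⁻¹ := by
    rw [hk, ← Real.rpow_mul hI.le, div_mul_cancel₀ _ hp0, Real.rpow_neg_one]
  have hd : dens hp (k • uc) = k ^ p • dens hp uc := by
    ext y
    rw [ContinuousMap.smul_apply, dens_apply, dens_apply, ContinuousMap.smul_apply, smul_eq_mul,
      smul_eq_mul, ← Real.mul_rpow hk0.le (le_max_right _ _), mul_max_of_nonneg _ _ hk0.le,
      mul_zero]
  refine (probF_eq_zero_iff hp).2 ⟨?_, ?_⟩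
  · rw [hd, map_smul, hkp, smul_eq_mul, inv_mul_cancel₀ hI.ne']
  · rw [hd, map_smul, hG, smul_smul, ← Real.rpow_add hk0, sub_add_cancel, Real.rpow_one, zero_smul,
      zero_add]

end Emden

theorem exists_localSolver_of_isC3Domain {N : ℕ} [Nontrivial (EuclideanSpace ℝ (Fin N))]
    {Ω : Set (EuclideanSpace ℝ (Fin N))} (hΩ : IsC3Domain Ω) {β : ℝ} (hβ : 0 < β) (hβ1 : β < 1)
    {x : EuclideanSpace ℝ (Fin N)} (hx : x ∈ closure Ω) :
    ∃ r, 0 < r ∧ LocalSolver (EuclideanSpace.basisFun (Fin N) ℝ) β Ω x r := by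
  obtain ⟨ho, -, -, hfr⟩ := hΩ
  by_cases hxΩ : x ∈ Ω
  · exact exists_localSolver_interior _ hβ hβ1 ho hxΩ
  · have hxf : x ∈ frontier Ω := by rw [ho.frontier_eq]; exact ⟨hx, hxΩ⟩
    obtain ⟨U, f, hU, hxU, hf, hd, h⟩ := hfr x hxf
    exact exists_localSolver_boundary _ hβ hβ1 ho hxf hU hxU hf (hd x hxU) h

end Schauder

open Schauder

theorem stmt19 (N : ℕ) (hN : 2 ≤ N) (Ω : Set (EuclideanSpace ℝ (Fin N)))
    (hΩ : IsC3Domain Ω) (hvol : volume Ω = 1) (p : ℝ) (hp1 : 1 < p)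
    (hpN : N = 2 ∨ p < (N : ℝ) / ((N : ℝ) - 2))
    (hall : ∀ lam : ℝ, 0 ≤ lam →
      ∀ (α : ℝ) (ψ : EuclideanSpace ℝ (Fin N) → ℝ), IsSol Ω p lam α ψ →
        ∀ σ : ℝ, IsEigen Ω p lam α ψ σ → 0 < σ) :
    (∃ u : EuclideanSpace ℝ (Fin N) → ℝ, IsEmden Ω p u) ∧
    ∀ u v : EuclideanSpace ℝ (Fin N) → ℝ, IsEmden Ω p u → IsEmden Ω p v →
      ∀ x ∈ closure Ω, u x = v x := by
  have ho : IsOpen Ω := hΩ.1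
  have hb : Bornology.IsBounded Ω := hΩ.2.2.1
  have hne : Ω.Nonempty := hΩ.2.1.nonempty
  have : Nonempty (Fin N) := ⟨⟨0, by omega⟩⟩
  have : Nontrivial (EuclideanSpace ℝ (Fin N)) := inferInstance
  have : CompactSpace (closure Ω) := isCompact_iff_compactSpace.1 hb.isCompact_closure
  have hfin : IsFiniteMeasure (muC Ω volume) := muC_finite volume hb
  have := isOpenPosMeasure_muC (volume : Measure (EuclideanSpace ℝ (Fin N))) ho
  obtain ⟨β, hβ, hβ1, hβp⟩ : ∃ β : ℝ, 0 < β ∧ β < 1 ∧ β ≤ p - 1 :=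
    ⟨min (1 / 2) (p - 1), lt_min (by norm_num) (by linarith),
      (min_le_left _ _).trans_lt (by norm_num), min_le_right _ _⟩
  obtain ⟨G, hcpt, hlip, hpos, hpot⟩ := exists_green (EuclideanSpace.basisFun (Fin N) ℝ) ho hb
    hβ hβ1 fun x hx => exists_localSolver_of_isC3Domain hΩ hβ hβ1 hx
  have hGO : GreenOp (muC Ω volume) p G :=
    greenOp_muC (EuclideanSpace.basisFun (Fin N) ℝ) volume ho hb hne hβ hβ1 hcpt hpos hpot
      (by simpa using hN) hp1 (by simpa using hpN)
  have h1 : intL (muC Ω volume) 1 = 1 := by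
    rw [intL_apply, integral_muC_congr volume ho (f := (1 : C(closure Ω, ℝ))) (g := fun _ => 1) fun x _ => rfl]
    simp [Measure.real, hvol]
  obtain ⟨l₀, w₀, hl₀, hz, huniq⟩ := existsUnique_zero_level hp1 hGO h1
    fun l α w hl hz t _ ht φ hφ =>
      eq_zero_of_isEigen_pos hp1 ho hβ hβ1 hβp hlip hpot (hall l hl α) hz ht hφ
  refine ⟨exists_isEmden hp1 ho hΩ.2.1.isPreconnected hβ hβ1 hlip hpos hpot hl₀ hz,
    fun u v hu hv x hx => ?_⟩
  obtain ⟨k, hk, hku⟩ := hu.exists_probF hp1 ho hb hne hβ hβ1 hpot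
    (uc := ⟨fun x => u x, hu.1.continuous.comp continuous_subtype_val⟩) fun _ => rfl
  obtain ⟨m, hm, hmv⟩ := hv.exists_probF hp1 ho hb hne hβ hβ1 hpot
    (uc := ⟨fun x => v x, hv.1.continuous.comp continuous_subtype_val⟩) fun _ => rfl
  obtain ⟨e1, e2⟩ := huniq _ _ (by positivity) hku
  obtain ⟨f1, f2⟩ := huniq _ _ (by positivity) hmv
  have hkm : k = m := (Real.rpow_left_inj hk.le hm.le (by linarith)).1 (e1.trans f1.symm)
  have h := DFunLike.congr_fun (e2.trans f2.symm) ⟨x, hx⟩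
  simp only [ContinuousMap.smul_apply, ContinuousMap.coe_mk, smul_eq_mul, hkm] at h
  exact mul_left_cancel₀ hm.ne' h

end
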